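/- (Decay estimate) For each C_T > 0 there exists a constant c̄ > 0, depending only on C_T, such that the following holds. Fix q,σ ∈ ℝ with 2 < q < σ < 6 and set α_{σ,q} := (6/σ)·(σ−q)/(6−q) ∈ (0,1). Let (u,d,p) be a suitable triple on Ω_T with constant C_T, and suppose z₀ ∈ Ω_T and ρ₀ ∈ (0,1] are such that Q*_{ρ₀}(z₀) ⊆ Ω_T, sup_{ρ∈(0,ρ₀]} B(ρ) ≤ 1, and sup_{ρ∈(0,ρ₀]} G_σ(ρ) ≤ g_σ for some finite g_σ ≥ 1. Then for every ρ ∈ (0,ρ₀] and every γ ∈ (0,1/4]: M_q(γρ) ≤ c̄ · g_σ^{6/(6−σ)} [ γ^{α_{σ,q}/8} ( M_q(ρ) + M_q(ρ)^{α_{σ,q}} ) + γ^{−15} B(ρ)^{(3/4)α_{σ,q}} Σ_{k=0}^{2} ( M_q(ρ)^{1/2^k} + M_q(ρ)^{α_{σ,q}/2^k} ) ]. -/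

import Mathlib

open MeasureTheory Set Filter
open scoped ENNReal NNReal

noncomputable section

abbrev E3 : Type := EuclideanSpace ℝ (Fin 3)

/-- Space-time `ℝ³ × ℝ`. -/
abbrev SpT : Type := E3 × ℝ

/-- Spatial partial derivative `∂_j` of a function on space-time. -/
def sderiv (j : Fin 3) (ψ : SpT → ℝ) (z : SpT) : ℝ :=
  fderiv ℝ ψ z ((EuclideanSpace.single j 1 : E3), (0 : ℝ))

/-- Time derivative `∂_t` of a function on space-time. -/
def tderiv (ψ : SpT → ℝ) (z : SpT) : ℝ :=
  fderiv ℝ ψ z ((0 : E3), (1 : ℝ))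

/-- Spatial Laplacian of a function on space-time. -/
def sLap (ψ : SpT → ℝ) (z : SpT) : ℝ := ∑ j, sderiv j (sderiv j ψ) z

/-- `ψ ∈ C_c^∞(U)`. -/
def IsTestOn (U : Set SpT) (ψ : SpT → ℝ) : Prop :=
  ContDiff ℝ (⊤ : ℕ∞) ψ ∧ HasCompactSupport ψ ∧ tsupport ψ ⊆ U

/-- `g` is the weak spatial gradient of `f` on `U`. -/
def WeakSGrad (U : Set SpT) (f : SpT → ℝ) (g : Fin 3 → SpT → ℝ) : Prop :=
  ∀ (j : Fin 3) (ψ : SpT → ℝ), IsTestOn U ψ →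
    ∫ z in U, f z * sderiv j ψ z = - ∫ z in U, g j z * ψ z

/-- Squared Frobenius norm of a `3×3` array, e.g. `|∇v|² = Σ_{i,j} (∂_j v_i)²`. -/
def nsq2 (M : Fin 3 → Fin 3 → ℝ) : ℝ := ∑ i, ∑ j, (M i j) ^ 2

/-- Squared norm of a `3×3×3` array, e.g. `|∇²d|² = Σ_{i,j,k} (∂_j ∂_k d_i)²`. -/
def nsq3 (A : Fin 3 → Fin 3 → Fin 3 → ℝ) : ℝ := ∑ i, ∑ j, ∑ k, (A i j k) ^ 2

/-- Open Euclidean ball in `ℝ³`. -/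
def ball3 (x : E3) (r : ℝ) : Set E3 := Metric.ball x r

/-- Parabolic cylinder `Q_r(z₀) = B_r(x₀) × (t₀ - r², t₀)`. -/
def Qcyl (z : SpT) (r : ℝ) : Set SpT := ball3 z.1 r ×ˢ Ioo (z.2 - r ^ 2) z.2

/-- Centered parabolic cylinder `Q*_r(z₀) = B_r(x₀) × (t₀ - (7/8)r², t₀ + (1/8)r²)`. -/
def Qstar (z : SpT) (r : ℝ) : Set SpT :=
  ball3 z.1 r ×ˢ Ioo (z.2 - 7 / 8 * r ^ 2) (z.2 + 1 / 8 * r ^ 2)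

/-- The time interval `I*_r(t₀) = (t₀ - (7/8)r², t₀ + (1/8)r²)`. -/
def Istar (t₀ r : ℝ) : Set ℝ := Ioo (t₀ - 7 / 8 * r ^ 2) (t₀ + 1 / 8 * r ^ 2)

/-- `u` is weakly divergence free on `U`. -/
def DivFreeOn (U : Set SpT) (u : SpT → E3) : Prop :=
  ∀ ψ : SpT → ℝ, IsTestOn U ψ → ∫ z in U, ∑ j, u z j * sderiv j ψ z = 0

/-- The weak pressure equation `-Δp = ∇·(∇ᵀ·(u⊗u + ∇d⊙∇d))` on `U`. -/
def PressureEqOn (U : Set SpT) (u : SpT → E3) (p : SpT → ℝ)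
    (Dd : SpT → Fin 3 → Fin 3 → ℝ) : Prop :=
  ∀ ψ : SpT → ℝ, IsTestOn U ψ →
    -∫ z in U, p z * sLap ψ z =
      ∫ z in U, ∑ i, ∑ j, (u z i * u z j + ∑ k, Dd z k i * Dd z k j) *
        sderiv i (sderiv j ψ) z

/-- Standard regularity of `(u,d,p)` on `Ω_T`, with weak spatial gradients `Du`, `Dd`, `D2d`
(`Du z i j = ∂_j u_i`, `Dd z i j = ∂_j d_i`, `D2d z i j k = ∂_j ∂_k d_i`). -/
structure StdReg (Ω : Set E3) (T : ℝ) (u d : SpT → E3) (p : SpT → ℝ)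
    (Du Dd : SpT → Fin 3 → Fin 3 → ℝ) (D2d : SpT → Fin 3 → Fin 3 → Fin 3 → ℝ) : Prop where
  meas_u : Measurable u
  meas_d : Measurable d
  meas_p : Measurable p
  meas_Du : Measurable Du
  meas_Dd : Measurable Dd
  meas_D2d : Measurable D2d
  grad_u : ∀ i : Fin 3, WeakSGrad (Ω ×ˢ Ioo 0 T) (fun z => u z i) (fun j z => Du z i j)
  grad_d : ∀ i : Fin 3, WeakSGrad (Ω ×ˢ Ioo 0 T) (fun z => d z i) (fun j z => Dd z i j)
  grad_Dd : ∀ i k : Fin 3,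
    WeakSGrad (Ω ×ˢ Ioo 0 T) (fun z => Dd z i k) (fun j z => D2d z i j k)
  linf_u : ∃ M : ℝ, ∀ᵐ t ∂(volume.restrict (Ioo 0 T)), ∫ x in Ω, ‖u (x, t)‖ ^ 2 ≤ M
  linf_d : ∃ M : ℝ, ∀ᵐ t ∂(volume.restrict (Ioo 0 T)), ∫ x in Ω, ‖d (x, t)‖ ^ 2 ≤ M
  linf_Dd : ∃ M : ℝ, ∀ᵐ t ∂(volume.restrict (Ioo 0 T)), ∫ x in Ω, nsq2 (Dd (x, t)) ≤ M
  l2_Du : IntegrableOn (fun z => nsq2 (Du z)) (Ω ×ˢ Ioo 0 T)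
  l2_D2d : IntegrableOn (fun z => nsq3 (D2d z)) (Ω ×ˢ Ioo 0 T)
  l32_p : IntegrableOn (fun z => |p z| ^ ((3 : ℝ) / 2)) (Ω ×ˢ Ioo 0 T)

/-- The local energy inequality on `Ω_T` with constant `CT`. -/
def LocalEnergyIneq (Ω : Set E3) (T CT : ℝ) (u d : SpT → E3) (p : SpT → ℝ)
    (Du Dd : SpT → Fin 3 → Fin 3 → ℝ) (D2d : SpT → Fin 3 → Fin 3 → Fin 3 → ℝ) : Prop :=
  ∀ᵐ t ∂(volume.restrict (Ioo 0 T)), ∀ φ : SpT → ℝ,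
    ContDiff ℝ (⊤ : ℕ∞) φ → HasCompactSupport φ → tsupport φ ⊆ Ω ×ˢ Ioi 0 → (∀ z, 0 ≤ φ z) →
    (∫ x in Ω, (‖u (x, t)‖ ^ 2 + nsq2 (Dd (x, t))) * φ (x, t)) +
      (∫ τ in Ioo 0 t, ∫ x in Ω, (nsq2 (Du (x, τ)) + nsq3 (D2d (x, τ))) * φ (x, τ)) ≤
    CT * ∫ τ in Ioo 0 t,
      ((∫ x in Ω, ((‖u (x, τ)‖ ^ 2 + nsq2 (Dd (x, τ))) *
            |tderiv φ (x, τ) + sLap φ (x, τ)| +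
          ‖d (x, τ)‖ ^ 2 * nsq2 (Dd (x, τ)) * φ (x, τ))) +
        abs (∫ x in Ω, ((‖u (x, τ)‖ ^ 2 / 2 + nsq2 (Dd (x, τ)) / 2 + p (x, τ)) *
            (∑ j, u (x, τ) j * sderiv j φ (x, τ)) +
          ∑ i, ∑ j, u (x, τ) i * sderiv j φ (x, τ) * (∑ k, Dd (x, τ) k i * Dd (x, τ) k j))))

/-- `(u,d,p)` is a suitable triple on `Ω_T` with constant `CT`. -/
structure Suitable (Ω : Set E3) (T CT : ℝ) (u d : SpT → E3) (p : SpT → ℝ)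
    (Du Dd : SpT → Fin 3 → Fin 3 → ℝ) (D2d : SpT → Fin 3 → Fin 3 → Fin 3 → ℝ) : Prop where
  reg : StdReg Ω T u d p Du Dd D2d
  divFree : DivFreeOn (Ω ×ˢ Ioo 0 T) u
  pres : PressureEqOn (Ω ×ˢ Ioo 0 T) u p Dd
  locen : LocalEnergyIneq Ω T CT u d p Du Dd D2d

/-- `A(r) = (1/r) esssup_{t ∈ I*_r} ∫_{B_r} (|u|² + |∇d|²) dx`. -/
def AQ (u : SpT → E3) (Dd : SpT → Fin 3 → Fin 3 → ℝ) (z₀ : SpT) (r : ℝ) : ℝ≥0∞ :=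
  (ENNReal.ofReal r)⁻¹ *
    essSup (fun t => ∫⁻ x in ball3 z₀.1 r, ENNReal.ofReal (‖u (x, t)‖ ^ 2 + nsq2 (Dd (x, t))))
      (volume.restrict (Istar z₀.2 r))

/-- `B(r) = (1/r) ∫∫_{Q*_r} (|∇u|² + |∇²d|²) dz`. -/
def BQ (Du : SpT → Fin 3 → Fin 3 → ℝ) (D2d : SpT → Fin 3 → Fin 3 → Fin 3 → ℝ)
    (z₀ : SpT) (r : ℝ) : ℝ≥0∞ :=
  (ENNReal.ofReal r)⁻¹ * ∫⁻ z in Qstar z₀ r, ENNReal.ofReal (nsq2 (Du z) + nsq3 (D2d z))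

/-- `C(r) = (1/r²) ∫∫_{Q*_r} (|u|³ + |∇d|³) dz`. -/
def CQ (u : SpT → E3) (Dd : SpT → Fin 3 → Fin 3 → ℝ) (z₀ : SpT) (r : ℝ) : ℝ≥0∞ :=
  (ENNReal.ofReal (r ^ 2))⁻¹ *
    ∫⁻ z in Qstar z₀ r, ENNReal.ofReal (‖u z‖ ^ 3 + Real.sqrt (nsq2 (Dd z)) ^ 3)

/-- `D(r) = (1/r²) ∫∫_{Q*_r} |p|^{3/2} dz`. -/
def DQ (p : SpT → ℝ) (z₀ : SpT) (r : ℝ) : ℝ≥0∞ :=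
  (ENNReal.ofReal (r ^ 2))⁻¹ * ∫⁻ z in Qstar z₀ r, ENNReal.ofReal (|p z| ^ ((3 : ℝ) / 2))

/-- `E(r) = (1/r²) ∫∫_{Q*_r} |u| (||u|² − ⨍|u|²| + ||∇d|² − ⨍|∇d|²|) dz`. -/
def EQ (u : SpT → E3) (Dd : SpT → Fin 3 → Fin 3 → ℝ) (z₀ : SpT) (r : ℝ) : ℝ≥0∞ :=
  (ENNReal.ofReal (r ^ 2))⁻¹ *
    ∫⁻ z in Qstar z₀ r, ENNReal.ofReal (‖u z‖ *
      (abs (‖u z‖ ^ 2 - ⨍ y in ball3 z₀.1 r, ‖u (y, z.2)‖ ^ 2) +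
       abs (nsq2 (Dd z) - ⨍ y in ball3 z₀.1 r, nsq2 (Dd (y, z.2)))))

/-- `F(r) = (1/r²) ∫∫_{Q*_r} |u||p| dz`. -/
def FQ (u : SpT → E3) (p : SpT → ℝ) (z₀ : SpT) (r : ℝ) : ℝ≥0∞ :=
  (ENNReal.ofReal (r ^ 2))⁻¹ * ∫⁻ z in Qstar z₀ r, ENNReal.ofReal (‖u z‖ * |p z|)

/-- `G_q(r) = (1/r^{2+q/2}) ∫∫_{Q*_r} |d|^q (|u|³ + |∇d|³)^{1 − q/6} dz`. -/
def GQ (u d : SpT → E3) (Dd : SpT → Fin 3 → Fin 3 → ℝ) (q : ℝ) (z₀ : SpT) (r : ℝ) : ℝ≥0∞ :=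
  (ENNReal.ofReal (r ^ (2 + q / 2)))⁻¹ *
    ∫⁻ z in Qstar z₀ r, ENNReal.ofReal (‖d z‖ ^ q *
      (‖u z‖ ^ 3 + Real.sqrt (nsq2 (Dd z)) ^ 3) ^ (1 - q / 6))

/-- `M_q(r) = (1/2)(C(r) + G_q(r)^{6/(6−q)}) + D(r)² + E(r)^{3/2} + F(r)^{3/2}`. -/
def MQ (u d : SpT → E3) (p : SpT → ℝ) (Dd : SpT → Fin 3 → Fin 3 → ℝ) (q : ℝ)
    (z₀ : SpT) (r : ℝ) : ℝ≥0∞ :=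
  (1 / 2 : ℝ≥0∞) * (CQ u Dd z₀ r + GQ u d Dd q z₀ r ^ ((6 : ℝ) / (6 - q))) +
    DQ p z₀ r ^ (2 : ℝ) + EQ u Dd z₀ r ^ ((3 : ℝ) / 2) + FQ u p z₀ r ^ ((3 : ℝ) / 2)

open scoped Topology

/-- Integrals of a bounded function vanishing at the origin against a concentrating family of
kernels tend to zero. -/
theorem tendsto_lintegral_concentrating {G : Type*} [NormedAddCommGroup G] [MeasurableSpace G]
    [OpensMeasurableSpace G] {μ : Measure G} {k : ℕ → G → ℝ≥0∞} {c : ℝ≥0∞} (hc : c ≠ ⊤)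
    (hk : ∀ n, Measurable (k n)) (hkc : ∀ n, ∫⁻ w, k n w ∂μ ≤ c)
    (hconc : ∀ δ : ℝ, 0 < δ → Tendsto (fun n => ∫⁻ w in {w | δ ≤ ‖w‖}, k n w ∂μ) atTop (𝓝 0))
    {ω : G → ℝ≥0∞} {W : ℝ≥0∞} (hW : W ≠ ⊤) (hωW : ∀ w, ω w ≤ W)
    (hω : Tendsto ω (𝓝 0) (𝓝 0)) :
    Tendsto (fun n => ∫⁻ w, k n w * ω w ∂μ) atTop (𝓝 0) := by
  rw [ENNReal.tendsto_nhds_zero] at hω ⊢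
  intro ε hε
  obtain ⟨η, hη, hηε⟩ : ∃ η : ℝ≥0∞, 0 < η ∧ c * η ≤ ε / 2 := by
    rcases eq_or_ne ε ⊤ with rfl | hεt
    · exact ⟨1, one_pos, by simp [ENNReal.top_div_of_ne_top]⟩
    refine ⟨ε / 2 / (c + 1), ENNReal.div_pos (by simp [hε.ne']) (by simp [hc]), ?_⟩
    calc c * (ε / 2 / (c + 1)) ≤ (c + 1) * (ε / 2 / (c + 1)) := by gcongr; simp
      _ ≤ _ := ENNReal.mul_div_le
  obtain ⟨δ, hδ, hδη⟩ := Metric.eventually_nhds_iff.1 (hω η hη)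
  have h2 := hconc δ hδ
  have h3 : Tendsto (fun n => (∫⁻ w in {w | δ ≤ ‖w‖}, k n w ∂μ) * W) atTop (𝓝 (0 * W)) :=
    ENNReal.Tendsto.mul_const h2 (Or.inr hW)
  rw [zero_mul, ENNReal.tendsto_nhds_zero] at h3
  filter_upwards [h3 (ε / 2) (by simp [hε.ne'])] with n hn
  have hms : MeasurableSet {w : G | δ ≤ ‖w‖} := measurableSet_le measurable_const measurable_norm
  rw [← lintegral_add_compl _ hms, ← ENNReal.add_halves ε]
  refine add_le_add ?_ ?_
  · refine le_trans ?_ hn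
    rw [← lintegral_mul_const _ (hk n)]
    exact lintegral_mono fun w => by gcongr; exact hωW w
  · calc ∫⁻ w in {w : G | δ ≤ ‖w‖}ᶜ, k n w * ω w ∂μ
        ≤ ∫⁻ w in {w : G | δ ≤ ‖w‖}ᶜ, k n w * η ∂μ := by
          refine setLIntegral_mono' hms.compl fun w hw => ?_
          gcongr
          apply hδη
          simpa using hw
      _ ≤ ∫⁻ w, k n w * η ∂μ := setLIntegral_le_lintegral _ _
      _ = (∫⁻ w, k n w ∂μ) * η := lintegral_mul_const _ (hk n)
      _ ≤ c * η := by gcongr; exact hkc n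
      _ ≤ ε / 2 := hηε

/-- Continuity of translations in `L^p`. -/
theorem tendsto_eLpNorm_translate {G : Type*} [NormedAddCommGroup G] [NormedSpace ℝ G]
    [FiniteDimensional ℝ G] [MeasurableSpace G] [BorelSpace G] {μ : Measure G} [μ.IsAddHaarMeasure]
    {p : ℝ≥0∞} [Fact (1 ≤ p)] (hp : p ≠ ∞) {f : G → ℝ} (hf : MemLp f p μ) :
    Tendsto (fun w => eLpNorm (fun x => f (x - w) - f x) p μ) (𝓝 0) (𝓝 0) := by
  have : Fact (p ≠ ∞) := ⟨hp⟩
  have h1 : Continuous (fun w : G => DomAddAct.mk (-w) +ᵥ hf.toLp f) := by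
    have : Continuous (fun w : G => (DomAddAct.mk (-w), hf.toLp f)) := by
      refine Continuous.prodMk ?_ continuous_const
      exact (DomAddAct.mkHomeomorph (M := G)).continuous.comp continuous_neg
    exact continuous_vadd.comp this
  have h2 : Tendsto (fun w : G => edist (DomAddAct.mk (-w) +ᵥ hf.toLp f) (hf.toLp f)) (𝓝 0)
      (𝓝 0) := by
    have := (h1.tendsto 0)
    have h3 := tendsto_iff_edist_tendsto_0.1 this
    simpa using h3
  refine h2.congr fun w => ?_
  rw [DomAddAct.mk_vadd_toLp, Lp.edist_toLp_toLp]
  congr 1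
  ext x
  simp [neg_add_eq_sub]

theorem lintegral_mul_sq_le {α : Type*} [MeasurableSpace α] {μ : Measure α} {k h : α → ℝ≥0∞}
    (hk : AEMeasurable k μ) (hh : AEMeasurable h μ) :
    (∫⁻ w, k w * h w ∂μ) ^ 2 ≤ (∫⁻ w, k w ^ 2 ∂μ) * ∫⁻ w, h w ^ 2 ∂μ := by
  have := ENNReal.lintegral_mul_le_Lp_mul_Lq μ Real.HolderConjugate.two_two hk hh
  calc (∫⁻ w, k w * h w ∂μ) ^ 2
      ≤ ((∫⁻ w, k w ^ (2 : ℝ) ∂μ) ^ (1 / (2 : ℝ)) * (∫⁻ w, h w ^ (2 : ℝ) ∂μ) ^ (1 / (2 : ℝ))) ^ 2 := by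
        gcongr; exact this
    _ = _ := by
        rw [mul_pow]
        simp only [← ENNReal.rpow_natCast, ← ENNReal.rpow_mul]
        norm_num

/-- Cauchy–Schwarz with a weight. -/
theorem lintegral_weight_mul_sq_le {α : Type*} [MeasurableSpace α] {μ : Measure α}
    {k h : α → ℝ≥0∞} (hk : AEMeasurable k μ) (hh : AEMeasurable h μ) :
    (∫⁻ w, k w * h w ∂μ) ^ 2 ≤ (∫⁻ w, k w ∂μ) * ∫⁻ w, k w * h w ^ 2 ∂μ := by
  have hs : ∀ x : ℝ≥0∞, (x ^ (1 / 2 : ℝ)) ^ 2 = x := fun x => by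
    rw [← ENNReal.rpow_natCast, ← ENNReal.rpow_mul]; norm_num
  have := lintegral_mul_sq_le (μ := μ) (k := fun w => k w ^ (1 / 2 : ℝ))
    (h := fun w => k w ^ (1 / 2 : ℝ) * h w) (by fun_prop) (by fun_prop)
  simp only [← mul_assoc, mul_pow, hs] at this
  refine le_trans (le_of_eq ?_) this
  congr 1
  refine lintegral_congr fun w => ?_
  rw [← sq, hs]

section ApproxIdentity

variable {G : Type*} [NormedAddCommGroup G] [NormedSpace ℝ G]
    [FiniteDimensional ℝ G] [MeasurableSpace G] [BorelSpace G] {μ : Measure G} [μ.IsAddHaarMeasure]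

/-- Approximate identities converge in `L¹`. -/
theorem tendsto_lintegral_approx_one {k : ℕ → G → ℝ≥0∞} {c : ℝ≥0∞} (hc : c ≠ ⊤)
    (hk : ∀ n, Measurable (k n)) (hkc : ∀ n, ∫⁻ w, k n w ∂μ ≤ c)
    (hconc : ∀ δ : ℝ, 0 < δ → Tendsto (fun n => ∫⁻ w in {w | δ ≤ ‖w‖}, k n w ∂μ) atTop (𝓝 0))
    {f : G → ℝ} (hfm : Measurable f) (hf : MemLp f 1 μ) :
    Tendsto (fun n => ∫⁻ x, (∫⁻ w, k n w * ‖f (x - w) - f x‖ₑ ∂μ) ∂μ) atTop (𝓝 0) := by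
  have hω := tendsto_eLpNorm_translate (by norm_num) hf
  have hmeas : ∀ w : G, AEStronglyMeasurable (fun x => f (x - w)) μ := fun w =>
    (hfm.comp (measurable_id.sub_const w)).aestronglyMeasurable
  have key := tendsto_lintegral_concentrating (μ := μ) hc hk hkc hconc (W := 2 * eLpNorm f 1 μ)
    (by finiteness [hf.2.ne]) ?_ hω
  · refine key.congr fun n => ?_
    rw [lintegral_lintegral_swap (by have := hk n; fun_prop)]
    refine lintegral_congr fun w => ?_
    rw [lintegral_const_mul _ (by fun_prop), eLpNorm_one_eq_lintegral_enorm]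
  · intro w
    refine (eLpNorm_sub_le (hmeas w) hf.1 le_rfl).trans ?_
    have : eLpNorm (fun x => f (x - w)) 1 μ = eLpNorm f 1 μ :=
      eLpNorm_comp_measurePreserving hf.1 (measurePreserving_sub_right μ w)
    rw [this, two_mul]

/-- Approximate identities converge in `L²`. -/
theorem tendsto_lintegral_approx_two {k : ℕ → G → ℝ≥0∞} {c : ℝ≥0∞} (hc : c ≠ ⊤)
    (hk : ∀ n, Measurable (k n)) (hkc : ∀ n, ∫⁻ w, k n w ∂μ ≤ c)
    (hconc : ∀ δ : ℝ, 0 < δ → Tendsto (fun n => ∫⁻ w in {w | δ ≤ ‖w‖}, k n w ∂μ) atTop (𝓝 0))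
    {f : G → ℝ} (hfm : Measurable f) (hf : MemLp f 2 μ) :
    Tendsto (fun n => ∫⁻ x, (∫⁻ w, k n w * ‖f (x - w) - f x‖ₑ ∂μ) ^ 2 ∂μ) atTop (𝓝 0) := by
  have hω := tendsto_eLpNorm_translate (by norm_num) hf
  have hω2 : Tendsto (fun w => eLpNorm (fun x => f (x - w) - f x) 2 μ ^ 2) (𝓝 0) (𝓝 0) := by
    have := ENNReal.Tendsto.pow (n := 2) hω
    simpa using this
  have hmeas : ∀ w : G, AEStronglyMeasurable (fun x => f (x - w)) μ := fun w =>
    (hfm.comp (measurable_id.sub_const w)).aestronglyMeasurable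
  have key := tendsto_lintegral_concentrating (μ := μ) hc hk hkc hconc
    (W := (2 * eLpNorm f 2 μ) ^ 2) (by finiteness [hf.2.ne]) ?_ hω2
  · have key2 := ENNReal.Tendsto.const_mul (a := c) key (Or.inr hc)
    rw [mul_zero] at key2
    refine tendsto_of_tendsto_of_tendsto_of_le_of_le tendsto_const_nhds key2 (fun _ => zero_le)
      fun n => ?_
    have hkn := hk n
    calc ∫⁻ x, (∫⁻ w, k n w * ‖f (x - w) - f x‖ₑ ∂μ) ^ 2 ∂μ
        ≤ ∫⁻ x, c * ∫⁻ w, k n w * ‖f (x - w) - f x‖ₑ ^ 2 ∂μ ∂μ := by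
          refine lintegral_mono fun x => ?_
          refine (lintegral_weight_mul_sq_le (by fun_prop) (by fun_prop)).trans ?_
          gcongr
          exact hkc n
      _ = c * ∫⁻ w, k n w * eLpNorm (fun x => f (x - w) - f x) 2 μ ^ 2 ∂μ := by
          rw [lintegral_const_mul' _ _ hc, lintegral_lintegral_swap (by fun_prop)]
          congr 1
          refine lintegral_congr fun w => ?_
          rw [lintegral_const_mul _ (by fun_prop),
            eLpNorm_eq_lintegral_rpow_enorm_toReal (by norm_num) (by norm_num),
            ← ENNReal.rpow_natCast, ← ENNReal.rpow_mul]
          norm_num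
  · intro w
    gcongr
    refine (eLpNorm_sub_le (hmeas w) hf.1 (by norm_num)).trans ?_
    have : eLpNorm (fun x => f (x - w)) 2 μ = eLpNorm f 2 μ :=
      eLpNorm_comp_measurePreserving hf.1 (measurePreserving_sub_right μ w)
    rw [this, two_mul]

end ApproxIdentity

instance instIsAddHaarMeasureSpT : (volume : Measure SpT).IsAddHaarMeasure :=
  inferInstanceAs ((volume : Measure E3).prod (volume : Measure ℝ)).IsAddHaarMeasure

section Mollify
variable {G : Type*} [NormedAddCommGroup G] [NormedSpace ℝ G] [HasContDiffBump G]
    [FiniteDimensional ℝ G] [MeasurableSpace G] [BorelSpace G] {μ : Measure G} [μ.IsAddHaarMeasure]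

open ContinuousLinearMap in
/-- Mollifications converge in `L²`. -/
theorem tendsto_lintegral_mollify {η : ℕ → ContDiffBump (0 : G)}
    (hη : Tendsto (fun n => (η n).rOut) atTop (𝓝 0)) {f : G → ℝ} (hfm : Measurable f)
    (hf : MemLp f 2 μ) :
    Tendsto (fun n => ∫⁻ x, ‖convolution f ((η n).normed μ) (lsmul ℝ ℝ) μ x - f x‖ₑ ^ 2 ∂μ)
      atTop (𝓝 0) := by
  have hloc : LocallyIntegrable f μ := hf.locallyIntegrable (by norm_num)
  have hkm : ∀ n, Measurable (fun w => ‖(η n).normed μ w‖ₑ) := fun n =>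
    (η n).continuous_normed.measurable.enorm
  have hk1 : ∀ n, ∫⁻ w, ‖(η n).normed μ w‖ₑ ∂μ = 1 := fun n => by
    have h := ofReal_integral_norm_eq_lintegral_enorm (μ := μ) (f := (η n).normed μ)
      ((η n).continuous_normed.integrable_of_hasCompactSupport (η n).hasCompactSupport_normed)
    have h2 : ∫ x, ‖(η n).normed μ x‖ ∂μ = 1 := by
      rw [← (η n).integral_normed (μ := μ)]
      exact integral_congr_ae (Eventually.of_forall fun x =>
        Real.norm_of_nonneg ((η n).nonneg_normed x))
    rw [← h, h2, ENNReal.ofReal_one]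
  refine tendsto_of_tendsto_of_tendsto_of_le_of_le tendsto_const_nhds
    (tendsto_lintegral_approx_two (c := 1) (by simp) hkm (fun n => (hk1 n).le) ?_ hfm hf)
    (fun _ => zero_le) fun n => ?_
  · intro δ hδ
    refine tendsto_const_nhds.congr' ?_
    filter_upwards [hη.eventually (gt_mem_nhds hδ)] with n hn
    refine (setLIntegral_eq_zero (measurableSet_le measurable_const measurable_norm) ?_).symm
    intro w hw
    have : w ∉ Function.support ((η n).normed μ) := by
      rw [(η n).support_normed_eq]
      simp only [Metric.mem_ball, dist_zero_right, not_lt]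
      exact hn.le.trans hw
    have h0 : (η n).normed μ w = 0 := Function.notMem_support.1 this
    simp only [h0, enorm_zero, Pi.zero_apply]
  · refine lintegral_mono fun x => ?_
    dsimp only
    gcongr
    have hce := ((η n).hasCompactSupport_normed (μ := μ)).convolutionExists_right (μ := μ) (lsmul ℝ ℝ) hloc
      (η n).continuous_normed x
    have hint : Integrable (fun w => f (x - w) * (η n).normed μ w) μ := by
      have := hce.integrable_swap
      simpa using this
    have h1 : convolution f ((η n).normed μ) (lsmul ℝ ℝ) μ x - f x
        = ∫ w, (η n).normed μ w * (f (x - w) - f x) ∂μ := by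
      rw [convolution_eq_swap]
      have : f x = ∫ w, (η n).normed μ w * f x ∂μ := by
        rw [integral_mul_const, (η n).integral_normed (μ := μ), one_mul]
      rw [show (∫ t, (lsmul ℝ ℝ) (f (x - t)) ((η n).normed μ t) ∂μ) - f x
        = (∫ t, f (x - t) * ((η n).normed μ t) ∂μ) - ∫ w, (η n).normed μ w * f x ∂μ by
          rw [← this]; rfl]
      rw [← integral_sub hint]
      · refine integral_congr_ae (Eventually.of_forall fun w => ?_)
        dsimp only; ring
      · exact ((η n).continuous_normed.integrable_of_hasCompactSupport
          (η n).hasCompactSupport_normed).mul_const _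
    rw [h1]
    refine (enorm_integral_le_lintegral_enorm _).trans (le_of_eq ?_)
    simp_rw [enorm_mul]

end Mollify

open ContinuousLinearMap in
/-- A square integrable function with square integrable weak spatial gradient is locally
approximated, together with its gradient, by smooth functions. -/
theorem WeakSGrad.exists_smooth_approx {U : Set SpT} (hU : IsOpen U) {f : SpT → ℝ}
    {g : Fin 3 → SpT → ℝ} (hf : Measurable f) (hg : ∀ j, Measurable (g j))
    (hf2 : ∫⁻ z in U, ‖f z‖ₑ ^ 2 ≠ ⊤) (hg2 : ∀ j, ∫⁻ z in U, ‖g j z‖ₑ ^ 2 ≠ ⊤)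
    (h : WeakSGrad U f g) {K : Set SpT} (hK : IsCompact K) (hKU : K ⊆ U) :
    ∃ F : ℕ → SpT → ℝ, (∀ n, ContDiff ℝ (⊤ : ℕ∞) (F n)) ∧
      Tendsto (fun n => ∫⁻ z in K, ‖F n z - f z‖ₑ ^ 2) atTop (𝓝 0) ∧
      ∀ j, Tendsto (fun n => ∫⁻ z in K, ‖sderiv j (F n) z - g j z‖ₑ ^ 2) atTop (𝓝 0) := by
  have hmem : ∀ f : SpT → ℝ, Measurable f → ∫⁻ z in U, ‖f z‖ₑ ^ 2 ≠ ⊤ →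
      MemLp (U.indicator f) 2 := by
    intro f hf hf2
    rw [memLp_indicator_iff_restrict hU.measurableSet]
    refine ⟨hf.aestronglyMeasurable, ?_⟩
    rw [eLpNorm_lt_top_iff_lintegral_rpow_enorm_lt_top (by norm_num) (by norm_num)]
    simpa using hf2.lt_top
  obtain ⟨δ, hδ, hδU⟩ := hK.exists_thickening_subset_open hU hKU
  have hpos : ∀ n : ℕ, 0 < δ / (n + 2) := fun n => by positivity
  let η : ℕ → ContDiffBump (0 : SpT) := fun n => ⟨δ / (n + 2) / 2, δ / (n + 2), by
    have := hpos n; positivity, by have := hpos n; linarith⟩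
  have hη : Tendsto (fun n => (η n).rOut) atTop (𝓝 0) := by
    change Tendsto (fun n : ℕ => δ / ((n : ℝ) + 2)) atTop (𝓝 0)
    exact Tendsto.div_atTop tendsto_const_nhds
      (tendsto_atTop_add_const_right _ _ tendsto_natCast_atTop_atTop)
  have hηδ : ∀ n, (η n).rOut < δ := fun n => by
    change δ / ((n : ℝ) + 2) < δ
    rw [div_lt_iff₀ (by positivity)]
    nlinarith [(Nat.cast_nonneg n : (0 : ℝ) ≤ n)]
  have hfl : LocallyIntegrable (U.indicator f) (volume : Measure SpT) :=
    (hmem f hf hf2).locallyIntegrable (by norm_num)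
  refine ⟨fun n => convolution (U.indicator f) ((η n).normed volume) (lsmul ℝ ℝ) volume,
    fun n => ?_, ?_, fun j => ?_⟩
  · exact (η n).hasCompactSupport_normed.contDiff_convolution_right _ hfl (η n).contDiff_normed
  · refine tendsto_of_tendsto_of_tendsto_of_le_of_le tendsto_const_nhds
      (tendsto_lintegral_mollify hη (hf.indicator hU.measurableSet) (hmem f hf hf2))
      (fun _ => zero_le) fun n => ?_
    refine le_trans (le_of_eq ?_) (setLIntegral_le_lintegral K _)
    refine setLIntegral_congr_fun hK.measurableSet fun z hz => ?_
    simp only [indicator_of_mem (hKU hz)]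
  · refine tendsto_of_tendsto_of_tendsto_of_le_of_le tendsto_const_nhds
      (tendsto_lintegral_mollify hη ((hg j).indicator hU.measurableSet) (hmem (g j) (hg j) (hg2 j)))
      (fun _ => zero_le) fun n => ?_
    refine le_trans (le_of_eq ?_) (setLIntegral_le_lintegral K _)
    refine setLIntegral_congr_fun hK.measurableSet fun z hz => ?_
    dsimp only
    rw [indicator_of_mem (hKU hz)]
    congr 2
    congr 1
    have hcd : ContDiff ℝ (⊤ : ℕ∞) ((η n).normed (volume : Measure SpT)) := (η n).contDiff_normed
    have hder := ((η n).hasCompactSupport_normed (μ := volume)).hasFDerivAt_convolution_right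
      (lsmul ℝ ℝ) hfl (hcd.of_le (by exact_mod_cast le_top)) z
    unfold sderiv
    rw [hder.fderiv, convolution_precompR_apply _ hfl
      (((η n).hasCompactSupport_normed (μ := volume)).fderiv ℝ) (hcd.continuous_fderiv (by simp))]
    rw [convolution_def, convolution_def]
    have hψ : IsTestOn U (fun w => (η n).normed (volume : Measure SpT) (z - w)) := by
      refine ⟨hcd.comp (contDiff_const.sub contDiff_id), ?_, ?_⟩
      · exact ((η n).hasCompactSupport_normed).comp_homeomorph (Homeomorph.subLeft z)
      · have h1 : tsupport (fun w => (η n).normed (volume : Measure SpT) (z - w))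
            ⊆ Metric.closedBall z (η n).rOut := by
          refine closure_minimal ?_ Metric.isClosed_closedBall
          intro w hw
          have h2 : z - w ∈ Function.support ((η n).normed (volume : Measure SpT)) := hw
          rw [(η n).support_normed_eq, Metric.mem_ball, dist_zero_right] at h2
          rw [Metric.mem_closedBall, dist_comm, dist_eq_norm]
          exact h2.le
        refine h1.trans fun w hw => hδU ?_
        exact Metric.mem_thickening_iff.2 ⟨z, hz, (Metric.mem_closedBall.1 hw).trans_lt (hηδ n)⟩
    have key := h j _ hψ
    have hsd : ∀ w, sderiv j (fun w => (η n).normed (volume : Measure SpT) (z - w)) w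
        = - fderiv ℝ ((η n).normed (volume : Measure SpT)) (z - w)
          ((EuclideanSpace.single j 1 : E3), (0 : ℝ)) := by
      intro w
      unfold sderiv
      have hd : DifferentiableAt ℝ ((η n).normed (volume : Measure SpT)) (z - w) :=
        (hcd.differentiable (by simp)) _
      have := hd.hasFDerivAt.comp w ((hasFDerivAt_const z w).sub (hasFDerivAt_id w))
      have h3 := this.fderiv
      rw [show (fun w => (η n).normed (volume : Measure SpT) (z - w))
        = (η n).normed (volume : Measure SpT) ∘ HSub.hSub z from rfl, h3]
      simp
    simp_rw [hsd, mul_neg, integral_neg, neg_inj] at key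
    have e1 : ∀ (f : SpT → ℝ) (k : SpT → ℝ), ∫ t, (lsmul ℝ ℝ) (U.indicator f t) (k t)
        = ∫ t in U, f t * k t := by
      intro f k
      rw [← integral_indicator hU.measurableSet]
      refine integral_congr_ae (Eventually.of_forall fun t => ?_)
      by_cases ht : t ∈ U <;> simp [ht]
    rw [e1, e1]
    exact key

theorem memLp_two_iff_lintegral {α : Type*} [MeasurableSpace α] {μ : Measure α} {f : α → ℝ}
    (hf : AEStronglyMeasurable f μ) : MemLp f 2 μ ↔ ∫⁻ z, ‖f z‖ₑ ^ 2 ∂μ ≠ ⊤ := by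
  have h := eLpNorm_lt_top_iff_lintegral_rpow_enorm_lt_top (μ := μ) (f := f) (p := 2)
    (by norm_num) (by norm_num)
  simp only [ENNReal.toReal_ofNat, ENNReal.rpow_ofNat] at h
  rw [← lt_top_iff_ne_top, ← h]
  exact ⟨fun h => h.2, fun h => ⟨hf, h⟩⟩

theorem integrable_mul_of_memLp_two {α : Type*} [MeasurableSpace α] {μ : Measure α}
    {f g : α → ℝ} (hf : MemLp f 2 μ) (hg : MemLp g 2 μ) : Integrable (fun z => f z * g z) μ :=
  hf.integrable_mul hg

/-- Pairing with a square integrable function is continuous for `L²` convergence. -/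
theorem tendsto_integral_mul_of_tendsto_two {α : Type*} [MeasurableSpace α] {μ : Measure α}
    {F : ℕ → α → ℝ} {f w : α → ℝ} (hF : ∀ n, MemLp (F n) 2 μ) (hf : MemLp f 2 μ)
    (hw : MemLp w 2 μ) (h : Tendsto (fun n => ∫⁻ z, ‖F n z - f z‖ₑ ^ 2 ∂μ) atTop (𝓝 0)) :
    Tendsto (fun n => ∫ z, F n z * w z ∂μ) atTop (𝓝 (∫ z, f z * w z ∂μ)) := by
  rw [tendsto_iff_edist_tendsto_0]
  have hw2 := (memLp_two_iff_lintegral hw.1).1 hw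
  have h2 : Tendsto (fun n => ((∫⁻ z, ‖F n z - f z‖ₑ ^ 2 ∂μ) * ∫⁻ z, ‖w z‖ₑ ^ 2 ∂μ) ^ (1 / 2 : ℝ))
      atTop (𝓝 0) := by
    have h3 := (ENNReal.Tendsto.mul_const h (Or.inr hw2)).ennrpow_const (1 / 2 : ℝ)
    simpa using h3
  refine tendsto_of_tendsto_of_tendsto_of_le_of_le tendsto_const_nhds h2 (fun _ => zero_le)
    fun n => ?_
  dsimp only
  rw [edist_eq_enorm_sub, ← integral_sub (integrable_mul_of_memLp_two (hF n) hw) (integrable_mul_of_memLp_two hf hw)]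
  refine (enorm_integral_le_lintegral_enorm _).trans ?_
  simp_rw [← sub_mul, enorm_mul]
  have := lintegral_mul_sq_le (μ := μ) (((hF n).1.sub hf.1).enorm) hw.1.enorm
  calc _ = ((∫⁻ z, ‖F n z - f z‖ₑ * ‖w z‖ₑ ∂μ) ^ 2) ^ (1 / 2 : ℝ) := by
        rw [← ENNReal.rpow_natCast, ← ENNReal.rpow_mul]; norm_num
    _ ≤ _ := by gcongr; exact this

theorem IsTestOn.sderiv_contDiff {ψ : SpT → ℝ} (hψ : ContDiff ℝ (⊤ : ℕ∞) ψ) (j : Fin 3) :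
    ContDiff ℝ (⊤ : ℕ∞) (sderiv j ψ) := by
  unfold sderiv
  exact (hψ.fderiv_right (m := (⊤ : ℕ∞)) (by simp)).clm_apply contDiff_const

theorem sderiv_mul {j : Fin 3} {F ψ : SpT → ℝ} {z : SpT} (hF : DifferentiableAt ℝ F z)
    (hψ : DifferentiableAt ℝ ψ z) :
    sderiv j (fun z => F z * ψ z) z = F z * sderiv j ψ z + ψ z * sderiv j F z := by
  unfold sderiv
  rw [fderiv_fun_mul hF hψ]
  simp

theorem sderiv_eq_zero_of_notMem_tsupport {j : Fin 3} {ψ : SpT → ℝ} {z : SpT}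
    (hz : z ∉ tsupport ψ) : sderiv j ψ z = 0 := by
  unfold sderiv
  rw [fderiv_of_notMem_tsupport (𝕜 := ℝ) hz]
  simp

/-- Leibniz rule for weak spatial gradients of square integrable functions. -/
theorem WeakSGrad.mul {U : Set SpT} (hU : IsOpen U) {f h : SpT → ℝ}
    {g k : Fin 3 → SpT → ℝ} (hf : Measurable f) (hg : ∀ j, Measurable (g j)) (hh : Measurable h)
    (hk : ∀ j, Measurable (k j))
    (hf2 : ∫⁻ z in U, ‖f z‖ₑ ^ 2 ≠ ⊤) (hg2 : ∀ j, ∫⁻ z in U, ‖g j z‖ₑ ^ 2 ≠ ⊤)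
    (hh2 : ∫⁻ z in U, ‖h z‖ₑ ^ 2 ≠ ⊤) (hk2 : ∀ j, ∫⁻ z in U, ‖k j z‖ₑ ^ 2 ≠ ⊤)
    (hfg : WeakSGrad U f g) (hhk : WeakSGrad U h k) :
    WeakSGrad U (fun z => f z * h z) (fun j z => g j z * h z + f z * k j z) := by
  intro j ψ hψ
  obtain ⟨hψs, hψc, hψU⟩ := hψ
  have hK : IsCompact (tsupport ψ) := hψc
  obtain ⟨F, hFs, hFf, hFg⟩ := hfg.exists_smooth_approx hU hf hg hf2 hg2 hK hψU
  set K := tsupport ψ with hKdef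
  have hKm : MeasurableSet K := hK.measurableSet
  have hmono : ∀ w : SpT → ℝ, Measurable w → ∫⁻ z in U, ‖w z‖ₑ ^ 2 ≠ ⊤ →
      MemLp w 2 (volume.restrict K) := fun w hw hw2 => by
    rw [memLp_two_iff_lintegral hw.aestronglyMeasurable]
    exact ((lintegral_mono_set hψU).trans_lt hw2.lt_top).ne
  have hbd : ∀ w b : SpT → ℝ, MemLp w 2 (volume.restrict K) → Continuous b →
      MemLp (fun z => w z * b z) 2 (volume.restrict K) := fun w b hw hb => by
    obtain ⟨C, hC⟩ := hK.exists_bound_of_continuousOn hb.continuousOn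
    exact MemLp.mul (p := 2) (q := ⊤) (r := 2) (μ := volume.restrict K)
      (memLp_top_of_bound hb.aestronglyMeasurable C (by
        filter_upwards [ae_restrict_mem hKm] with z hz using hC z hz)) hw
  have hcont : ∀ b : SpT → ℝ, Continuous b → MemLp b 2 (volume.restrict K) := fun b hb => by
    have : IsFiniteMeasure (volume.restrict K) := ⟨by simpa using hK.measure_lt_top⟩
    have := hbd (fun _ => 1) b (memLp_const 1) hb
    simpa using this
  have hUK : ∀ w : SpT → ℝ, (∀ z, z ∉ K → w z = 0) → ∫ z in U, w z = ∫ z in K, w z :=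
    fun w hw => (setIntegral_eq_of_subset_of_forall_sdiff_eq_zero
      (hU.measurableSet) hψU fun z hz => hw z hz.2)
  have hψ0 : ∀ z, z ∉ K → ψ z = 0 := fun z hz => image_eq_zero_of_notMem_tsupport hz
  have hdψ0 : ∀ z, z ∉ K → sderiv j ψ z = 0 := fun z hz => sderiv_eq_zero_of_notMem_tsupport hz
  have hψcont := hψs.continuous
  have hdψcont := (IsTestOn.sderiv_contDiff hψs j).continuous
  have hfK := hmono f hf hf2
  have hhK := hmono h hh hh2
  have hgK := hmono _ (hg j) (hg2 j)
  have hkK := hmono _ (hk j) (hk2 j)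
  have hFK : ∀ n, MemLp (F n) 2 (volume.restrict K) := fun n => hcont _ (hFs n).continuous
  have hdFK : ∀ n, MemLp (sderiv j (F n)) 2 (volume.restrict K) := fun n =>
    hcont _ (IsTestOn.sderiv_contDiff (hFs n) j).continuous
  have L1 := tendsto_integral_mul_of_tendsto_two hFK hfK (hbd h _ hhK hdψcont) hFf
  have L2 := tendsto_integral_mul_of_tendsto_two hFK hfK (hbd (k j) _ hkK hψcont) hFf
  have L3 := tendsto_integral_mul_of_tendsto_two hdFK hgK (hbd h _ hhK hψcont) (hFg j)
  have key : ∀ n, ∫ z in K, F n z * (h z * sderiv j ψ z)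
      = - ((∫ z in K, F n z * (k j z * ψ z)) + ∫ z in K, sderiv j (F n) z * (h z * ψ z)) := by
    intro n
    have hT : IsTestOn U (fun z => F n z * ψ z) := by
      refine ⟨(hFs n).mul hψs, hψc.mul_left, ?_⟩
      exact (tsupport_mul_subset_right (f := F n) (g := ψ)).trans hψU
    have := hhk j _ hT
    simp_rw [fun z => sderiv_mul (j := j) ((hFs n).differentiable (by simp) z)
      (hψs.differentiable (by simp) z)] at this
    rw [hUK _ (fun z hz => by simp [hψ0 z hz, hdψ0 z hz]),
      hUK _ (fun z hz => by simp [hψ0 z hz])] at this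
    have e1 : ∫ z in K, h z * (F n z * sderiv j ψ z + ψ z * sderiv j (F n) z)
        = (∫ z in K, F n z * (h z * sderiv j ψ z)) +
          ∫ z in K, sderiv j (F n) z * (h z * ψ z) := by
      rw [← integral_add (integrable_mul_of_memLp_two (hFK n) (hbd h _ hhK hdψcont))
        (integrable_mul_of_memLp_two (hdFK n) (hbd h _ hhK hψcont))]
      refine integral_congr_ae (Eventually.of_forall fun z => ?_)
      dsimp only; ring
    have e2 : ∫ z in K, k j z * (F n z * ψ z) = ∫ z in K, F n z * (k j z * ψ z) := by
      refine integral_congr_ae (Eventually.of_forall fun z => ?_)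
      dsimp only; ring
    rw [e1, e2] at this
    linarith
  have hlim := tendsto_nhds_unique L1 (((L2.add L3).neg).congr fun n => (key n).symm)
  rw [hUK _ (fun z hz => by simp [hdψ0 z hz]), hUK _ (fun z hz => by simp [hψ0 z hz])]
  have e3 : ∫ z in K, f z * h z * sderiv j ψ z = ∫ z in K, f z * (h z * sderiv j ψ z) := by
    simp_rw [mul_assoc]
  rw [e3, hlim, ← integral_add (integrable_mul_of_memLp_two hfK (hbd (k j) _ hkK hψcont))
    (integrable_mul_of_memLp_two hgK (hbd h _ hhK hψcont))]
  congr 1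
  refine integral_congr_ae (Eventually.of_forall fun z => ?_)
  dsimp only; ring

/-- Partial derivative of a function on space. -/
def pderiv3 (j : Fin 3) (ξ : E3 → ℝ) (x : E3) : ℝ := fderiv ℝ ξ x (EuclideanSpace.single j 1)

theorem contDiff_pderiv3 {ξ : E3 → ℝ} (hξ : ContDiff ℝ (⊤ : ℕ∞) ξ) (j : Fin 3) :
    ContDiff ℝ (⊤ : ℕ∞) (pderiv3 j ξ) := by
  unfold pderiv3
  exact (hξ.fderiv_right (m := (⊤ : ℕ∞)) (by simp)).clm_apply contDiff_const

theorem sderiv_tensor {ξ : E3 → ℝ} (hξ : ContDiff ℝ (⊤ : ℕ∞) ξ) {θ : ℝ → ℝ}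
    (hθ : ContDiff ℝ (⊤ : ℕ∞) θ) (j : Fin 3) :
    sderiv j (fun z => ξ z.1 * θ z.2) = fun z => pderiv3 j ξ z.1 * θ z.2 := by
  funext z
  have h1 : HasFDerivAt (fun z : SpT => ξ z.1) _ z :=
    (hξ.differentiable (by simp) z.1).hasFDerivAt.comp z hasFDerivAt_fst
  have h2 : HasFDerivAt (fun z : SpT => θ z.2) _ z :=
    (hθ.differentiable (by simp) z.2).hasFDerivAt.comp z hasFDerivAt_snd
  unfold sderiv pderiv3
  rw [(h1.fun_mul h2).fderiv]
  simp [mul_comm]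

theorem sLap_tensor {ξ : E3 → ℝ} (hξ : ContDiff ℝ (⊤ : ℕ∞) ξ) {θ : ℝ → ℝ}
    (hθ : ContDiff ℝ (⊤ : ℕ∞) θ) (z : SpT) :
    sLap (fun z => ξ z.1 * θ z.2) z = (∑ j, pderiv3 j (pderiv3 j ξ) z.1) * θ z.2 := by
  unfold sLap
  simp_rw [fun j => sderiv_tensor hξ hθ j,
    fun j => sderiv_tensor (contDiff_pderiv3 hξ j) hθ j, Finset.sum_mul]

theorem tderiv_tensor {ξ : E3 → ℝ} (hξ : ContDiff ℝ (⊤ : ℕ∞) ξ) {θ : ℝ → ℝ}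
    (hθ : ContDiff ℝ (⊤ : ℕ∞) θ) (z : SpT) :
    tderiv (fun z => ξ z.1 * θ z.2) z = ξ z.1 * deriv θ z.2 := by
  have h1 : HasFDerivAt (fun z : SpT => ξ z.1) _ z :=
    (hξ.differentiable (by simp) z.1).hasFDerivAt.comp z hasFDerivAt_fst
  have h2 : HasFDerivAt (fun z : SpT => θ z.2) _ z :=
    (hθ.differentiable (by simp) z.2).hasFDerivAt.comp z hasFDerivAt_snd
  unfold tderiv
  rw [(h1.fun_mul h2).fderiv]
  simp

theorem tsupport_tensor_subset (ξ : E3 → ℝ) (θ : ℝ → ℝ) :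
    tsupport (fun z : SpT => ξ z.1 * θ z.2) ⊆ tsupport ξ ×ˢ tsupport θ := by
  refine closure_minimal ?_ ((isClosed_tsupport ξ).prod (isClosed_tsupport θ))
  intro z hz
  have hz' : ξ z.1 * θ z.2 ≠ 0 := hz
  exact ⟨subset_tsupport _ (left_ne_zero_of_mul hz'), subset_tsupport _ (right_ne_zero_of_mul hz')⟩

theorem isTestOn_tensor {S : Set E3} {I : Set ℝ} {ξ : E3 → ℝ} (hξ : ContDiff ℝ (⊤ : ℕ∞) ξ)
    (hξc : HasCompactSupport ξ) (hξS : tsupport ξ ⊆ S) {θ : ℝ → ℝ}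
    (hθ : ContDiff ℝ (⊤ : ℕ∞) θ) (hθc : HasCompactSupport θ) (hθI : tsupport θ ⊆ I) :
    IsTestOn (S ×ˢ I) (fun z => ξ z.1 * θ z.2) := by
  refine ⟨(hξ.comp contDiff_fst).mul (hθ.comp contDiff_snd), ?_, ?_⟩
  · exact IsCompact.of_isClosed_subset (hξc.prod hθc) (isClosed_tsupport _)
      (tsupport_tensor_subset ξ θ)
  · exact (tsupport_tensor_subset ξ θ).trans (prod_mono hξS hθI)

theorem volume_restrict_prod_SpT (S : Set E3) (I : Set ℝ) :
    (volume : Measure SpT).restrict (S ×ˢ I)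
      = (volume.restrict S).prod (volume.restrict I) := by
  rw [Measure.prod_restrict]; rfl

/-- A space-time integral vanishing against all time test functions vanishes on almost every
time slice. -/
theorem ae_setIntegral_slice_eq_zero {S : Set E3} {I : Set ℝ} (hI : IsOpen I) {H : SpT → ℝ}
    (hH : IntegrableOn H (S ×ˢ I))
    (h : ∀ θ : ℝ → ℝ, ContDiff ℝ (⊤ : ℕ∞) θ → HasCompactSupport θ → tsupport θ ⊆ I →
      ∫ z in S ×ˢ I, H z * θ z.2 = 0) :
    ∀ᵐ t ∂(volume.restrict I), ∫ x in S, H (x, t) = 0 := by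
  unfold IntegrableOn at hH
  rw [volume_restrict_prod_SpT] at hH h
  have hi : Integrable (fun t => ∫ x in S, H (x, t)) (volume.restrict I) :=
    hH.integral_prod_right
  have key := hI.ae_eq_zero_of_integral_contDiff_smul_eq_zero (μ := volume)
    (f := fun t => ∫ x in S, H (x, t)) (IntegrableOn.locallyIntegrableOn hi) ?_
  · rw [ae_restrict_iff' hI.measurableSet]; exact key
  · intro θ hθ hθc hθI
    have h1 := h θ hθ hθc hθI
    have hb : Integrable (fun z : SpT => H z * θ z.2)
        ((volume.restrict S).prod (volume.restrict I)) := by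
      obtain ⟨C, hC⟩ := hθc.exists_bound_of_continuous hθ.continuous
      exact hH.mul_bdd (c := C) (hθ.continuous.comp continuous_snd).aestronglyMeasurable
        (Eventually.of_forall fun z => hC z.2)
    rw [integral_prod_symm _ hb] at h1
    simp only [integral_mul_const] at h1
    rw [← setIntegral_eq_integral_of_forall_compl_eq_zero (s := I), ← h1]
    · refine integral_congr_ae (Eventually.of_forall fun t => ?_)
      simp [mul_comm]
    · intro t ht
      have : θ t = 0 := image_eq_zero_of_notMem_tsupport fun h => ht (hθI h)
      simp [this]

/-- Slices of a divergence free field are divergence free. -/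
theorem DivFreeOn.ae_slice {S : Set E3} {I : Set ℝ} (hI : IsOpen I)
    {u : SpT → E3} (hu : IntegrableOn u (S ×ˢ I)) (h : DivFreeOn (S ×ˢ I) u) {ξ : E3 → ℝ}
    (hξ : ContDiff ℝ (⊤ : ℕ∞) ξ) (hξc : HasCompactSupport ξ) (hξS : tsupport ξ ⊆ S) :
    ∀ᵐ t ∂(volume.restrict I), ∫ x in S, ∑ j, u (x, t) j * pderiv3 j ξ x = 0 := by
  refine ae_setIntegral_slice_eq_zero hI (H := fun z => ∑ j, u z j * pderiv3 j ξ z.1) ?_ ?_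
  · refine integrable_finsetSum _ fun j _ => ?_
    have hc : Continuous (pderiv3 j ξ) := (contDiff_pderiv3 hξ j).continuous
    obtain ⟨C, hC⟩ := (hξc.fderiv_apply ℝ (EuclideanSpace.single j 1)).exists_bound_of_continuous hc
    refine Integrable.mul_bdd (c := C) ?_ (hc.comp continuous_fst).aestronglyMeasurable
      (Eventually.of_forall fun z => hC z.1)
    exact (EuclideanSpace.proj (𝕜 := ℝ) j).integrable_comp hu
  · intro θ hθ hθc hθI
    have := h _ (isTestOn_tensor hξ hξc hξS hθ hθc hθI)
    simp_rw [fun j => sderiv_tensor hξ hθ j] at this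
    rw [← this]
    refine integral_congr_ae (Eventually.of_forall fun z => ?_)
    simp only [Finset.sum_mul, mul_assoc]

/-- Slices of a weak Poisson equation. -/
theorem ae_slice_poisson {S : Set E3} {I : Set ℝ} (hI : IsOpen I)
    {P : SpT → ℝ} {G : Fin 3 → SpT → ℝ} (hP : IntegrableOn P (S ×ˢ I))
    (hG : ∀ j, IntegrableOn (G j) (S ×ˢ I))
    (h : ∀ ψ, IsTestOn (S ×ˢ I) ψ →
      ∫ z in S ×ˢ I, (P z * sLap ψ z - ∑ j, G j z * sderiv j ψ z) = 0) {ξ : E3 → ℝ}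
    (hξ : ContDiff ℝ (⊤ : ℕ∞) ξ) (hξc : HasCompactSupport ξ) (hξS : tsupport ξ ⊆ S) :
    ∀ᵐ t ∂(volume.restrict I), ∫ x in S,
      (P (x, t) * (∑ j, pderiv3 j (pderiv3 j ξ) x) - ∑ j, G j (x, t) * pderiv3 j ξ x) = 0 := by
  refine ae_setIntegral_slice_eq_zero hI (H := fun z =>
    P z * (∑ j, pderiv3 j (pderiv3 j ξ) z.1) - ∑ j, G j z * pderiv3 j ξ z.1) ?_ ?_
  · have hb : ∀ (w : SpT → ℝ) (b : E3 → ℝ), IntegrableOn w (S ×ˢ I) → Continuous b →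
        HasCompactSupport b → IntegrableOn (fun z => w z * b z.1) (S ×ˢ I) := by
      intro w b hw hb hbc
      obtain ⟨C, hC⟩ := hbc.exists_bound_of_continuous hb
      exact Integrable.mul_bdd (c := C) hw (hb.comp continuous_fst).aestronglyMeasurable
        (Eventually.of_forall fun z => hC z.1)
    have hcs : ∀ (b : E3 → ℝ) (j : Fin 3), HasCompactSupport b →
      HasCompactSupport (pderiv3 j b) := fun b j hb => hb.fderiv_apply ℝ (EuclideanSpace.single j 1)
    simp_rw [Finset.mul_sum]
    refine Integrable.sub (integrable_finsetSum _ fun j _ => ?_)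
      (integrable_finsetSum _ fun j _ => ?_)
    · exact hb _ _ hP (contDiff_pderiv3 (contDiff_pderiv3 hξ j) j).continuous
        (hcs _ _ (hcs _ _ hξc))
    · exact hb _ _ (hG j) (contDiff_pderiv3 hξ j).continuous (hcs _ _ hξc)
  · intro θ hθ hθc hθI
    have := h _ (isTestOn_tensor hξ hξc hξS hθ hθc hθI)
    simp_rw [fun j => sderiv_tensor hξ hθ j, fun z => sLap_tensor hξ hθ z] at this
    rw [← this]
    refine integral_congr_ae (Eventually.of_forall fun z => ?_)
    simp only [Finset.sum_mul, sub_mul, mul_assoc]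

/-- Squared Euclidean norm of the gradient. -/
def gradSq (F : E3 → ℝ) (x : E3) : ℝ≥0∞ := ∑ j, ‖pderiv3 j F x‖ₑ ^ 2

theorem continuous_pderiv3 {F : E3 → ℝ} (hF : ContDiff ℝ 1 F) (j : Fin 3) :
    Continuous (pderiv3 j F) :=
  (hF.continuous_fderiv (by simp)).clm_apply continuous_const

theorem measurable_gradSq {F : E3 → ℝ} (hF : ContDiff ℝ 1 F) : Measurable (gradSq F) :=
  Finset.measurable_sum _ fun j _ => (continuous_pderiv3 hF j).measurable.enorm.pow_const 2

theorem enorm_sq_eq_ofReal (x : ℝ) : ‖x‖ₑ ^ 2 = ENNReal.ofReal (x ^ 2) := by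
  rw [Real.enorm_eq_ofReal_abs, ← ENNReal.ofReal_pow (abs_nonneg x), sq_abs]

theorem enorm_fderiv_apply_sq_le (F : E3 → ℝ) (x v : E3) :
    ‖fderiv ℝ F x v‖ₑ ^ 2 ≤ ‖v‖ₑ ^ 2 * gradSq F x := by
  have hv : v = ∑ j, v j • (EuclideanSpace.single j 1 : E3) := by
    ext i; simp [Finset.sum_apply, Pi.single_apply]
  have h1 : fderiv ℝ F x v = ∑ j, v j * pderiv3 j F x := by
    conv_lhs => rw [hv]
    simp [pderiv3]
  have h2 : (fderiv ℝ F x v) ^ 2 ≤ ‖v‖ ^ 2 * ∑ j, pderiv3 j F x ^ 2 := by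
    rw [h1, EuclideanSpace.real_norm_sq_eq]
    exact Finset.sum_mul_sq_le_sq_mul_sq _ _ _
  unfold gradSq
  simp_rw [enorm_sq_eq_ofReal]
  rw [← ENNReal.ofReal_sum_of_nonneg (fun _ _ => sq_nonneg _), ← ofReal_norm,
    ← ENNReal.ofReal_pow (norm_nonneg v), ← ENNReal.ofReal_mul (sq_nonneg _)]
  exact ENNReal.ofReal_le_ofReal h2

theorem enorm_sub_midpoint_sq_le {F : E3 → ℝ} (hF : ContDiff ℝ 1 F) (x y : E3) :
    ‖F y - F ((1 / 2 : ℝ) • x + (1 / 2 : ℝ) • y)‖ₑ ^ 2 ≤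
      ‖y - x‖ₑ ^ 2 * ∫⁻ s in Ioc (1 / 2 : ℝ) 1, gradSq F ((1 - s) • x + s • y) := by
  have hd : ∀ s : ℝ, HasDerivAt (fun s : ℝ => F ((1 - s) • x + s • y))
      (fderiv ℝ F ((1 - s) • x + s • y) (y - x)) s := fun s => by
    have h1 : HasDerivAt (fun s : ℝ => (1 - s) • x + s • y) (y - x) s := by
      have e : (y - x : E3) = (0 - 1 : ℝ) • x + (1 : ℝ) • y := by
        simp [sub_eq_neg_add]
      rw [e]
      exact (((hasDerivAt_const s (1 : ℝ)).sub (hasDerivAt_id s)).smul_const x).add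
        ((hasDerivAt_id s).smul_const y)
    exact ((hF.differentiable (by simp)) _).hasFDerivAt.comp_hasDerivAt s h1
  have hc : Continuous fun s : ℝ => fderiv ℝ F ((1 - s) • x + s • y) (y - x) :=
    ((hF.continuous_fderiv (by simp)).comp (by fun_prop)).clm_apply continuous_const
  have hft := intervalIntegral.integral_eq_sub_of_hasDerivAt (a := 1 / 2) (b := 1)
    (fun s _ => hd s) (hc.intervalIntegrable _ _)
  have e1 : F y - F ((1 / 2 : ℝ) • x + (1 / 2 : ℝ) • y)
      = ∫ s in (1 / 2 : ℝ)..1, fderiv ℝ F ((1 - s) • x + s • y) (y - x) := by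
    rw [hft]; norm_num
  rw [e1, intervalIntegral.integral_of_le (by norm_num)]
  have h2 := lintegral_mul_sq_le (μ := volume.restrict (Ioc (1 / 2 : ℝ) 1))
    (k := fun _ => 1) (h := fun s => ‖fderiv ℝ F ((1 - s) • x + s • y) (y - x)‖ₑ)
    aemeasurable_const hc.measurable.enorm.aemeasurable
  calc _ ≤ (∫⁻ s in Ioc (1 / 2 : ℝ) 1, ‖fderiv ℝ F ((1 - s) • x + s • y) (y - x)‖ₑ) ^ 2 := by
        gcongr; exact enorm_integral_le_lintegral_enorm _
    _ ≤ 1 * ∫⁻ s in Ioc (1 / 2 : ℝ) 1, ‖fderiv ℝ F ((1 - s) • x + s • y) (y - x)‖ₑ ^ 2 := by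
        simp only [one_mul] at h2 ⊢
        refine h2.trans ?_
        conv_rhs => rw [← one_mul (lintegral _ _)]
        gcongr
        simp only [one_pow, lintegral_const, one_mul, Measure.restrict_apply MeasurableSet.univ,
          univ_inter, Real.volume_Ioc]
        rw [ENNReal.ofReal_le_one]; norm_num
    _ ≤ ∫⁻ s in Ioc (1 / 2 : ℝ) 1, ‖y - x‖ₑ ^ 2 * gradSq F ((1 - s) • x + s • y) := by
        rw [one_mul]
        exact lintegral_mono fun s => enorm_fderiv_apply_sq_le F _ _
    _ = _ := by
        rw [lintegral_const_mul' _ _ (by finiteness)]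

theorem lintegral_comp_add_smul (g : E3 → ℝ≥0∞) (hg : Measurable g) (c : E3) {s : ℝ} (hs : 0 < s) :
    ∫⁻ y, g (c + s • y) = ENNReal.ofReal (s ^ 3)⁻¹ * ∫⁻ y, g y := by
  have h1 : ∫⁻ y, g (c + s • y) = ∫⁻ y, g (c + y) ∂(Measure.map (s • ·) (volume : Measure E3)) := by
    rw [lintegral_map (f := fun y => g (c + y)) (hg.comp (measurable_const_add c))
      (measurable_const_smul s)]
  rw [h1, Measure.map_addHaar_smul _ hs.ne', lintegral_smul_measure,
    lintegral_add_left_eq_self g c]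
  simp [abs_of_pos hs]

/-- The Poincaré inequality on balls, in two-point form. -/
theorem poincare_ball {R : ℝ} (hR : R ≤ 1) : ∃ c : ℝ≥0, ∀ F : E3 → ℝ, ContDiff ℝ 1 F →
    ∫⁻ x in Metric.ball (0 : E3) R, ∫⁻ y in Metric.ball (0 : E3) R, ‖F x - F y‖ₑ ^ 2 ≤
      c * ∫⁻ x in Metric.ball (0 : E3) R, gradSq F x := by
  set B := Metric.ball (0 : E3) R with hB
  have hBm : MeasurableSet B := measurableSet_ball
  have hBf : volume B ≠ ⊤ := measure_ball_lt_top.ne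
  refine ⟨4 * (4 * (8 * (volume B).toNNReal)), fun F hF => ?_⟩
  set g := gradSq F
  have hg : Measurable g := measurable_gradSq hF
  have hFm : Measurable F := hF.continuous.measurable
  have hmid : ∀ a b : E3, ‖a - b‖ₑ ^ 2 = ‖b - a‖ₑ ^ 2 := fun a b => by rw [enorm_sub_rev]
  have inner : ∀ x ∈ B, ∀ s ∈ Ioc (1 / 2 : ℝ) 1,
      ∫⁻ y in B, g ((1 - s) • x + s • y) ≤ 8 * ∫⁻ y in B, g y := by
    intro x hx s hs
    have hs0 : 0 < s := by linarith [hs.1]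
    rw [← lintegral_indicator hBm, ← lintegral_indicator hBm]
    calc ∫⁻ y, B.indicator (fun y => g ((1 - s) • x + s • y)) y
        ≤ ∫⁻ y, B.indicator g ((1 - s) • x + s • y) := by
          refine lintegral_mono fun y => ?_
          refine indicator_apply_le' (fun hy => ?_) (fun _ => zero_le)
          have : (1 - s) • x + s • y ∈ B :=
            (convex_ball (0 : E3) R) hx hy (by linarith [hs.2]) hs0.le (by ring)
          rw [indicator_of_mem this]
      _ = ENNReal.ofReal (s ^ 3)⁻¹ * ∫⁻ y, B.indicator g y :=
          lintegral_comp_add_smul _ (hg.indicator hBm) _ hs0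
      _ ≤ 8 * ∫⁻ y, B.indicator g y := by
          gcongr
          rw [show (8 : ℝ≥0∞) = ENNReal.ofReal 8 by norm_num]
          apply ENNReal.ofReal_le_ofReal
          rw [inv_le_comm₀ (by positivity) (by norm_num)]
          calc (8 : ℝ)⁻¹ = (1 / 2) ^ 3 := by norm_num
            _ ≤ s ^ 3 := by gcongr; exact hs.1.le
  have half : ∫⁻ x in B, ∫⁻ y in B, ‖F y - F ((1 / 2 : ℝ) • x + (1 / 2 : ℝ) • y)‖ₑ ^ 2 ≤
      4 * (8 * volume B) * ∫⁻ x in B, g x := by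
    calc _ ≤ ∫⁻ x in B, ∫⁻ y in B, 4 * ∫⁻ s in Ioc (1 / 2 : ℝ) 1, g ((1 - s) • x + s • y) := by
          refine setLIntegral_mono' hBm fun x hx => setLIntegral_mono' hBm fun y hy => ?_
          refine (enorm_sub_midpoint_sq_le hF x y).trans ?_
          gcongr
          have h2 : ‖y - x‖ ≤ 2 := by
            have := norm_sub_le y x
            have hx' := mem_ball_zero_iff.1 hx
            have hy' := mem_ball_zero_iff.1 hy
            linarith
          calc ‖y - x‖ₑ ^ 2 ≤ (ENNReal.ofReal 2) ^ 2 := by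
                rw [← ofReal_norm]; gcongr
            _ = 4 := by norm_num
      _ = ∫⁻ x in B, 4 * ∫⁻ s in Ioc (1 / 2 : ℝ) 1, ∫⁻ y in B, g ((1 - s) • x + s • y) := by
          refine lintegral_congr fun x => ?_
          rw [lintegral_const_mul' _ _ (by norm_num), lintegral_lintegral_swap]
          refine Measurable.aemeasurable ?_
          exact hg.comp (by fun_prop)
      _ ≤ ∫⁻ x in B, 4 * ∫⁻ s in Ioc (1 / 2 : ℝ) 1, 8 * ∫⁻ y in B, g y := by
          refine setLIntegral_mono' hBm fun x hx => ?_
          gcongr 4 * ?_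
          exact setLIntegral_mono' measurableSet_Ioc fun s hs => inner x hx s hs
      _ ≤ ∫⁻ x in B, 4 * (8 * ∫⁻ y in B, g y) := by
          refine lintegral_mono fun x => ?_
          dsimp only
          gcongr 4 * ?_
          rw [lintegral_const, Measure.restrict_apply MeasurableSet.univ, univ_inter,
            Real.volume_Ioc]
          refine mul_le_of_le_one_right' ?_
          rw [ENNReal.ofReal_le_one]; norm_num
      _ = _ := by
          rw [lintegral_const, Measure.restrict_apply MeasurableSet.univ, univ_inter]
          ring
  calc _ ≤ ∫⁻ x in B, ∫⁻ y in B, (2 * ‖F y - F ((1 / 2 : ℝ) • x + (1 / 2 : ℝ) • y)‖ₑ ^ 2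
            + 2 * ‖F x - F ((1 / 2 : ℝ) • y + (1 / 2 : ℝ) • x)‖ₑ ^ 2) := by
        refine lintegral_mono fun x => lintegral_mono fun y => ?_
        dsimp only
        rw [add_comm ((1 / 2 : ℝ) • y)]
        set m := F ((1 / 2 : ℝ) • x + (1 / 2 : ℝ) • y)
        simp_rw [enorm_sq_eq_ofReal]
        rw [show (2 : ℝ≥0∞) = ENNReal.ofReal 2 by norm_num, ← ENNReal.ofReal_mul (by norm_num),
          ← ENNReal.ofReal_mul (by norm_num), ← ENNReal.ofReal_add (by positivity) (by positivity)]
        apply ENNReal.ofReal_le_ofReal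
        nlinarith [sq_nonneg ((F x - m) + (F y - m))]
    _ = 2 * (∫⁻ x in B, ∫⁻ y in B, ‖F y - F ((1 / 2 : ℝ) • x + (1 / 2 : ℝ) • y)‖ₑ ^ 2)
        + 2 * ∫⁻ x in B, ∫⁻ y in B, ‖F y - F ((1 / 2 : ℝ) • x + (1 / 2 : ℝ) • y)‖ₑ ^ 2 := by
        have hm : Measurable fun z : E3 × E3 =>
            ‖F z.2 - F ((1 / 2 : ℝ) • z.1 + (1 / 2 : ℝ) • z.2)‖ₑ ^ 2 := by fun_prop
        have hm2 : Measurable fun z : E3 × E3 =>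
            ‖F z.1 - F ((1 / 2 : ℝ) • z.2 + (1 / 2 : ℝ) • z.1)‖ₑ ^ 2 := by fun_prop
        have e : ∀ x, ∫⁻ y in B, (2 * ‖F y - F ((1 / 2 : ℝ) • x + (1 / 2 : ℝ) • y)‖ₑ ^ 2
            + 2 * ‖F x - F ((1 / 2 : ℝ) • y + (1 / 2 : ℝ) • x)‖ₑ ^ 2)
            = 2 * (∫⁻ y in B, ‖F y - F ((1 / 2 : ℝ) • x + (1 / 2 : ℝ) • y)‖ₑ ^ 2)
            + 2 * ∫⁻ y in B, ‖F x - F ((1 / 2 : ℝ) • y + (1 / 2 : ℝ) • x)‖ₑ ^ 2 := fun x => by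
          rw [lintegral_add_left (by fun_prop), lintegral_const_mul' _ _ (by norm_num),
            lintegral_const_mul' _ _ (by norm_num)]
        simp_rw [e]
        rw [lintegral_add_left (Measurable.const_mul (hm.lintegral_prod_right') 2),
          lintegral_const_mul' _ _ (by norm_num), lintegral_const_mul' _ _ (by norm_num)]
        congr 2
        rw [lintegral_lintegral_swap hm2.aemeasurable]
    _ ≤ 2 * (4 * (8 * volume B) * ∫⁻ x in B, g x) + 2 * (4 * (8 * volume B) * ∫⁻ x in B, g x) := by
        gcongr
    _ = _ := by
        push_cast
        rw [ENNReal.coe_toNNReal hBf]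
        ring

/-- Convergence to zero of integrals gives almost everywhere convergence to zero along a
subsequence. -/
theorem exists_subseq_ae_tendsto_zero {α : Type*} [MeasurableSpace α] {μ : Measure α}
    {e : ℕ → α → ℝ≥0∞} (he : ∀ n, AEMeasurable (e n) μ)
    (h : Tendsto (fun n => ∫⁻ a, e n a ∂μ) atTop (𝓝 0)) :
    ∃ ns : ℕ → ℕ, StrictMono ns ∧ ∀ᵐ a ∂μ, Tendsto (fun k => e (ns k) a) atTop (𝓝 0) := by
  have hev : ∀ k : ℕ, ∀ᶠ n in atTop, ∫⁻ a, e n a ∂μ < (2⁻¹ : ℝ≥0∞) ^ k := fun k =>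
    h.eventually (gt_mem_nhds (ENNReal.pow_pos (by simp) k))
  obtain ⟨ns, hns, hlt⟩ := extraction_forall_of_eventually hev
  refine ⟨ns, hns, ?_⟩
  have hsum : ∫⁻ a, ∑' k, e (ns k) a ∂μ ≠ ⊤ := by
    rw [lintegral_tsum fun k => he _]
    refine ne_top_of_le_ne_top ?_ (ENNReal.tsum_le_tsum fun k => (hlt k).le)
    rw [ENNReal.tsum_geometric]
    simp
  filter_upwards [ae_lt_top' (AEMeasurable.tsum fun k => he _) hsum] with a ha
  exact ENNReal.tendsto_atTop_zero_of_tsum_ne_top ha.ne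

theorem enorm_fderiv_sq_le (F : E3 → ℝ) (x : E3) : ‖fderiv ℝ F x‖ₑ ^ 2 ≤ gradSq F x := by
  have hfin : gradSq F x ≠ ⊤ := ENNReal.sum_ne_top.2 fun j _ => by finiteness
  have h1 : ‖fderiv ℝ F x‖ ≤ Real.sqrt (gradSq F x).toReal := by
    refine ContinuousLinearMap.opNorm_le_bound _ (Real.sqrt_nonneg _) fun v => ?_
    refine abs_le_of_sq_le_sq' ?_ (by positivity) |> abs_le.2
    have h2 := ENNReal.toReal_mono (by finiteness) (enorm_fderiv_apply_sq_le F x v)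
    simp only [ENNReal.toReal_pow, toReal_enorm, ENNReal.toReal_mul, Real.norm_eq_abs, sq_abs] at h2
    rw [mul_pow, Real.sq_sqrt ENNReal.toReal_nonneg]
    linarith
  calc ‖fderiv ℝ F x‖ₑ ^ 2 ≤ ENNReal.ofReal (Real.sqrt (gradSq F x).toReal) ^ 2 := by
        rw [← ofReal_norm]; gcongr
    _ = gradSq F x := by
        rw [← ENNReal.ofReal_pow (Real.sqrt_nonneg _), Real.sq_sqrt ENNReal.toReal_nonneg,
          ENNReal.ofReal_toReal hfin]

theorem ennreal_add_sq_le (a b : ℝ≥0∞) : (a + b) ^ 2 ≤ 2 * (a ^ 2 + b ^ 2) := by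
  have := ENNReal.rpow_add_le_mul_rpow_add_rpow a b (p := 2) (by norm_num)
  norm_num at this
  exact_mod_cast this

theorem enorm_add_sq_le {E : Type*} [NormedAddCommGroup E] (a b : E) :
    ‖a + b‖ₑ ^ 2 ≤ 2 * (‖a‖ₑ ^ 2 + ‖b‖ₑ ^ 2) :=
  (pow_le_pow_left' (enorm_add_le a b) 2).trans (ennreal_add_sq_le _ _)

/-- A local Sobolev inequality on concentric balls. -/
theorem sobolev_ball {r R : ℝ} (hr : 0 < r) (hrR : r < R) : ∃ c : ℝ≥0, ∀ F : E3 → ℝ,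
    ContDiff ℝ 1 F → ∀ m : ℝ,
    ∫⁻ x in Metric.ball (0 : E3) r, ‖F x - m‖ₑ ^ 4 ≤
      c * ((∫⁻ x in Metric.ball (0 : E3) R, gradSq F x) +
        ∫⁻ x in Metric.ball (0 : E3) R, ‖F x - m‖ₑ ^ 2) ^ 2 := by
  let χ : ContDiffBump (0 : E3) := ⟨r, (r + R) / 2, hr, by linarith⟩
  set B := Metric.ball (0 : E3) R with hB
  have hχs : ContDiff ℝ 1 χ := χ.contDiff
  have hts : tsupport χ ⊆ B := by
    rw [χ.tsupport_eq]
    exact Metric.closedBall_subset_ball (show (r + R) / 2 < R by linarith)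
  obtain ⟨L, hL⟩ := (χ.hasCompactSupport.fderiv (𝕜 := ℝ)).exists_bound_of_continuous
    (hχs.continuous_fderiv (by simp))
  set K := eLpNormLESNormFDerivOfLeConst ℝ (volume : Measure E3) B 2 4
  refine ⟨K ^ 4 * (2 * (1 + Real.toNNReal L ^ 2)) ^ 2, fun F hF m => ?_⟩
  set U : E3 → ℝ := fun x => χ x * (F x - m) with hU
  have hUs : ContDiff ℝ 1 U := hχs.mul (hF.sub contDiff_const)
  have hUsupp : U.support ⊆ B := fun x hx =>
    hts (subset_tsupport _ (left_ne_zero_of_mul (show χ x * (F x - m) ≠ 0 from hx)))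
  have hsob := eLpNorm_le_eLpNorm_fderiv_of_le (μ := (volume : Measure E3)) hUs hUsupp
    (p := 2) (q := 4) (by norm_num) (by simp; norm_num) (by simp; norm_num)
    Metric.isBounded_ball
  have e4 : eLpNorm U (4 : ℝ≥0) volume ^ 4 = ∫⁻ x, ‖U x‖ₑ ^ 4 := by
    rw [eLpNorm_eq_lintegral_rpow_enorm_toReal (by norm_num) (by simp), ← ENNReal.rpow_natCast,
      ← ENNReal.rpow_mul]
    simp
  have e2 : eLpNorm (fderiv ℝ U) (2 : ℝ≥0) volume ^ 2 = ∫⁻ x, ‖fderiv ℝ U x‖ₑ ^ 2 := by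
    rw [eLpNorm_eq_lintegral_rpow_enorm_toReal (by norm_num) (by simp), ← ENNReal.rpow_natCast,
      ← ENNReal.rpow_mul]
    simp
  have hgrad : ∫⁻ x, ‖fderiv ℝ U x‖ₑ ^ 2 ≤ 2 * (1 + Real.toNNReal L ^ 2) *
      ((∫⁻ x in B, gradSq F x) + ∫⁻ x in B, ‖F x - m‖ₑ ^ 2) := by
    have h0 : ∀ x, x ∉ B → ‖fderiv ℝ U x‖ₑ ^ 2 = 0 := fun x hx => by
      have hx' : x ∉ tsupport U := fun h =>
        hx (hts ((tsupport_mul_subset_left (f := χ) (g := fun x => F x - m)) h))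
      rw [fderiv_of_notMem_tsupport (𝕜 := ℝ) hx', ← ofReal_norm, norm_zero]
      simp
    rw [← setLIntegral_eq_of_support_subset (s := B) (f := fun x => ‖fderiv ℝ U x‖ₑ ^ 2)
      (fun x hx => by_contra fun h => hx (h0 x h)),
      ← lintegral_add_left (measurable_gradSq hF), ← lintegral_const_mul' _ _ (by finiteness)]
    refine lintegral_mono fun x => ?_
    have hd : fderiv ℝ U x = χ x • fderiv ℝ F x + (F x - m) • fderiv ℝ χ x := by
      have h1 := ((hχs.differentiable (by simp) x).hasFDerivAt).fun_mul
        (((hF.differentiable (by simp) x).hasFDerivAt).sub_const m)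
      exact h1.fderiv
    dsimp only
    rw [hd]
    refine (enorm_add_sq_le _ _).trans ?_
    rw [mul_assoc]
    gcongr
    rw [enorm_smul, enorm_smul, mul_pow, mul_pow]
    have h1 : ‖χ x‖ₑ ^ 2 * ‖fderiv ℝ F x‖ₑ ^ 2 ≤ gradSq F x := by
      calc _ ≤ 1 ^ 2 * gradSq F x := by
            gcongr
            · rw [Real.enorm_of_nonneg χ.nonneg]
              exact ENNReal.ofReal_le_one.2 χ.le_one
            · exact enorm_fderiv_sq_le F x
        _ = _ := by simp
    have h2 : ‖F x - m‖ₑ ^ 2 * ‖fderiv ℝ χ x‖ₑ ^ 2 ≤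
        (Real.toNNReal L : ℝ≥0∞) ^ 2 * ‖F x - m‖ₑ ^ 2 := by
      rw [mul_comm]
      gcongr
      rw [← ofReal_norm]
      exact ENNReal.ofReal_le_ofReal (hL x)
    calc _ ≤ gradSq F x + (Real.toNNReal L : ℝ≥0∞) ^ 2 * ‖F x - m‖ₑ ^ 2 := add_le_add h1 h2
      _ ≤ (gradSq F x + (Real.toNNReal L : ℝ≥0∞) ^ 2 * ‖F x - m‖ₑ ^ 2) +
          (‖F x - m‖ₑ ^ 2 + (Real.toNNReal L : ℝ≥0∞) ^ 2 * gradSq F x) := le_self_add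
      _ = _ := by ring
  calc ∫⁻ x in Metric.ball (0 : E3) r, ‖F x - m‖ₑ ^ 4
      = ∫⁻ x in Metric.ball (0 : E3) r, ‖U x‖ₑ ^ 4 := by
        refine setLIntegral_congr_fun measurableSet_ball fun x hx => ?_
        have : χ x = 1 := χ.one_of_mem_closedBall (Metric.ball_subset_closedBall hx)
        simp [hU, this]
    _ ≤ ∫⁻ x, ‖U x‖ₑ ^ 4 := setLIntegral_le_lintegral _ _
    _ ≤ ((K : ℝ≥0∞) * eLpNorm (fderiv ℝ U) (2 : ℝ≥0) volume) ^ 4 := by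
        rw [← e4]; gcongr
    _ = (K : ℝ≥0∞) ^ 4 * (∫⁻ x, ‖fderiv ℝ U x‖ₑ ^ 2) ^ 2 := by
        rw [← e2]; ring
    _ ≤ (K : ℝ≥0∞) ^ 4 * (2 * (1 + Real.toNNReal L ^ 2) *
      ((∫⁻ x in B, gradSq F x) + ∫⁻ x in B, ‖F x - m‖ₑ ^ 2)) ^ 2 := by gcongr
    _ = _ := by push_cast; ring

/-- `f` is an `L²(B_R)` limit of `C¹` functions whose gradients converge to `g` in `L²(B_R)`. -/
def SliceApprox (R : ℝ) (f : E3 → ℝ) (g : Fin 3 → E3 → ℝ) : Prop :=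
  ∃ F : ℕ → E3 → ℝ, (∀ n, ContDiff ℝ 1 (F n)) ∧
    Tendsto (fun n => ∫⁻ x in Metric.ball (0 : E3) R, ‖F n x - f x‖ₑ ^ 2) atTop (𝓝 0) ∧
    ∀ j, Tendsto (fun n => ∫⁻ x in Metric.ball (0 : E3) R, ‖pderiv3 j (F n) x - g j x‖ₑ ^ 2)
      atTop (𝓝 0)

theorem tendsto_lintegral_gradSq_bound {R : ℝ} {F : ℕ → E3 → ℝ} {g : Fin 3 → E3 → ℝ}
    (hF : ∀ n, ContDiff ℝ 1 (F n)) (hg : ∀ j, Measurable (g j))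
    (h : ∀ j, Tendsto (fun n => ∫⁻ x in Metric.ball (0 : E3) R,
      ‖pderiv3 j (F n) x - g j x‖ₑ ^ 2) atTop (𝓝 0)) :
    ∃ ε : ℕ → ℝ≥0∞, Tendsto ε atTop (𝓝 0) ∧ ∀ n,
      ∫⁻ x in Metric.ball (0 : E3) R, gradSq (F n) x ≤
        2 * (∫⁻ x in Metric.ball (0 : E3) R, ∑ j, ‖g j x‖ₑ ^ 2) + ε n := by
  refine ⟨fun n => 2 * ∑ j, ∫⁻ x in Metric.ball (0 : E3) R, ‖pderiv3 j (F n) x - g j x‖ₑ ^ 2,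
    ?_, fun n => ?_⟩
  · have h1 := ENNReal.Tendsto.const_mul (a := 2)
      (tendsto_finsetSum Finset.univ fun j _ => h j) (Or.inr (by simp))
    simpa using h1
  · have hm : ∀ j, Measurable fun x => ‖pderiv3 j (F n) x - g j x‖ₑ ^ 2 := fun j =>
      (((continuous_pderiv3 (hF n) j).measurable.sub (hg j)).enorm.pow_const 2)
    beta_reduce
    rw [← lintegral_finsetSum _ fun j _ => hm j, ← mul_add,
      ← lintegral_add_left (Finset.measurable_fun_sum _ fun j _ => ((hg j).enorm.pow_const 2)),
      ← lintegral_const_mul' _ _ (by simp)]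
    refine lintegral_mono fun x => ?_
    rw [gradSq, ← Finset.sum_add_distrib, Finset.mul_sum]
    refine Finset.sum_le_sum fun j _ => ?_
    have := enorm_add_sq_le (g j x) (pderiv3 j (F n) x - g j x)
    simpa using this

theorem SliceApprox.poincare {R : ℝ} (hR : R ≤ 1) : ∃ c : ℝ≥0, ∀ f g, Measurable f →
    (∀ j, Measurable (g j)) → SliceApprox R f g →
    ∫⁻ x in Metric.ball (0 : E3) R, ∫⁻ y in Metric.ball (0 : E3) R, ‖f x - f y‖ₑ ^ 2 ≤
      c * ∫⁻ x in Metric.ball (0 : E3) R, ∑ j, ‖g j x‖ₑ ^ 2 := by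
  obtain ⟨c, hc⟩ := poincare_ball hR
  refine ⟨4 * c, fun f g hf hg ⟨F, hF, hFf, hFg⟩ => ?_⟩
  obtain ⟨ε, hε, hle⟩ := tendsto_lintegral_gradSq_bound hF hg hFg
  set B := Metric.ball (0 : E3) R
  have hV : volume B ≠ ⊤ := measure_ball_lt_top.ne
  have hlim : Tendsto (fun n => 2 * (c * (2 * (∫⁻ x in B, ∑ j, ‖g j x‖ₑ ^ 2) + ε n)) +
      (8 * volume B) * ∫⁻ x in B, ‖F n x - f x‖ₑ ^ 2) atTop
      (𝓝 (2 * (c * (2 * (∫⁻ x in B, ∑ j, ‖g j x‖ₑ ^ 2) + 0)) + (8 * volume B) * 0)) := by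
    refine Tendsto.add (ENNReal.Tendsto.const_mul (ENNReal.Tendsto.const_mul
      (tendsto_const_nhds.add hε) (Or.inr (by simp))) (Or.inr (by simp))) ?_
    exact ENNReal.Tendsto.const_mul hFf (Or.inr (by finiteness))
  have h1 : ∀ n, ∫⁻ x in B, ∫⁻ y in B, ‖f x - f y‖ₑ ^ 2 ≤
      2 * (c * (2 * (∫⁻ x in B, ∑ j, ‖g j x‖ₑ ^ 2) + ε n)) +
      (8 * volume B) * ∫⁻ x in B, ‖F n x - f x‖ₑ ^ 2 := by
    intro n
    have hmF : Measurable (F n) := (hF n).continuous.measurable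
    have hmd : Measurable fun x => ‖F n x - f x‖ₑ ^ 2 := (hmF.sub hf).enorm.pow_const 2
    have hpt : ∀ x y, ‖f x - f y‖ₑ ^ 2 ≤ 2 * ‖F n x - F n y‖ₑ ^ 2 +
        (4 * ‖F n x - f x‖ₑ ^ 2 + 4 * ‖F n y - f y‖ₑ ^ 2) := by
      intro x y
      calc ‖f x - f y‖ₑ ^ 2 = ‖(F n x - F n y) + ((F n y - f y) + -(F n x - f x))‖ₑ ^ 2 := by
            congr 2; ring
        _ ≤ 2 * (‖F n x - F n y‖ₑ ^ 2 + 2 * (‖F n y - f y‖ₑ ^ 2 + ‖-(F n x - f x)‖ₑ ^ 2)) :=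
            (enorm_add_sq_le _ _).trans (by gcongr; exact enorm_add_sq_le _ _)
        _ = _ := by rw [enorm_neg]; ring
    have hm2 : Measurable fun z : E3 × E3 => ‖F n z.1 - F n z.2‖ₑ ^ 2 :=
      ((hmF.comp measurable_fst).sub (hmF.comp measurable_snd)).enorm.pow_const 2
    calc ∫⁻ x in B, ∫⁻ y in B, ‖f x - f y‖ₑ ^ 2
        ≤ ∫⁻ x in B, ∫⁻ y in B, (2 * ‖F n x - F n y‖ₑ ^ 2 +
          (4 * ‖F n x - f x‖ₑ ^ 2 + 4 * ‖F n y - f y‖ₑ ^ 2)) :=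
          lintegral_mono fun x => lintegral_mono fun y => hpt x y
      _ = ∫⁻ x in B, (2 * (∫⁻ y in B, ‖F n x - F n y‖ₑ ^ 2) +
          (4 * volume B * ‖F n x - f x‖ₑ ^ 2 + 4 * ∫⁻ y in B, ‖F n y - f y‖ₑ ^ 2)) := by
          refine lintegral_congr fun x => ?_
          rw [lintegral_add_right _ (show Measurable fun y =>
              4 * ‖F n x - f x‖ₑ ^ 2 + 4 * ‖F n y - f y‖ₑ ^ 2 by fun_prop),
            lintegral_const_mul' _ _ (by simp), lintegral_add_right _ (hmd.const_mul 4),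
            lintegral_const_mul _ hmd, setLIntegral_const]
          ring
      _ = 2 * (∫⁻ x in B, ∫⁻ y in B, ‖F n x - F n y‖ₑ ^ 2) +
          (8 * volume B) * ∫⁻ x in B, ‖F n x - f x‖ₑ ^ 2 := by
          rw [lintegral_add_right _ (show Measurable fun x => 4 * volume B * ‖F n x - f x‖ₑ ^ 2 +
              4 * ∫⁻ y in B, ‖F n y - f y‖ₑ ^ 2 by fun_prop),
            lintegral_const_mul' _ _ (by simp), lintegral_add_right _ measurable_const,
            lintegral_const_mul' _ _ (by finiteness), setLIntegral_const]
          ring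
      _ ≤ _ := by
          gcongr
          exact (hc _ (hF n)).trans (by gcongr; exact hle n)
  refine (ge_of_tendsto' hlim h1).trans_eq ?_
  push_cast
  ring

theorem SliceApprox.sobolev {r R : ℝ} (hr : 0 < r) (hrR : r < R) : ∃ c : ℝ≥0, ∀ f g,
    Measurable f → (∀ j, Measurable (g j)) → SliceApprox R f g → ∀ m : ℝ,
    ∫⁻ x in Metric.ball (0 : E3) r, ‖f x - m‖ₑ ^ 4 ≤
      c * ((∫⁻ x in Metric.ball (0 : E3) R, ∑ j, ‖g j x‖ₑ ^ 2) +
        ∫⁻ x in Metric.ball (0 : E3) R, ‖f x - m‖ₑ ^ 2) ^ 2 := by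
  obtain ⟨c, hc⟩ := sobolev_ball hr hrR
  refine ⟨4 * c, fun f g hf hg ⟨F, hF, hFf, hFg⟩ m => ?_⟩
  obtain ⟨ε, hε, hle⟩ := tendsto_lintegral_gradSq_bound hF hg hFg
  set B := Metric.ball (0 : E3) R
  have hmd : ∀ n, Measurable fun x => ‖F n x - f x‖ₑ ^ 2 := fun n =>
    ((hF n).continuous.measurable.sub hf).enorm.pow_const 2
  obtain ⟨ns, hns, hae⟩ := exists_subseq_ae_tendsto_zero (fun n => (hmd n).aemeasurable) hFf
  have hsub : Metric.ball (0 : E3) r ⊆ B := Metric.ball_subset_ball hrR.le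
  have hlim : ∀ᵐ x ∂(volume.restrict (Metric.ball (0 : E3) r)),
      ‖f x - m‖ₑ ^ 4 ≤ liminf (fun k => ‖F (ns k) x - m‖ₑ ^ 4) atTop := by
    filter_upwards [ae_restrict_of_ae_restrict_of_subset hsub hae] with x hx
    have h0 : Tendsto (fun k => F (ns k) x - f x) atTop (𝓝 0) := by
      rw [tendsto_zero_iff_norm_tendsto_zero]
      have h2 : Tendsto (fun k => (‖F (ns k) x - f x‖ₑ ^ 2).toReal) atTop (𝓝 0) := by
        have := (ENNReal.tendsto_toReal ENNReal.zero_ne_top).comp hx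
        exact this
      have h3 := (Real.continuous_sqrt.tendsto 0).comp h2
      simpa [Function.comp_def, Real.sqrt_sq_eq_abs] using h3
    have h1 : Tendsto (fun k => F (ns k) x - m) atTop (𝓝 (f x - m)) := by
      have := h0.add_const (f x - m)
      simpa using this
    have h4 : Tendsto (fun k => ‖F (ns k) x - m‖ₑ ^ 4) atTop (𝓝 (‖f x - m‖ₑ ^ 4)) :=
      ENNReal.Tendsto.pow ((continuous_enorm.tendsto _).comp h1)
    exact h4.liminf_eq.ge
  have hb : Tendsto (fun n => c * ((2 * (∫⁻ x in B, ∑ j, ‖g j x‖ₑ ^ 2) + ε n) +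
      (2 * (∫⁻ x in B, ‖F n x - f x‖ₑ ^ 2) + 2 * ∫⁻ x in B, ‖f x - m‖ₑ ^ 2)) ^ 2) atTop
      (𝓝 (c * ((2 * (∫⁻ x in B, ∑ j, ‖g j x‖ₑ ^ 2) + 0) +
      (2 * 0 + 2 * ∫⁻ x in B, ‖f x - m‖ₑ ^ 2)) ^ 2)) := by
    refine ENNReal.Tendsto.const_mul (ENNReal.Tendsto.pow ?_) (Or.inr (by simp))
    exact (tendsto_const_nhds.add hε).add
      ((ENNReal.Tendsto.const_mul hFf (Or.inr (by simp))).add tendsto_const_nhds)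
  calc ∫⁻ x in Metric.ball (0 : E3) r, ‖f x - m‖ₑ ^ 4
      ≤ ∫⁻ x in Metric.ball (0 : E3) r, liminf (fun k => ‖F (ns k) x - m‖ₑ ^ 4) atTop :=
        lintegral_mono_ae hlim
    _ ≤ liminf (fun k => ∫⁻ x in Metric.ball (0 : E3) r, ‖F (ns k) x - m‖ₑ ^ 4) atTop :=
        lintegral_liminf_le fun k =>
          ((hF _).continuous.measurable.sub_const m).enorm.pow_const 4
    _ ≤ liminf (fun k => c * ((2 * (∫⁻ x in B, ∑ j, ‖g j x‖ₑ ^ 2) + ε (ns k)) +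
      (2 * (∫⁻ x in B, ‖F (ns k) x - f x‖ₑ ^ 2) + 2 * ∫⁻ x in B, ‖f x - m‖ₑ ^ 2)) ^ 2) atTop := by
        refine liminf_le_liminf (Eventually.of_forall fun k => ?_)
        refine (hc _ (hF _) m).trans ?_
        gcongr
        · exact hle _
        · rw [← mul_add, ← lintegral_add_left (hmd _), ← lintegral_const_mul' _ _ (by simp)]
          refine lintegral_mono fun x => ?_
          have := enorm_add_sq_le (F (ns k) x - f x) (f x - m)
          simpa using this
    _ = _ := (hb.comp hns.tendsto_atTop).liminf_eq
    _ = _ := by push_cast; ring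

/-- Squared deviation from a mean value is at most the mean squared difference. -/
theorem enorm_sub_average_sq_le {f : E3 → ℝ} {S : Set E3} (h0 : volume S ≠ 0)
    (hT : volume S ≠ ⊤) (hf : Measurable f) (hi : IntegrableOn f S) (a : ℝ) :
    ‖a - ⨍ y in S, f y‖ₑ ^ 2 ≤ (volume S)⁻¹ * ∫⁻ y in S, ‖a - f y‖ₑ ^ 2 := by
  have h1 : a - ⨍ y in S, f y = ((volume S).toReal)⁻¹ * ∫ y in S, (a - f y) := by
    rw [integral_sub (integrableOn_const (C := a) hT (by simp)) hi, setIntegral_const, setAverage_eq, smul_eq_mul,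
      smul_eq_mul, mul_sub, Measure.real, ← mul_assoc,
      inv_mul_cancel₀ (ENNReal.toReal_ne_zero.2 ⟨h0, hT⟩), one_mul]
  have h2 : ‖((volume S).toReal)⁻¹‖ₑ = (volume S)⁻¹ := by
    rw [Real.enorm_of_nonneg (by positivity), ← ENNReal.toReal_inv,
      ENNReal.ofReal_toReal (by simpa using h0)]
  rw [h1, enorm_mul, h2, mul_pow]
  have h3 : (∫⁻ y in S, ‖a - f y‖ₑ) ^ 2 ≤ volume S * ∫⁻ y in S, ‖a - f y‖ₑ ^ 2 := by
    have := lintegral_mul_sq_le (μ := volume.restrict S) (k := fun _ => 1)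
      (h := fun y => ‖a - f y‖ₑ) aemeasurable_const (hf.const_sub a).enorm.aemeasurable
    simpa using this
  calc (volume S)⁻¹ ^ 2 * ‖∫ y in S, (a - f y)‖ₑ ^ 2
      ≤ (volume S)⁻¹ ^ 2 * (volume S * ∫⁻ y in S, ‖a - f y‖ₑ ^ 2) := by
        gcongr
        exact (pow_le_pow_left' (enorm_integral_le_lintegral_enorm _) 2).trans h3
    _ = ((volume S)⁻¹ * volume S) * ((volume S)⁻¹ * ∫⁻ y in S, ‖a - f y‖ₑ ^ 2) := by ring
    _ = _ := by rw [ENNReal.inv_mul_cancel h0 hT, one_mul]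

theorem integrableOn_of_lintegral_sq {S : Set E3} {f : E3 → ℝ} (hT : volume S ≠ ⊤)
    (hf : Measurable f) (h : ∫⁻ x in S, ‖f x‖ₑ ^ 2 ≠ ⊤) : IntegrableOn f S := by
  have : Fact (volume S < ⊤) := ⟨hT.lt_top⟩
  exact ((memLp_two_iff_lintegral hf.aestronglyMeasurable).2 h).integrable (by norm_num)

/-- Poincaré and Sobolev inequalities for Sobolev slices, with the mean over `B_{1/2}`. -/
theorem SliceApprox.poincare_sobolev : ∃ c : ℝ≥0, ∀ f g, Measurable f →
    (∀ j, Measurable (g j)) → ∫⁻ x in Metric.ball (0 : E3) (3 / 4), ‖f x‖ₑ ^ 2 ≠ ⊤ →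
    SliceApprox (3 / 4) f g →
    (∫⁻ x in Metric.ball (0 : E3) (3 / 4), ‖f x - ⨍ y in Metric.ball (0 : E3) (1 / 2), f y‖ₑ ^ 2 ≤
      c * ∫⁻ x in Metric.ball (0 : E3) (3 / 4), ∑ j, ‖g j x‖ₑ ^ 2) ∧
    (∫⁻ x in Metric.ball (0 : E3) (5 / 8), ‖f x - ⨍ y in Metric.ball (0 : E3) (1 / 2), f y‖ₑ ^ 4 ≤
      c * (∫⁻ x in Metric.ball (0 : E3) (3 / 4), ∑ j, ‖g j x‖ₑ ^ 2) ^ 2) := by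
  obtain ⟨c₁, h₁⟩ := SliceApprox.poincare (R := 3 / 4) (by norm_num)
  obtain ⟨c₂, h₂⟩ := SliceApprox.sobolev (r := 5 / 8) (R := 3 / 4) (by norm_num) (by norm_num)
  set S := Metric.ball (0 : E3) (1 / 2)
  set B := Metric.ball (0 : E3) (3 / 4)
  have hSB : S ⊆ B := Metric.ball_subset_ball (by norm_num)
  have h0 : volume S ≠ 0 := (Metric.measure_ball_pos _ _ (by norm_num)).ne'
  have hT : volume S ≠ ⊤ := measure_ball_lt_top.ne
  set v : ℝ≥0 := ((volume S)⁻¹).toNNReal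
  have hv : (v : ℝ≥0∞) = (volume S)⁻¹ := ENNReal.coe_toNNReal (by simpa using h0)
  refine ⟨max (v * c₁) (c₂ * (1 + v * c₁) ^ 2), fun f g hf hg hf2 hfg => ?_⟩
  have hi : IntegrableOn f S := integrableOn_of_lintegral_sq hT hf
    (ne_top_of_le_ne_top hf2 (lintegral_mono_set hSB))
  have hP : ∫⁻ x in B, ‖f x - ⨍ y in S, f y‖ₑ ^ 2 ≤
      (v * c₁ : ℝ≥0) * ∫⁻ x in B, ∑ j, ‖g j x‖ₑ ^ 2 := by
    calc _ ≤ ∫⁻ x in B, (volume S)⁻¹ * ∫⁻ y in B, ‖f x - f y‖ₑ ^ 2 := by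
          refine lintegral_mono fun x => ?_
          refine (enorm_sub_average_sq_le h0 hT hf hi (f x)).trans ?_
          gcongr
      _ = v * ∫⁻ x in B, ∫⁻ y in B, ‖f x - f y‖ₑ ^ 2 := by
          rw [lintegral_const_mul' _ _ (by simpa using h0), hv]
      _ ≤ v * (c₁ * ∫⁻ x in B, ∑ j, ‖g j x‖ₑ ^ 2) := by gcongr; exact h₁ f g hf hg hfg
      _ = _ := by push_cast; ring
  refine ⟨hP.trans ?_, (h₂ f g hf hg hfg _).trans ?_⟩
  · gcongr
    exact le_max_left _ _
  · calc _ ≤ c₂ * ((∫⁻ x in B, ∑ j, ‖g j x‖ₑ ^ 2) +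
          (v * c₁ : ℝ≥0) * ∫⁻ x in B, ∑ j, ‖g j x‖ₑ ^ 2) ^ 2 := by gcongr
      _ = ((c₂ * (1 + v * c₁) ^ 2 : ℝ≥0) : ℝ≥0∞) * (∫⁻ x in B, ∑ j, ‖g j x‖ₑ ^ 2) ^ 2 := by
          push_cast; ring
      _ ≤ _ := by
          gcongr
          exact le_max_right _ _

theorem pderiv3_slice {F : SpT → ℝ} (hF : ContDiff ℝ (⊤ : ℕ∞) F) (j : Fin 3) (t : ℝ) (x : E3) :
    pderiv3 j (fun y => F (y, t)) x = sderiv j F (x, t) := by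
  have h1 : HasFDerivAt (fun y : E3 => ((y, t) : SpT))
      (ContinuousLinearMap.inl ℝ E3 ℝ) x := hasFDerivAt_prodMk_left x t
  have h2 := (hF.differentiable (by simp) (x, t)).hasFDerivAt
  have h3 := h2.comp x h1
  unfold pderiv3 sderiv
  rw [show (fun y => F (y, t)) = F ∘ fun y : E3 => ((y, t) : SpT) from rfl, h3.fderiv]
  simp

/-- Almost every time slice of a weakly differentiable function is a Sobolev slice. -/
theorem WeakSGrad.ae_sliceApprox {R R' a b a' b' : ℝ} (hR : R < R') (ha : a < a') (hb : b' < b)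
    {f : SpT → ℝ} {g : Fin 3 → SpT → ℝ} (hf : Measurable f) (hg : ∀ j, Measurable (g j))
    (hf2 : ∫⁻ z in Metric.ball 0 R' ×ˢ Ioo a b, ‖f z‖ₑ ^ 2 ≠ ⊤)
    (hg2 : ∀ j, ∫⁻ z in Metric.ball 0 R' ×ˢ Ioo a b, ‖g j z‖ₑ ^ 2 ≠ ⊤)
    (h : WeakSGrad (Metric.ball 0 R' ×ˢ Ioo a b) f g) :
    ∀ᵐ t ∂(volume.restrict (Ioo a' b')),
      SliceApprox R (fun x => f (x, t)) (fun j x => g j (x, t)) := by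
  have hK : IsCompact (Metric.closedBall (0 : E3) R ×ˢ Icc a' b') :=
    (isCompact_closedBall _ _).prod isCompact_Icc
  have hKU : Metric.closedBall (0 : E3) R ×ˢ Icc a' b' ⊆ Metric.ball (0 : E3) R' ×ˢ Ioo a b :=
    prod_mono (Metric.closedBall_subset_ball hR) (Icc_subset_Ioo ha hb)
  obtain ⟨F, hF, hFf, hFg⟩ := h.exists_smooth_approx (Metric.isOpen_ball.prod isOpen_Ioo)
    hf hg hf2 hg2 hK hKU
  set B := Metric.ball (0 : E3) R
  have hsub : B ×ˢ Ioo a' b' ⊆ Metric.closedBall (0 : E3) R ×ˢ Icc a' b' :=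
    prod_mono Metric.ball_subset_closedBall Ioo_subset_Icc_self
  have hm1 : ∀ n, Measurable fun z => ‖F n z - f z‖ₑ ^ 2 := fun n =>
    ((hF n).continuous.measurable.sub hf).enorm.pow_const 2
  have hm2 : ∀ n j, Measurable fun z => ‖sderiv j (F n) z - g j z‖ₑ ^ 2 := fun n j =>
    (((IsTestOn.sderiv_contDiff (hF n) j).continuous).measurable.sub (hg j)).enorm.pow_const 2
  set e : ℕ → SpT → ℝ≥0∞ := fun n z =>
    ‖F n z - f z‖ₑ ^ 2 + ∑ j, ‖sderiv j (F n) z - g j z‖ₑ ^ 2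
  have hme : ∀ n, Measurable (e n) := fun n =>
    (hm1 n).add (Finset.measurable_fun_sum _ fun j _ => hm2 n j)
  have hlim : Tendsto (fun n => ∫⁻ z in Metric.closedBall (0 : E3) R ×ˢ Icc a' b', e n z)
      atTop (𝓝 0) := by
    have h1 := hFf.add (tendsto_finsetSum Finset.univ fun j _ => hFg j)
    simp only [Finset.sum_const_zero, add_zero] at h1
    refine h1.congr fun n => ?_
    rw [lintegral_add_left (hm1 n), lintegral_finsetSum _ fun j _ => hm2 n j]
  have hlim2 : Tendsto (fun n => ∫⁻ t in Ioo a' b', ∫⁻ x in B, e n (x, t)) atTop (𝓝 0) := by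
    refine tendsto_of_tendsto_of_tendsto_of_le_of_le tendsto_const_nhds hlim
      (fun _ => zero_le) fun n => ?_
    refine le_trans (le_of_eq ?_) (lintegral_mono_set hsub)
    rw [volume_restrict_prod_SpT, lintegral_prod_symm' _ (hme n)]
  obtain ⟨ns, -, hns⟩ := exists_subseq_ae_tendsto_zero
    (fun n => ((hme n).lintegral_prod_left').aemeasurable) hlim2
  filter_upwards [hns] with t ht
  refine ⟨fun k x => F (ns k) (x, t), fun k => ?_, ?_, fun j => ?_⟩
  · exact ((hF _).of_le (by exact_mod_cast le_top)).comp (contDiff_id.prodMk contDiff_const)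
  · refine tendsto_of_tendsto_of_tendsto_of_le_of_le tendsto_const_nhds ht
      (fun _ => zero_le) fun n => lintegral_mono fun x => le_self_add
  · refine tendsto_of_tendsto_of_tendsto_of_le_of_le tendsto_const_nhds ht
      (fun _ => zero_le) fun n => lintegral_mono fun x => ?_
    simp only [pderiv3_slice (hF _)]
    exact le_add_of_nonneg_of_le zero_le (Finset.single_le_sum
      (f := fun j => ‖sderiv j (F (ns n)) (x, t) - g j (x, t)‖ₑ ^ 2) (fun _ _ => zero_le)
      (Finset.mem_univ j))

/-- The regularised powers `(|y - x|² + δ²)^p`. -/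
def regPow (p δ : ℝ) (x y : E3) : ℝ := (‖y - x‖ ^ 2 + δ ^ 2) ^ p

theorem regPow_base_pos {δ : ℝ} (hδ : 0 < δ) (x y : E3) : 0 < ‖y - x‖ ^ 2 + δ ^ 2 := by positivity

theorem contDiff_regPow {p δ : ℝ} (hδ : 0 < δ) (x : E3) : ContDiff ℝ (⊤ : ℕ∞) (regPow p δ x) := by
  unfold regPow
  refine ContDiff.rpow_const_of_ne ?_ fun y => (regPow_base_pos hδ x y).ne'
  exact ((contDiff_id.sub contDiff_const).norm_sq ℝ).add contDiff_const

theorem pderiv3_regPow {p δ : ℝ} (hδ : 0 < δ) (x y : E3) (j : Fin 3) :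
    pderiv3 j (regPow p δ x) y = 2 * p * (y j - x j) * regPow (p - 1) δ x y := by
  have h1 : HasFDerivAt (fun y : E3 => ‖y - x‖ ^ 2 + δ ^ 2)
      ((2 • innerSL ℝ (y - x)).comp (ContinuousLinearMap.id ℝ E3)) y :=
    (((hasFDerivAt_id y).sub_const x).norm_sq).add_const _
  have h2 := h1.rpow_const (p := p) (Or.inl (regPow_base_pos hδ x y).ne')
  unfold pderiv3
  rw [show regPow p δ x = fun y => (‖y - x‖ ^ 2 + δ ^ 2) ^ p from rfl, h2.fderiv]
  simp [regPow, EuclideanSpace.inner_single_right]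
  ring

theorem regPow_le {p δ : ℝ} {x y : E3} (hp : p ≤ 0) (hxy : y ≠ x) : regPow p δ x y ≤ ‖y - x‖ ^ (2 * p) := by
  have h0 : 0 < ‖y - x‖ := norm_pos_iff.2 (sub_ne_zero.2 hxy)
  unfold regPow
  rw [Real.rpow_mul h0.le]
  refine Real.rpow_le_rpow_of_nonpos (by positivity) ?_ hp
  simp [sq_nonneg]

theorem regPow_nonneg (p δ : ℝ) (x y : E3) : 0 ≤ regPow p δ x y := by
  unfold regPow; positivity

theorem base_mul_regPow {p δ : ℝ} (hδ : 0 < δ) (x y : E3) :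
    (‖y - x‖ ^ 2 + δ ^ 2) * regPow (p - 1) δ x y = regPow p δ x y := by
  unfold regPow
  rw [Real.rpow_sub_one (regPow_base_pos hδ x y).ne']
  field_simp [(regPow_base_pos hδ x y).ne']

theorem pderiv3_mul {F H : E3 → ℝ} {y : E3} (hF : DifferentiableAt ℝ F y)
    (hH : DifferentiableAt ℝ H y) (j : Fin 3) :
    pderiv3 j (fun y => F y * H y) y = pderiv3 j F y * H y + F y * pderiv3 j H y := by
  unfold pderiv3
  rw [(hF.hasFDerivAt.fun_mul hH.hasFDerivAt).fderiv]
  simp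
  ring

theorem pderiv3_cutoff_regPow {χ : E3 → ℝ} (hχ : ContDiff ℝ (⊤ : ℕ∞) χ) {δ : ℝ} (hδ : 0 < δ)
    (x y : E3) (j : Fin 3) :
    pderiv3 j (fun y => χ y * regPow (-1 / 2) δ x y) y =
      pderiv3 j χ y * regPow (-1 / 2) δ x y - χ y * ((y j - x j) * regPow (-3 / 2) δ x y) := by
  rw [pderiv3_mul (hχ.differentiable (by simp) y)
    ((contDiff_regPow hδ x).differentiable (by simp) y), pderiv3_regPow hδ]
  norm_num
  ring

theorem laplacian_cutoff_regPow {χ : E3 → ℝ} (hχ : ContDiff ℝ (⊤ : ℕ∞) χ) {δ : ℝ} (hδ : 0 < δ)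
    (x y : E3) :
    ∑ j, pderiv3 j (pderiv3 j (fun y => χ y * regPow (-1 / 2) δ x y)) y =
      (∑ j, pderiv3 j (pderiv3 j χ) y) * regPow (-1 / 2) δ x y -
        2 * (∑ j, pderiv3 j χ y * ((y j - x j) * regPow (-3 / 2) δ x y)) -
        χ y * (3 * δ ^ 2 * regPow (-5 / 2) δ x y) := by
  have hd : ∀ {F : E3 → ℝ}, ContDiff ℝ (⊤ : ℕ∞) F → DifferentiableAt ℝ F y := fun hF =>
    hF.differentiable (by simp) y
  have hcoord : ∀ j : Fin 3, ContDiff ℝ (⊤ : ℕ∞) fun y : E3 => y j - x j := fun j =>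
    ((EuclideanSpace.proj (𝕜 := ℝ) j).contDiff).sub contDiff_const
  have hpc : ∀ j : Fin 3, pderiv3 j (fun y : E3 => y j - x j) y = 1 := fun j => by
    unfold pderiv3
    have h1 : HasFDerivAt (fun y : E3 => y j - x j)
        (EuclideanSpace.proj j : E3 →L[ℝ] ℝ) y :=
      ((EuclideanSpace.proj j : E3 →L[ℝ] ℝ).hasFDerivAt).sub_const (x j)
    rw [h1.fderiv]
    simp
  have hR : ∀ p, ContDiff ℝ (⊤ : ℕ∞) (regPow p δ x) := fun p => contDiff_regPow hδ x
  have key : ∀ j : Fin 3, pderiv3 j (pderiv3 j (fun y => χ y * regPow (-1 / 2) δ x y)) y =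
      pderiv3 j (pderiv3 j χ) y * regPow (-1 / 2) δ x y
        - 2 * (pderiv3 j χ y * ((y j - x j) * regPow (-3 / 2) δ x y))
        - χ y * (regPow (-3 / 2) δ x y - 3 * (y j - x j) ^ 2 * regPow (-5 / 2) δ x y) := by
    intro j
    rw [funext fun y => pderiv3_cutoff_regPow hχ hδ x y j]
    have hsub : ∀ F H : E3 → ℝ, DifferentiableAt ℝ F y → DifferentiableAt ℝ H y →
        pderiv3 j (fun y => F y - H y) y = pderiv3 j F y - pderiv3 j H y := by
      intro F H hF hH
      unfold pderiv3
      rw [(hF.hasFDerivAt.fun_sub hH.hasFDerivAt).fderiv]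
      rfl
    rw [hsub _ _ ((hd (contDiff_pderiv3 hχ j)).fun_mul (hd (hR _)))
      ((hd hχ).fun_mul ((hd (hcoord j)).fun_mul (hd (hR _)))),
      pderiv3_mul (hd (contDiff_pderiv3 hχ j)) (hd (hR _)),
      pderiv3_mul (hd hχ) ((hd (hcoord j)).fun_mul (hd (hR _))),
      pderiv3_mul (hd (hcoord j)) (hd (hR _)), hpc, pderiv3_regPow hδ, pderiv3_regPow hδ]
    norm_num
    ring
  simp_rw [key]
  have h3 : ∑ j, (y j - x j) ^ 2 = ‖y - x‖ ^ 2 := by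
    rw [EuclideanSpace.norm_sq_eq]; simp
  have h4 := base_mul_regPow (p := -3 / 2) hδ x y
  rw [show (-3 / 2 - 1 : ℝ) = -5 / 2 by norm_num] at h4
  rw [Finset.sum_sub_distrib, Finset.sum_sub_distrib, ← Finset.sum_mul, ← Finset.mul_sum,
    ← Finset.mul_sum, Finset.sum_sub_distrib, ← Finset.sum_mul, ← Finset.mul_sum, h3]
  simp only [Finset.sum_const, Finset.card_univ, Fintype.card_fin, nsmul_eq_mul]
  push_cast
  linear_combination (3 * χ y) * h4

/-- The approximate identity `-Δ (|w|² + δ²)^{-1/2}`. -/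
def newtonKernel (δ : ℝ) (w : E3) : ℝ := 3 * δ ^ 2 * (‖w‖ ^ 2 + δ ^ 2) ^ (-5 / 2 : ℝ)

theorem newtonKernel_nonneg (δ : ℝ) (w : E3) : 0 ≤ newtonKernel δ w := by
  unfold newtonKernel; positivity

theorem continuous_newtonKernel {δ : ℝ} (hδ : 0 < δ) : Continuous (newtonKernel δ) := by
  unfold newtonKernel
  exact continuous_const.mul (Continuous.rpow_const (by fun_prop)
    fun w => Or.inl (by positivity : (0 : ℝ) < ‖w‖ ^ 2 + δ ^ 2).ne')

theorem integrable_newtonKernel_one : Integrable (newtonKernel 1) := by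
  have := (integrable_rpow_neg_one_add_norm_sq (E := E3) (μ := volume) (r := 5)
    (by simp; norm_num)).const_mul 3
  refine this.congr (Eventually.of_forall fun w => ?_)
  simp [newtonKernel, add_comm]

theorem newtonKernel_smul {δ : ℝ} (hδ : 0 < δ) (w : E3) :
    newtonKernel δ (δ • w) = (δ ^ 3)⁻¹ * newtonKernel 1 w := by
  have h : ‖δ • w‖ ^ 2 + δ ^ 2 = δ ^ 2 * (‖w‖ ^ 2 + 1) := by
    rw [norm_smul, Real.norm_of_nonneg hδ.le]; ring
  have h2 : (δ ^ 2) ^ (-5 / 2 : ℝ) = (δ ^ 5)⁻¹ := by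
    rw [← Real.rpow_natCast, ← Real.rpow_mul hδ.le, ← Real.rpow_natCast, ← Real.rpow_neg hδ.le]
    norm_num
  unfold newtonKernel
  rw [h, Real.mul_rpow (by positivity) (by positivity), h2, one_pow]
  field_simp

theorem lintegral_newtonKernel {δ : ℝ} (hδ : 0 < δ) :
    ∫⁻ w, ‖newtonKernel δ w‖ₑ = ∫⁻ w, ‖newtonKernel 1 w‖ₑ := by
  have h := lintegral_comp_add_smul (fun w => ‖newtonKernel δ w‖ₑ)
    (continuous_newtonKernel hδ).enorm.measurable 0 hδ
  simp only [zero_add, newtonKernel_smul hδ, enorm_mul] at h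
  have h3 : ‖(δ ^ 3)⁻¹‖ₑ = ENNReal.ofReal (δ ^ 3)⁻¹ := Real.enorm_of_nonneg (by positivity)
  rw [lintegral_const_mul' _ _ (by simp), h3] at h
  exact ((ENNReal.mul_right_inj (by positivity) (by simp)).1 h).symm

theorem newtonKernel_le_of_le_norm {δ η : ℝ} (hη : 0 < η) {w : E3} (hw : η ≤ ‖w‖) :
    newtonKernel δ w ≤ (η ^ 2 / (1 + η ^ 2)) ^ (-5 / 2 : ℝ) * δ ^ 2 * newtonKernel 1 w := by
  have h1 : η ^ 2 / (1 + η ^ 2) * (‖w‖ ^ 2 + 1 ^ 2) ≤ ‖w‖ ^ 2 + δ ^ 2 := by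
    have : η ^ 2 ≤ ‖w‖ ^ 2 := by gcongr
    rw [div_mul_eq_mul_div, div_le_iff₀ (by positivity)]
    nlinarith [sq_nonneg δ, mul_nonneg (sq_nonneg δ) (sq_nonneg η)]
  have h2 := Real.rpow_le_rpow_of_nonpos (z := (-5 / 2 : ℝ)) (by positivity) h1 (by norm_num)
  rw [Real.mul_rpow (by positivity) (by positivity)] at h2
  unfold newtonKernel
  calc 3 * δ ^ 2 * (‖w‖ ^ 2 + δ ^ 2) ^ (-5 / 2 : ℝ) ≤ 3 * δ ^ 2 *
        ((η ^ 2 / (1 + η ^ 2)) ^ (-5 / 2 : ℝ) * (‖w‖ ^ 2 + 1 ^ 2) ^ (-5 / 2 : ℝ)) := by gcongr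
    _ = _ := by ring

theorem tendsto_newtonKernel_tail {η : ℝ} (hη : 0 < η) {δ : ℕ → ℝ} (hδ : Tendsto δ atTop (𝓝 0)) :
    Tendsto (fun n => ∫⁻ w in {w : E3 | η ≤ ‖w‖}, ‖newtonKernel (δ n) w‖ₑ) atTop (𝓝 0) := by
  set c := (η ^ 2 / (1 + η ^ 2)) ^ (-5 / 2 : ℝ)
  have hT : ∫⁻ w, ‖newtonKernel 1 w‖ₑ ≠ ⊤ := integrable_newtonKernel_one.2.ne
  have hlim : Tendsto (fun n => ENNReal.ofReal (c * δ n ^ 2) * ∫⁻ w, ‖newtonKernel 1 w‖ₑ)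
      atTop (𝓝 (ENNReal.ofReal (c * 0 ^ 2) * ∫⁻ w, ‖newtonKernel 1 w‖ₑ)) :=
    ENNReal.Tendsto.mul_const (ENNReal.tendsto_ofReal ((hδ.pow 2).const_mul c)) (Or.inr hT)
  simp only [ne_eq, OfNat.ofNat_ne_zero, not_false_eq_true, zero_pow, mul_zero,
    ENNReal.ofReal_zero, zero_mul] at hlim
  refine tendsto_of_tendsto_of_tendsto_of_le_of_le tendsto_const_nhds hlim (fun _ => zero_le)
    fun n => ?_
  refine le_trans ?_ (lintegral_const_mul' _ _ (by simp)).le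
  refine le_trans (setLIntegral_mono' (measurableSet_le measurable_const measurable_norm)
    fun w hw => ?_) (setLIntegral_le_lintegral _ _)
  rw [Real.enorm_of_nonneg (newtonKernel_nonneg _ _), Real.enorm_of_nonneg (newtonKernel_nonneg _ _),
    ← ENNReal.ofReal_mul (by positivity)]
  exact ENNReal.ofReal_le_ofReal (newtonKernel_le_of_le_norm hη hw)

/-- A pointwise a.e. bound from uniform bounds on mollifications. -/
theorem ae_le_of_newtonKernel_bound {f : E3 → ℝ} (hfm : Measurable f) (hf : Integrable f)
    {S : Set E3} {b : E3 → ℝ≥0∞} {δ : ℕ → ℝ} (hδ0 : ∀ n, 0 < δ n) (hδ : Tendsto δ atTop (𝓝 0))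
    (h : ∀ᵐ x ∂(volume.restrict S), ∀ n, ‖∫ y, newtonKernel (δ n) (y - x) * f y‖ₑ ≤ b x) :
    ∀ᵐ x ∂(volume.restrict S), (∫⁻ w, ‖newtonKernel 1 w‖ₑ) * ‖f x‖ₑ ≤ b x := by
  have hT : ∫⁻ w, ‖newtonKernel 1 w‖ₑ ≠ ⊤ := integrable_newtonKernel_one.2.ne
  have hkm : ∀ n, Measurable fun w => ‖newtonKernel (δ n) w‖ₑ := fun n =>
    (continuous_newtonKernel (hδ0 n)).enorm.measurable
  have hlim := tendsto_lintegral_approx_one (μ := volume) hT hkm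
    (fun n => (lintegral_newtonKernel (hδ0 n)).le)
    (fun η hη => tendsto_newtonKernel_tail hη hδ) hfm (memLp_one_iff_integrable.2 hf)
  obtain ⟨ns, -, hns⟩ := exists_subseq_ae_tendsto_zero (fun n => by
    have h1 : Measurable fun p : E3 × E3 => ‖newtonKernel (δ n) p.2‖ₑ := (hkm n).comp measurable_snd
    exact (Measurable.lintegral_prod_right' (f := fun p : E3 × E3 =>
      ‖newtonKernel (δ n) p.2‖ₑ * ‖f (p.1 - p.2) - f p.1‖ₑ) (h1.mul (by fun_prop))).aemeasurable) hlim
  filter_upwards [h, ae_restrict_of_ae hns] with x hx hxn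
  have hle : ∀ k, (∫⁻ w, ‖newtonKernel 1 w‖ₑ) * ‖f x‖ₑ ≤
      b x + ∫⁻ w, ‖newtonKernel (δ (ns k)) w‖ₑ * ‖f (x - w) - f x‖ₑ := by
    intro k
    set K := newtonKernel (δ (ns k))
    have hKc : Continuous K := continuous_newtonKernel (hδ0 _)
    have hKi : Integrable K := ⟨hKc.aestronglyMeasurable, by
      rw [HasFiniteIntegral, lintegral_newtonKernel (hδ0 _)]; exact hT.lt_top⟩
    have hKb : ∀ w, ‖K w‖ ≤ 3 * δ (ns k) ^ 2 * (δ (ns k) ^ 2) ^ (-5 / 2 : ℝ) := fun w => by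
      rw [Real.norm_of_nonneg (newtonKernel_nonneg _ _)]
      refine mul_le_mul_of_nonneg_left (Real.rpow_le_rpow_of_nonpos ?_ ?_ (by norm_num))
        (by positivity)
      · have := hδ0 (ns k); positivity
      · simp
    have hfi : Integrable fun w => f (x - w) := hf.comp_sub_left x
    have h1 : Integrable fun w => K w * f (x - w) :=
      hfi.bdd_mul hKc.aestronglyMeasurable (Eventually.of_forall hKb)
    have h2 : Integrable fun w => K w * f x := hKi.mul_const _
    have h3 : ∫ w, K w * f (x - w) = ∫ y, K (y - x) * f y := by
      rw [← integral_sub_left_eq_self _ volume x]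
      refine integral_congr_ae (Eventually.of_forall fun w => ?_)
      have : K (x - w) = K (w - x) := by simp only [K, newtonKernel, norm_sub_rev]
      simp [this]
    have h4 : (∫⁻ w, ‖newtonKernel 1 w‖ₑ) * ‖f x‖ₑ = ‖∫ w, K w * f x‖ₑ := by
      rw [integral_mul_const, enorm_mul, ← lintegral_newtonKernel (hδ0 (ns k)),
        Real.enorm_of_nonneg (integral_nonneg (newtonKernel_nonneg _)),
        ofReal_integral_eq_lintegral_ofReal hKi
          (Eventually.of_forall (newtonKernel_nonneg _))]
      congr 1
      exact lintegral_congr fun w => Real.enorm_of_nonneg (newtonKernel_nonneg _ _)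
    have h5 : ∫ w, K w * f x = (∫ w, K w * f (x - w)) - ∫ w, K w * (f (x - w) - f x) := by
      rw [← integral_sub h1 (by simp only [mul_sub]; exact h1.sub h2)]
      exact integral_congr_ae (Eventually.of_forall fun w => by simp only; ring)
    rw [h4, h5, h3]
    refine enorm_sub_le.trans (add_le_add (hx _) ((enorm_integral_le_lintegral_enorm _).trans ?_))
    simp only [enorm_mul, le_refl]
  have := ge_of_tendsto' (tendsto_const_nhds.add hxn) hle
  simpa using this

theorem pderiv3_eq_zero_of_eventually_const {F : E3 → ℝ} {y : E3} {a : ℝ}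
    (h : F =ᶠ[𝓝 y] fun _ => a) (j : Fin 3) : pderiv3 j F y = 0 := by
  unfold pderiv3
  rw [h.fderiv_eq]
  simp

theorem exists_bound_pderiv3 {χ : E3 → ℝ} (hχ : ContDiff ℝ (⊤ : ℕ∞) χ) (hc : HasCompactSupport χ) :
    ∃ L : ℝ, 0 ≤ L ∧ (∀ j y, |pderiv3 j χ y| ≤ L) ∧
      ∀ y, |∑ j, pderiv3 j (pderiv3 j χ) y| ≤ L := by
  have h1 : ∀ j, HasCompactSupport (pderiv3 j χ) := fun j =>
    hc.fderiv_apply ℝ (EuclideanSpace.single j 1)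
  have h2 : ∀ j, HasCompactSupport (pderiv3 j (pderiv3 j χ)) := fun j =>
    (h1 j).fderiv_apply ℝ (EuclideanSpace.single j 1)
  choose L₁ hL₁ using fun j => (h1 j).exists_bound_of_continuous (contDiff_pderiv3 hχ j).continuous
  choose L₂ hL₂ using fun j => (h2 j).exists_bound_of_continuous
    (contDiff_pderiv3 (contDiff_pderiv3 hχ j) j).continuous
  have p1 : ∀ j, 0 ≤ L₁ j := fun j => (norm_nonneg _).trans (hL₁ j 0)
  have p2 : ∀ j, 0 ≤ L₂ j := fun j => (norm_nonneg _).trans (hL₂ j 0)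
  have s1 : 0 ≤ ∑ j, L₁ j := Finset.sum_nonneg fun j _ => p1 j
  have s2 : 0 ≤ ∑ j, L₂ j := Finset.sum_nonneg fun j _ => p2 j
  refine ⟨(∑ j, L₁ j) + ∑ j, L₂ j, by positivity, fun j y => ?_, fun y => ?_⟩
  · have := Finset.single_le_sum (f := L₁) (fun j _ => p1 j) (Finset.mem_univ j)
    have h := hL₁ j y
    rw [Real.norm_eq_abs] at h
    linarith
  · refine (Finset.abs_sum_le_sum_abs _ _).trans ?_
    have : ∑ j, |pderiv3 j (pderiv3 j χ) y| ≤ ∑ j, L₂ j := Finset.sum_le_sum fun j _ => hL₂ j y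
    linarith

/-- The bound for the Newtonian gradient kernel. -/
theorem enorm_coord_mul_regPow_le (δ : ℝ) (x y : E3) (j : Fin 3) :
    ‖(y j - x j) * regPow (-3 / 2) δ x y‖ₑ ≤ ‖y - x‖ₑ ^ (-2 : ℝ) := by
  rcases eq_or_ne y x with rfl | hxy
  · simp
  have h0 : 0 < ‖y - x‖ := norm_pos_iff.2 (sub_ne_zero.2 hxy)
  rw [← ofReal_norm, ← ofReal_norm, ENNReal.ofReal_rpow_of_pos h0]
  refine ENNReal.ofReal_le_ofReal ?_
  rw [norm_mul, Real.norm_of_nonneg (regPow_nonneg _ _ _ _)]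
  have h1 : ‖y j - x j‖ ≤ ‖y - x‖ := by
    simpa using PiLp.norm_apply_le (y - x) j
  calc ‖y j - x j‖ * regPow (-3 / 2) δ x y
      ≤ ‖y - x‖ * ‖y - x‖ ^ (2 * (-3 / 2) : ℝ) := by
        gcongr
        · exact regPow_nonneg _ _ _ _
        · exact regPow_le (p := -3 / 2) (by norm_num) hxy
    _ = ‖y - x‖ ^ (-2 : ℝ) := by
        rw [mul_comm, ← Real.rpow_add_one h0.ne']; norm_num

theorem regPow_neg_half_le {δ : ℝ} {x y : E3} (h : 1 / 8 ≤ ‖y - x‖) : regPow (-1 / 2) δ x y ≤ 8 := by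
  have hxy : y ≠ x := by rintro rfl; norm_num at h
  refine (regPow_le (p := -1 / 2) (by norm_num) hxy).trans ?_
  have : (8 : ℝ) = (1 / 8 : ℝ) ^ (2 * (-1 / 2) : ℝ) := by norm_num
  rw [this]
  exact Real.rpow_le_rpow_of_nonpos (by norm_num) h (by norm_num)

theorem abs_coord_mul_regPow_le (δ : ℝ) {x y : E3} (h : 1 / 8 ≤ ‖y - x‖) (j : Fin 3) :
    |(y j - x j) * regPow (-3 / 2) δ x y| ≤ 64 := by
  have h0 : 0 < ‖y - x‖ := by linarith
  have h1 := enorm_coord_mul_regPow_le δ x y j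
  rw [← ofReal_norm, ← ofReal_norm, ENNReal.ofReal_rpow_of_pos h0,
    ENNReal.ofReal_le_ofReal_iff (by positivity), Real.norm_eq_abs] at h1
  refine h1.trans ?_
  have : (64 : ℝ) = (1 / 8 : ℝ) ^ (-2 : ℝ) := by
    rw [Real.rpow_neg (by norm_num)]; norm_num
  rw [this]
  exact Real.rpow_le_rpow_of_nonpos (by norm_num) h (by norm_num)

/-- A local representation bound for solutions of a Poisson equation on a ball, static version. -/
theorem newton_bound_slice (χ : ContDiffBump (0 : E3)) (hin : χ.rIn = 3 / 8) (hout : χ.rOut = 7 / 16) :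
    ∃ c : ℝ≥0, ∀ (P : E3 → ℝ) (G : Fin 3 → E3 → ℝ) (δ : ℕ → ℝ), Measurable P →
    IntegrableOn P (Metric.ball 0 (1 / 2)) → (∀ j, Measurable (G j)) →
    (∀ j, IntegrableOn (G j) (Metric.ball 0 (1 / 2))) → (∀ n, 0 < δ n) → Tendsto δ atTop (𝓝 0) →
    (∀ᵐ x ∂(volume.restrict (Metric.ball 0 (1 / 4))), ∀ n, ∫ y in Metric.ball (0 : E3) (1 / 2),
      (P y * (∑ j, pderiv3 j (pderiv3 j (fun y => χ y * regPow (-1 / 2) (δ n) x y)) y) -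
        ∑ j, G j y * pderiv3 j (fun y => χ y * regPow (-1 / 2) (δ n) x y) y) = 0) →
    ∀ᵐ x ∂(volume.restrict (Metric.ball 0 (1 / 4))), ‖P x‖ₑ ≤
      c * ((∫⁻ y in Metric.ball (0 : E3) (1 / 2), ‖y - x‖ₑ ^ (-2 : ℝ) * ∑ j, ‖G j y‖ₑ) +
        ∫⁻ y in Metric.ball (0 : E3) (1 / 2), ‖P y‖ₑ) := by
  have hχ : ContDiff ℝ (⊤ : ℕ∞) χ := χ.contDiff
  obtain ⟨L, hL0, hL1, hL2⟩ := exists_bound_pderiv3 hχ χ.hasCompactSupport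
  set S := Metric.ball (0 : E3) (1 / 2) with hS
  set κ := ∫⁻ w, ‖newtonKernel 1 w‖ₑ with hκ
  have hκT : κ ≠ ⊤ := integrable_newtonKernel_one.2.ne
  have hκ0 : κ ≠ 0 := by
    have hc : Continuous fun w => ‖newtonKernel 1 w‖ₑ := (continuous_newtonKernel one_pos).enorm
    refine (lintegral_pos_iff_support hc.measurable |>.2 ?_).ne'
    have : (Function.support fun w => ‖newtonKernel 1 w‖ₑ) = univ := by
      ext w
      simp only [newtonKernel, Function.mem_support, mem_univ, iff_true, enorm_ne_zero]
      positivity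
    rw [this]
    simp
  set C₁ : ℝ≥0 := ⟨L * 8 + 2 * (3 * (L * 64)), by positivity⟩
  set C₂ : ℝ≥0 := ⟨L * 8 + 1, by positivity⟩
  refine ⟨κ⁻¹.toNNReal * (C₁ + C₂), fun P G δ hPm hP hGm hG hδ0 hδ h => ?_⟩
  have hbdd : ∀ (w b : E3 → ℝ), IntegrableOn w S → Continuous b →
      IntegrableOn (fun y => w y * b y) S := by
    intro w b hw hb
    obtain ⟨C, hC⟩ := (isCompact_closedBall (0 : E3) (1 / 2)).exists_bound_of_continuousOn
      hb.continuousOn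
    refine Integrable.mul_bdd (c := C) hw hb.aestronglyMeasurable ?_
    filter_upwards [ae_restrict_mem measurableSet_ball] with y hy
    exact hC y (Metric.ball_subset_closedBall hy)
  have hχ0 : ∀ y, y ∉ S → χ y = 0 := fun y hy => by
    by_contra hne
    have : y ∈ Function.support χ := hne
    rw [χ.support_eq, hout] at this
    exact hy (Metric.ball_subset_ball (by norm_num) this)
  have hfS : IntegrableOn (fun y => χ y * P y) S := by
    simpa only [mul_comm] using hbdd P χ hP hχ.continuous
  have hf : Integrable fun y => χ y * P y :=
    (integrableOn_iff_integrable_of_support_subset fun y hy => by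
      by_contra hn; exact hy (by simp [hχ0 y hn])).1 hfS
  set b : ℝ≥0∞ := ∫⁻ y in S, ‖P y‖ₑ
  set a : E3 → ℝ≥0∞ := fun x => ∫⁻ y in S, ‖y - x‖ₑ ^ (-2 : ℝ) * ∑ j, ‖G j y‖ₑ
  have hkey : ∀ᵐ x ∂(volume.restrict (Metric.ball (0 : E3) (1 / 4))), ∀ n,
      ‖∫ y, newtonKernel (δ n) (y - x) * (χ y * P y)‖ₑ ≤ C₂ * a x + C₁ * b := by
    filter_upwards [h, ae_restrict_mem measurableSet_ball] with x hx hxb n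
    have hx4 : ‖x‖ < 1 / 4 := by simpa using hxb
    have hδn := hδ0 n
    have hξ : ContDiff ℝ (⊤ : ℕ∞) fun y => χ y * regPow (-1 / 2) (δ n) x y :=
      hχ.mul (contDiff_regPow hδn x)
    set V : E3 → ℝ := fun y => (∑ j, pderiv3 j (pderiv3 j χ) y) * regPow (-1 / 2) (δ n) x y -
        2 * (∑ j, pderiv3 j χ y * ((y j - x j) * regPow (-3 / 2) (δ n) x y)) with hV
    set W : Fin 3 → E3 → ℝ := fun j => pderiv3 j fun y => χ y * regPow (-1 / 2) (δ n) x y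
    have hWc : ∀ j, Continuous (W j) := fun j => (contDiff_pderiv3 hξ j).continuous
    have hlapc : Continuous fun y => ∑ j, pderiv3 j (W j) y :=
      continuous_finsetSum _ fun j _ => (contDiff_pderiv3 (contDiff_pderiv3 hξ j) j).continuous
    have hKc : Continuous fun y => newtonKernel (δ n) (y - x) :=
      (continuous_newtonKernel hδn).comp (continuous_id.sub continuous_const)
    have hlap : ∀ y, ∑ j, pderiv3 j (W j) y = V y - χ y * newtonKernel (δ n) (y - x) := fun y => by
      rw [laplacian_cutoff_regPow hχ hδn x y]; rfl
    have h1 : ∫ y, newtonKernel (δ n) (y - x) * (χ y * P y) =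
        ∫ y in S, (P y * V y - ∑ j, G j y * W j y) := by
      rw [← setIntegral_eq_integral_of_forall_compl_eq_zero (s := S)
        (fun y hy => by simp [hχ0 y hy]), ← sub_eq_zero, ← neg_eq_zero, neg_sub, ← hx n,
        ← integral_sub]
      · refine integral_congr_ae (Eventually.of_forall fun y => ?_)
        simp only
        rw [show ∑ j, pderiv3 j (pderiv3 j (fun y => χ y * regPow (-1 / 2) (δ n) x y)) y =
          V y - χ y * newtonKernel (δ n) (y - x) from hlap y]
        ring
      · refine Integrable.sub ?_ (integrable_finsetSum _ fun j _ => hbdd _ _ (hG j) (hWc j))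
        have hVc : Continuous V := by
          have : V = fun y => (∑ j, pderiv3 j (W j) y) + χ y * newtonKernel (δ n) (y - x) := by
            funext y; rw [hlap y]; ring
          rw [this]
          exact hlapc.add (hχ.continuous.mul hKc)
        exact hbdd _ _ hP hVc
      · have h3 : IntegrableOn (fun y => newtonKernel (δ n) (y - x) * (χ y * P y)) S :=
          (hbdd _ _ hfS hKc).congr (Eventually.of_forall fun y => mul_comm _ _)
        exact h3
    rw [h1]
    have hpt : ∀ y ∈ S, (‖V y‖ₑ ≤ C₁) ∧ ∀ j, ‖W j y‖ₑ ≤ C₂ * ‖y - x‖ₑ ^ (-2 : ℝ) := by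
      intro y hy
      have hy2 : ‖y‖ < 1 / 2 := by simpa [hS] using hy
      have hWe : ∀ j, W j y = pderiv3 j χ y * regPow (-1 / 2) (δ n) x y -
          χ y * ((y j - x j) * regPow (-3 / 2) (δ n) x y) := fun j =>
        pderiv3_cutoff_regPow hχ hδn x y j
      have hone : (1 : ℝ≥0∞) ≤ ‖y - x‖ₑ ^ (-2 : ℝ) := by
        rw [ENNReal.rpow_neg, ENNReal.one_le_inv]
        refine ENNReal.rpow_le_one ?_ (by norm_num)
        rw [← ofReal_norm, ENNReal.ofReal_le_one]
        linarith [norm_sub_le y x]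
      have hχle : ‖χ y‖ₑ ≤ 1 := by
        rw [Real.enorm_of_nonneg χ.nonneg, ENNReal.ofReal_le_one]
        exact χ.le_one
      have hsnd : ∀ j, ‖χ y * ((y j - x j) * regPow (-3 / 2) (δ n) x y)‖ₑ ≤
          ‖y - x‖ₑ ^ (-2 : ℝ) := fun j => by
        rw [enorm_mul]
        exact mul_le_of_le_one_of_le hχle (enorm_coord_mul_regPow_le (δ n) x y j)
      by_cases hyb : y ∈ Metric.ball (0 : E3) (3 / 8)
      · have hev : χ =ᶠ[𝓝 y] fun _ => (1 : ℝ) := by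
          filter_upwards [Metric.isOpen_ball.mem_nhds hyb] with w hw
          exact χ.one_of_mem_closedBall (by rw [hin]; exact Metric.ball_subset_closedBall hw)
        have hd : ∀ j, pderiv3 j χ =ᶠ[𝓝 y] fun _ => (0 : ℝ) := fun j =>
          hev.eventually_nhds.mono fun w hw => pderiv3_eq_zero_of_eventually_const hw j
        have hd1 : ∀ j, pderiv3 j χ y = 0 := fun j => (hd j).eq_of_nhds
        have hd2 : ∀ j, pderiv3 j (pderiv3 j χ) y = 0 := fun j =>
          pderiv3_eq_zero_of_eventually_const (hd j) j
        refine ⟨by simp [hV, hd1, hd2], fun j => ?_⟩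
        rw [hWe, hd1, zero_mul, zero_sub, enorm_neg]
        refine (hsnd j).trans (le_mul_of_one_le_left zero_le ?_)
        exact_mod_cast (show (1 : ℝ) ≤ L * 8 + 1 by linarith [mul_nonneg hL0 (by norm_num : (0:ℝ) ≤ 8)])
      · have h8 : 1 / 8 ≤ ‖y - x‖ := by
          have : 3 / 8 ≤ ‖y‖ := by simpa using hyb
          linarith [norm_sub_norm_le y x]
        have hN : |regPow (-1 / 2) (δ n) x y| ≤ 8 := by
          rw [abs_of_nonneg (regPow_nonneg _ _ _ _)]; exact regPow_neg_half_le h8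
        have e1 : ∀ j, |pderiv3 j χ y * regPow (-1 / 2) (δ n) x y| ≤ L * 8 := fun j => by
          rw [abs_mul]
          exact mul_le_mul (hL1 j y) hN (abs_nonneg _) hL0
        refine ⟨?_, fun j => ?_⟩
        · rw [← ofReal_norm, Real.norm_eq_abs]
          refine ENNReal.ofReal_le_of_le_toReal ?_ |>.trans_eq rfl
          show |V y| ≤ L * 8 + 2 * (3 * (L * 64))
          refine (abs_sub _ _).trans (add_le_add ?_ ?_)
          · rw [abs_mul]
            exact mul_le_mul (hL2 y) hN (abs_nonneg _) hL0
          · rw [abs_mul, abs_of_pos (by norm_num : (0 : ℝ) < 2)]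
            refine mul_le_mul_of_nonneg_left ((Finset.abs_sum_le_sum_abs _ _).trans ?_) (by norm_num)
            have : ∀ j ∈ Finset.univ, |pderiv3 j χ y * ((y j - x j) *
                regPow (-3 / 2) (δ n) x y)| ≤ L * 64 := fun j _ => by
              rw [abs_mul]
              exact mul_le_mul (hL1 j y) (abs_coord_mul_regPow_le (δ n) h8 j) (abs_nonneg _) hL0
            simpa using Finset.sum_le_card_nsmul _ _ _ this
        · rw [hWe]
          refine enorm_sub_le.trans ?_
          have hC : (C₂ : ℝ≥0∞) = ENNReal.ofReal (L * 8) + 1 := by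
            rw [← ENNReal.ofReal_one, ← ENNReal.ofReal_add (by positivity) (by norm_num),
              ENNReal.ofReal_eq_coe_nnreal (show 0 ≤ L * 8 + 1 by positivity)]
            rfl
          rw [hC, add_mul, one_mul]
          refine add_le_add (le_trans ?_ (le_mul_of_one_le_right zero_le hone)) (hsnd j)
          rw [← ofReal_norm, Real.norm_eq_abs]
          exact ENNReal.ofReal_le_ofReal (e1 j)
    calc ‖∫ y in S, (P y * V y - ∑ j, G j y * W j y)‖ₑ
        ≤ ∫⁻ y in S, ‖P y * V y - ∑ j, G j y * W j y‖ₑ := enorm_integral_le_lintegral_enorm _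
      _ ≤ ∫⁻ y in S, (C₂ * (‖y - x‖ₑ ^ (-2 : ℝ) * ∑ j, ‖G j y‖ₑ) + C₁ * ‖P y‖ₑ) := by
          refine setLIntegral_mono' measurableSet_ball fun y hy => ?_
          obtain ⟨hVy, hWy⟩ := hpt y hy
          rw [add_comm]
          refine enorm_sub_le.trans (add_le_add ?_ ?_)
          · rw [enorm_mul, mul_comm]
            gcongr
          · refine (enorm_sum_le _ _).trans ?_
            rw [← mul_assoc, Finset.mul_sum]
            refine Finset.sum_le_sum fun j _ => ?_
            rw [enorm_mul, mul_comm]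
            gcongr
            exact hWy j
      _ = C₂ * a x + C₁ * b := by
          rw [lintegral_add_right _ (hPm.enorm.const_mul _), lintegral_const_mul' _ _ (by simp),
            lintegral_const_mul' _ _ (by simp)]
  filter_upwards [ae_le_of_newtonKernel_bound (hχ.continuous.measurable.mul hPm) hf hδ0 hδ hkey,
    ae_restrict_mem measurableSet_ball] with x hx hxb
  have hχ1 : χ x = 1 := χ.one_of_mem_closedBall (by
    rw [hin]; exact Metric.ball_subset_closedBall (Metric.ball_subset_ball (by norm_num) hxb))
  simp only [Pi.mul_apply, hχ1, one_mul] at hx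
  rw [ENNReal.coe_mul, ENNReal.coe_toNNReal (by simpa using hκ0), mul_assoc,
    ← ENNReal.div_eq_inv_mul, ENNReal.le_div_iff_mul_le (Or.inl hκ0) (Or.inl hκT), mul_comm]
  refine hx.trans ?_
  push_cast
  calc (C₂ : ℝ≥0∞) * a x + C₁ * b ≤ (C₂ * a x + C₁ * b) + (C₁ * a x + C₂ * b) := le_self_add
    _ = _ := by ring

theorem measurable_integral_cutoff_regPow {χ : E3 → ℝ} (hχ : ContDiff ℝ (⊤ : ℕ∞) χ) {δ : ℝ}
    (hδ : 0 < δ) {P : SpT → ℝ} {G : Fin 3 → SpT → ℝ} (hPm : Measurable P)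
    (hGm : ∀ j, Measurable (G j)) (S : Set E3) :
    Measurable fun w : E3 × ℝ => ∫ y in S,
      (P (y, w.2) * (∑ j, pderiv3 j (pderiv3 j (fun y => χ y * regPow (-1 / 2) δ w.1 y)) y) -
        ∑ j, G j (y, w.2) * pderiv3 j (fun y => χ y * regPow (-1 / 2) δ w.1 y) y) := by
  have m1 : ∀ p, Measurable fun q : (E3 × ℝ) × E3 => regPow p δ q.1.1 q.2 := fun p => by
    unfold regPow
    exact Measurable.pow_const (by fun_prop) p
  have m2 : ∀ j, Measurable fun q : (E3 × ℝ) × E3 => pderiv3 j χ q.2 := fun j =>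
    (contDiff_pderiv3 hχ j).continuous.measurable.comp measurable_snd
  have m3 : ∀ j, Measurable fun q : (E3 × ℝ) × E3 => pderiv3 j (pderiv3 j χ) q.2 := fun j =>
    (contDiff_pderiv3 (contDiff_pderiv3 hχ j) j).continuous.measurable.comp measurable_snd
  have m4 : Measurable fun q : (E3 × ℝ) × E3 => χ q.2 :=
    hχ.continuous.measurable.comp measurable_snd
  have m5 : Measurable fun q : (E3 × ℝ) × E3 => P (q.2, q.1.2) :=
    hPm.comp (measurable_snd.prodMk measurable_fst.snd)
  have m6 : ∀ j, Measurable fun q : (E3 × ℝ) × E3 => G j (q.2, q.1.2) := fun j =>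
    (hGm j).comp (measurable_snd.prodMk measurable_fst.snd)
  have m7 : ∀ j : Fin 3, Measurable fun q : (E3 × ℝ) × E3 => q.2 j - q.1.1 j := fun j => by
    fun_prop
  have m8 : Measurable fun q : (E3 × ℝ) × E3 => P (q.2, q.1.2) *
      ((∑ j, pderiv3 j (pderiv3 j χ) q.2) * regPow (-1 / 2) δ q.1.1 q.2 -
        2 * (∑ j, pderiv3 j χ q.2 * ((q.2 j - q.1.1 j) * regPow (-3 / 2) δ q.1.1 q.2)) -
        χ q.2 * (3 * δ ^ 2 * regPow (-5 / 2) δ q.1.1 q.2)) :=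
    m5.mul ((((Finset.measurable_fun_sum _ fun j _ => m3 j).mul (m1 _)).sub
      ((Finset.measurable_fun_sum _ fun j _ => (m2 j).mul ((m7 j).mul (m1 _))).const_mul 2)).sub
      (m4.mul ((m1 _).const_mul _)))
  have m9 : Measurable fun q : (E3 × ℝ) × E3 => ∑ j, G j (q.2, q.1.2) *
      (pderiv3 j χ q.2 * regPow (-1 / 2) δ q.1.1 q.2 -
        χ q.2 * ((q.2 j - q.1.1 j) * regPow (-3 / 2) δ q.1.1 q.2)) :=
    Finset.measurable_fun_sum _ fun j _ =>
      (m6 j).mul (((m2 j).mul (m1 _)).sub (m4.mul ((m7 j).mul (m1 _))))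
  simp only [laplacian_cutoff_regPow hχ hδ, pderiv3_cutoff_regPow hχ hδ]
  exact ((m8.sub m9).stronglyMeasurable.integral_prod_right' (ν := volume.restrict S)).measurable

/-- A local representation bound for solutions of a Poisson equation on a cylinder. -/
theorem newton_bound : ∃ c : ℝ≥0, ∀ (a b : ℝ) (P : SpT → ℝ) (G : Fin 3 → SpT → ℝ), Measurable P →
    IntegrableOn P (Metric.ball 0 (1 / 2) ×ˢ Ioo a b) → (∀ j, Measurable (G j)) →
    (∀ j, IntegrableOn (G j) (Metric.ball 0 (1 / 2) ×ˢ Ioo a b)) →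
    (∀ ψ, IsTestOn (Metric.ball 0 (1 / 2) ×ˢ Ioo a b) ψ →
      ∫ z in Metric.ball 0 (1 / 2) ×ˢ Ioo a b, (P z * sLap ψ z - ∑ j, G j z * sderiv j ψ z) = 0) →
    ∀ᵐ t ∂(volume.restrict (Ioo a b)), ∀ᵐ x ∂(volume.restrict (Metric.ball (0 : E3) (1 / 4))),
      ‖P (x, t)‖ₑ ≤
      c * ((∫⁻ y in Metric.ball (0 : E3) (1 / 2), ‖y - x‖ₑ ^ (-2 : ℝ) * ∑ j, ‖G j (y, t)‖ₑ) +
        ∫⁻ y in Metric.ball (0 : E3) (1 / 2), ‖P (y, t)‖ₑ) := by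
  set χ : ContDiffBump (0 : E3) := ⟨3 / 8, 7 / 16, by norm_num, by norm_num⟩ with hχdef
  have hχ : ContDiff ℝ (⊤ : ℕ∞) χ := χ.contDiff
  obtain ⟨c, hc⟩ := newton_bound_slice χ rfl rfl
  refine ⟨c, fun a b P G hPm hP hGm hG h => ?_⟩
  set δ : ℕ → ℝ := fun n => 1 / ((n : ℝ) + 1)
  have hδ0 : ∀ n, 0 < δ n := fun n => by positivity
  have hδ : Tendsto δ atTop (𝓝 0) := tendsto_one_div_add_atTop_nhds_zero_nat
  set S := Metric.ball (0 : E3) (1 / 2) with hS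
  set H : ℕ → E3 → ℝ → ℝ := fun n x t => ∫ y in S,
    (P (y, t) * (∑ j, pderiv3 j (pderiv3 j (fun y => χ y * regPow (-1 / 2) (δ n) x y)) y) -
        ∑ j, G j (y, t) * pderiv3 j (fun y => χ y * regPow (-1 / 2) (δ n) x y) y) with hH
  have hχs : tsupport χ ⊆ S := by
    rw [χ.tsupport_eq]
    exact Metric.closedBall_subset_ball (by norm_num [hχdef])
  have hsl : ∀ x n, ∀ᵐ t ∂(volume.restrict (Ioo a b)), H n x t = 0 := fun x n =>
    ae_slice_poisson isOpen_Ioo hP hG h (hχ.mul (contDiff_regPow (hδ0 n) x))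
      χ.hasCompactSupport.mul_right ((tsupport_mul_subset_left).trans hχs)
  have hm : ∀ n, Measurable fun w : E3 × ℝ => H n w.1 w.2 := fun n =>
    measurable_integral_cutoff_regPow hχ (hδ0 n) hPm hGm S
  have hswap : ∀ᵐ t ∂(volume.restrict (Ioo a b)),
      ∀ᵐ x ∂(volume.restrict (Metric.ball (0 : E3) (1 / 4))), ∀ n, H n x t = 0 := by
    refine (Measure.ae_ae_comm (μ := volume.restrict (Metric.ball (0 : E3) (1 / 4)))
      (ν := volume.restrict (Ioo a b)) (p := fun x t => ∀ n, H n x t = 0) ?_).1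
      (Eventually.of_forall fun x => ae_all_iff.2 fun n => hsl x n)
    simp only [ofPred_forall]
    exact MeasurableSet.iInter fun n => hm n (measurableSet_singleton 0)
  have hPs : ∀ᵐ t ∂(volume.restrict (Ioo a b)), IntegrableOn (fun y => P (y, t)) S := by
    rw [IntegrableOn, volume_restrict_prod_SpT] at hP
    exact hP.prod_left_ae
  have hGs : ∀ᵐ t ∂(volume.restrict (Ioo a b)), ∀ j, IntegrableOn (fun y => G j (y, t)) S := by
    refine ae_all_iff.2 fun j => ?_
    have := hG j
    rw [IntegrableOn, volume_restrict_prod_SpT] at this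
    exact this.prod_left_ae
  filter_upwards [hswap, hPs, hGs] with t h1 h2 h3
  exact hc (fun y => P (y, t)) (fun j y => G j (y, t)) δ (hPm.comp (by fun_prop)) h2
    (fun j => (hGm j).comp (by fun_prop)) h3 hδ0 hδ h1

theorem lintegral_enorm_rpow_ball {s : ℝ} (hs : s < 3) : ∃ N : ℝ≥0,
    ∀ x ∈ Metric.ball (0 : E3) (1 / 2),
      ∫⁻ y in Metric.ball (0 : E3) (1 / 2), ‖y - x‖ₑ ^ (-s) ≤ N := by
  have hI : IntegrableOn (fun w : E3 => ‖w‖ ^ (-s)) (Metric.ball 0 1) := by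
    rw [integrableOn_fun_norm_addHaar (volume : Measure E3) (f := fun r : ℝ => r ^ (-s))]
    have h : IntegrableOn (fun r : ℝ => r ^ (2 - s)) (Ioo 0 1) :=
      (intervalIntegral.integrableOn_Ioo_rpow_iff one_pos).2 (by linarith)
    refine h.congr_fun (fun r hr => ?_) measurableSet_Ioo
    simp only [finrank_euclideanSpace_fin, smul_eq_mul]
    rw [sub_eq_add_neg, Real.rpow_add hr.1]
    norm_num
  refine ⟨(∫⁻ w in Metric.ball (0 : E3) 1, ‖‖w‖ ^ (-s)‖ₑ).toNNReal, fun x hx => ?_⟩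
  rw [ENNReal.coe_toNNReal hI.2.ne]
  have hx' : ‖x‖ < 1 / 2 := by simpa using hx
  calc ∫⁻ y in Metric.ball (0 : E3) (1 / 2), ‖y - x‖ₑ ^ (-s)
      ≤ ∫⁻ y in Metric.ball x 1, ‖y - x‖ₑ ^ (-s) := by
        refine lintegral_mono_set (Metric.ball_subset_ball' ?_)
        rw [dist_zero_left]; linarith
    _ = ∫⁻ w in Metric.ball (0 : E3) 1, ‖w‖ₑ ^ (-s) := by
        rw [← lintegral_indicator measurableSet_ball, ← lintegral_indicator measurableSet_ball,
          ← lintegral_sub_right_eq_self ((Metric.ball (0 : E3) 1).indicator fun w => ‖w‖ₑ ^ (-s)) x]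
        refine lintegral_congr fun y => ?_
        simp only [indicator, Metric.mem_ball, dist_eq_norm, sub_zero]
    _ = ∫⁻ w in Metric.ball (0 : E3) 1, ‖‖w‖ ^ (-s)‖ₑ := by
        refine lintegral_congr_ae ?_
        filter_upwards [ae_restrict_of_ae (compl_mem_ae_iff.2 (measure_singleton (0 : E3)))] with w hw
        have hw0 : 0 < ‖w‖ := norm_pos_iff.2 hw
        rw [Real.enorm_of_nonneg (by positivity), ← ENNReal.ofReal_rpow_of_pos hw0, ofReal_norm]

theorem potential_bound : ∃ c : ℝ≥0, ∀ (e b : E3 → ℝ≥0∞), Measurable e → Measurable b →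
    ∫⁻ x in Metric.ball (0 : E3) (1 / 4), (∫⁻ y in Metric.ball (0 : E3) (1 / 2),
      ‖y - x‖ₑ ^ (-2 : ℝ) * (e y * b y) ^ (1 / 2 : ℝ)) ^ (3 / 2 : ℝ) ≤
    c * (∫⁻ y in Metric.ball (0 : E3) (1 / 2), b y) ^ (3 / 4 : ℝ) *
      ((∫⁻ y in Metric.ball (0 : E3) (1 / 2), e y ^ 2) ^ (1 / 2 : ℝ) *
        (∫⁻ y in Metric.ball (0 : E3) (1 / 2), e y) ^ 2) ^ (1 / 4 : ℝ) := by
  obtain ⟨N₁, h₁⟩ := lintegral_enorm_rpow_ball (s := 11 / 4) (by norm_num)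
  obtain ⟨N₂, h₂⟩ := lintegral_enorm_rpow_ball (s := 5 / 2) (by norm_num)
  refine ⟨((N₁ : ℝ≥0∞) ^ (3 / 4 : ℝ) * ((N₂ : ℝ≥0∞) ^ (1 / 2 : ℝ) * N₂) ^ (1 / 4 : ℝ)).toNNReal, fun e b he hb => ?_⟩
  set S := Metric.ball (0 : E3) (1 / 2)
  set S' := Metric.ball (0 : E3) (1 / 4)
  have hSS : S' ⊆ S := Metric.ball_subset_ball (by norm_num)
  set Kb : E3 → ℝ≥0∞ := fun x => ∫⁻ y in S, ‖y - x‖ₑ ^ (-(11 / 4) : ℝ) * b y with hKb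
  set Ke : E3 → ℝ≥0∞ := fun x => ∫⁻ y in S, e y * ‖y - x‖ₑ ^ (-(5 / 4) : ℝ) with hKe
  have mker : ∀ s : ℝ, Measurable fun p : E3 × E3 => ‖p.2 - p.1‖ₑ ^ s := fun s => by fun_prop
  have mk1 : ∀ (s : ℝ) (x : E3), Measurable fun y : E3 => ‖y - x‖ₑ ^ s := fun s x => by fun_prop
  have mk2 : ∀ (s : ℝ) (y : E3), Measurable fun x : E3 => ‖y - x‖ₑ ^ s := fun s y => by fun_prop
  have mKb : Measurable Kb := by
    have : Measurable fun p : E3 × E3 => ‖p.2 - p.1‖ₑ ^ (-(11 / 4) : ℝ) * b p.2 :=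
      (mker _).mul (hb.comp measurable_snd)
    exact this.lintegral_prod_right'
  have mKe : Measurable Ke := by
    have : Measurable fun p : E3 × E3 => e p.2 * ‖p.2 - p.1‖ₑ ^ (-(5 / 4) : ℝ) :=
      (he.comp measurable_snd).mul (mker _)
    exact this.lintegral_prod_right'
  have hsq : ∀ x : ℝ≥0∞, (x ^ (1 / 2 : ℝ)) ^ 2 = x := fun x => by
    rw [← ENNReal.rpow_natCast, ← ENNReal.rpow_mul]; norm_num
  have hker : ∀ w : E3, (‖w‖ₑ ^ (-(5 / 4) : ℝ)) ^ 2 = ‖w‖ₑ ^ (-(5 / 2) : ℝ) := fun w => by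
    rw [← ENNReal.rpow_natCast, ← ENNReal.rpow_mul]; norm_num
  -- the pointwise Cauchy–Schwarz splitting
  have hcs : ∀ x, (∫⁻ y in S, ‖y - x‖ₑ ^ (-2 : ℝ) * (e y * b y) ^ (1 / 2 : ℝ)) ^ 2 ≤
      Kb x * Ke x := fun x => by
    have := lintegral_mul_sq_le (μ := volume.restrict S)
      (k := fun y => (‖y - x‖ₑ ^ (-(11 / 4) : ℝ) * b y) ^ (1 / 2 : ℝ))
      (h := fun y => (e y * ‖y - x‖ₑ ^ (-(5 / 4) : ℝ)) ^ (1 / 2 : ℝ))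
      (by fun_prop) (by fun_prop)
    simp only [hsq] at this
    refine le_trans (le_of_eq ?_) this
    congr 1
    refine lintegral_congr_ae ?_
    filter_upwards [ae_restrict_of_ae (compl_mem_ae_iff.2 (measure_singleton x))] with y hy
    have hw0 : ‖y - x‖ₑ ≠ 0 := enorm_ne_zero.2 (sub_ne_zero.2 hy)
    simp only [ENNReal.mul_rpow_of_nonneg _ _ (by norm_num : (0 : ℝ) ≤ 1 / 2), ← ENNReal.rpow_mul]
    calc _ = (‖y - x‖ₑ ^ (-(11 / 4) * (1 / 2) : ℝ) * ‖y - x‖ₑ ^ (-(5 / 4) * (1 / 2) : ℝ)) *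
          (e y ^ (1 / 2 : ℝ) * b y ^ (1 / 2 : ℝ)) := by
            rw [← ENNReal.rpow_add _ _ hw0 enorm_ne_top]; norm_num
      _ = _ := by ring
  have hI1 : ∫⁻ x in S', Kb x ≤ N₁ * ∫⁻ y in S, b y := by
    simp only [hKb]
    rw [lintegral_lintegral_swap ((mker _).mul (hb.comp measurable_snd)).aemeasurable,
      ← lintegral_const_mul _ hb]
    refine setLIntegral_mono' measurableSet_ball fun y hy => ?_
    rw [lintegral_mul_const _ (mk2 _ y)]
    gcongr
    refine (lintegral_mono_set hSS).trans ?_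
    have := h₁ y hy
    simp only [← enorm_neg (y - _), neg_sub]
    exact this
  have hI2 : ∀ x ∈ S', Ke x ^ 2 ≤ N₂ * ∫⁻ y in S, e y ^ 2 := fun x hx => by
    refine (lintegral_mul_sq_le he.aemeasurable (mk1 _ x).aemeasurable).trans ?_
    rw [mul_comm]
    simp only [hker]
    gcongr
    exact h₂ x (hSS hx)
  have hI3 : ∫⁻ x in S', Ke x ^ 2 ≤ N₂ * (∫⁻ y in S, e y) ^ 2 := by
    calc ∫⁻ x in S', Ke x ^ 2
        ≤ ∫⁻ x in S', (∫⁻ y in S, e y) * ∫⁻ y in S, e y * ‖y - x‖ₑ ^ (-(5 / 2) : ℝ) := by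
          refine lintegral_mono fun x => ?_
          refine (lintegral_weight_mul_sq_le he.aemeasurable (mk1 _ x).aemeasurable).trans_eq ?_
          simp only [hker]
      _ = (∫⁻ y in S, e y) * ∫⁻ y in S, ∫⁻ x in S', e y * ‖y - x‖ₑ ^ (-(5 / 2) : ℝ) := by
          have hm : Measurable fun p : E3 × E3 => e p.2 * ‖p.2 - p.1‖ₑ ^ (-(5 / 2) : ℝ) :=
            (he.comp measurable_snd).mul (mker _)
          rw [lintegral_const_mul _ hm.lintegral_prod_right',
            lintegral_lintegral_swap hm.aemeasurable]
      _ ≤ (∫⁻ y in S, e y) * ∫⁻ y in S, e y * N₂ := by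
          refine mul_le_mul' le_rfl ?_
          refine setLIntegral_mono' measurableSet_ball fun y hy => ?_
          rw [lintegral_const_mul _ (mk2 _ y)]
          gcongr
          refine (lintegral_mono_set hSS).trans ?_
          simp only [← enorm_neg (y - _), neg_sub]
          exact h₂ y hy
      _ = _ := by rw [lintegral_mul_const _ he]; ring
  have hI4 : ∫⁻ x in S', Ke x ^ 3 ≤
      (N₂ * ∫⁻ y in S, e y ^ 2) ^ (1 / 2 : ℝ) * (N₂ * (∫⁻ y in S, e y) ^ 2) := by
    calc ∫⁻ x in S', Ke x ^ 3
        ≤ ∫⁻ x in S', (N₂ * ∫⁻ y in S, e y ^ 2) ^ (1 / 2 : ℝ) * Ke x ^ 2 := by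
          refine setLIntegral_mono' measurableSet_ball fun x hx => ?_
          rw [pow_succ, mul_comm]
          gcongr
          rw [← ENNReal.rpow_le_rpow_iff (by norm_num : (0 : ℝ) < 2), ← ENNReal.rpow_mul]
          simpa using hI2 x hx
      _ = (N₂ * ∫⁻ y in S, e y ^ 2) ^ (1 / 2 : ℝ) * ∫⁻ x in S', Ke x ^ 2 :=
          lintegral_const_mul _ (mKe.pow_const 2)
      _ ≤ _ := by gcongr
  calc ∫⁻ x in S', (∫⁻ y in S, ‖y - x‖ₑ ^ (-2 : ℝ) * (e y * b y) ^ (1 / 2 : ℝ)) ^ (3 / 2 : ℝ)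
      ≤ ∫⁻ x in S', Kb x ^ (3 / 4 : ℝ) * Ke x ^ (3 / 4 : ℝ) := by
        refine lintegral_mono fun x => ?_
        rw [← ENNReal.mul_rpow_of_nonneg _ _ (by norm_num)]
        refine le_trans (le_of_eq ?_) (ENNReal.rpow_le_rpow (hcs x) (by norm_num))
        rw [← ENNReal.rpow_natCast, ← ENNReal.rpow_mul]; norm_num
    _ ≤ (∫⁻ x in S', (Kb x ^ (3 / 4 : ℝ)) ^ (4 / 3 : ℝ)) ^ (1 / (4 / 3 : ℝ)) *
        (∫⁻ x in S', (Ke x ^ (3 / 4 : ℝ)) ^ (4 : ℝ)) ^ (1 / (4 : ℝ)) :=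
        ENNReal.lintegral_mul_le_Lp_mul_Lq _ (by constructor <;> norm_num)
          (mKb.pow_const _).aemeasurable (mKe.pow_const _).aemeasurable
    _ = (∫⁻ x in S', Kb x) ^ (3 / 4 : ℝ) * (∫⁻ x in S', Ke x ^ 3) ^ (1 / 4 : ℝ) := by
        simp only [← ENNReal.rpow_mul, ← ENNReal.rpow_natCast]
        norm_num
    _ ≤ (N₁ * ∫⁻ y in S, b y) ^ (3 / 4 : ℝ) *
        ((N₂ * ∫⁻ y in S, e y ^ 2) ^ (1 / 2 : ℝ) * (N₂ * (∫⁻ y in S, e y) ^ 2)) ^ (1 / 4 : ℝ) := by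
        gcongr
    _ = _ := by
        rw [ENNReal.coe_toNNReal (by finiteness)]
        simp only [ENNReal.mul_rpow_of_nonneg _ _ (by norm_num : (0 : ℝ) ≤ 3 / 4),
          ENNReal.mul_rpow_of_nonneg _ _ (by norm_num : (0 : ℝ) ≤ 1 / 4),
          ENNReal.mul_rpow_of_nonneg _ _ (by norm_num : (0 : ℝ) ≤ 1 / 2)]
        ring

theorem lintegral_enorm_sub_average_sq_le {f : E3 → ℝ} {S : Set E3} (h0 : volume S ≠ 0)
    (hT : volume S ≠ ⊤) (hf : Measurable f) :
    ∫⁻ x in S, ‖f x - ⨍ y in S, f y‖ₑ ^ 2 ≤ 4 * ∫⁻ x in S, ‖f x‖ₑ ^ 2 := by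
  rcases eq_or_ne (∫⁻ x in S, ‖f x‖ₑ ^ 2) ⊤ with h | h
  · rw [h]; simp
  have hi := integrableOn_of_lintegral_sq hT hf h
  have h1 := enorm_sub_average_sq_le h0 hT hf hi 0
  simp only [zero_sub, enorm_neg] at h1
  calc ∫⁻ x in S, ‖f x - ⨍ y in S, f y‖ₑ ^ 2
      ≤ ∫⁻ x in S, 2 * (‖f x‖ₑ ^ 2 + (volume S)⁻¹ * ∫⁻ y in S, ‖f y‖ₑ ^ 2) := by
        refine lintegral_mono fun x => ?_
        rw [sub_eq_add_neg]
        refine (enorm_add_sq_le _ _).trans ?_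
        rw [enorm_neg]
        gcongr
    _ = 4 * ∫⁻ x in S, ‖f x‖ₑ ^ 2 := by
        rw [lintegral_const_mul' _ _ (by simp), lintegral_add_right _ measurable_const,
          setLIntegral_const, mul_comm _ (volume S), ← mul_assoc, ENNReal.mul_inv_cancel h0 hT]
        ring

/-- Vector version of the local Poincaré and Sobolev inequalities on slices. -/
theorem SliceApprox.vector (ι : Type*) [Fintype ι] : ∃ c : ℝ≥0, ∀ (f : ι → E3 → ℝ)
    (g : ι → Fin 3 → E3 → ℝ), (∀ i, Measurable (f i)) → (∀ i j, Measurable (g i j)) →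
    (∀ i, ∫⁻ x in Metric.ball (0 : E3) (3 / 4), ‖f i x‖ₑ ^ 2 ≠ ⊤) →
    (∀ i, SliceApprox (3 / 4) (f i) (g i)) →
    (∫⁻ x in Metric.ball (0 : E3) (3 / 4),
        ∑ i, ‖f i x - ⨍ y in Metric.ball (0 : E3) (1 / 2), f i y‖ₑ ^ 2 ≤
      c * ∫⁻ x in Metric.ball (0 : E3) (3 / 4), ∑ i, ∑ j, ‖g i j x‖ₑ ^ 2) ∧
    (∫⁻ x in Metric.ball (0 : E3) (5 / 8),
        (∑ i, ‖f i x - ⨍ y in Metric.ball (0 : E3) (1 / 2), f i y‖ₑ ^ 2) ^ 2 ≤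
      c * (∫⁻ x in Metric.ball (0 : E3) (3 / 4), ∑ i, ∑ j, ‖g i j x‖ₑ ^ 2) ^ 2) ∧
    (∫⁻ x in Metric.ball (0 : E3) (1 / 2),
        ∑ i, ‖f i x - ⨍ y in Metric.ball (0 : E3) (1 / 2), f i y‖ₑ ^ 2 ≤
      4 * ∫⁻ x in Metric.ball (0 : E3) (1 / 2), ∑ i, ‖f i x‖ₑ ^ 2) := by
  obtain ⟨c, hc⟩ := SliceApprox.poincare_sobolev
  set n : ℝ≥0 := (Fintype.card ι : ℝ≥0) with hn
  refine ⟨c + n * (n * c), fun f g hf hg hf2 h => ?_⟩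
  set S := Metric.ball (0 : E3) (1 / 2)
  set B := Metric.ball (0 : E3) (3 / 4)
  have h0 : volume S ≠ 0 := (Metric.measure_ball_pos _ _ (by norm_num)).ne'
  have hT : volume S ≠ ⊤ := measure_ball_lt_top.ne
  have mv : ∀ i, Measurable fun x => ‖f i x - ⨍ y in S, f i y‖ₑ ^ 2 := fun i =>
    ((hf i).sub measurable_const).enorm.pow_const 2
  have mv4 : ∀ i, Measurable fun x => ‖f i x - ⨍ y in S, f i y‖ₑ ^ 4 := fun i =>
    ((hf i).sub measurable_const).enorm.pow_const 4
  have mg : ∀ i, Measurable fun x => ∑ j, ‖g i j x‖ₑ ^ 2 := fun i =>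
    Finset.measurable_fun_sum _ fun j _ => (hg i j).enorm.pow_const 2
  set β := ∫⁻ x in B, ∑ i, ∑ j, ‖g i j x‖ₑ ^ 2 with hβ
  have hβs : β = ∑ i, ∫⁻ x in B, ∑ j, ‖g i j x‖ₑ ^ 2 :=
    lintegral_finsetSum _ fun i _ => mg i
  have hβi : ∀ i, ∫⁻ x in B, ∑ j, ‖g i j x‖ₑ ^ 2 ≤ β := fun i => by
    rw [hβs]
    exact Finset.single_le_sum (f := fun i => ∫⁻ x in B, ∑ j, ‖g i j x‖ₑ ^ 2)
      (fun _ _ => zero_le) (Finset.mem_univ i)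
  refine ⟨?_, ?_, ?_⟩
  · rw [lintegral_finsetSum _ fun i _ => mv i]
    calc _ ≤ ∑ i, c * ∫⁻ x in B, ∑ j, ‖g i j x‖ₑ ^ 2 :=
          Finset.sum_le_sum fun i _ => (hc _ _ (hf i) (hg i) (hf2 i) (h i)).1
      _ = c * β := by rw [← Finset.mul_sum, hβs]
      _ ≤ _ := by gcongr; exact_mod_cast le_self_add
  · calc _ ≤ ∫⁻ x in Metric.ball (0 : E3) (5 / 8),
            n * ∑ i, ‖f i x - ⨍ y in S, f i y‖ₑ ^ 4 := by
          refine lintegral_mono fun x => ?_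
          have := sq_sum_le_card_mul_sum_sq (s := Finset.univ)
            (f := fun i => ‖f i x - ⨍ y in S, f i y‖₊ ^ 2)
          simp only [← pow_mul, enorm_eq_nnnorm] at this ⊢
          exact_mod_cast this
      _ = n * ∑ i, ∫⁻ x in Metric.ball (0 : E3) (5 / 8), ‖f i x - ⨍ y in S, f i y‖ₑ ^ 4 := by
          rw [lintegral_const_mul' _ _ (by simp), lintegral_finsetSum _ fun i _ => mv4 i]
      _ ≤ n * ∑ i : ι, c * β ^ 2 := by
          gcongr with i
          refine (hc _ _ (hf i) (hg i) (hf2 i) (h i)).2.trans ?_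
          gcongr
          exact hβi i
      _ = (n * (n * c) : ℝ≥0) * β ^ 2 := by
          simp only [Finset.sum_const, nsmul_eq_mul, Finset.card_univ]
          push_cast
          rw [hn]
          push_cast
          ring
      _ ≤ _ := by gcongr; exact_mod_cast le_add_self
  · rw [lintegral_finsetSum _ fun i _ => mv i,
      lintegral_finsetSum _ fun i _ => (hf i).enorm.pow_const 2, Finset.mul_sum]
    exact Finset.sum_le_sum fun i _ => lintegral_enorm_sub_average_sq_le h0 hT (hf i)

theorem volume_ball_E3 (r : ℝ) : volume (Metric.ball (0 : E3) r) =
    ENNReal.ofReal (r ^ 3) * volume (Metric.ball (0 : E3) 1) := by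
  rcases le_or_gt r 0 with h | h
  · rw [Metric.ball_eq_empty.2 h, ENNReal.ofReal_of_nonpos]
    · simp
    · exact Odd.pow_nonpos (by decide) h
  · rw [Measure.addHaar_ball_of_pos _ _ h, finrank_euclideanSpace_fin]

theorem lintegral_rpow_three_halves_le {α : Type*} [MeasurableSpace α] {μ : Measure α}
    {V : α → ℝ≥0∞} (hV : Measurable V) :
    ∫⁻ x, V x ^ (3 / 2 : ℝ) ∂μ ≤ (∫⁻ x, V x ∂μ) ^ (1 / 2 : ℝ) * (∫⁻ x, V x ^ 2 ∂μ) ^ (1 / 2 : ℝ) := by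
  have h := lintegral_mul_sq_le (μ := μ) (k := fun x => V x ^ (1 / 2 : ℝ)) (h := V)
    (hV.pow_const _).aemeasurable hV.aemeasurable
  have h1 : ∀ y : ℝ≥0∞, (y ^ (1 / 2 : ℝ)) ^ 2 = y := fun y => by
    rw [← ENNReal.rpow_natCast, ← ENNReal.rpow_mul]; norm_num
  have h2 : ∀ y : ℝ≥0∞, y ^ (1 / 2 : ℝ) * y = y ^ (3 / 2 : ℝ) := fun y => by
    nth_rw 2 [← ENNReal.rpow_one y]
    rw [← ENNReal.rpow_add_of_nonneg _ _ (by norm_num) (by norm_num)]; norm_num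
  have h3 : ∀ y : ℝ≥0∞, (y ^ 2) ^ (1 / 2 : ℝ) = y := fun y => by
    rw [← ENNReal.rpow_natCast, ← ENNReal.rpow_mul]; norm_num
  simp only [h1, h2] at h
  rw [← ENNReal.mul_rpow_of_nonneg _ _ (by norm_num), ← h3 (∫⁻ x, V x ^ (3 / 2 : ℝ) ∂μ)]
  exact ENNReal.rpow_le_rpow h (by norm_num)

/-- Consequences, on a single slice, of the Poincaré and Sobolev bounds for the density `V` of the
oscillation around the mean, whose density is `μ`; here `N` is the density of the field itself. -/
theorem slice_estimates (c₀ : ℝ≥0) : ∃ c : ℝ≥0, ∀ (N V : E3 → ℝ≥0∞) (μ β : ℝ≥0∞), Measurable N →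
    Measurable V → (∀ x, N x ≤ 2 * (V x + μ)) → (∀ x, μ ≤ 2 * (V x + N x)) →
    ∫⁻ x in Metric.ball (0 : E3) (1 / 2), V x ≤ c₀ * β →
    ∫⁻ x in Metric.ball (0 : E3) (1 / 2), V x ^ 2 ≤ c₀ * β ^ 2 →
    ∫⁻ x in Metric.ball (0 : E3) (1 / 2), V x ≤ 4 * ∫⁻ x in Metric.ball (0 : E3) (1 / 2), N x →
    (∀ r ≤ (1 / 2 : ℝ), ∫⁻ x in Metric.ball (0 : E3) r, N x ^ (3 / 2 : ℝ) ≤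
      c * ((∫⁻ x in Metric.ball (0 : E3) (1 / 2), N x) ^ (1 / 2 : ℝ) * β + ENNReal.ofReal (r ^ 3) *
        ∫⁻ x in Metric.ball (0 : E3) (1 / 2), N x ^ (3 / 2 : ℝ))) ∧
    (∫⁻ x in Metric.ball (0 : E3) (1 / 2), N x ^ 2 ≤
      c * (β + ∫⁻ x in Metric.ball (0 : E3) (1 / 2), N x) ^ 2) ∧
    (∫⁻ x in Metric.ball (0 : E3) (1 / 2), (V x ^ 2 + V x * μ) ≤
      c * (β ^ 2 + β * ∫⁻ x in Metric.ball (0 : E3) (1 / 2), N x)) := by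
  set S := Metric.ball (0 : E3) (1 / 2) with hS
  set S₁ := Metric.ball (0 : E3) 1
  have h0 : volume S ≠ 0 := (Metric.measure_ball_pos _ _ (by norm_num)).ne'
  have hT : volume S ≠ ⊤ := measure_ball_lt_top.ne
  have hT1 : volume S₁ ≠ ⊤ := measure_ball_lt_top.ne
  set k : ℝ≥0∞ := 10 * (volume S)⁻¹ with hk
  set w : ℝ≥0∞ := volume S₁
  set s := volume S with hs
  have hkT : k ≠ ⊤ := by finiteness
  -- the constants of the three estimates
  set C₁ : ℝ≥0∞ := 4 * (4 * (c₀ : ℝ≥0∞) ^ (1 / 2 : ℝ)) with hC₁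
  set c₁ : ℝ≥0∞ := (1 + w * s⁻¹ * 4) * C₁ + w * s⁻¹ * 16 with hc₁
  set c₂ : ℝ≥0∞ := 8 * (c₀ + k ^ 2 * s) with hc₂
  set c₃ : ℝ≥0∞ := c₀ + c₀ * k with hc₃
  refine ⟨(c₁ + c₂ + c₃).toNNReal, fun N V μ β hN hV hNV hμ h1 h2 h3 => ?_⟩
  rw [ENNReal.coe_toNNReal (by finiteness)]
  set X := ∫⁻ x in S, N x
  have hμX : μ ≤ k * X := by
    have : μ * s ≤ 10 * X := by
      calc μ * s = ∫⁻ x in S, μ := by rw [setLIntegral_const]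
        _ ≤ ∫⁻ x in S, 2 * (V x + N x) := lintegral_mono fun x => hμ x
        _ = 2 * ((∫⁻ x in S, V x) + X) := by
            rw [lintegral_const_mul' _ _ (by simp), lintegral_add_left hV]
        _ ≤ 2 * (4 * X + X) := by gcongr
        _ = 10 * X := by ring
    rw [hk, mul_right_comm, ← div_eq_mul_inv, ENNReal.le_div_iff_mul_le (Or.inl h0) (Or.inl hT)]
    exact this
  refine ⟨fun r hr => ?_, ?_, ?_⟩
  · have hrS : Metric.ball (0 : E3) r ⊆ S := Metric.ball_subset_ball hr
    set Y := ∫⁻ x in S, N x ^ (3 / 2 : ℝ)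
    have hpt : ∀ a b : ℝ≥0∞, (2 * (a + b)) ^ (3 / 2 : ℝ) ≤
        4 * (a ^ (3 / 2 : ℝ) + b ^ (3 / 2 : ℝ)) := fun a b => by
      rw [ENNReal.mul_rpow_of_nonneg _ _ (by norm_num)]
      calc (2 : ℝ≥0∞) ^ (3 / 2 : ℝ) * (a + b) ^ (3 / 2 : ℝ)
          ≤ 2 ^ (3 / 2 : ℝ) * (2 ^ (3 / 2 - 1 : ℝ) * (a ^ (3 / 2 : ℝ) + b ^ (3 / 2 : ℝ))) := by
            gcongr
            exact ENNReal.rpow_add_le_mul_rpow_add_rpow _ _ (by norm_num)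
        _ = _ := by
            rw [← mul_assoc, ← ENNReal.rpow_add _ _ (by norm_num) (by norm_num)]; norm_num
    have hVi : ∫⁻ x in S, V x ^ (3 / 2 : ℝ) ≤ 4 * (c₀ : ℝ≥0∞) ^ (1 / 2 : ℝ) * (X ^ (1 / 2 : ℝ) * β) := by
      calc _ ≤ (4 * X) ^ (1 / 2 : ℝ) * (c₀ * β ^ 2) ^ (1 / 2 : ℝ) :=
            (lintegral_rpow_three_halves_le hV).trans (by gcongr)
        _ = (4 : ℝ≥0∞) ^ (1 / 2 : ℝ) * (c₀ : ℝ≥0∞) ^ (1 / 2 : ℝ) * (X ^ (1 / 2 : ℝ) * β) := by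
            rw [ENNReal.mul_rpow_of_nonneg _ _ (by norm_num),
              ENNReal.mul_rpow_of_nonneg _ _ (by norm_num), ← ENNReal.rpow_natCast β,
              ← ENNReal.rpow_mul β]
            norm_num
            ring
        _ ≤ _ := by
            gcongr
            calc (4 : ℝ≥0∞) ^ (1 / 2 : ℝ) ≤ 4 ^ (1 : ℝ) :=
                  ENNReal.rpow_le_rpow_of_exponent_le (by norm_num) (by norm_num)
              _ = 4 := by simp
    have hμ3 : μ ^ (3 / 2 : ℝ) ≤ s⁻¹ * (4 * ((∫⁻ x in S, V x ^ (3 / 2 : ℝ)) + Y)) := by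
      rw [mul_comm, ← div_eq_mul_inv, ENNReal.le_div_iff_mul_le (Or.inl h0) (Or.inl hT)]
      calc μ ^ (3 / 2 : ℝ) * s = ∫⁻ x in S, μ ^ (3 / 2 : ℝ) := by rw [setLIntegral_const]
        _ ≤ ∫⁻ x in S, 4 * (V x ^ (3 / 2 : ℝ) + N x ^ (3 / 2 : ℝ)) :=
            lintegral_mono fun x => (ENNReal.rpow_le_rpow (hμ x) (by norm_num)).trans (hpt _ _)
        _ = _ := by
            rw [lintegral_const_mul' _ _ (by simp),
              lintegral_add_left (hV.pow_const _)]
    have hr3 : ENNReal.ofReal (r ^ 3) ≤ 1 := by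
      rw [ENNReal.ofReal_le_one]
      rcases le_or_gt r 0 with h | h
      · exact (Odd.pow_nonpos (by decide) h).trans zero_le_one
      · exact pow_le_one₀ h.le (by linarith)
    set W := ∫⁻ x in S, V x ^ (3 / 2 : ℝ)
    set R := ENNReal.ofReal (r ^ 3)
    calc ∫⁻ x in Metric.ball (0 : E3) r, N x ^ (3 / 2 : ℝ)
        ≤ ∫⁻ x in Metric.ball (0 : E3) r, 4 * (V x ^ (3 / 2 : ℝ) + μ ^ (3 / 2 : ℝ)) :=
          lintegral_mono fun x => (ENNReal.rpow_le_rpow (hNV x) (by norm_num)).trans (hpt _ _)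
      _ = 4 * ((∫⁻ x in Metric.ball (0 : E3) r, V x ^ (3 / 2 : ℝ)) + μ ^ (3 / 2 : ℝ) * (R * w)) := by
          rw [lintegral_const_mul' _ _ (by simp), lintegral_add_right _ measurable_const,
            setLIntegral_const, volume_ball_E3]
      _ ≤ 4 * (W + s⁻¹ * (4 * (W + Y)) * (R * w)) := by
          gcongr
          exact lintegral_mono_set hrS
      _ = 4 * (W + w * s⁻¹ * 4 * (R * W)) + w * s⁻¹ * 16 * (R * Y) := by ring
      _ ≤ 4 * (W + w * s⁻¹ * 4 * (1 * W)) + w * s⁻¹ * 16 * (R * Y) := by gcongr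
      _ = (1 + w * s⁻¹ * 4) * (4 * W) + w * s⁻¹ * 16 * (R * Y) := by ring
      _ ≤ (1 + w * s⁻¹ * 4) * (C₁ * (X ^ (1 / 2 : ℝ) * β)) + w * s⁻¹ * 16 * (R * Y) := by
          rw [hC₁, mul_assoc 4]
          exact add_le_add (mul_le_mul' le_rfl (mul_le_mul' le_rfl hVi)) le_rfl
      _ ≤ (1 + w * s⁻¹ * 4) * (C₁ * (X ^ (1 / 2 : ℝ) * β)) + w * s⁻¹ * 16 * (R * Y) +
          (w * s⁻¹ * 16 * (X ^ (1 / 2 : ℝ) * β) + (1 + w * s⁻¹ * 4) * C₁ * (R * Y)) := le_self_add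
      _ = c₁ * (X ^ (1 / 2 : ℝ) * β + R * Y) := by rw [hc₁]; ring
      _ ≤ _ := by
          gcongr
          rw [add_assoc]; exact le_self_add
  · calc ∫⁻ x in S, N x ^ 2 ≤ ∫⁻ x in S, 8 * (V x ^ 2 + μ ^ 2) := by
          refine lintegral_mono fun x => (pow_le_pow_left' (hNV x) 2).trans ?_
          rw [mul_pow]
          calc (2 : ℝ≥0∞) ^ 2 * (V x + μ) ^ 2 ≤ 2 ^ 2 * (2 * (V x ^ 2 + μ ^ 2)) := by
                gcongr; exact ennreal_add_sq_le _ _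
            _ = _ := by ring
      _ = 8 * ((∫⁻ x in S, V x ^ 2) + μ ^ 2 * s) := by
          rw [lintegral_const_mul' _ _ (by simp), lintegral_add_right _ measurable_const,
            setLIntegral_const]
      _ ≤ 8 * (c₀ * β ^ 2 + (k * X) ^ 2 * s) := by gcongr
      _ ≤ 8 * (c₀ * β ^ 2 + (k * X) ^ 2 * s) +
          8 * (c₀ * (X ^ 2 + 2 * β * X) + k ^ 2 * s * (β ^ 2 + 2 * β * X)) := le_self_add
      _ = c₂ * (β + X) ^ 2 := by rw [hc₂]; ring
      _ ≤ _ := by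
          gcongr
          rw [add_right_comm]; exact le_add_self
  · calc ∫⁻ x in S, (V x ^ 2 + V x * μ) = (∫⁻ x in S, V x ^ 2) + (∫⁻ x in S, V x) * μ := by
          rw [lintegral_add_left (hV.pow_const 2), lintegral_mul_const _ hV]
      _ ≤ c₀ * β ^ 2 + c₀ * β * (k * X) := by gcongr
      _ ≤ c₀ * β ^ 2 + c₀ * β * (k * X) + (c₀ * k * β ^ 2 + c₀ * (β * X)) := le_self_add
      _ = c₃ * (β ^ 2 + β * X) := by rw [hc₃]; ring
      _ ≤ _ := by
          gcongr
          exact le_add_self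

/-- Squared Euclidean length of a finite family of functions. -/
def famSq {ι : Type*} [Fintype ι] (f : ι → E3 → ℝ) (x : E3) : ℝ≥0∞ := ∑ i, ‖f i x‖ₑ ^ 2

/-- Mean value over the ball of radius `1/2`. -/
def halfMean (f : E3 → ℝ) : ℝ := ⨍ y in Metric.ball (0 : E3) (1 / 2), f y

/-- The family minus its means over the ball of radius `1/2`. -/
def famOsc {ι : Type*} (f : ι → E3 → ℝ) (i : ι) (x : E3) : ℝ := f i x - halfMean (f i)

/-- Squared length of the vector of means over the ball of radius `1/2`. -/
def meanSq {ι : Type*} [Fintype ι] (f : ι → E3 → ℝ) : ℝ≥0∞ := ∑ i, ‖halfMean (f i)‖ₑ ^ 2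

theorem measurable_famSq {ι : Type*} [Fintype ι] {f : ι → E3 → ℝ} (hf : ∀ i, Measurable (f i)) :
    Measurable (famSq f) :=
  Finset.measurable_fun_sum _ fun i _ => (hf i).enorm.pow_const 2

theorem measurable_famOsc {ι : Type*} {f : ι → E3 → ℝ} (hf : ∀ i, Measurable (f i)) (i : ι) :
    Measurable (famOsc f i) :=
  (hf i).sub measurable_const

theorem famSq_le_osc {ι : Type*} [Fintype ι] (f : ι → E3 → ℝ) (x : E3) :
    famSq f x ≤ 2 * (famSq (famOsc f) x + meanSq f) := by
  unfold famSq meanSq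
  rw [← Finset.sum_add_distrib, Finset.mul_sum]
  refine Finset.sum_le_sum fun i _ => ?_
  refine le_trans (le_of_eq ?_) (enorm_add_sq_le _ _)
  simp [famOsc]

theorem meanSq_le_osc {ι : Type*} [Fintype ι] (f : ι → E3 → ℝ) (x : E3) :
    meanSq f ≤ 2 * (famSq (famOsc f) x + famSq f x) := by
  unfold famSq meanSq
  rw [← Finset.sum_add_distrib, Finset.mul_sum]
  refine Finset.sum_le_sum fun i _ => ?_
  rw [← enorm_neg (famOsc f i x)]
  refine le_trans (le_of_eq ?_) (enorm_add_sq_le _ _)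
  simp [famOsc]

/-- Poincaré and Sobolev type bounds for a family of functions on a time slice, in terms of the
Dirichlet energy `β`. -/
structure SliceBounds {ι : Type*} [Fintype ι] (c : ℝ≥0) (f : ι → E3 → ℝ) (β : ℝ≥0∞) : Prop where
  meas : ∀ i, Measurable (f i)
  finite : ∫⁻ x in Metric.ball (0 : E3) (3 / 4), famSq f x ≠ ⊤
  poincare : ∫⁻ x in Metric.ball (0 : E3) (3 / 4), famSq (famOsc f) x ≤ c * β
  sobolev : ∫⁻ x in Metric.ball (0 : E3) (5 / 8), famSq (famOsc f) x ^ 2 ≤ c * β ^ 2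
  cubic : ∀ r ≤ (1 / 2 : ℝ), ∫⁻ x in Metric.ball (0 : E3) r, famSq f x ^ (3 / 2 : ℝ) ≤
      c * ((∫⁻ x in Metric.ball (0 : E3) (1 / 2), famSq f x) ^ (1 / 2 : ℝ) * β +
        ENNReal.ofReal (r ^ 3) * ∫⁻ x in Metric.ball (0 : E3) (1 / 2), famSq f x ^ (3 / 2 : ℝ))
  quartic : ∫⁻ x in Metric.ball (0 : E3) (1 / 2), famSq f x ^ 2 ≤
      c * (β + ∫⁻ x in Metric.ball (0 : E3) (1 / 2), famSq f x) ^ 2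
  oscillation : ∫⁻ x in Metric.ball (0 : E3) (1 / 2),
      (famSq (famOsc f) x ^ 2 + famSq (famOsc f) x * meanSq f) ≤
      c * (β ^ 2 + β * ∫⁻ x in Metric.ball (0 : E3) (1 / 2), famSq f x)

theorem SliceBounds.exists_const (ι : Type*) [Fintype ι] : ∃ c : ℝ≥0, ∀ (f : ι → E3 → ℝ)
    (g : ι → Fin 3 → E3 → ℝ), (∀ i, Measurable (f i)) → (∀ i j, Measurable (g i j)) →
    ∫⁻ x in Metric.ball (0 : E3) (3 / 4), famSq f x ≠ ⊤ →
    (∀ i, SliceApprox (3 / 4) (f i) (g i)) →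
    SliceBounds c f (∫⁻ x in Metric.ball (0 : E3) (3 / 4), ∑ i, ∑ j, ‖g i j x‖ₑ ^ 2) := by
  obtain ⟨c₀, hc₀⟩ := SliceApprox.vector ι
  obtain ⟨c₁, hc₁⟩ := slice_estimates c₀
  refine ⟨c₀ + c₁, fun f g hf hg hfin h => ?_⟩
  have hle : ∀ i x, ‖f i x‖ₑ ^ 2 ≤ famSq f x := fun i x =>
    Finset.single_le_sum (f := fun i => ‖f i x‖ₑ ^ 2) (fun _ _ => zero_le) (Finset.mem_univ i)
  obtain ⟨h1, h2, h3⟩ := hc₀ f g hf hg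
    (fun i => ne_top_of_le_ne_top hfin (lintegral_mono fun x => hle i x)) h
  set β := ∫⁻ x in Metric.ball (0 : E3) (3 / 4), ∑ i, ∑ j, ‖g i j x‖ₑ ^ 2
  obtain ⟨k1, k2, k3⟩ := hc₁ (famSq f) (famSq (famOsc f)) (meanSq f) β (measurable_famSq hf)
    (measurable_famSq (measurable_famOsc hf)) (famSq_le_osc f) (meanSq_le_osc f)
    ((lintegral_mono_set (Metric.ball_subset_ball (by norm_num))).trans h1)
    ((lintegral_mono_set (Metric.ball_subset_ball (by norm_num))).trans h2) h3
  have l0 : (c₀ : ℝ≥0∞) ≤ (c₀ + c₁ : ℝ≥0) := by exact_mod_cast le_self_add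
  have l1 : (c₁ : ℝ≥0∞) ≤ (c₀ + c₁ : ℝ≥0) := by exact_mod_cast le_add_self
  exact ⟨hf, hfin, h1.trans (mul_le_mul' l0 le_rfl), h2.trans (mul_le_mul' l0 le_rfl),
    fun r hr => (k1 r hr).trans (mul_le_mul' l1 le_rfl), k2.trans (mul_le_mul' l1 le_rfl),
    k3.trans (mul_le_mul' l1 le_rfl)⟩

/-- The components of the pair `(u, a)`. -/
def fieldComp (u : SpT → E3) (a : SpT → Fin 3 → Fin 3 → ℝ) : Fin 3 ⊕ Fin 3 × Fin 3 → SpT → ℝ :=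
  Sum.elim (fun i z => u z i) (fun ik z => a z ik.1 ik.2)

/-- The spatial derivatives of the components of the pair `(u, a)`. -/
def gradComp (Du : SpT → Fin 3 → Fin 3 → ℝ) (Da : SpT → Fin 3 → Fin 3 → Fin 3 → ℝ) :
    Fin 3 ⊕ Fin 3 × Fin 3 → Fin 3 → SpT → ℝ :=
  Sum.elim (fun i j z => Du z i j) (fun ik j z => Da z ik.1 j ik.2)

/-- The field `(u, a)` on the time slice `t`. -/
def sliceField (u : SpT → E3) (a : SpT → Fin 3 → Fin 3 → ℝ) (t : ℝ) :
    Fin 3 ⊕ Fin 3 × Fin 3 → E3 → ℝ := fun i x => fieldComp u a i (x, t)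

theorem famSq_sliceField (u : SpT → E3) (a : SpT → Fin 3 → Fin 3 → ℝ) (t : ℝ) (x : E3) :
    famSq (sliceField u a t) x = ENNReal.ofReal (‖u (x, t)‖ ^ 2 + nsq2 (a (x, t))) := by
  simp only [famSq, sliceField, enorm_sq_eq_ofReal]
  rw [← ENNReal.ofReal_sum_of_nonneg (fun i _ => sq_nonneg _), Fintype.sum_sum_type,
    Fintype.sum_prod_type, EuclideanSpace.real_norm_sq_eq]
  rfl

theorem sum_gradComp_sq (Du : SpT → Fin 3 → Fin 3 → ℝ) (Da : SpT → Fin 3 → Fin 3 → Fin 3 → ℝ)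
    (z : SpT) : ∑ i, ∑ j, ‖gradComp Du Da i j z‖ₑ ^ 2 =
      ENNReal.ofReal (nsq2 (Du z) + nsq3 (Da z)) := by
  simp only [enorm_sq_eq_ofReal]
  simp_rw [← ENNReal.ofReal_sum_of_nonneg (fun i _ => sq_nonneg _)]
  rw [← ENNReal.ofReal_sum_of_nonneg (fun i _ => Finset.sum_nonneg fun i _ => sq_nonneg _),
    Fintype.sum_sum_type, Fintype.sum_prod_type]
  congr 2
  unfold nsq3
  refine Finset.sum_congr rfl fun i _ => ?_
  rw [Finset.sum_comm]
  rfl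

theorem lintegral_prod_SpT {f : SpT → ℝ≥0∞} (hf : Measurable f) (S : Set E3) (I : Set ℝ) :
    ∫⁻ z in S ×ˢ I, f z = ∫⁻ t in I, ∫⁻ x in S, f (x, t) := by
  rw [volume_restrict_prod_SpT, lintegral_prod_symm _ hf.aemeasurable]

/-- The data of the decay estimate rescaled to the unit cylinder; `a` plays the role of the
gradient of `d`. -/
structure UnitTriple (K : ℝ) (u d : SpT → E3) (p : SpT → ℝ) (Du a : SpT → Fin 3 → Fin 3 → ℝ)
    (Da : SpT → Fin 3 → Fin 3 → Fin 3 → ℝ) : Prop where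
  meas_u : Measurable u
  meas_d : Measurable d
  meas_p : Measurable p
  meas_Du : Measurable Du
  meas_a : Measurable a
  meas_Da : Measurable Da
  grad_u : ∀ i : Fin 3, WeakSGrad (Metric.ball 0 1 ×ˢ Ioo (-7 / 8) (1 / 8)) (fun z => u z i)
    (fun j z => Du z i j)
  grad_a : ∀ i k : Fin 3, WeakSGrad (Metric.ball 0 1 ×ˢ Ioo (-7 / 8) (1 / 8)) (fun z => a z i k)
    (fun j z => Da z i j k)
  divFree : DivFreeOn (Metric.ball 0 1 ×ˢ Ioo (-7 / 8) (1 / 8)) u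
  pres : PressureEqOn (Metric.ball 0 1 ×ˢ Ioo (-7 / 8) (1 / 8)) u p a
  energy : ∀ φ, IsTestOn (Metric.ball 0 1 ×ˢ Ioo (-7 / 8) (1 / 8)) φ → (∀ z, 0 ≤ φ z) →
    ∀ᵐ t ∂(volume.restrict (Ioo (-7 / 8 : ℝ) (1 / 8))),
    ENNReal.ofReal (∫ x in Metric.ball (0 : E3) 1, (‖u (x, t)‖ ^ 2 + nsq2 (a (x, t))) * φ (x, t)) ≤
    ENNReal.ofReal K * ∫⁻ τ in Ioo (-7 / 8 : ℝ) (1 / 8), ((∫⁻ x in Metric.ball (0 : E3) 1,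
      ENNReal.ofReal ((‖u (x, τ)‖ ^ 2 + nsq2 (a (x, τ))) * |tderiv φ (x, τ) + sLap φ (x, τ)| +
          ‖d (x, τ)‖ ^ 2 * nsq2 (a (x, τ)) * φ (x, τ))) +
      ‖∫ x in Metric.ball (0 : E3) 1, ((‖u (x, τ)‖ ^ 2 / 2 + nsq2 (a (x, τ)) / 2 + p (x, τ)) *
            (∑ j, u (x, τ) j * sderiv j φ (x, τ)) +
          ∑ i, ∑ j, u (x, τ) i * sderiv j φ (x, τ) * (∑ k, a (x, τ) k i * a (x, τ) k j))‖ₑ)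

section
variable {K : ℝ} {u d : SpT → E3} {p : SpT → ℝ} {Du a : SpT → Fin 3 → Fin 3 → ℝ}
  {Da : SpT → Fin 3 → Fin 3 → Fin 3 → ℝ}

theorem UnitTriple.measurable_fieldComp (h : UnitTriple K u d p Du a Da) (i) :
    Measurable (fieldComp u a i) := by
  have := h.meas_u
  have := h.meas_a
  rcases i with i | ⟨i, k⟩ <;> simp only [fieldComp, Sum.elim_inl, Sum.elim_inr] <;> fun_prop

theorem UnitTriple.measurable_gradComp (h : UnitTriple K u d p Du a Da) (i j) :
    Measurable (gradComp Du Da i j) := by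
  have := h.meas_Du
  have := h.meas_Da
  rcases i with i | ⟨i, k⟩ <;> simp only [gradComp, Sum.elim_inl, Sum.elim_inr] <;> fun_prop

theorem UnitTriple.weakSGrad (h : UnitTriple K u d p Du a Da) (i) :
    WeakSGrad (Metric.ball 0 1 ×ˢ Ioo (-7 / 8) (1 / 8)) (fieldComp u a i) (gradComp Du Da i) := by
  rcases i with i | ⟨i, k⟩
  · exact h.grad_u i
  · exact h.grad_a i k

/-- Square of the length of the pair `(u, a)`. -/
def fdens (u : SpT → E3) (a : SpT → Fin 3 → Fin 3 → ℝ) (z : SpT) : ℝ≥0∞ :=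
  ENNReal.ofReal (‖u z‖ ^ 2 + nsq2 (a z))

/-- Square of the length of the spatial gradient of `(u, a)`. -/
def gdens (Du : SpT → Fin 3 → Fin 3 → ℝ) (Da : SpT → Fin 3 → Fin 3 → Fin 3 → ℝ) (z : SpT) :
    ℝ≥0∞ := ENNReal.ofReal (nsq2 (Du z) + nsq3 (Da z))

theorem fdens_eq_sum (z : SpT) : fdens u a z = ∑ i, ‖fieldComp u a i z‖ₑ ^ 2 :=
  (famSq_sliceField u a z.2 z.1).symm

theorem UnitTriple.measurable_fdens (h : UnitTriple K u d p Du a Da) : Measurable (fdens u a) := by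
  have := h.meas_u
  have := h.meas_a
  unfold fdens nsq2
  fun_prop

theorem UnitTriple.measurable_gdens (h : UnitTriple K u d p Du a Da) :
    Measurable (gdens Du Da) := by
  have := h.meas_Du
  have := h.meas_Da
  unfold gdens nsq2 nsq3
  fun_prop

theorem UnitTriple.sliceBounds : ∃ c : ℝ≥0, ∀ {K : ℝ} {u d : SpT → E3} {p : SpT → ℝ}
    {Du a : SpT → Fin 3 → Fin 3 → ℝ} {Da : SpT → Fin 3 → Fin 3 → Fin 3 → ℝ},
    UnitTriple K u d p Du a Da →
    ∫⁻ z in Metric.ball 0 1 ×ˢ Ioo (-7 / 8) (1 / 8), fdens u a z ≠ ⊤ →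
    ∫⁻ z in Metric.ball 0 1 ×ˢ Ioo (-7 / 8) (1 / 8), gdens Du Da z ≠ ⊤ →
    ∀ᵐ t ∂(volume.restrict (Ioo (-63 / 128 : ℝ) (9 / 128))), SliceBounds c (sliceField u a t)
      (∫⁻ x in Metric.ball (0 : E3) (3 / 4), gdens Du Da (x, t)) := by
  obtain ⟨c, hc⟩ := SliceBounds.exists_const (Fin 3 ⊕ Fin 3 × Fin 3)
  refine ⟨c, fun {K u d p Du a Da} h hf hg => ?_⟩
  set Q : Set SpT := Metric.ball 0 1 ×ˢ Ioo (-7 / 8) (1 / 8) with hQ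
  have hf2 : ∀ i, ∫⁻ z in Q, ‖fieldComp u a i z‖ₑ ^ 2 ≠ ⊤ := fun i =>
    ne_top_of_le_ne_top hf (lintegral_mono fun z => by
      rw [fdens_eq_sum]
      exact Finset.single_le_sum (f := fun i => ‖fieldComp u a i z‖ₑ ^ 2) (fun _ _ => zero_le)
        (Finset.mem_univ i))
  have hg2 : ∀ i j, ∫⁻ z in Q, ‖gradComp Du Da i j z‖ₑ ^ 2 ≠ ⊤ := fun i j =>
    ne_top_of_le_ne_top hg (lintegral_mono fun z => by
      rw [gdens, ← sum_gradComp_sq]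
      refine le_trans ?_ (Finset.single_le_sum
        (f := fun i => ∑ j, ‖gradComp Du Da i j z‖ₑ ^ 2) (fun _ _ => zero_le)
        (Finset.mem_univ i))
      exact Finset.single_le_sum (f := fun j => ‖gradComp Du Da i j z‖ₑ ^ 2) (fun _ _ => zero_le)
        (Finset.mem_univ j))
  have hs : ∀ i, ∀ᵐ t ∂(volume.restrict (Ioo (-63 / 128 : ℝ) (9 / 128))),
      SliceApprox (3 / 4) (fun x => fieldComp u a i (x, t))
        (fun j x => gradComp Du Da i j (x, t)) := fun i =>
    (h.weakSGrad i).ae_sliceApprox (by norm_num) (by norm_num) (by norm_num)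
      (h.measurable_fieldComp i) (h.measurable_gradComp i) (hf2 i) (hg2 i)
  have hfin : ∀ᵐ t ∂(volume.restrict (Ioo (-63 / 128 : ℝ) (9 / 128))),
      ∫⁻ x in Metric.ball (0 : E3) (3 / 4), famSq (sliceField u a t) x ≠ ⊤ := by
    have h1 : ∫⁻ t in Ioo (-7 / 8 : ℝ) (1 / 8), ∫⁻ x in Metric.ball (0 : E3) 1, fdens u a (x, t)
        ≠ ⊤ := by
      rwa [hQ, lintegral_prod_SpT h.measurable_fdens] at hf
    have h2 := ae_lt_top' (h.measurable_fdens.lintegral_prod_left'.aemeasurable) h1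
    have hI : Ioo (-63 / 128 : ℝ) (9 / 128) ⊆ Ioo (-7 / 8) (1 / 8) :=
      Ioo_subset_Ioo (by norm_num) (by norm_num)
    filter_upwards [ae_restrict_of_ae_restrict_of_subset hI h2] with t ht
    simp only [famSq_sliceField]
    exact ne_top_of_le_ne_top ht.ne (lintegral_mono_set (Metric.ball_subset_ball (by norm_num)))
  filter_upwards [ae_all_iff.2 hs, hfin] with t ht htf
  have := hc (sliceField u a t) (fun i j x => gradComp Du Da i j (x, t))
    (fun i => (h.measurable_fieldComp i).comp measurable_prodMk_right)
    (fun i j => (h.measurable_gradComp i j).comp measurable_prodMk_right) htf ht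
  simp only [sum_gradComp_sq] at this
  exact this
end

section
variable {K : ℝ} {u d : SpT → E3} {p : SpT → ℝ} {Du a : SpT → Fin 3 → Fin 3 → ℝ}
  {Da : SpT → Fin 3 → Fin 3 → Fin 3 → ℝ}

theorem enorm_fieldComp_le (i) (z : SpT) :
    ‖fieldComp u a i z‖ₑ ≤ fdens u a z ^ (1 / 2 : ℝ) := by
  have h : ‖fieldComp u a i z‖ₑ ^ 2 ≤ fdens u a z := by
    rw [fdens_eq_sum]
    exact Finset.single_le_sum (f := fun i => ‖fieldComp u a i z‖ₑ ^ 2) (fun _ _ => zero_le)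
      (Finset.mem_univ i)
  calc ‖fieldComp u a i z‖ₑ = (‖fieldComp u a i z‖ₑ ^ 2) ^ (1 / 2 : ℝ) := by
        rw [← ENNReal.rpow_natCast, ← ENNReal.rpow_mul]; norm_num
    _ ≤ _ := ENNReal.rpow_le_rpow h (by norm_num)

theorem enorm_gradComp_le (i j) (z : SpT) :
    ‖gradComp Du Da i j z‖ₑ ≤ gdens Du Da z ^ (1 / 2 : ℝ) := by
  have h : ‖gradComp Du Da i j z‖ₑ ^ 2 ≤ gdens Du Da z := by
    rw [gdens, ← sum_gradComp_sq]
    refine le_trans ?_ (Finset.single_le_sum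
      (f := fun i => ∑ j, ‖gradComp Du Da i j z‖ₑ ^ 2) (fun _ _ => zero_le) (Finset.mem_univ i))
    exact Finset.single_le_sum (f := fun j => ‖gradComp Du Da i j z‖ₑ ^ 2) (fun _ _ => zero_le)
      (Finset.mem_univ j)
  calc ‖gradComp Du Da i j z‖ₑ = (‖gradComp Du Da i j z‖ₑ ^ 2) ^ (1 / 2 : ℝ) := by
        rw [← ENNReal.rpow_natCast, ← ENNReal.rpow_mul]; norm_num
    _ ≤ _ := ENNReal.rpow_le_rpow h (by norm_num)

/-- Enumeration of the rows of `(u, a)` whose tensor squares appear in the pressure equation. -/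
def rowIdx (κ : Option (Fin 3)) (i : Fin 3) : Fin 3 ⊕ Fin 3 × Fin 3 :=
  κ.elim (Sum.inl i) (fun k => Sum.inr (k, i))

/-- The divergence of the stress tensor `u ⊗ u + a ⊙ a`, computed by the Leibniz rule. -/
def stressDiv (u : SpT → E3) (a Du : SpT → Fin 3 → Fin 3 → ℝ)
    (Da : SpT → Fin 3 → Fin 3 → Fin 3 → ℝ) (j : Fin 3) (z : SpT) : ℝ :=
  ∑ i, ∑ κ, (gradComp Du Da (rowIdx κ i) i z * fieldComp u a (rowIdx κ j) z +
    fieldComp u a (rowIdx κ i) z * gradComp Du Da (rowIdx κ j) i z)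

theorem stress_eq_sum (i j : Fin 3) (z : SpT) : u z i * u z j + ∑ k, a z k i * a z k j =
    ∑ κ, fieldComp u a (rowIdx κ i) z * fieldComp u a (rowIdx κ j) z := by
  rw [Fintype.sum_option]; rfl

theorem sum_enorm_stressDiv_le (z : SpT) :
    ∑ j, ‖stressDiv u a Du Da j z‖ₑ ≤ 72 * (fdens u a z * gdens Du Da z) ^ (1 / 2 : ℝ) := by
  set R := (fdens u a z * gdens Du Da z) ^ (1 / 2 : ℝ) with hR
  have hR' : R = fdens u a z ^ (1 / 2 : ℝ) * gdens Du Da z ^ (1 / 2 : ℝ) :=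
    ENNReal.mul_rpow_of_nonneg _ _ (by norm_num)
  have h1 : ∀ i j κ, ‖gradComp Du Da (rowIdx κ i) i z * fieldComp u a (rowIdx κ j) z +
      fieldComp u a (rowIdx κ i) z * gradComp Du Da (rowIdx κ j) i z‖ₑ ≤ 2 * R := fun i j κ => by
    refine (enorm_add_le _ _).trans ?_
    rw [two_mul, enorm_mul, enorm_mul]
    refine add_le_add ?_ ?_
    · rw [hR', mul_comm]
      exact mul_le_mul' (enorm_fieldComp_le _ _) (enorm_gradComp_le _ _ _)
    · rw [hR']
      exact mul_le_mul' (enorm_fieldComp_le _ _) (enorm_gradComp_le _ _ _)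
  calc ∑ j, ‖stressDiv u a Du Da j z‖ₑ ≤ ∑ j : Fin 3, ∑ i : Fin 3, ∑ κ : Option (Fin 3), 2 * R := by
        refine Finset.sum_le_sum fun j _ => (enorm_sum_le _ _).trans ?_
        refine Finset.sum_le_sum fun i _ => (enorm_sum_le _ _).trans ?_
        exact Finset.sum_le_sum fun κ _ => h1 i j κ
    _ = 72 * R := by
        simp only [Finset.sum_const, Finset.card_univ, Fintype.card_fin, Fintype.card_option,
          nsmul_eq_mul]
        push_cast
        ring

theorem UnitTriple.lintegral_fieldComp_ne_top
    (hf : ∫⁻ z in Metric.ball 0 1 ×ˢ Ioo (-7 / 8) (1 / 8), fdens u a z ≠ ⊤) (i) :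
    ∫⁻ z in Metric.ball 0 1 ×ˢ Ioo (-7 / 8) (1 / 8), ‖fieldComp u a i z‖ₑ ^ 2 ≠ ⊤ :=
  ne_top_of_le_ne_top hf (lintegral_mono fun z => by
    rw [fdens_eq_sum]
    exact Finset.single_le_sum (f := fun i => ‖fieldComp u a i z‖ₑ ^ 2) (fun _ _ => zero_le)
      (Finset.mem_univ i))

theorem UnitTriple.lintegral_gradComp_ne_top
    (hg : ∫⁻ z in Metric.ball 0 1 ×ˢ Ioo (-7 / 8) (1 / 8), gdens Du Da z ≠ ⊤) (i j) :
    ∫⁻ z in Metric.ball 0 1 ×ˢ Ioo (-7 / 8) (1 / 8), ‖gradComp Du Da i j z‖ₑ ^ 2 ≠ ⊤ :=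
  ne_top_of_le_ne_top hg (lintegral_mono fun z => by
    rw [gdens, ← sum_gradComp_sq]
    refine le_trans ?_ (Finset.single_le_sum
      (f := fun i => ∑ j, ‖gradComp Du Da i j z‖ₑ ^ 2) (fun _ _ => zero_le)
      (Finset.mem_univ i))
    exact Finset.single_le_sum (f := fun j => ‖gradComp Du Da i j z‖ₑ ^ 2) (fun _ _ => zero_le)
      (Finset.mem_univ j))

theorem UnitTriple.poisson (h : UnitTriple K u d p Du a Da)
    (hf : ∫⁻ z in Metric.ball 0 1 ×ˢ Ioo (-7 / 8) (1 / 8), fdens u a z ≠ ⊤)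
    (hg : ∫⁻ z in Metric.ball 0 1 ×ˢ Ioo (-7 / 8) (1 / 8), gdens Du Da z ≠ ⊤)
    (hp : IntegrableOn p (Metric.ball 0 1 ×ˢ Ioo (-7 / 8) (1 / 8))) :
    (∀ j, Measurable (stressDiv u a Du Da j)) ∧
    (∀ j, IntegrableOn (stressDiv u a Du Da j) (Metric.ball 0 1 ×ˢ Ioo (-7 / 8) (1 / 8))) ∧
    ∀ ψ, IsTestOn (Metric.ball 0 1 ×ˢ Ioo (-7 / 8) (1 / 8)) ψ →
    ∫ z in Metric.ball 0 1 ×ˢ Ioo (-7 / 8) (1 / 8),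
      (p z * sLap ψ z - ∑ j, stressDiv u a Du Da j z * sderiv j ψ z) = 0 := by
  set Q : Set SpT := Metric.ball 0 1 ×ˢ Ioo (-7 / 8) (1 / 8) with hQ
  have hQo : IsOpen Q := Metric.isOpen_ball.prod isOpen_Ioo
  have mF := h.measurable_fieldComp
  have mG := h.measurable_gradComp
  have F2 : ∀ i, MemLp (fieldComp u a i) 2 (volume.restrict Q) := fun i =>
    (memLp_two_iff_lintegral (mF i).aestronglyMeasurable).2
      (UnitTriple.lintegral_fieldComp_ne_top hf i)
  have G2 : ∀ i j, MemLp (gradComp Du Da i j) 2 (volume.restrict Q) := fun i j =>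
    (memLp_two_iff_lintegral (mG i j).aestronglyMeasurable).2
      (UnitTriple.lintegral_gradComp_ne_top hg i j)
  have iFF : ∀ i j, IntegrableOn (fun z => fieldComp u a i z * fieldComp u a j z) Q :=
    fun i j => integrable_mul_of_memLp_two (F2 i) (F2 j)
  have iT : ∀ i l m n j, IntegrableOn (fun z => gradComp Du Da i m z * fieldComp u a j z +
      fieldComp u a l z * gradComp Du Da n m z) Q := fun i l m n j =>
    (integrable_mul_of_memLp_two (G2 i m) (F2 j)).add (integrable_mul_of_memLp_two (F2 l) (G2 n m))
  have iS : ∀ j, IntegrableOn (stressDiv u a Du Da j) Q := fun j =>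
    integrable_finsetSum _ fun i _ => integrable_finsetSum _ fun κ _ => iT _ _ _ _ _
  refine ⟨fun j => Finset.measurable_fun_sum _ fun i _ => Finset.measurable_fun_sum _ fun κ _ =>
    ((mG _ _).mul (mF _)).add ((mF _).mul (mG _ _)), iS, fun ψ hψ => ?_⟩
  have htest : ∀ j, IsTestOn Q (sderiv j ψ) := fun j =>
    ⟨IsTestOn.sderiv_contDiff hψ.1 j, hψ.2.1.fderiv_apply ℝ _,
      (tsupport_fderiv_apply_subset ℝ _).trans hψ.2.2⟩
  have bdd : ∀ {φ : SpT → ℝ}, IsTestOn Q φ → ∀ {f : SpT → ℝ}, IntegrableOn f Q →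
      IntegrableOn (fun z => f z * φ z) Q := fun {φ} hφ {f} hf => by
    obtain ⟨C, hC⟩ := hφ.2.1.exists_bound_of_continuous hφ.1.continuous
    exact Integrable.mul_bdd (c := C) hf hφ.1.continuous.aestronglyMeasurable
      (Eventually.of_forall hC)
  have htest2 : ∀ i j, IsTestOn Q (sderiv i (sderiv j ψ)) := fun i j =>
    ⟨IsTestOn.sderiv_contDiff (htest j).1 i, (htest j).2.1.fderiv_apply ℝ _,
      (tsupport_fderiv_apply_subset ℝ _).trans (htest j).2.2⟩
  have hw : ∀ i j κ, ∫ z in Q, fieldComp u a (rowIdx κ i) z * fieldComp u a (rowIdx κ j) z *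
      sderiv i (sderiv j ψ) z = -∫ z in Q, (gradComp Du Da (rowIdx κ i) i z *
        fieldComp u a (rowIdx κ j) z + fieldComp u a (rowIdx κ i) z *
        gradComp Du Da (rowIdx κ j) i z) * sderiv j ψ z := fun i j κ =>
    WeakSGrad.mul hQo (mF _) (mG _) (mF _) (mG _) (UnitTriple.lintegral_fieldComp_ne_top hf _)
      (UnitTriple.lintegral_gradComp_ne_top hg _) (UnitTriple.lintegral_fieldComp_ne_top hf _)
      (UnitTriple.lintegral_gradComp_ne_top hg _) (h.weakSGrad _) (h.weakSGrad _) i _ (htest j)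
  have hpr := h.pres ψ hψ
  have e1 : ∫ z in Q, ∑ i, ∑ j, (u z i * u z j + ∑ k, a z k i * a z k j) *
      sderiv i (sderiv j ψ) z = -∫ z in Q, ∑ j, stressDiv u a Du Da j z * sderiv j ψ z := by
    simp only [stress_eq_sum, stressDiv, Finset.sum_mul]
    refine (integral_congr_ae (Eventually.of_forall fun z => Finset.sum_comm)).trans ?_
    rw [integral_finsetSum _ fun j _ => integrable_finsetSum _ fun i _ =>
      integrable_finsetSum _ fun κ _ => bdd (htest2 i j) (iFF _ _),
      integral_finsetSum _ fun j _ => integrable_finsetSum _ fun i _ =>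
      integrable_finsetSum _ fun κ _ => bdd (htest j) (iT _ _ _ _ _), ← Finset.sum_neg_distrib]
    refine Finset.sum_congr rfl fun j _ => ?_
    rw [integral_finsetSum _ fun i _ => integrable_finsetSum _ fun κ _ =>
      bdd (htest2 i j) (iFF _ _), integral_finsetSum _ fun i _ => integrable_finsetSum _ fun κ _ =>
      bdd (htest j) (iT _ _ _ _ _), ← Finset.sum_neg_distrib]
    refine Finset.sum_congr rfl fun i _ => ?_
    rw [integral_finsetSum _ fun κ _ => bdd (htest2 i j) (iFF _ _),
      integral_finsetSum _ fun κ _ => bdd (htest j) (iT _ _ _ _ _), ← Finset.sum_neg_distrib]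
    exact Finset.sum_congr rfl fun κ _ => hw i j κ
  rw [integral_sub]
  · rw [e1, ← hQ] at hpr
    linarith
  · unfold sLap
    simp only [Finset.mul_sum]
    exact integrable_finsetSum _ fun j _ => bdd (htest2 j j) hp
  · exact integrable_finsetSum _ fun j _ => bdd (htest j) (iS j)
end

theorem lintegral_rpow_le_lintegral_rpow {α : Type*} [MeasurableSpace α] {μ : Measure α}
    {f : α → ℝ≥0∞} (hf : AEMeasurable f μ) :
    (∫⁻ x, f x ∂μ) ^ (3 / 2 : ℝ) ≤ μ univ ^ (1 / 2 : ℝ) * ∫⁻ x, f x ^ (3 / 2 : ℝ) ∂μ := by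
  have hpq : Real.HolderConjugate (3 / 2 : ℝ) 3 := by
    constructor <;> norm_num
  have h := ENNReal.lintegral_mul_le_Lp_mul_Lq μ hpq hf (aemeasurable_const (b := (1 : ℝ≥0∞)))
  simp only [Pi.mul_apply, mul_one, ENNReal.one_rpow, lintegral_const, one_mul] at h
  calc (∫⁻ x, f x ∂μ) ^ (3 / 2 : ℝ)
      ≤ ((∫⁻ x, f x ^ (3 / 2 : ℝ) ∂μ) ^ (1 / (3 / 2) : ℝ) * μ univ ^ (1 / 3 : ℝ)) ^ (3 / 2 : ℝ) :=
        ENNReal.rpow_le_rpow h (by norm_num)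
    _ = _ := by
        rw [ENNReal.mul_rpow_of_nonneg _ _ (by norm_num), ← ENNReal.rpow_mul, ← ENNReal.rpow_mul]
        norm_num [mul_comm]

theorem ennreal_add_rpow_three_halves_le (a b : ℝ≥0∞) :
    (a + b) ^ (3 / 2 : ℝ) ≤ 2 * (a ^ (3 / 2 : ℝ) + b ^ (3 / 2 : ℝ)) := by
  refine (ENNReal.rpow_add_le_mul_rpow_add_rpow _ _ (by norm_num)).trans ?_
  gcongr
  calc (2 : ℝ≥0∞) ^ (3 / 2 - 1 : ℝ) ≤ 2 ^ (1 : ℝ) :=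
        ENNReal.rpow_le_rpow_of_exponent_le (by norm_num) (by norm_num)
    _ = 2 := by simp

section
variable {K : ℝ} {u d : SpT → E3} {p : SpT → ℝ} {Du a : SpT → Fin 3 → Fin 3 → ℝ}
  {Da : SpT → Fin 3 → Fin 3 → Fin 3 → ℝ}

theorem integrableOn_of_lintegral_rpow {α : Type*} [MeasurableSpace α] {μ : Measure α} {Q : Set α}
    (hQ : μ Q ≠ ⊤) {p : α → ℝ} (hm : Measurable p)
    (hp : ∫⁻ z in Q, ‖p z‖ₑ ^ (3 / 2 : ℝ) ∂μ ≠ ⊤) : IntegrableOn p Q μ := by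
  refine ⟨hm.aestronglyMeasurable, ?_⟩
  have h := lintegral_rpow_le_lintegral_rpow (μ := μ.restrict Q) hm.enorm.aemeasurable
  rw [Measure.restrict_apply_univ] at h
  have h1 : (∫⁻ z in Q, ‖p z‖ₑ ∂μ) ^ (3 / 2 : ℝ) < ⊤ := h.trans_lt (by finiteness)
  exact (ENNReal.rpow_lt_top_iff_of_pos (by norm_num)).1 h1

theorem sLap_eq_zero_of_notMem_tsupport {ψ : SpT → ℝ} {z : SpT} (hz : z ∉ tsupport ψ) :
    sLap ψ z = 0 :=
  Finset.sum_eq_zero fun _ _ => sderiv_eq_zero_of_notMem_tsupport fun h =>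
    hz (tsupport_fderiv_apply_subset ℝ _ h)

/-- Pressure bound on time slices. -/
theorem UnitTriple.pressure_slice : ∃ c : ℝ≥0, ∀ {K : ℝ} {u d : SpT → E3} {p : SpT → ℝ}
    {Du a : SpT → Fin 3 → Fin 3 → ℝ} {Da : SpT → Fin 3 → Fin 3 → Fin 3 → ℝ},
    UnitTriple K u d p Du a Da →
    ∫⁻ z in Metric.ball 0 1 ×ˢ Ioo (-7 / 8) (1 / 8), fdens u a z ≠ ⊤ →
    ∫⁻ z in Metric.ball 0 1 ×ˢ Ioo (-7 / 8) (1 / 8), gdens Du Da z ≠ ⊤ →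
    ∫⁻ z in Metric.ball 0 1 ×ˢ Ioo (-7 / 8) (1 / 8), ‖p z‖ₑ ^ (3 / 2 : ℝ) ≠ ⊤ →
    ∀ᵐ t ∂(volume.restrict (Ioo (-63 / 128 : ℝ) (9 / 128))), ∀ r ≤ (1 / 4 : ℝ),
      ∫⁻ x in Metric.ball (0 : E3) r, ‖p (x, t)‖ₑ ^ (3 / 2 : ℝ) ≤ c * (
        (∫⁻ x in Metric.ball (0 : E3) (3 / 4), gdens Du Da (x, t)) *
          (∫⁻ x in Metric.ball (0 : E3) (1 / 2), fdens u a (x, t)) ^ (1 / 2 : ℝ) +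
        (∫⁻ x in Metric.ball (0 : E3) (3 / 4), gdens Du Da (x, t)) ^ (3 / 4 : ℝ) *
          (∫⁻ x in Metric.ball (0 : E3) (1 / 2), fdens u a (x, t)) ^ (3 / 4 : ℝ) +
        ENNReal.ofReal (r ^ 3) *
          ∫⁻ x in Metric.ball (0 : E3) (1 / 2), ‖p (x, t)‖ₑ ^ (3 / 2 : ℝ)) := by
  obtain ⟨c₁, h₁⟩ := newton_bound
  obtain ⟨c₂, h₂⟩ := potential_bound
  obtain ⟨c₃, h₃⟩ := UnitTriple.sliceBounds
  set S := Metric.ball (0 : E3) (1 / 2)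
  set w := volume (Metric.ball (0 : E3) 1)
  have hw : w ≠ ⊤ := measure_ball_lt_top.ne
  have hsT : volume S ≠ ⊤ := measure_ball_lt_top.ne
  -- the constant
  set k : ℝ≥0∞ := (c₁ : ℝ≥0∞) ^ (3 / 2 : ℝ) * 2 with hk
  set l : ℝ≥0∞ := (72 : ℝ≥0∞) ^ (3 / 2 : ℝ) * (c₂ * (c₃ : ℝ≥0∞) ^ (1 / 8 : ℝ)) with hl
  set m : ℝ≥0∞ := volume S ^ (1 / 2 : ℝ) * w with hm
  refine ⟨(k * (l + m)).toNNReal, fun {K u d p Du a Da} h hf hg hp => ?_⟩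
  rw [ENNReal.coe_toNNReal (by finiteness)]
  have hpi := integrableOn_of_lintegral_rpow (by
    rw [show (volume : Measure SpT) (Metric.ball 0 1 ×ˢ Ioo (-7 / 8) (1 / 8)) = _ from
      Measure.prod_prod _ _, Real.volume_Ioo]
    finiteness) h.meas_p hp
  obtain ⟨mG, iG, hG⟩ := h.poisson hf hg hpi
  set I := Ioo (-63 / 128 : ℝ) (9 / 128)
  have hIQ : S ×ˢ I ⊆ Metric.ball 0 1 ×ˢ Ioo (-7 / 8) (1 / 8) :=
    prod_mono (Metric.ball_subset_ball (by norm_num)) (Ioo_subset_Ioo (by norm_num) (by norm_num))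
  have key := h₁ (-63 / 128) (9 / 128) p (stressDiv u a Du Da) h.meas_p (hpi.mono_set hIQ) mG
    (fun j => (iG j).mono_set hIQ) fun ψ hψ => by
      rw [← hG ψ ⟨hψ.1, hψ.2.1, hψ.2.2.trans hIQ⟩]
      refine (setIntegral_eq_of_subset_of_forall_sdiff_eq_zero
        (measurableSet_ball.prod measurableSet_Ioo) hIQ fun z hz => ?_).symm
      have hz' : z ∉ tsupport ψ := fun hh => hz.2 (hψ.2.2 hh)
      simp [sLap_eq_zero_of_notMem_tsupport hz', sderiv_eq_zero_of_notMem_tsupport hz']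
  filter_upwards [key, h₃ h hf hg] with t ht hs r hr
  have hrS : Metric.ball (0 : E3) r ⊆ Metric.ball 0 (1 / 4) := Metric.ball_subset_ball hr
  set β := ∫⁻ x in Metric.ball (0 : E3) (3 / 4), gdens Du Da (x, t)
  have me : Measurable fun x => fdens u a (x, t) := h.measurable_fdens.comp measurable_prodMk_right
  have mb : Measurable fun x => gdens Du Da (x, t) :=
    h.measurable_gdens.comp measurable_prodMk_right
  have mp : Measurable fun x => p (x, t) := h.meas_p.comp measurable_prodMk_right
  set X := ∫⁻ x in S, fdens u a (x, t)
  have hq : ∫⁻ x in S, fdens u a (x, t) ^ 2 ≤ c₃ * (β + X) ^ 2 := by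
    have := hs.quartic
    simp only [famSq_sliceField] at this
    exact this
  have hpot := h₂ (fun x => fdens u a (x, t)) (fun x => gdens Du Da (x, t)) me mb
  set Φ : E3 → ℝ≥0∞ := fun x => ∫⁻ y in S, ‖y - x‖ₑ ^ (-2 : ℝ) *
    (fdens u a (y, t) * gdens Du Da (y, t)) ^ (1 / 2 : ℝ) with hΦ
  set Y := ∫⁻ x in S, ‖p (x, t)‖ₑ
  have mΦ : Measurable Φ := by
    have m1 : Measurable fun q : E3 × E3 => ‖q.2 - q.1‖ₑ ^ (-2 : ℝ) *
        (fdens u a (q.2, t) * gdens Du Da (q.2, t)) ^ (1 / 2 : ℝ) :=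
      ((by fun_prop : Measurable fun q : E3 × E3 => ‖q.2 - q.1‖ₑ).pow_const _).mul
        (((me.comp measurable_snd).mul (mb.comp measurable_snd)).pow_const _)
    exact m1.lintegral_prod_right'
  have hpt : ∀ᵐ x ∂(volume.restrict (Metric.ball (0 : E3) r)), ‖p (x, t)‖ₑ ^ (3 / 2 : ℝ) ≤
      k * (72 ^ (3 / 2 : ℝ) * Φ x ^ (3 / 2 : ℝ) + Y ^ (3 / 2 : ℝ)) := by
    filter_upwards [ae_restrict_of_ae_restrict_of_subset hrS ht] with x hx
    have h4 : ∫⁻ y in S, ‖y - x‖ₑ ^ (-2 : ℝ) * ∑ j, ‖stressDiv u a Du Da j (y, t)‖ₑ ≤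
        72 * Φ x := by
      rw [hΦ, ← lintegral_const_mul' _ _ (by simp)]
      refine lintegral_mono fun y => ?_
      calc _ ≤ ‖y - x‖ₑ ^ (-2 : ℝ) * (72 * (fdens u a (y, t) * gdens Du Da (y, t)) ^ (1 / 2 : ℝ)) :=
            mul_le_mul' le_rfl (sum_enorm_stressDiv_le _)
        _ = _ := by ring
    calc ‖p (x, t)‖ₑ ^ (3 / 2 : ℝ) ≤ (c₁ * (72 * Φ x + Y)) ^ (3 / 2 : ℝ) :=
          ENNReal.rpow_le_rpow (hx.trans (mul_le_mul' le_rfl (add_le_add h4 le_rfl))) (by norm_num)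
      _ = (c₁ : ℝ≥0∞) ^ (3 / 2 : ℝ) * (72 * Φ x + Y) ^ (3 / 2 : ℝ) :=
          ENNReal.mul_rpow_of_nonneg _ _ (by norm_num)
      _ ≤ (c₁ : ℝ≥0∞) ^ (3 / 2 : ℝ) * (2 * ((72 * Φ x) ^ (3 / 2 : ℝ) + Y ^ (3 / 2 : ℝ))) :=
          mul_le_mul' le_rfl (ennreal_add_rpow_three_halves_le _ _)
      _ = _ := by rw [ENNReal.mul_rpow_of_nonneg _ _ (by norm_num), hk, mul_assoc]
  have hY : Y ^ (3 / 2 : ℝ) ≤ volume S ^ (1 / 2 : ℝ) * ∫⁻ x in S, ‖p (x, t)‖ₑ ^ (3 / 2 : ℝ) := by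
    have := lintegral_rpow_le_lintegral_rpow (μ := volume.restrict S) mp.enorm.aemeasurable
    rwa [Measure.restrict_apply_univ] at this
  have hΦi : ∫⁻ x in Metric.ball (0 : E3) r, Φ x ^ (3 / 2 : ℝ) ≤
      c₂ * (c₃ : ℝ≥0∞) ^ (1 / 8 : ℝ) *
        (β * X ^ (1 / 2 : ℝ) + β ^ (3 / 4 : ℝ) * X ^ (3 / 4 : ℝ)) := by
    have hβS : ∫⁻ y in S, gdens Du Da (y, t) ≤ β :=
      lintegral_mono_set (Metric.ball_subset_ball (by norm_num))
    have e1 : ∀ y : ℝ≥0∞, (y ^ 2) ^ (1 / 2 : ℝ) = y := fun y => by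
      rw [← ENNReal.rpow_natCast, ← ENNReal.rpow_mul]; norm_num
    calc ∫⁻ x in Metric.ball (0 : E3) r, Φ x ^ (3 / 2 : ℝ)
        ≤ ∫⁻ x in Metric.ball (0 : E3) (1 / 4), Φ x ^ (3 / 2 : ℝ) := lintegral_mono_set hrS
      _ ≤ c₂ * β ^ (3 / 4 : ℝ) * ((c₃ * (β + X) ^ 2) ^ (1 / 2 : ℝ) * X ^ 2) ^ (1 / 4 : ℝ) := by
          refine hpot.trans ?_
          gcongr
      _ = c₂ * (c₃ : ℝ≥0∞) ^ (1 / 8 : ℝ) *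
          (β ^ (3 / 4 : ℝ) * ((β + X) ^ (1 / 4 : ℝ) * X ^ (1 / 2 : ℝ))) := by
          rw [ENNReal.mul_rpow_of_nonneg _ _ (by norm_num : (0 : ℝ) ≤ 1 / 2), e1,
            ENNReal.mul_rpow_of_nonneg _ _ (by norm_num), ENNReal.mul_rpow_of_nonneg _ _ (by norm_num),
            ← ENNReal.rpow_mul, ← ENNReal.rpow_natCast, ← ENNReal.rpow_mul]
          norm_num
          ring
      _ ≤ c₂ * (c₃ : ℝ≥0∞) ^ (1 / 8 : ℝ) *
          (β ^ (3 / 4 : ℝ) * ((β ^ (1 / 4 : ℝ) + X ^ (1 / 4 : ℝ)) * X ^ (1 / 2 : ℝ))) := by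
          gcongr
          exact ENNReal.rpow_add_le_add_rpow _ _ (by norm_num) (by norm_num)
      _ = c₂ * (c₃ : ℝ≥0∞) ^ (1 / 8 : ℝ) * (β ^ (3 / 4 : ℝ) * β ^ (1 / 4 : ℝ) * X ^ (1 / 2 : ℝ) +
          β ^ (3 / 4 : ℝ) * (X ^ (1 / 4 : ℝ) * X ^ (1 / 2 : ℝ))) := by ring
      _ = _ := by
          rw [← ENNReal.rpow_add_of_nonneg _ _ (by norm_num) (by norm_num),
            ← ENNReal.rpow_add_of_nonneg _ _ (by norm_num) (by norm_num)]
          norm_num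
  calc ∫⁻ x in Metric.ball (0 : E3) r, ‖p (x, t)‖ₑ ^ (3 / 2 : ℝ)
      ≤ ∫⁻ x in Metric.ball (0 : E3) r,
          k * (72 ^ (3 / 2 : ℝ) * Φ x ^ (3 / 2 : ℝ) + Y ^ (3 / 2 : ℝ)) := lintegral_mono_ae hpt
    _ = k * (72 ^ (3 / 2 : ℝ) * (∫⁻ x in Metric.ball (0 : E3) r, Φ x ^ (3 / 2 : ℝ)) +
          Y ^ (3 / 2 : ℝ) * (ENNReal.ofReal (r ^ 3) * w)) := by
        rw [lintegral_const_mul' _ _ (by finiteness), lintegral_add_right _ measurable_const,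
          setLIntegral_const, volume_ball_E3, lintegral_const_mul' _ _ (by finiteness)]
    _ ≤ k * (72 ^ (3 / 2 : ℝ) * (c₂ * (c₃ : ℝ≥0∞) ^ (1 / 8 : ℝ) *
        (β * X ^ (1 / 2 : ℝ) + β ^ (3 / 4 : ℝ) * X ^ (3 / 4 : ℝ))) +
          (volume S ^ (1 / 2 : ℝ) * ∫⁻ x in S, ‖p (x, t)‖ₑ ^ (3 / 2 : ℝ)) *
            (ENNReal.ofReal (r ^ 3) * w)) := by gcongr
    _ ≤ k * (72 ^ (3 / 2 : ℝ) * (c₂ * (c₃ : ℝ≥0∞) ^ (1 / 8 : ℝ) *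
        (β * X ^ (1 / 2 : ℝ) + β ^ (3 / 4 : ℝ) * X ^ (3 / 4 : ℝ))) +
          (volume S ^ (1 / 2 : ℝ) * ∫⁻ x in S, ‖p (x, t)‖ₑ ^ (3 / 2 : ℝ)) *
            (ENNReal.ofReal (r ^ 3) * w)) +
        k * (l * (ENNReal.ofReal (r ^ 3) * ∫⁻ x in S, ‖p (x, t)‖ₑ ^ (3 / 2 : ℝ)) +
          m * (β * X ^ (1 / 2 : ℝ) + β ^ (3 / 4 : ℝ) * X ^ (3 / 4 : ℝ))) := le_self_add
    _ = _ := by rw [hl, hm]; ring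
end

theorem lintegral_enorm_sub_average_sq_le_const {f : E3 → ℝ} {S : Set E3} (h0 : volume S ≠ 0)
    (hT : volume S ≠ ⊤) (hf : Measurable f) (k : ℝ) :
    ∫⁻ x in S, ‖f x - ⨍ y in S, f y‖ₑ ^ 2 ≤ 4 * ∫⁻ x in S, ‖f x - k‖ₑ ^ 2 := by
  rcases eq_or_ne (∫⁻ x in S, ‖f x - k‖ₑ ^ 2) ⊤ with h | h
  · rw [h]; simp
  have hm : Measurable fun x => f x - k := hf.sub measurable_const
  have hi : IntegrableOn (fun x => f x - k) S := integrableOn_of_lintegral_sq hT hm h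
  have hk : IntegrableOn (fun _ : E3 => k) S := integrableOn_const hT
  have hfi : IntegrableOn f S := (hi.add hk).congr (Eventually.of_forall fun x => by simp)
  have hav : ⨍ y in S, (f y - k) = (⨍ y in S, f y) - k := by
    rw [setAverage_eq, setAverage_eq, integral_sub hfi hk, smul_sub, setIntegral_const, smul_smul,
      inv_mul_cancel₀, one_smul]
    exact (ENNReal.toReal_pos h0 hT).ne'
  have h1 := lintegral_enorm_sub_average_sq_le h0 hT hm
  rw [hav] at h1
  simpa using h1

section
variable {ι : Type*} [Fintype ι]

theorem enorm_sum_sq_sub_le (f : ι → E3 → ℝ) (s : Finset ι) (x : E3) :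
    ‖(∑ i ∈ s, f i x ^ 2) - ∑ i ∈ s, halfMean (f i) ^ 2‖ₑ ^ 2 ≤
      8 * (famSq (famOsc f) x ^ 2 + famSq (famOsc f) x * meanSq f) := by
  set A : ℝ := ∑ i ∈ s, famOsc f i x ^ 2 with hA
  set m : ℝ := ∑ i ∈ s, halfMean (f i) ^ 2 with hm
  have hA0 : 0 ≤ A := Finset.sum_nonneg fun i _ => sq_nonneg _
  have hm0 : 0 ≤ m := Finset.sum_nonneg fun i _ => sq_nonneg _
  have hP := Finset.sum_mul_sq_le_sq_mul_sq s (fun i => famOsc f i x) (fun i => halfMean (f i))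
  set P : ℝ := ∑ i ∈ s, famOsc f i x * halfMean (f i) with hP'
  have e : (∑ i ∈ s, f i x ^ 2) - m = A + 2 * P := by
    rw [hA, hm, hP', Finset.mul_sum, ← Finset.sum_add_distrib, ← Finset.sum_sub_distrib]
    refine Finset.sum_congr rfl fun i _ => ?_
    unfold famOsc
    ring
  have hAle : ENNReal.ofReal A ≤ famSq (famOsc f) x := by
    rw [hA, ENNReal.ofReal_sum_of_nonneg fun i _ => sq_nonneg _]
    simp only [← enorm_sq_eq_ofReal]
    exact Finset.sum_le_sum_of_subset (Finset.subset_univ s)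
  have hmle : ENNReal.ofReal m ≤ meanSq f := by
    rw [hm, ENNReal.ofReal_sum_of_nonneg fun i _ => sq_nonneg _]
    simp only [← enorm_sq_eq_ofReal]
    exact Finset.sum_le_sum_of_subset (Finset.subset_univ s)
  rw [e, enorm_sq_eq_ofReal]
  calc ENNReal.ofReal ((A + 2 * P) ^ 2) ≤ ENNReal.ofReal (8 * (A ^ 2 + A * m)) := by
        apply ENNReal.ofReal_le_ofReal
        nlinarith [sq_nonneg (A - 2 * P), sq_nonneg A]
    _ = 8 * (ENNReal.ofReal A ^ 2 + ENNReal.ofReal A * ENNReal.ofReal m) := by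
        rw [ENNReal.ofReal_mul (by norm_num), ENNReal.ofReal_add (by positivity) (by positivity),
          ENNReal.ofReal_pow hA0, ENNReal.ofReal_mul hA0]
        norm_num
    _ ≤ _ := by gcongr

theorem SliceBounds.oscillation_average {c : ℝ≥0} {f : ι → E3 → ℝ} {β : ℝ≥0∞}
    (h : SliceBounds c f β) (s : Finset ι) {r : ℝ} (hr0 : 0 < r) (hr : r ≤ 1 / 2) :
    ∫⁻ x in Metric.ball (0 : E3) r, ‖(∑ i ∈ s, f i x ^ 2) -
      ⨍ y in Metric.ball (0 : E3) r, ∑ i ∈ s, f i y ^ 2‖ₑ ^ 2 ≤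
      32 * c * (β ^ 2 + β * ∫⁻ x in Metric.ball (0 : E3) (1 / 2), famSq f x) := by
  have hm : Measurable fun x => ∑ i ∈ s, f i x ^ 2 :=
    Finset.measurable_fun_sum _ fun i _ => (h.meas i).pow_const 2
  refine (lintegral_enorm_sub_average_sq_le_const (Metric.measure_ball_pos _ _ hr0).ne'
    measure_ball_lt_top.ne hm (∑ i ∈ s, halfMean (f i) ^ 2)).trans ?_
  calc _ ≤ 4 * ∫⁻ x in Metric.ball (0 : E3) (1 / 2),
        8 * (famSq (famOsc f) x ^ 2 + famSq (famOsc f) x * meanSq f) := by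
        exact mul_le_mul' le_rfl ((lintegral_mono fun x => enorm_sum_sq_sub_le f s x).trans
          (lintegral_mono_set (Metric.ball_subset_ball hr)))
    _ ≤ 4 * (8 * (c * (β ^ 2 + β * ∫⁻ x in Metric.ball (0 : E3) (1 / 2), famSq f x))) := by
        rw [lintegral_const_mul' _ _ (by simp)]
        exact mul_le_mul' le_rfl (mul_le_mul' le_rfl h.oscillation)
    _ = _ := by ring
end

section
variable {u : SpT → E3} {a : SpT → Fin 3 → Fin 3 → ℝ}

theorem sum_sliceField_inl (t : ℝ) (x : E3) :
    ∑ i ∈ Finset.univ.map Function.Embedding.inl, sliceField u a t i x ^ 2 = ‖u (x, t)‖ ^ 2 := by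
  rw [Finset.sum_map, EuclideanSpace.real_norm_sq_eq]; rfl

theorem sum_sliceField_inr (t : ℝ) (x : E3) :
    ∑ i ∈ Finset.univ.map Function.Embedding.inr, sliceField u a t i x ^ 2 = nsq2 (a (x, t)) := by
  rw [Finset.sum_map, Fintype.sum_prod_type]; rfl

theorem enorm_u_sq_le (z : SpT) : ‖u z‖ₑ ^ 2 ≤ fdens u a z := by
  rw [fdens, ← ofReal_norm, ← ENNReal.ofReal_pow (norm_nonneg _)]
  refine ENNReal.ofReal_le_ofReal (le_add_of_nonneg_right ?_)
  exact Finset.sum_nonneg fun i _ => Finset.sum_nonneg fun j _ => sq_nonneg _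

/-- Slice bound for the trilinear oscillation functional. -/
theorem SliceBounds.trilinear {c : ℝ≥0} {t : ℝ} {β : ℝ≥0∞}
    (h : SliceBounds c (sliceField u a t) β) (hu : Measurable u) {r : ℝ} (hr0 : 0 < r)
    (hr : r ≤ 1 / 2) :
    ∫⁻ x in Metric.ball (0 : E3) r, ‖u (x, t)‖ₑ *
      (‖‖u (x, t)‖ ^ 2 - ⨍ y in Metric.ball (0 : E3) r, ‖u (y, t)‖ ^ 2‖ₑ +
        ‖nsq2 (a (x, t)) - ⨍ y in Metric.ball (0 : E3) r, nsq2 (a (y, t))‖ₑ) ≤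
      (128 * c : ℝ≥0∞) ^ (1 / 2 : ℝ) *
        ((∫⁻ x in Metric.ball (0 : E3) (1 / 2), fdens u a (x, t)) ^ (1 / 2 : ℝ) * β +
        (∫⁻ x in Metric.ball (0 : E3) (1 / 2), fdens u a (x, t)) * β ^ (1 / 2 : ℝ)) := by
  have h1 := h.oscillation_average (Finset.univ.map Function.Embedding.inl) hr0 hr
  have h2 := h.oscillation_average (Finset.univ.map Function.Embedding.inr) hr0 hr
  have m1 : Measurable fun x => ‖u (x, t)‖ ^ 2 := by
    have := hu.comp (measurable_prodMk_right (y := t))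
    exact (this.norm).pow_const 2
  have m2 : Measurable fun x => nsq2 (a (x, t)) := by
    simp only [← sum_sliceField_inr (u := u)]
    exact Finset.measurable_fun_sum _ fun i _ => (h.meas i).pow_const 2
  simp only [sum_sliceField_inl, sum_sliceField_inr, famSq_sliceField] at h1 h2
  set X := ∫⁻ x in Metric.ball (0 : E3) (1 / 2), fdens u a (x, t)
  set H₁ : E3 → ℝ≥0∞ := fun x =>
    ‖‖u (x, t)‖ ^ 2 - ⨍ y in Metric.ball (0 : E3) r, ‖u (y, t)‖ ^ 2‖ₑ
  set H₂ : E3 → ℝ≥0∞ := fun x =>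
    ‖nsq2 (a (x, t)) - ⨍ y in Metric.ball (0 : E3) r, nsq2 (a (y, t))‖ₑ
  have mH₁ : Measurable H₁ := (m1.sub measurable_const).enorm
  have mH₂ : Measurable H₂ := (m2.sub measurable_const).enorm
  have hcs := lintegral_mul_sq_le (μ := volume.restrict (Metric.ball (0 : E3) r))
    (k := fun x => ‖u (x, t)‖ₑ) (h := fun x => H₁ x + H₂ x)
    (hu.comp (measurable_prodMk_right (y := t))).enorm.aemeasurable (mH₁.add mH₂).aemeasurable
  have e1 : ∀ y : ℝ≥0∞, (y ^ 2) ^ (1 / 2 : ℝ) = y := fun y => by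
    rw [← ENNReal.rpow_natCast, ← ENNReal.rpow_mul]; norm_num
  have hU : ∫⁻ x in Metric.ball (0 : E3) r, ‖u (x, t)‖ₑ ^ 2 ≤ X :=
    (lintegral_mono fun x => enorm_u_sq_le _).trans
      (lintegral_mono_set (Metric.ball_subset_ball hr))
  have hH : ∫⁻ x in Metric.ball (0 : E3) r, (H₁ x + H₂ x) ^ 2 ≤ 128 * c * (β ^ 2 + β * X) := by
    calc _ ≤ ∫⁻ x in Metric.ball (0 : E3) r, 2 * (H₁ x ^ 2 + H₂ x ^ 2) :=
          lintegral_mono fun x => ennreal_add_sq_le _ _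
      _ = 2 * ((∫⁻ x in Metric.ball (0 : E3) r, H₁ x ^ 2) +
          ∫⁻ x in Metric.ball (0 : E3) r, H₂ x ^ 2) := by
          rw [lintegral_const_mul' _ _ (by simp), lintegral_add_left (mH₁.pow_const 2)]
      _ ≤ 2 * (32 * c * (β ^ 2 + β * X) + 32 * c * (β ^ 2 + β * X)) :=
          mul_le_mul' le_rfl (add_le_add h1 h2)
      _ = _ := by ring
  rw [← e1 (∫⁻ x in Metric.ball (0 : E3) r, ‖u (x, t)‖ₑ * (H₁ x + H₂ x))]
  calc _ ≤ (X * (128 * c * (β ^ 2 + β * X))) ^ (1 / 2 : ℝ) := by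
        refine ENNReal.rpow_le_rpow (hcs.trans ?_) (by norm_num)
        gcongr
    _ = (128 * c : ℝ≥0∞) ^ (1 / 2 : ℝ) * (X * β ^ 2 + X ^ 2 * β) ^ (1 / 2 : ℝ) := by
        rw [← ENNReal.mul_rpow_of_nonneg _ _ (by norm_num)]
        congr 1
        ring
    _ ≤ (128 * c : ℝ≥0∞) ^ (1 / 2 : ℝ) *
        ((X * β ^ 2) ^ (1 / 2 : ℝ) + (X ^ 2 * β) ^ (1 / 2 : ℝ)) :=
        mul_le_mul' le_rfl (ENNReal.rpow_add_le_add_rpow _ _ (by norm_num) (by norm_num))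
    _ = _ := by
        rw [ENNReal.mul_rpow_of_nonneg X (β ^ 2) (by norm_num),
          ENNReal.mul_rpow_of_nonneg (X ^ 2) β (by norm_num), e1, e1]
end

/-! ### Integration of the slice estimates in time -/

theorem lintegral_rpow_le_rpow_lintegral {α : Type*} [MeasurableSpace α] {μ : Measure α}
    (hμ : μ univ ≤ 1) {f : α → ℝ≥0∞} (hf : AEMeasurable f μ) {s : ℝ} (hs0 : 0 < s) (hs1 : s ≤ 1) :
    ∫⁻ x, f x ^ s ∂μ ≤ (∫⁻ x, f x ∂μ) ^ s := by
  have h := eLpNorm'_le_eLpNorm'_mul_rpow_measure_univ (μ := μ) (f := f) hs0 hs1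
    hf.aestronglyMeasurable
  have h1 : μ univ ^ (1 / s - 1 / 1 : ℝ) ≤ 1 :=
    ENNReal.rpow_le_one hμ (sub_nonneg.2 (one_div_le_one_div_of_le hs0 hs1))
  have h2 := h.trans (mul_le_of_le_one_right zero_le h1)
  simp only [eLpNorm', enorm_eq_self, ENNReal.rpow_one, div_one] at h2
  have h3 := ENNReal.rpow_le_rpow h2 hs0.le
  rwa [← ENNReal.rpow_mul, one_div_mul_cancel hs0.ne', ENNReal.rpow_one] at h3

/-- The oscillation integrand. -/
def oscDens (u : SpT → E3) (a : SpT → Fin 3 → Fin 3 → ℝ) (r : ℝ) (z : SpT) : ℝ≥0∞ :=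
  ‖u z‖ₑ * (‖‖u z‖ ^ 2 - ⨍ y in Metric.ball (0 : E3) r, ‖u (y, z.2)‖ ^ 2‖ₑ +
    ‖nsq2 (a z) - ⨍ y in Metric.ball (0 : E3) r, nsq2 (a (y, z.2))‖ₑ)

theorem measurable_setAverage_slice {g : SpT → ℝ} (hg : Measurable g) (S : Set E3) :
    Measurable fun z : SpT => ⨍ y in S, g (y, z.2) := by
  simp only [setAverage_eq]
  have h : StronglyMeasurable fun t : ℝ => ∫ y in S, g (y, t) :=
    hg.stronglyMeasurable.integral_prod_left'
  exact (h.measurable.comp measurable_snd).const_mul _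

theorem measurable_oscDens {u : SpT → E3} {a : SpT → Fin 3 → Fin 3 → ℝ} (hu : Measurable u)
    (ha : Measurable a) (r : ℝ) : Measurable (oscDens u a r) := by
  have h1 : Measurable fun z => ‖u z‖ ^ 2 := by fun_prop
  have h2 : Measurable fun z => nsq2 (a z) := by unfold nsq2; fun_prop
  exact hu.enorm.mul ((h1.sub (measurable_setAverage_slice h1 _)).enorm.add
    (h2.sub (measurable_setAverage_slice h2 _)).enorm)

theorem lintegral_cylinder_mono {f : SpT → ℝ≥0∞} (hf : Measurable f) {S S' : Set E3}
    {I I' : Set ℝ} (hS : S ⊆ S') (hI : I ⊆ I') :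
    ∫⁻ t in I, ∫⁻ x in S, f (x, t) ≤ ∫⁻ z in S' ×ˢ I', f z := by
  rw [← lintegral_prod_SpT hf]
  exact lintegral_mono_set (prod_mono hS hI)

theorem UnitTriple.integral_decay : ∃ c : ℝ≥0, ∀ {K : ℝ} {u d : SpT → E3} {p : SpT → ℝ}
    {Du a : SpT → Fin 3 → Fin 3 → ℝ} {Da : SpT → Fin 3 → Fin 3 → Fin 3 → ℝ},
    UnitTriple K u d p Du a Da → ∀ {A B : ℝ≥0∞},
    ∫⁻ z in Metric.ball 0 1 ×ˢ Ioo (-7 / 8) (1 / 8), fdens u a z ≠ ⊤ →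
    ∫⁻ z in Metric.ball 0 1 ×ˢ Ioo (-7 / 8) (1 / 8), gdens Du Da z ≤ B → B ≠ ⊤ →
    ∫⁻ z in Metric.ball 0 1 ×ˢ Ioo (-7 / 8) (1 / 8), ‖p z‖ₑ ^ (3 / 2 : ℝ) ≠ ⊤ →
    (∀ᵐ t ∂(volume.restrict (Ioo (-7 / 32 : ℝ) (1 / 32))),
      ∫⁻ x in Metric.ball (0 : E3) (1 / 2), fdens u a (x, t) ≤ A) →
    ∀ γ : ℝ, 0 < γ → γ ≤ 1 / 4 →
    (∫⁻ z in Metric.ball 0 γ ×ˢ Ioo (-(7 / 8 * γ ^ 2)) (1 / 8 * γ ^ 2),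
        fdens u a z ^ (3 / 2 : ℝ) ≤ c * (A ^ (1 / 2 : ℝ) * B + ENNReal.ofReal (γ ^ 3) *
          ∫⁻ z in Metric.ball 0 1 ×ˢ Ioo (-7 / 8) (1 / 8), fdens u a z ^ (3 / 2 : ℝ))) ∧
    (∫⁻ z in Metric.ball 0 γ ×ˢ Ioo (-(7 / 8 * γ ^ 2)) (1 / 8 * γ ^ 2),
        oscDens u a γ z ≤ c * (A ^ (1 / 2 : ℝ) * B + A * B ^ (1 / 2 : ℝ))) ∧
    (∫⁻ z in Metric.ball 0 γ ×ˢ Ioo (-(7 / 8 * γ ^ 2)) (1 / 8 * γ ^ 2),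
        ‖p z‖ₑ ^ (3 / 2 : ℝ) ≤ c * (A ^ (1 / 2 : ℝ) * B + A ^ (3 / 4 : ℝ) * B ^ (3 / 4 : ℝ) +
          ENNReal.ofReal (γ ^ 3) *
          ∫⁻ z in Metric.ball 0 1 ×ˢ Ioo (-7 / 8) (1 / 8), ‖p z‖ₑ ^ (3 / 2 : ℝ))) := by
  obtain ⟨c₁, h₁⟩ := UnitTriple.sliceBounds
  obtain ⟨c₂, h₂⟩ := UnitTriple.pressure_slice
  set c₃ : ℝ≥0∞ := (128 * c₁ : ℝ≥0∞) ^ (1 / 2 : ℝ) with hc₃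
  have hc₃t : c₃ ≠ ⊤ := by rw [hc₃]; finiteness
  refine ⟨c₁ + c₂ + c₃.toNNReal, fun {K u d p Du a Da} h {A B} hf hB hBt hp hA γ hγ0 hγ => ?_⟩
  have hc1 : (c₁ : ℝ≥0∞) ≤ ↑(c₁ + c₂ + c₃.toNNReal) := by
    rw [add_assoc]; exact_mod_cast le_self_add
  have hc2 : (c₂ : ℝ≥0∞) ≤ ↑(c₁ + c₂ + c₃.toNNReal) := by
    rw [add_right_comm]; exact_mod_cast le_add_self
  have hc3 : c₃ ≤ ↑(c₁ + c₂ + c₃.toNNReal) := by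
    rw [← ENNReal.coe_toNNReal hc₃t]; exact_mod_cast le_add_self
  have hg := ne_top_of_le_ne_top hBt hB
  have mF := h.measurable_fdens
  have mG := h.measurable_gdens
  have mp := h.meas_p
  set I := Ioo (-(7 / 8 * γ ^ 2)) (1 / 8 * γ ^ 2) with hI
  have hγ2 : γ ^ 2 ≤ 1 / 16 := by nlinarith
  have hIa : I ⊆ Ioo (-7 / 32) (1 / 32) := Ioo_subset_Ioo (by linarith) (by linarith)
  have hIb : I ⊆ Ioo (-63 / 128) (9 / 128) := Ioo_subset_Ioo (by linarith) (by linarith)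
  have hIc : I ⊆ Ioo (-7 / 8) (1 / 8) := Ioo_subset_Ioo (by linarith) (by linarith)
  have hball : Metric.ball (0 : E3) (1 / 2) ⊆ Metric.ball 0 1 :=
    Metric.ball_subset_ball (by norm_num)
  have hμ : (volume.restrict I) univ ≤ 1 := by
    rw [Measure.restrict_apply_univ, hI, Real.volume_Ioo]
    exact ENNReal.ofReal_le_one.2 (by linarith)
  have hAI := ae_restrict_of_ae_restrict_of_subset hIa hA
  have h1I := ae_restrict_of_ae_restrict_of_subset hIb (h₁ h hf hg)
  have h2I := ae_restrict_of_ae_restrict_of_subset hIb (h₂ h hf hg hp)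
  set β : ℝ → ℝ≥0∞ := fun t => ∫⁻ x in Metric.ball (0 : E3) (3 / 4), gdens Du Da (x, t)
  have mβ : Measurable β := mG.lintegral_prod_left'
  have hβ : ∫⁻ t in I, β t ≤ B :=
    (lintegral_cylinder_mono mG (Metric.ball_subset_ball (by norm_num)) hIc).trans hB
  have hβs : ∀ s : ℝ, 0 < s → s ≤ 1 → ∫⁻ t in I, β t ^ s ≤ B ^ s := fun s hs0 hs1 =>
    (lintegral_rpow_le_rpow_lintegral hμ mβ.aemeasurable hs0 hs1).trans
      (ENNReal.rpow_le_rpow hβ hs0.le)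
  refine ⟨?_, ?_, ?_⟩
  · rw [lintegral_prod_SpT (mF.pow_const _)]
    have mF' := mF.pow_const (3 / 2 : ℝ)
    calc _ ≤ ∫⁻ t in I, c₁ * (A ^ (1 / 2 : ℝ) * β t + ENNReal.ofReal (γ ^ 3) *
          ∫⁻ x in Metric.ball (0 : E3) (1 / 2), fdens u a (x, t) ^ (3 / 2 : ℝ)) := by
          refine lintegral_mono_ae ?_
          filter_upwards [hAI, h1I] with t ht hs
          have := hs.cubic γ (by linarith)
          simp only [famSq_sliceField] at this
          refine this.trans (mul_le_mul' le_rfl (add_le_add (mul_le_mul' ?_ le_rfl) le_rfl))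
          exact ENNReal.rpow_le_rpow ht (by norm_num)
      _ = c₁ * (A ^ (1 / 2 : ℝ) * (∫⁻ t in I, β t) + ENNReal.ofReal (γ ^ 3) *
          ∫⁻ t in I, ∫⁻ x in Metric.ball (0 : E3) (1 / 2), fdens u a (x, t) ^ (3 / 2 : ℝ)) := by
          rw [lintegral_const_mul' _ _ (by simp), lintegral_add_left (mβ.const_mul _),
            lintegral_const_mul _ mβ, lintegral_const_mul' _ _ (by simp)]
      _ ≤ _ := by
          refine mul_le_mul' hc1 (add_le_add (mul_le_mul' le_rfl hβ) (mul_le_mul' le_rfl ?_))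
          exact lintegral_cylinder_mono mF' hball hIc
  · rw [lintegral_prod_SpT (measurable_oscDens h.meas_u h.meas_a γ)]
    calc _ ≤ ∫⁻ t in I, c₃ * (A ^ (1 / 2 : ℝ) * β t + A * β t ^ (1 / 2 : ℝ)) := by
          refine lintegral_mono_ae ?_
          filter_upwards [hAI, h1I] with t ht hs
          refine (hs.trilinear h.meas_u hγ0 (by linarith)).trans (mul_le_mul' le_rfl
            (add_le_add (mul_le_mul' ?_ le_rfl) (mul_le_mul' ht le_rfl)))
          exact ENNReal.rpow_le_rpow ht (by norm_num)
      _ = c₃ * (A ^ (1 / 2 : ℝ) * (∫⁻ t in I, β t) + A * ∫⁻ t in I, β t ^ (1 / 2 : ℝ)) := by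
          rw [lintegral_const_mul' _ _ hc₃t, lintegral_add_left (mβ.const_mul _),
            lintegral_const_mul _ mβ, lintegral_const_mul _ (mβ.pow_const _)]
      _ ≤ _ := mul_le_mul' hc3 (add_le_add (mul_le_mul' le_rfl hβ)
          (mul_le_mul' le_rfl (hβs _ (by norm_num) (by norm_num))))
  · have mP : Measurable fun z => ‖p z‖ₑ ^ (3 / 2 : ℝ) := by fun_prop
    rw [lintegral_prod_SpT mP]
    calc _ ≤ ∫⁻ t in I, c₂ * (A ^ (1 / 2 : ℝ) * β t + A ^ (3 / 4 : ℝ) * β t ^ (3 / 4 : ℝ) +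
          ENNReal.ofReal (γ ^ 3) *
          ∫⁻ x in Metric.ball (0 : E3) (1 / 2), ‖p (x, t)‖ₑ ^ (3 / 2 : ℝ)) := by
          refine lintegral_mono_ae ?_
          filter_upwards [hAI, h2I] with t ht hs
          refine (hs γ hγ).trans (mul_le_mul' le_rfl (add_le_add (add_le_add ?_ ?_) le_rfl)) <;>
          · rw [mul_comm]
            exact mul_le_mul' (ENNReal.rpow_le_rpow ht (by norm_num)) le_rfl
      _ = c₂ * (A ^ (1 / 2 : ℝ) * (∫⁻ t in I, β t) +
          A ^ (3 / 4 : ℝ) * (∫⁻ t in I, β t ^ (3 / 4 : ℝ)) + ENNReal.ofReal (γ ^ 3) *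
          ∫⁻ t in I, ∫⁻ x in Metric.ball (0 : E3) (1 / 2), ‖p (x, t)‖ₑ ^ (3 / 2 : ℝ)) := by
          rw [lintegral_const_mul' _ _ (by simp), lintegral_add_left (by fun_prop),
            lintegral_add_left (mβ.const_mul _),
            lintegral_const_mul _ mβ, lintegral_const_mul _ (mβ.pow_const _),
            lintegral_const_mul' _ _ (by simp)]
      _ ≤ _ := by
          refine mul_le_mul' hc2 (add_le_add (add_le_add (mul_le_mul' le_rfl hβ)
            (mul_le_mul' le_rfl (hβs _ (by norm_num) (by norm_num)))) (mul_le_mul' le_rfl ?_))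
          exact lintegral_cylinder_mono mP hball hIc

/-! ### Slice estimates for the energy flux -/

section
variable {ι : Type*} [Fintype ι]

theorem enorm_setAverage_sq_mul_le {f : E3 → ℝ} {S : Set E3} (h0 : volume S ≠ 0)
    (hT : volume S ≠ ⊤) (hf : Measurable f) :
    ‖⨍ y in S, f y‖ₑ ^ 2 * volume S ≤ ∫⁻ y in S, ‖f y‖ₑ ^ 2 := by
  have h1 : ‖⨍ y in S, f y‖ₑ ≤ (volume S)⁻¹ * ∫⁻ y in S, ‖f y‖ₑ := by
    rw [setAverage_eq, enorm_smul]
    refine mul_le_mul' (le_of_eq ?_) (enorm_integral_le_lintegral_enorm _)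
    rw [Measure.real, enorm_inv (ENNReal.toReal_pos h0 hT).ne', Real.enorm_of_nonneg (by simp),
      ENNReal.ofReal_toReal hT]
  have h2 := lintegral_mul_sq_le (μ := volume.restrict S) (k := fun y => ‖f y‖ₑ)
    (h := fun _ => (1 : ℝ≥0∞)) hf.enorm.aemeasurable aemeasurable_const
  simp only [mul_one, one_pow, lintegral_const, Measure.restrict_apply_univ, one_mul] at h2
  calc _ ≤ ((volume S)⁻¹ * ∫⁻ y in S, ‖f y‖ₑ) ^ 2 * volume S := by gcongr
    _ = (volume S)⁻¹ ^ 2 * volume S * (∫⁻ y in S, ‖f y‖ₑ) ^ 2 := by ring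
    _ ≤ (volume S)⁻¹ ^ 2 * volume S * ((∫⁻ y in S, ‖f y‖ₑ ^ 2) * volume S) :=
        mul_le_mul' le_rfl h2
    _ = ((volume S)⁻¹ * volume S) ^ 2 * (∫⁻ y in S, ‖f y‖ₑ ^ 2) := by ring
    _ = _ := by rw [ENNReal.inv_mul_cancel h0 hT]; simp

theorem meanSq_mul_volume_le {f : ι → E3 → ℝ} (hf : ∀ i, Measurable (f i)) :
    meanSq f * volume (Metric.ball (0 : E3) (1 / 2)) ≤
      ∫⁻ x in Metric.ball (0 : E3) (1 / 2), famSq f x := by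
  unfold meanSq famSq
  rw [lintegral_finsetSum _ fun i _ => (hf i).enorm.pow_const 2, Finset.sum_mul]
  exact Finset.sum_le_sum fun i _ => enorm_setAverage_sq_mul_le
    (Metric.measure_ball_pos _ _ (by norm_num)).ne' measure_ball_lt_top.ne (hf i)

theorem volume_ball_five_eighths_le : volume (Metric.ball (0 : E3) (5 / 8)) ≤
    2 * volume (Metric.ball (0 : E3) (1 / 2)) := by
  rw [volume_ball_E3 (5 / 8), volume_ball_E3 (1 / 2), ← mul_assoc]
  refine mul_le_mul' ?_ le_rfl
  rw [show (2 : ℝ≥0∞) = ENNReal.ofReal 2 by norm_num, ← ENNReal.ofReal_mul (by norm_num)]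
  exact ENNReal.ofReal_le_ofReal (by norm_num)

theorem meanSq_rpow_mul_volume_le {f : ι → E3 → ℝ} (hf : ∀ i, Measurable (f i)) :
    meanSq f ^ (3 / 2 : ℝ) * volume (Metric.ball (0 : E3) (1 / 2)) ≤
      ∫⁻ x in Metric.ball (0 : E3) (1 / 2), famSq f x ^ (3 / 2 : ℝ) := by
  set v := volume (Metric.ball (0 : E3) (1 / 2))
  have hv0 : v ≠ 0 := (Metric.measure_ball_pos _ _ (by norm_num)).ne'
  have hvt : v ≠ ⊤ := measure_ball_lt_top.ne
  have h1 := (ENNReal.rpow_le_rpow (meanSq_mul_volume_le hf) (by norm_num : (0 : ℝ) ≤ 3 / 2)).trans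
    (lintegral_rpow_le_lintegral_rpow (measurable_famSq hf).aemeasurable)
  rw [Measure.restrict_apply_univ, ENNReal.mul_rpow_of_nonneg _ _ (by norm_num),
    show (3 / 2 : ℝ) = 1 / 2 + 1 by norm_num, ENNReal.rpow_add _ _ hv0 hvt, ENNReal.rpow_one] at h1
  have h2 : v ^ (1 / 2 : ℝ) * (meanSq f ^ (1 / 2 + 1 : ℝ) * v) ≤ v ^ (1 / 2 : ℝ) *
      ∫⁻ x in Metric.ball (0 : E3) (1 / 2), famSq f x ^ (1 / 2 + 1 : ℝ) := by
    refine le_trans (le_of_eq ?_) h1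
    ring
  rw [show (3 / 2 : ℝ) = 1 / 2 + 1 by norm_num]
  exact (ENNReal.mul_le_mul_iff_right (by simp [hv0, hvt]) (by finiteness)).1 h2

/-- Hölder's inequality with exponents `4, 4, 2`. -/
theorem lintegral_holder_four_four_two {α : Type*} [MeasurableSpace α] {μ : Measure α}
    {V S w : α → ℝ≥0∞} (hV : Measurable V) (hS : Measurable S) (hw : Measurable w)
    (hw1 : ∀ x, w x ≤ 1) :
    ∫⁻ x, V x ^ (1 / 2 : ℝ) * (w x * S x) ∂μ ≤ (∫⁻ x, V x ^ 2 ∂μ) ^ (1 / 4 : ℝ) *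
      (∫⁻ x, S x * w x ^ 2 ∂μ) ^ (1 / 4 : ℝ) * (∫⁻ x, S x ^ (3 / 2 : ℝ) ∂μ) ^ (1 / 2 : ℝ) := by
  have key : ∀ (y : ℝ≥0∞) (s t : ℝ), (y ^ s) ^ t = y ^ (s * t) := fun y s t =>
    (ENNReal.rpow_mul y s t).symm
  have key2 : ∀ (y : ℝ≥0∞) (s : ℝ), (y ^ s) ^ 2 = y ^ (s * 2) := fun y s => by
    rw [← ENNReal.rpow_natCast, key]; norm_num
  have e1 : ∀ y : ℝ≥0∞, (y ^ 2) ^ (1 / 2 : ℝ) = y := fun y => by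
    rw [← ENNReal.rpow_natCast, key]; norm_num
  have h1 := lintegral_mul_sq_le (μ := μ)
    (k := fun x => V x ^ (1 / 2 : ℝ) * (S x ^ (1 / 4 : ℝ) * w x ^ (1 / 2 : ℝ)))
    (h := fun x => S x ^ (3 / 4 : ℝ)) (by fun_prop) (by fun_prop)
  have h2 := lintegral_mul_sq_le (μ := μ) (k := V) (h := fun x => S x ^ (1 / 2 : ℝ) * w x)
    hV.aemeasurable (by fun_prop)
  have h0 : ∀ x, V x ^ (1 / 2 : ℝ) * (w x * S x) ≤
      V x ^ (1 / 2 : ℝ) * (S x ^ (1 / 4 : ℝ) * w x ^ (1 / 2 : ℝ)) * S x ^ (3 / 4 : ℝ) := by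
    intro x
    have a1 : S x ^ (1 / 4 : ℝ) * S x ^ (3 / 4 : ℝ) = S x := by
      rw [← ENNReal.rpow_add_of_nonneg _ _ (by norm_num) (by norm_num)]; norm_num
    have a2 : w x ≤ w x ^ (1 / 2 : ℝ) := by
      simpa using ENNReal.rpow_le_rpow_of_exponent_ge (hw1 x) (by norm_num : (1 / 2 : ℝ) ≤ 1)
    calc _ ≤ V x ^ (1 / 2 : ℝ) * (w x ^ (1 / 2 : ℝ) * S x) := by gcongr
      _ = V x ^ (1 / 2 : ℝ) * (w x ^ (1 / 2 : ℝ) * (S x ^ (1 / 4 : ℝ) * S x ^ (3 / 4 : ℝ))) := by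
          rw [a1]
      _ = _ := by ring
  simp only [mul_pow, key2] at h1 h2
  norm_num only at h1 h2
  simp only [ENNReal.rpow_one] at h1 h2
  have h3 : ∫⁻ x, V x ^ (1 / 2 : ℝ) * (w x * S x) ∂μ ≤
      (((∫⁻ x, V x ^ 2 ∂μ) * ∫⁻ x, S x * w x ^ 2 ∂μ) ^ (1 / 2 : ℝ) *
        ∫⁻ x, S x ^ (3 / 2 : ℝ) ∂μ) ^ (1 / 2 : ℝ) := by
    rw [← e1 (∫⁻ x, V x ^ (1 / 2 : ℝ) * (w x * S x) ∂μ)]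
    refine ENNReal.rpow_le_rpow ?_ (by norm_num)
    refine ((pow_le_pow_left' (lintegral_mono h0) 2).trans h1).trans (mul_le_mul' ?_ le_rfl)
    rw [← e1 (∫⁻ x, V x * (S x ^ (1 / 2 : ℝ) * w x) ∂μ)]
    exact ENNReal.rpow_le_rpow h2 (by norm_num)
  refine h3.trans (le_of_eq ?_)
  rw [ENNReal.mul_rpow_of_nonneg _ _ (by norm_num), key,
    ENNReal.mul_rpow_of_nonneg _ _ (by norm_num)]
  norm_num

theorem SliceBounds.cubic_oscillation {c : ℝ≥0} {f : ι → E3 → ℝ} {β : ℝ≥0∞}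
    (h : SliceBounds c f β) {w : E3 → ℝ≥0∞} (hw : Measurable w) (hw1 : ∀ x, w x ≤ 1)
    (hw2 : ∀ x ∈ Metric.ball (0 : E3) (1 / 2), w x = 1) :
    ∫⁻ x in Metric.ball (0 : E3) (5 / 8),
      famSq (famOsc f) x ^ (1 / 2 : ℝ) * (w x * (famSq f x + meanSq f)) ≤
    (c * β ^ 2) ^ (1 / 4 : ℝ) *
      (3 * ∫⁻ x in Metric.ball (0 : E3) 1, famSq f x * w x ^ 2) ^ (1 / 4 : ℝ) *
      (6 * ∫⁻ x in Metric.ball (0 : E3) 1, famSq f x ^ (3 / 2 : ℝ)) ^ (1 / 2 : ℝ) := by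
  have mS := measurable_famSq h.meas
  have h58 : Metric.ball (0 : E3) (5 / 8) ⊆ Metric.ball 0 1 :=
    Metric.ball_subset_ball (by norm_num)
  have h12 : Metric.ball (0 : E3) (1 / 2) ⊆ Metric.ball 0 1 :=
    Metric.ball_subset_ball (by norm_num)
  refine (lintegral_holder_four_four_two (measurable_famSq (measurable_famOsc h.meas))
    (mS.add_const _) hw hw1).trans ?_
  refine mul_le_mul' (mul_le_mul' (ENNReal.rpow_le_rpow h.sobolev (by norm_num))
    (ENNReal.rpow_le_rpow ?_ (by norm_num))) (ENNReal.rpow_le_rpow ?_ (by norm_num))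
  · have hm : meanSq f * volume (Metric.ball (0 : E3) (1 / 2)) ≤
        ∫⁻ x in Metric.ball (0 : E3) 1, famSq f x * w x ^ 2 := by
      refine ((meanSq_mul_volume_le h.meas).trans (le_of_eq ?_)).trans (lintegral_mono_set h12)
      exact setLIntegral_congr_fun measurableSet_ball fun x hx => by simp [hw2 x hx]
    calc _ ≤ ∫⁻ x in Metric.ball (0 : E3) (5 / 8), (famSq f x * w x ^ 2 + meanSq f) := by
          refine lintegral_mono fun x => ?_
          rw [add_mul]
          exact add_le_add le_rfl (mul_le_of_le_one_right zero_le (pow_le_one' (hw1 x) 2))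
      _ = (∫⁻ x in Metric.ball (0 : E3) (5 / 8), famSq f x * w x ^ 2) +
          meanSq f * volume (Metric.ball (0 : E3) (5 / 8)) := by
          rw [lintegral_add_right _ measurable_const, setLIntegral_const]
      _ ≤ (∫⁻ x in Metric.ball (0 : E3) 1, famSq f x * w x ^ 2) +
          2 * (meanSq f * volume (Metric.ball (0 : E3) (1 / 2))) := by
          refine add_le_add (lintegral_mono_set h58) ?_
          rw [mul_left_comm]
          exact mul_le_mul' le_rfl volume_ball_five_eighths_le
      _ ≤ (∫⁻ x in Metric.ball (0 : E3) 1, famSq f x * w x ^ 2) +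
          2 * ∫⁻ x in Metric.ball (0 : E3) 1, famSq f x * w x ^ 2 :=
          add_le_add le_rfl (mul_le_mul' le_rfl hm)
      _ = _ := by ring
  · calc _ ≤ ∫⁻ x in Metric.ball (0 : E3) (5 / 8),
          2 * (famSq f x ^ (3 / 2 : ℝ) + meanSq f ^ (3 / 2 : ℝ)) :=
          lintegral_mono fun x => ennreal_add_rpow_three_halves_le _ _
      _ = 2 * ((∫⁻ x in Metric.ball (0 : E3) (5 / 8), famSq f x ^ (3 / 2 : ℝ)) +
          meanSq f ^ (3 / 2 : ℝ) * volume (Metric.ball (0 : E3) (5 / 8))) := by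
          rw [lintegral_const_mul' _ _ (by simp), lintegral_add_right _ measurable_const,
            setLIntegral_const]
      _ ≤ 2 * ((∫⁻ x in Metric.ball (0 : E3) 1, famSq f x ^ (3 / 2 : ℝ)) +
          2 * (meanSq f ^ (3 / 2 : ℝ) * volume (Metric.ball (0 : E3) (1 / 2)))) := by
          refine mul_le_mul' le_rfl (add_le_add (lintegral_mono_set h58) ?_)
          rw [mul_left_comm]
          exact mul_le_mul' le_rfl volume_ball_five_eighths_le
      _ ≤ 2 * ((∫⁻ x in Metric.ball (0 : E3) 1, famSq f x ^ (3 / 2 : ℝ)) +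
          2 * ∫⁻ x in Metric.ball (0 : E3) 1, famSq f x ^ (3 / 2 : ℝ)) :=
          mul_le_mul' le_rfl (add_le_add le_rfl (mul_le_mul' le_rfl
            ((meanSq_rpow_mul_volume_le h.meas).trans (lintegral_mono_set h12))))
      _ = _ := by ring

theorem enorm_le_famSq_rpow (f : ι → E3 → ℝ) (i : ι) (x : E3) :
    ‖f i x‖ₑ ≤ famSq f x ^ (1 / 2 : ℝ) := by
  have h : ‖f i x‖ₑ ^ 2 ≤ famSq f x :=
    Finset.single_le_sum (f := fun i => ‖f i x‖ₑ ^ 2) (fun _ _ => zero_le) (Finset.mem_univ i)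
  have := ENNReal.rpow_le_rpow h (by norm_num : (0 : ℝ) ≤ 1 / 2)
  rw [← ENNReal.rpow_natCast, ← ENNReal.rpow_mul] at this
  simpa using this

theorem enorm_cubic_sub_le (f : ι → E3 → ℝ) (i j k : ι) (x : E3) :
    ‖f i x * (f j x * f k x) - halfMean (f i) * (halfMean (f j) * halfMean (f k))‖ₑ ≤
      2 * (famSq (famOsc f) x ^ (1 / 2 : ℝ) * (famSq f x + meanSq f)) := by
  have hm : ∀ i, ‖halfMean (f i)‖ₑ ≤ meanSq f ^ (1 / 2 : ℝ) := fun i =>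
    enorm_le_famSq_rpow (fun i _ => halfMean (f i)) i x
  have e1 : ∀ y : ℝ≥0∞, (y ^ (1 / 2 : ℝ)) ^ 2 = y := fun y => by
    rw [← ENNReal.rpow_natCast, ← ENNReal.rpow_mul]; norm_num
  set σ := famSq f x ^ (1 / 2 : ℝ) with hσ
  set μ := meanSq f ^ (1 / 2 : ℝ) with hμ
  set ω := famSq (famOsc f) x ^ (1 / 2 : ℝ) with hω
  have hf := fun i => enorm_le_famSq_rpow f i x
  have ho := fun i => enorm_le_famSq_rpow (famOsc f) i x
  have hab : σ * μ ≤ σ ^ 2 + μ ^ 2 := by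
    rcases le_total σ μ with h | h
    · exact (mul_le_mul' h le_rfl).trans (by rw [← sq]; exact le_add_self)
    · exact (mul_le_mul' le_rfl h).trans (by rw [← sq]; exact le_self_add)
  have e : f i x * (f j x * f k x) - halfMean (f i) * (halfMean (f j) * halfMean (f k)) =
      famOsc f i x * (f j x * f k x) + halfMean (f i) * (famOsc f j x * f k x) +
        halfMean (f i) * (halfMean (f j) * famOsc f k x) := by unfold famOsc; ring
  calc _ ≤ ω * (σ * σ) + μ * (ω * σ) + μ * (μ * ω) := by
        rw [e]
        refine (enorm_add_le _ _).trans (add_le_add ((enorm_add_le _ _).trans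
          (add_le_add ?_ ?_)) ?_) <;> simp only [enorm_mul]
        · exact mul_le_mul' (ho i) (mul_le_mul' (hf j) (hf k))
        · exact mul_le_mul' (hm i) (mul_le_mul' (ho j) (hf k))
        · exact mul_le_mul' (hm i) (mul_le_mul' (hm j) (ho k))
    _ = ω * (σ ^ 2 + σ * μ + μ ^ 2) := by ring
    _ ≤ ω * (σ ^ 2 + (σ ^ 2 + μ ^ 2) + μ ^ 2) := by gcongr
    _ = 2 * (ω * (σ ^ 2 + μ ^ 2)) := by ring
    _ = _ := by rw [hσ, hμ, e1, e1]

end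

theorem enorm_coord_le (v : E3) (j : Fin 3) : ‖v j‖ₑ ≤ ‖v‖ₑ := by
  rw [← ofReal_norm, ← ofReal_norm]
  exact ENNReal.ofReal_le_ofReal (PiLp.norm_apply_le v j)

theorem enorm_div_two_le (x : ℝ) : ‖x / 2‖ₑ ≤ ‖x‖ₑ := by
  rw [← ofReal_norm, ← ofReal_norm, norm_div]
  exact ENNReal.ofReal_le_ofReal (by norm_num)

/-- The energy flux through a time slice, estimated after subtraction of constants that are
invisible to divergence-free velocities and to compactly supported cutoffs. -/
theorem enorm_flux_le {S : Set E3} (hS : volume S ≠ ⊤) {U : E3 → E3} {P : E3 → ℝ}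
    {A : E3 → Fin 3 → Fin 3 → ℝ} {Ψ : Fin 3 → E3 → ℝ} {L : ℝ≥0} (mU : Measurable U)
    (mP : Measurable P) (mA : Measurable A) (mΨ : ∀ j, Measurable (Ψ j))
    (hΨ : ∀ j x, ‖Ψ j x‖ₑ ≤ L) (hΨ0 : ∀ j, ∫ x in S, Ψ j x = 0) (hU : IntegrableOn U S)
    (hdiv : ∫ x in S, ∑ j, U x j * Ψ j x = 0) (c₁ c₂ : ℝ) (κ : Fin 3 → Fin 3 → Fin 3 → ℝ) :
    ‖∫ x in S, ((‖U x‖ ^ 2 / 2 + nsq2 (A x) / 2 + P x) * (∑ j, U x j * Ψ j x) +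
      ∑ i, ∑ j, U x i * Ψ j x * (∑ k, A x k i * A x k j))‖ₑ ≤
    3 * L * (∫⁻ x in S, ‖U x‖ₑ * (‖‖U x‖ ^ 2 - c₁‖ₑ + ‖nsq2 (A x) - c₂‖ₑ)) +
      3 * L * (∫⁻ x in S, ‖U x‖ₑ * ‖P x‖ₑ) +
      ∫⁻ x in S, ∑ i, ∑ j, ∑ k, ‖Ψ j x‖ₑ * ‖U x i * (A x k i * A x k j) - κ i j k‖ₑ := by
  set H : E3 → ℝ := fun x => (‖U x‖ ^ 2 / 2 + nsq2 (A x) / 2 + P x) * (∑ j, U x j * Ψ j x) +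
      ∑ i, ∑ j, U x i * Ψ j x * (∑ k, A x k i * A x k j) with hH
  set G : E3 → ℝ := fun x => (c₁ / 2 + c₂ / 2) * (∑ j, U x j * Ψ j x) +
    ∑ i, ∑ j, ∑ k, κ i j k * Ψ j x with hG
  set H' : E3 → ℝ := fun x => ((‖U x‖ ^ 2 - c₁) / 2 + (nsq2 (A x) - c₂) / 2 + P x) *
    (∑ j, U x j * Ψ j x) + ∑ i, ∑ j, ∑ k, Ψ j x * (U x i * (A x k i * A x k j) - κ i j k) with hH'
  have hsub : ∀ x, H x - G x = H' x := by
    intro x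
    simp only [hH, hG, hH', Fin.sum_univ_three]
    ring
  by_cases hint : IntegrableOn H S
  swap
  · rw [integral_undef hint]; simp
  have iΨ : ∀ j, IntegrableOn (Ψ j) S := fun j => by
    refine Measure.integrableOn_of_bounded (M := L) hS (mΨ j).aestronglyMeasurable
      (Eventually.of_forall fun x => ?_)
    have := hΨ j x
    rw [← ofReal_norm, ENNReal.ofReal_le_iff_le_toReal (by simp)] at this
    simpa using this
  have iUΨ : ∀ j, IntegrableOn (fun x => U x j * Ψ j x) S := fun j => by
    refine Integrable.mul_bdd (c := L) ?_ (mΨ j).aestronglyMeasurable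
      (Eventually.of_forall fun x => ?_)
    · exact (EuclideanSpace.proj (𝕜 := ℝ) j).integrable_comp hU
    · have := hΨ j x
      rw [← ofReal_norm, ENNReal.ofReal_le_iff_le_toReal (by simp)] at this
      simpa using this
  have i1 : IntegrableOn (fun x => (c₁ / 2 + c₂ / 2) * (∑ j, U x j * Ψ j x)) S :=
    (integrable_finsetSum _ fun j _ => iUΨ j).const_mul _
  have i2 : IntegrableOn (fun x => ∑ i, ∑ j, ∑ k, κ i j k * Ψ j x) S :=
    integrable_finsetSum _ fun i _ => integrable_finsetSum _ fun j _ =>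
      integrable_finsetSum _ fun k _ => (iΨ j).const_mul _
  have hG0 : ∫ x in S, G x = 0 := by
    rw [hG, integral_add i1 i2, integral_const_mul, hdiv, mul_zero, zero_add,
      integral_finsetSum _ fun i _ => integrable_finsetSum _ fun j _ =>
      integrable_finsetSum _ fun k _ => (iΨ j).const_mul _]
    refine Finset.sum_eq_zero fun i _ => ?_
    rw [integral_finsetSum _ fun j _ => integrable_finsetSum _ fun k _ => (iΨ j).const_mul _]
    refine Finset.sum_eq_zero fun j _ => ?_
    rw [integral_finsetSum _ fun k _ => (iΨ j).const_mul _]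
    refine Finset.sum_eq_zero fun k _ => ?_
    rw [integral_const_mul, hΨ0, mul_zero]
  have hHH' : ∫ x in S, H x = ∫ x in S, H' x := by
    have iG : IntegrableOn G S := i1.add i2
    rw [← sub_zero (∫ x in S, H x), ← hG0, ← integral_sub hint iG]
    simp only [hsub]
  have mUj : ∀ j, Measurable fun x => U x j := fun j => by fun_prop
  have mN : Measurable fun x => nsq2 (A x) := by unfold nsq2; fun_prop
  have hUΨ : ∀ x, ‖∑ j, U x j * Ψ j x‖ₑ ≤ 3 * L * ‖U x‖ₑ := by
    intro x
    refine (enorm_sum_le _ _).trans ?_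
    calc _ ≤ ∑ _j : Fin 3, ‖U x‖ₑ * L := Finset.sum_le_sum fun j _ => by
            rw [enorm_mul]; exact mul_le_mul' (enorm_coord_le _ _) (hΨ j x)
      _ = _ := by simp; ring
  have hpt : ∀ x, ‖H' x‖ₑ ≤
      3 * L * (‖U x‖ₑ * (‖‖U x‖ ^ 2 - c₁‖ₑ + ‖nsq2 (A x) - c₂‖ₑ)) + 3 * L * (‖U x‖ₑ * ‖P x‖ₑ) +
      ∑ i, ∑ j, ∑ k, ‖Ψ j x‖ₑ * ‖U x i * (A x k i * A x k j) - κ i j k‖ₑ := by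
    intro x
    refine (enorm_add_le _ _).trans (add_le_add ?_ ?_)
    · rw [enorm_mul]
      calc _ ≤ (‖‖U x‖ ^ 2 - c₁‖ₑ + ‖nsq2 (A x) - c₂‖ₑ + ‖P x‖ₑ) * (3 * L * ‖U x‖ₑ) := by
            refine mul_le_mul' ((enorm_add_le _ _).trans (add_le_add ((enorm_add_le _ _).trans
              (add_le_add (enorm_div_two_le _) (enorm_div_two_le _))) le_rfl)) (hUΨ x)
        _ = _ := by ring
    · refine (enorm_sum_le _ _).trans (Finset.sum_le_sum fun i _ => ?_)
      refine (enorm_sum_le _ _).trans (Finset.sum_le_sum fun j _ => ?_)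
      refine (enorm_sum_le _ _).trans (Finset.sum_le_sum fun k _ => ?_)
      rw [enorm_mul]
  rw [hHH']
  refine (enorm_integral_le_lintegral_enorm _).trans ((lintegral_mono hpt).trans (le_of_eq ?_))
  rw [lintegral_add_left (by fun_prop), lintegral_add_left (by fun_prop),
    lintegral_const_mul' _ _ (by finiteness), lintegral_const_mul' _ _ (by finiteness)]

/-- Product cutoffs `χ(x)² θ(t)` adapted to the cylinders of radii `1/2` and `3/4`. -/
structure EnergyCutoff (χ : E3 → ℝ) (θ : ℝ → ℝ) (L : ℝ≥0) : Prop where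
  smooth_space : ContDiff ℝ (⊤ : ℕ∞) χ
  smooth_time : ContDiff ℝ (⊤ : ℕ∞) θ
  compact_space : HasCompactSupport χ
  compact_time : HasCompactSupport θ
  support_space : tsupport χ ⊆ Metric.ball 0 (5 / 8)
  support_time : tsupport θ ⊆ Ioo (-63 / 128) (9 / 128)
  space_nonneg : ∀ x, 0 ≤ χ x
  space_le_one : ∀ x, χ x ≤ 1
  space_eq_one : ∀ x ∈ Metric.ball (0 : E3) (1 / 2), χ x = 1
  time_nonneg : ∀ t, 0 ≤ θ t
  time_le_one : ∀ t, θ t ≤ 1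
  time_eq_one : ∀ t ∈ Ioo (-7 / 32 : ℝ) (1 / 32), θ t = 1
  grad_le : ∀ j x, ‖pderiv3 j (fun y => χ y ^ 2) x‖ₑ ≤ L * ENNReal.ofReal (χ x)
  heat_le : ∀ z : SpT, |tderiv (fun z => χ z.1 ^ 2 * θ z.2) z +
    sLap (fun z => χ z.1 ^ 2 * θ z.2) z| ≤ L

theorem pderiv3_sq {χ : E3 → ℝ} (hχ : Differentiable ℝ χ) (j : Fin 3) (x : E3) :
    pderiv3 j (fun y => χ y ^ 2) x = 2 * χ x * pderiv3 j χ x := by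
  unfold pderiv3
  rw [(((hχ x).hasFDerivAt).pow 2).fderiv]
  simp

theorem hasCompactSupport_sq {χ : E3 → ℝ} (h : HasCompactSupport χ) :
    HasCompactSupport fun y => χ y ^ 2 := by
  have : (fun y => χ y ^ 2) = fun y => χ y * χ y := by funext y; ring
  rw [this]
  exact h.mul_left

theorem tsupport_sq_subset (χ : E3 → ℝ) : tsupport (fun y => χ y ^ 2) ⊆ tsupport χ := by
  refine closure_mono fun x hx => ?_
  simpa using hx

theorem exists_bound_norm_pderiv3 {ξ : E3 → ℝ} (hξ : ContDiff ℝ (⊤ : ℕ∞) ξ) (hξc : HasCompactSupport ξ)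
    (j : Fin 3) : ∃ C : ℝ, ∀ x, ‖pderiv3 j ξ x‖ ≤ C :=
  (hξc.fderiv_apply ℝ (EuclideanSpace.single j 1)).exists_bound_of_continuous
    (contDiff_pderiv3 hξ j).continuous

theorem EnergyCutoff.exists : ∃ χ θ L, EnergyCutoff χ θ L := by
  let χ : ContDiffBump (0 : E3) := ⟨1 / 2, 9 / 16, by norm_num, by norm_num⟩
  let θ : ContDiffBump (-3 / 32 : ℝ) := ⟨1 / 8, 5 / 32, by norm_num, by norm_num⟩
  have sχ : ContDiff ℝ (⊤ : ℕ∞) χ := χ.contDiff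
  have sθ : ContDiff ℝ (⊤ : ℕ∞) θ := θ.contDiff
  have cχ2 := hasCompactSupport_sq χ.hasCompactSupport
  choose C hC using fun j => exists_bound_norm_pderiv3 sχ χ.hasCompactSupport j
  have hC2 : ∀ j, ∃ C : ℝ, ∀ x, ‖pderiv3 j (pderiv3 j fun y => χ y ^ 2) x‖ ≤ C := fun j =>
    exists_bound_norm_pderiv3 (contDiff_pderiv3 (sχ.pow 2) j) (cχ2.fderiv_apply ℝ _) j
  choose C₂ hC₂ using hC2
  obtain ⟨C₃, hC₃⟩ := (HasCompactSupport.deriv (𝕜 := ℝ) θ.hasCompactSupport).exists_bound_of_continuous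
    (sθ.continuous_deriv (by simp))
  have hC0 : ∀ j, 0 ≤ C j := fun j => (norm_nonneg _).trans (hC j 0)
  have hC₂0 : ∀ j, 0 ≤ C₂ j := fun j => (norm_nonneg _).trans (hC₂ j 0)
  have hC₃0 : 0 ≤ C₃ := (norm_nonneg _).trans (hC₃ 0)
  refine ⟨χ, θ, (2 * (∑ j, C j) + (∑ j, C₂ j) + C₃).toNNReal, sχ, sθ, χ.hasCompactSupport,
    θ.hasCompactSupport, ?_, ?_, fun x => χ.nonneg, fun x => χ.le_one, ?_, fun t => θ.nonneg,
    fun t => θ.le_one, ?_, ?_, ?_⟩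
  · rw [χ.tsupport_eq]
    exact Metric.closedBall_subset_ball (by norm_num [χ])
  · rw [θ.tsupport_eq, Real.closedBall_eq_Icc]
    exact fun t ht => ⟨by have := ht.1; norm_num [θ] at this; linarith,
      by have := ht.2; norm_num [θ] at this; linarith⟩
  · exact fun x hx => χ.one_of_mem_closedBall (Metric.ball_subset_closedBall hx)
  · refine fun t ht => θ.one_of_mem_closedBall ?_
    rw [Real.closedBall_eq_Icc]
    exact ⟨by have := ht.1; norm_num [θ]; linarith, by have := ht.2; norm_num [θ]; linarith⟩
  · intro j x
    rw [pderiv3_sq (sχ.differentiable (by simp)), ← ofReal_norm, ← ENNReal.ofReal_coe_nnreal,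
      ← ENNReal.ofReal_mul (by simp)]
    refine ENNReal.ofReal_le_ofReal ?_
    have h0 : (0 : ℝ) ≤ χ x := χ.nonneg
    have h1 : C j ≤ ∑ j, C j := Finset.single_le_sum (fun i _ => hC0 i) (Finset.mem_univ j)
    have h2 := Finset.sum_nonneg fun i (_ : i ∈ Finset.univ) => hC₂0 i
    have h3 := (hC0 j).trans h1
    rw [Real.coe_toNNReal _ (by positivity), norm_mul, norm_mul, Real.norm_of_nonneg h0,
      Real.norm_ofNat]
    nlinarith [hC j x, mul_le_mul_of_nonneg_left ((hC j x).trans h1) h0]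
  · intro z
    have h1 := Finset.sum_nonneg fun i (_ : i ∈ Finset.univ) => hC0 i
    rw [tderiv_tensor (sχ.pow 2) sθ, sLap_tensor (sχ.pow 2) sθ, Real.coe_toNNReal _ (by
      have := Finset.sum_nonneg fun i (_ : i ∈ Finset.univ) => hC₂0 i
      positivity)]
    have hχ0 : (0 : ℝ) ≤ χ z.1 := χ.nonneg
    have hχ1 : χ z.1 ≤ 1 := χ.le_one
    have hθ0 : (0 : ℝ) ≤ θ z.2 := θ.nonneg
    have hθ1 : θ z.2 ≤ 1 := θ.le_one
    have a1 : |χ z.1 ^ 2 * deriv θ z.2| ≤ C₃ := by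
      rw [abs_mul, abs_of_nonneg (by positivity)]
      exact (mul_le_of_le_one_left (abs_nonneg _) (pow_le_one₀ hχ0 hχ1)).trans (hC₃ z.2)
    have a2 : |(∑ j, pderiv3 j (pderiv3 j fun y => χ y ^ 2) z.1) * θ z.2| ≤ ∑ j, C₂ j := by
      rw [abs_mul, abs_of_nonneg hθ0]
      exact (mul_le_of_le_one_right (abs_nonneg _) hθ1).trans
        ((Finset.abs_sum_le_sum_abs _ _).trans (Finset.sum_le_sum fun j _ => hC₂ j z.1))
    linarith [abs_add_le (χ z.1 ^ 2 * deriv θ z.2)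
      ((∑ j, pderiv3 j (pderiv3 j fun y => χ y ^ 2) z.1) * θ z.2)]

/-! ### The local energy estimate -/

theorem integral_pderiv3_eq_zero {ξ : E3 → ℝ} (hξ : ContDiff ℝ (⊤ : ℕ∞) ξ)
    (hξc : HasCompactSupport ξ) {S : Set E3} (hS : tsupport ξ ⊆ S) (j : Fin 3) :
    ∫ x in S, pderiv3 j ξ x = 0 := by
  have hc : HasCompactSupport (pderiv3 j ξ) := hξc.fderiv_apply ℝ _
  rw [setIntegral_eq_integral_of_forall_compl_eq_zero fun x hx => ?_]
  · have h := integral_mul_fderiv_eq_neg_fderiv_mul_of_integrable (μ := volume)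
      (f := fun _ : E3 => (1 : ℝ)) (g := ξ) (v := EuclideanSpace.single j 1) (by simp) ?_ ?_
      (fun x _ => differentiableAt_const _)
      (fun x _ => (hξ.differentiable (by simp)) x)
    · simpa [pderiv3] using h
    · simp only [one_mul]
      exact (contDiff_pderiv3 hξ j).continuous.integrable_of_hasCompactSupport hc
    · simpa using hξ.continuous.integrable_of_hasCompactSupport hξc
  · have : x ∉ tsupport ξ := fun h => hx (hS h)
    unfold pderiv3
    rw [fderiv_of_notMem_tsupport (𝕜 := ℝ) this]
    simp

section
variable {K : ℝ} {u d : SpT → E3} {p : SpT → ℝ} {Du a : SpT → Fin 3 → Fin 3 → ℝ}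
  {Da : SpT → Fin 3 → Fin 3 → Fin 3 → ℝ} {χ : E3 → ℝ} {θ : ℝ → ℝ} {L : ℝ≥0}

/-- The flux density in the local energy inequality for the cutoff `χ² θ`. -/
def cutoffFlux (u : SpT → E3) (p : SpT → ℝ) (a : SpT → Fin 3 → Fin 3 → ℝ) (χ : E3 → ℝ)
    (θ : ℝ → ℝ) (t : ℝ) : ℝ :=
  ∫ x in Metric.ball (0 : E3) 1, ((‖u (x, t)‖ ^ 2 / 2 + nsq2 (a (x, t)) / 2 + p (x, t)) *
      (∑ j, u (x, t) j * sderiv j (fun z => χ z.1 ^ 2 * θ z.2) (x, t)) +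
    ∑ i, ∑ j, u (x, t) i * sderiv j (fun z => χ z.1 ^ 2 * θ z.2) (x, t) *
      (∑ k, a (x, t) k i * a (x, t) k j))

theorem cutoffFlux_eq (hc : EnergyCutoff χ θ L) (t : ℝ) :
    cutoffFlux u p a χ θ t = θ t * ∫ x in Metric.ball (0 : E3) 1,
      ((‖u (x, t)‖ ^ 2 / 2 + nsq2 (a (x, t)) / 2 + p (x, t)) *
        (∑ j, u (x, t) j * pderiv3 j (fun y => χ y ^ 2) x) +
      ∑ i, ∑ j, u (x, t) i * pderiv3 j (fun y => χ y ^ 2) x *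
        (∑ k, a (x, t) k i * a (x, t) k j)) := by
  unfold cutoffFlux
  rw [← integral_const_mul]
  refine integral_congr_ae (Eventually.of_forall fun x => ?_)
  simp only [sderiv_tensor (hc.smooth_space.pow 2) hc.smooth_time, Fin.sum_univ_three]
  ring

theorem sum_cubic_le (κ : Fin 3 → Fin 3 → Fin 3 → ℝ) (Ψ : Fin 3 → ℝ) (U : Fin 3 → ℝ)
    (A : Fin 3 → Fin 3 → ℝ) {W V : ℝ≥0∞} (hΨ : ∀ j, ‖Ψ j‖ₑ ≤ W)
    (hV : ∀ i j k, ‖U i * (A k i * A k j) - κ i j k‖ₑ ≤ V) :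
    ∑ i, ∑ j, ∑ k, ‖Ψ j‖ₑ * ‖U i * (A k i * A k j) - κ i j k‖ₑ ≤ 27 * (W * V) := by
  calc _ ≤ ∑ _i : Fin 3, ∑ _j : Fin 3, ∑ _k : Fin 3, W * V :=
        Finset.sum_le_sum fun i _ => Finset.sum_le_sum fun j _ => Finset.sum_le_sum fun k _ =>
          mul_le_mul' (hΨ j) (hV i j k)
    _ = _ := by simp; ring

theorem cutoffFlux_le (h : UnitTriple K u d p Du a Da) (hc : EnergyCutoff χ θ L) {t : ℝ}
    (hU : IntegrableOn (fun x => u (x, t)) (Metric.ball 0 1))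
    (hdiv : ∫ x in Metric.ball (0 : E3) 1,
      ∑ j, u (x, t) j * pderiv3 j (fun y => χ y ^ 2) x = 0) :
    ‖cutoffFlux u p a χ θ t‖ₑ ≤ 3 * L * (∫⁻ x in Metric.ball (0 : E3) 1, oscDens u a 1 (x, t)) +
      3 * L * (∫⁻ x in Metric.ball (0 : E3) 1, ‖u (x, t)‖ₑ * ‖p (x, t)‖ₑ) +
      27 * (L * ∫⁻ x in Metric.ball (0 : E3) 1, fdens u a (x, t) ^ (3 / 2 : ℝ)) ∧
    ∀ {c : ℝ≥0} {β : ℝ≥0∞}, SliceBounds c (sliceField u a t) β →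
    ‖cutoffFlux u p a χ θ t‖ₑ ≤ 3 * L * (∫⁻ x in Metric.ball (0 : E3) 1, oscDens u a 1 (x, t)) +
      3 * L * (∫⁻ x in Metric.ball (0 : E3) 1, ‖u (x, t)‖ₑ * ‖p (x, t)‖ₑ) +
      54 * L * ((c * β ^ 2) ^ (1 / 4 : ℝ) *
      (3 * (ENNReal.ofReal (θ t) * ∫⁻ x in Metric.ball (0 : E3) 1,
        fdens u a (x, t) * ENNReal.ofReal (χ x) ^ 2)) ^ (1 / 4 : ℝ) *
      (6 * ∫⁻ x in Metric.ball (0 : E3) 1, fdens u a (x, t) ^ (3 / 2 : ℝ)) ^ (1 / 2 : ℝ)) := by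
  have mu := h.meas_u
  have mp := h.meas_p
  have ma := h.meas_a
  have mf := h.measurable_fdens
  have mfx : Measurable fun x => fdens u a (x, t) := mf.comp measurable_prodMk_right
  set Ψ : Fin 3 → E3 → ℝ := fun j => pderiv3 j (fun y => χ y ^ 2) with hΨd
  have mΨ : ∀ j, Measurable (Ψ j) := fun j =>
    (contDiff_pderiv3 (hc.smooth_space.pow 2) j).continuous.measurable
  have hw1 : ∀ x, ENNReal.ofReal (χ x) ≤ 1 := fun x => by simpa using hc.space_le_one x
  have hΨL : ∀ j x, ‖Ψ j x‖ₑ ≤ L := fun j x =>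
    (hc.grad_le j x).trans (mul_le_of_le_one_right' (hw1 x))
  have hΨ0 : ∀ j, ∫ x in Metric.ball (0 : E3) 1, Ψ j x = 0 := fun j =>
    integral_pderiv3_eq_zero (hc.smooth_space.pow 2) (hasCompactSupport_sq hc.compact_space)
      ((tsupport_sq_subset χ).trans (hc.support_space.trans
        (Metric.ball_subset_ball (by norm_num)))) j
  have key := fun κ => enorm_flux_le (S := Metric.ball (0 : E3) 1) measure_ball_lt_top.ne
    (U := fun x => u (x, t)) (P := fun x => p (x, t)) (A := fun x => a (x, t)) (Ψ := Ψ) (L := L)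
    (mu.comp measurable_prodMk_right) (mp.comp measurable_prodMk_right)
    (ma.comp measurable_prodMk_right) mΨ hΨL hΨ0 hU hdiv
    (⨍ y in Metric.ball (0 : E3) 1, ‖u (y, t)‖ ^ 2)
    (⨍ y in Metric.ball (0 : E3) 1, nsq2 (a (y, t))) κ
  set f := sliceField u a t with hf
  have hfam : ∀ x, famSq f x = fdens u a (x, t) := fun x => famSq_sliceField u a t x
  have hθ1 : ENNReal.ofReal (θ t) ≤ 1 := by simpa using hc.time_le_one t
  set O := ∫⁻ x in Metric.ball (0 : E3) 1, oscDens u a 1 (x, t)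
  set N := ∫⁻ x in Metric.ball (0 : E3) 1, ‖u (x, t)‖ₑ * ‖p (x, t)‖ₑ
  have hθe : ‖θ t‖ₑ = ENNReal.ofReal (θ t) := Real.enorm_of_nonneg (hc.time_nonneg t)
  constructor
  · rw [cutoffFlux_eq hc, enorm_mul, hθe]
    refine (mul_le_of_le_one_left' hθ1).trans ((key 0).trans (add_le_add le_rfl ?_))
    rw [← lintegral_const_mul' _ _ (by simp), ← lintegral_const_mul' _ _ (by simp)]
    refine lintegral_mono fun x => ?_
    refine sum_cubic_le 0 (fun j => Ψ j x) (fun i => u (x, t) i) (a (x, t))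
      (fun j => hΨL j x) fun i j k => ?_
    rw [← hfam]
    have e1 := enorm_le_famSq_rpow f (Sum.inl i) x
    have e2 := enorm_le_famSq_rpow f (Sum.inr (k, i)) x
    have e3 := enorm_le_famSq_rpow f (Sum.inr (k, j)) x
    calc _ = ‖f (Sum.inl i) x * (f (Sum.inr (k, i)) x * f (Sum.inr (k, j)) x)‖ₑ := by
          simp; rfl
      _ ≤ famSq f x ^ (1 / 2 : ℝ) * (famSq f x ^ (1 / 2 : ℝ) * famSq f x ^ (1 / 2 : ℝ)) := by
          rw [enorm_mul, enorm_mul]; gcongr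
      _ = _ := by
          rw [← ENNReal.rpow_add_of_nonneg _ _ (by norm_num) (by norm_num),
            ← ENNReal.rpow_add_of_nonneg _ _ (by norm_num) (by norm_num)]
          norm_num
  · intro c β hb
    rw [cutoffFlux_eq hc, enorm_mul, hθe]
    set w : E3 → ℝ≥0∞ := fun x => ENNReal.ofReal (χ x) with hw
    have mw : Measurable w := hc.smooth_space.continuous.measurable.ennreal_ofReal
    have hco := hb.cubic_oscillation mw hw1 (fun x hx => by
      simp [hw, hc.space_eq_one x hx])
    have hk := key fun i j k => halfMean (f (Sum.inl i)) *
      (halfMean (f (Sum.inr (k, i))) * halfMean (f (Sum.inr (k, j))))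
    set g : E3 → ℝ≥0∞ := fun x =>
      famSq (famOsc f) x ^ (1 / 2 : ℝ) * (w x * (famSq f x + meanSq f)) with hg
    set R := (c * β ^ 2) ^ (1 / 4 : ℝ) *
      (3 * ∫⁻ x in Metric.ball (0 : E3) 1, famSq f x * w x ^ 2) ^ (1 / 4 : ℝ) *
      (6 * ∫⁻ x in Metric.ball (0 : E3) 1, famSq f x ^ (3 / 2 : ℝ)) ^ (1 / 2 : ℝ) with hR
    have hlast : ∫⁻ x in Metric.ball (0 : E3) 1, ∑ i, ∑ j, ∑ k, ‖Ψ j x‖ₑ *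
        ‖u (x, t) i * (a (x, t) k i * a (x, t) k j) - halfMean (f (Sum.inl i)) *
      (halfMean (f (Sum.inr (k, i))) * halfMean (f (Sum.inr (k, j))))‖ₑ ≤ 54 * L * R := by
      refine le_trans ?_ (mul_le_mul' le_rfl hco)
      rw [← lintegral_const_mul' _ _ (by finiteness),
        ← lintegral_indicator (s := Metric.ball (0 : E3) (5 / 8)) measurableSet_ball]
      refine (lintegral_mono fun x => ?_).trans (setLIntegral_le_lintegral _ _)
      have h1 := sum_cubic_le (fun i j k => halfMean (f (Sum.inl i)) *
        (halfMean (f (Sum.inr (k, i))) * halfMean (f (Sum.inr (k, j))))) (fun j => Ψ j x)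
        (fun i => u (x, t) i) (a (x, t)) (fun j => hc.grad_le j x)
        fun i j k => enorm_cubic_sub_le f (Sum.inl i) (Sum.inr (k, i)) (Sum.inr (k, j)) x
      refine h1.trans ?_
      by_cases hx : x ∈ Metric.ball (0 : E3) (5 / 8)
      · rw [indicator_of_mem hx]
        refine le_of_eq ?_
        simp only [hw]
        ring
      · have : χ x = 0 := by
          by_contra h0
          exact hx (hc.support_space (subset_tsupport _ h0))
        simp [this]
    have hθ4 : ENNReal.ofReal (θ t) ≤ ENNReal.ofReal (θ t) ^ (1 / 4 : ℝ) := by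
      conv_lhs => rw [← ENNReal.rpow_one (ENNReal.ofReal (θ t))]
      exact ENNReal.rpow_le_rpow_of_exponent_ge hθ1 (by norm_num)
    calc _ ≤ ENNReal.ofReal (θ t) * (3 * L * O + 3 * L * N + 54 * L * R) :=
          mul_le_mul' le_rfl (hk.trans (add_le_add le_rfl hlast))
      _ = ENNReal.ofReal (θ t) * (3 * L * O + 3 * L * N) +
          54 * L * (ENNReal.ofReal (θ t) * R) := by ring
      _ ≤ _ := by
          refine add_le_add (mul_le_of_le_one_left' hθ1) (mul_le_mul' le_rfl ?_)
          simp only [← hfam]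
          rw [mul_left_comm 3, ENNReal.mul_rpow_of_nonneg (ENNReal.ofReal (θ t)) _ (by norm_num)]
          refine (mul_le_mul' hθ4 le_rfl).trans (le_of_eq ?_)
          rw [hR]
          ring

end

/-- Absorption of a sublinear term. -/
theorem le_of_le_add_mul_rpow_quarter {P Q Y : ℝ≥0∞} (hY : Y ≠ ⊤)
    (h : Y ≤ P + Q * Y ^ (1 / 4 : ℝ)) : Y ≤ 2 * P + (2 * Q) ^ (4 / 3 : ℝ) := by
  rcases le_total (Q * Y ^ (1 / 4 : ℝ)) P with h1 | h1
  · exact (h.trans (add_le_add le_rfl h1)).trans (by rw [← two_mul]; exact le_self_add)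
  · refine le_add_left ?_
    rcases eq_or_ne Y 0 with rfl | hY0
    · exact zero_le
    have h2 : Y ^ (3 / 4 : ℝ) * Y ^ (1 / 4 : ℝ) ≤ 2 * Q * Y ^ (1 / 4 : ℝ) := by
      rw [← ENNReal.rpow_add _ _ hY0 hY, show (3 / 4 + 1 / 4 : ℝ) = 1 by norm_num,
        ENNReal.rpow_one, mul_assoc, two_mul]
      exact h.trans (add_le_add h1 le_rfl)
    have h3 : Y ^ (3 / 4 : ℝ) ≤ 2 * Q :=
      (ENNReal.mul_le_mul_iff_left (by simp [hY0, hY]) (by finiteness)).1 h2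
    calc Y = (Y ^ (3 / 4 : ℝ)) ^ (4 / 3 : ℝ) := by
          rw [← ENNReal.rpow_mul]; norm_num
      _ ≤ _ := ENNReal.rpow_le_rpow h3 (by norm_num)

section
variable {K : ℝ} {u d : SpT → E3} {p : SpT → ℝ} {Du a : SpT → Fin 3 → Fin 3 → ℝ}
  {Da : SpT → Fin 3 → Fin 3 → Fin 3 → ℝ} {χ : E3 → ℝ} {θ : ℝ → ℝ} {L : ℝ≥0}

theorem measurable_slice_lintegral {f : SpT → ℝ≥0∞} (hf : Measurable f) (S : Set E3) :
    Measurable fun t => ∫⁻ x in S, f (x, t) :=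
  hf.lintegral_prod_left'

theorem UnitTriple.integrableOn_u (h : UnitTriple K u d p Du a Da) {Q : Set SpT}
    (hQ : volume Q ≠ ⊤) (hf : ∫⁻ z in Q, fdens u a z ≠ ⊤) : IntegrableOn u Q := by
  refine ⟨h.meas_u.aestronglyMeasurable, ?_⟩
  have hpt : ∀ z, ‖u z‖ₑ ≤ 1 + fdens u a z := fun z => by
    rcases le_total ‖u z‖ₑ 1 with h1 | h1
    · exact h1.trans le_self_add
    · refine le_add_left (le_trans ?_ (enorm_u_sq_le z))
      rw [sq]
      exact le_mul_of_one_le_left' h1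
  refine (lintegral_mono hpt).trans_lt ?_
  rw [lintegral_add_left measurable_const]
  simp [hQ.lt_top, Ne.lt_top hf]

theorem slice_energy_eq (hc : EnergyCutoff χ θ L) (hu : Measurable u) (ha : Measurable a) {t : ℝ}
    (hf : ∫⁻ x in Metric.ball (0 : E3) 1, fdens u a (x, t) ≠ ⊤) :
    ENNReal.ofReal (∫ x in Metric.ball (0 : E3) 1,
      (‖u (x, t)‖ ^ 2 + nsq2 (a (x, t))) * (χ x ^ 2 * θ t)) =
    ENNReal.ofReal (θ t) *
      ∫⁻ x in Metric.ball (0 : E3) 1, fdens u a (x, t) * ENNReal.ofReal (χ x) ^ 2 := by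
  have hn : ∀ x, 0 ≤ ‖u (x, t)‖ ^ 2 + nsq2 (a (x, t)) := fun x => by unfold nsq2; positivity
  have hm : Measurable fun x => ‖u (x, t)‖ ^ 2 + nsq2 (a (x, t)) := by unfold nsq2; fun_prop
  have hχ := hc.smooth_space.continuous.measurable
  have hi : IntegrableOn (fun x => ‖u (x, t)‖ ^ 2 + nsq2 (a (x, t))) (Metric.ball (0 : E3) 1) :=
    (lintegral_ofReal_ne_top_iff_integrable hm.aestronglyMeasurable
      (Eventually.of_forall hn)).1 hf
  have hi2 : IntegrableOn (fun x => (‖u (x, t)‖ ^ 2 + nsq2 (a (x, t))) * (χ x ^ 2 * θ t))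
      (Metric.ball (0 : E3) 1) := by
    refine hi.mul_bdd (c := 1) (by fun_prop) (Eventually.of_forall fun x => ?_)
    rw [Real.norm_of_nonneg (mul_nonneg (sq_nonneg _) (hc.time_nonneg t))]
    exact mul_le_one₀ (pow_le_one₀ (hc.space_nonneg x) (hc.space_le_one x)) (hc.time_nonneg t)
      (hc.time_le_one t)
  rw [ofReal_integral_eq_lintegral_ofReal hi2 (Eventually.of_forall fun x =>
    mul_nonneg (hn x) (mul_nonneg (sq_nonneg _) (hc.time_nonneg t))),
    ← lintegral_const_mul' _ _ (by simp)]
  refine lintegral_congr fun x => ?_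
  rw [ENNReal.ofReal_mul (hn x), ENNReal.ofReal_mul (sq_nonneg _),
    ENNReal.ofReal_pow (hc.space_nonneg x), fdens]
  ring

theorem slice_heat_le (hc : EnergyCutoff χ θ L) (hu : Measurable u) (ha : Measurable a) (t : ℝ) :
    ∫⁻ x in Metric.ball (0 : E3) 1,
      ENNReal.ofReal ((‖u (x, t)‖ ^ 2 + nsq2 (a (x, t))) *
        |tderiv (fun z => χ z.1 ^ 2 * θ z.2) (x, t) + sLap (fun z => χ z.1 ^ 2 * θ z.2) (x, t)| +
        ‖d (x, t)‖ ^ 2 * nsq2 (a (x, t)) * (χ x ^ 2 * θ t)) ≤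
    L * (∫⁻ x in Metric.ball (0 : E3) 1, fdens u a (x, t)) +
      ∫⁻ x in Metric.ball (0 : E3) 1, ENNReal.ofReal (‖d (x, t)‖ ^ 2 * nsq2 (a (x, t))) := by
  have hm : Measurable fun x => fdens u a (x, t) := by unfold fdens nsq2; fun_prop
  rw [← lintegral_const_mul' _ _ (by simp), ← lintegral_add_left (hm.const_mul _)]
  refine lintegral_mono fun x => ?_
  have hn : 0 ≤ ‖u (x, t)‖ ^ 2 + nsq2 (a (x, t)) := by unfold nsq2; positivity
  have hn2 : 0 ≤ ‖d (x, t)‖ ^ 2 * nsq2 (a (x, t)) := by unfold nsq2; positivity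
  have hφ : χ x ^ 2 * θ t ≤ 1 :=
    mul_le_one₀ (pow_le_one₀ (hc.space_nonneg x) (hc.space_le_one x)) (hc.time_nonneg t)
      (hc.time_le_one t)
  refine ENNReal.ofReal_add_le.trans (add_le_add ?_ ?_)
  · rw [fdens, mul_comm (L : ℝ≥0∞), ← ENNReal.ofReal_coe_nnreal, ← ENNReal.ofReal_mul hn]
    exact ENNReal.ofReal_le_ofReal (mul_le_mul_of_nonneg_left (hc.heat_le (x, t)) hn)
  · exact ENNReal.ofReal_le_ofReal (mul_le_of_le_one_right hn2 hφ)

end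

theorem lintegral_rpow_half_mul_le {α : Type*} [MeasurableSpace α] {μ : Measure α}
    {f g : α → ℝ≥0∞} (hf : AEMeasurable f μ) (hg : AEMeasurable g μ) :
    ∫⁻ x, f x ^ (1 / 2 : ℝ) * g x ^ (1 / 2 : ℝ) ∂μ ≤
      (∫⁻ x, f x ∂μ) ^ (1 / 2 : ℝ) * (∫⁻ x, g x ∂μ) ^ (1 / 2 : ℝ) := by
  have hs : ∀ x : ℝ≥0∞, (x ^ (1 / 2 : ℝ)) ^ 2 = x := fun x => by
    rw [← ENNReal.rpow_natCast, ← ENNReal.rpow_mul]; norm_num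
  have h := lintegral_mul_sq_le (hf.pow_const (1 / 2 : ℝ)) (hg.pow_const (1 / 2 : ℝ))
  simp only [hs] at h
  have h1 := ENNReal.rpow_le_rpow h (by norm_num : (0 : ℝ) ≤ 1 / 2)
  rw [← ENNReal.rpow_natCast, ← ENNReal.rpow_mul, ENNReal.mul_rpow_of_nonneg _ _ (by norm_num)]
    at h1
  simpa using h1

section
variable {K : ℝ} {u d : SpT → E3} {p : SpT → ℝ} {Du a : SpT → Fin 3 → Fin 3 → ℝ}
  {Da : SpT → Fin 3 → Fin 3 → Fin 3 → ℝ} {χ : E3 → ℝ} {θ : ℝ → ℝ} {L : ℝ≥0}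

theorem UnitTriple.energy_cutoff_le {c : ℝ≥0} (hc : EnergyCutoff χ θ L)
    (h : UnitTriple K u d p Du a Da) {F S H O N B : ℝ≥0∞}
    (hF : ∫⁻ z in Metric.ball 0 1 ×ˢ Ioo (-7 / 8) (1 / 8), fdens u a z ≤ F) (hFt : F ≠ ⊤)
    (hS : ∫⁻ z in Metric.ball 0 1 ×ˢ Ioo (-7 / 8) (1 / 8), fdens u a z ^ (3 / 2 : ℝ) ≤ S)
    (hSt : S ≠ ⊤)
    (hH : ∫⁻ z in Metric.ball 0 1 ×ˢ Ioo (-7 / 8) (1 / 8),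
      ENNReal.ofReal (‖d z‖ ^ 2 * nsq2 (a z)) ≤ H) (hHt : H ≠ ⊤)
    (hO : ∫⁻ z in Metric.ball 0 1 ×ˢ Ioo (-7 / 8) (1 / 8), oscDens u a 1 z ≤ O) (hOt : O ≠ ⊤)
    (hN : ∫⁻ z in Metric.ball 0 1 ×ˢ Ioo (-7 / 8) (1 / 8), ‖u z‖ₑ * ‖p z‖ₑ ≤ N) (hNt : N ≠ ⊤)
    (hB : ∫⁻ z in Metric.ball 0 1 ×ˢ Ioo (-7 / 8) (1 / 8), gdens Du Da z ≤ B)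
    (hs : ∀ᵐ t ∂(volume.restrict (Ioo (-63 / 128 : ℝ) (9 / 128))),
      SliceBounds c (sliceField u a t)
      (∫⁻ x in Metric.ball (0 : E3) (3 / 4), gdens Du Da (x, t))) :
    ∀ᵐ t ∂(volume.restrict (Ioo (-7 / 32 : ℝ) (1 / 32))),
      ∫⁻ x in Metric.ball (0 : E3) (1 / 2), fdens u a (x, t) ≤
      2 * (ENNReal.ofReal K * (L * F + H + 3 * L * O + 3 * L * N)) +
      (2 * (ENNReal.ofReal K * (54 * L * ((c : ℝ≥0∞) ^ (1 / 4 : ℝ) * 3 ^ (1 / 4 : ℝ) *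
        6 ^ (1 / 2 : ℝ)) * (B ^ (1 / 2 : ℝ) * S ^ (1 / 2 : ℝ))))) ^ (4 / 3 : ℝ) := by
  have mu := h.meas_u
  have md := h.meas_d
  have mp := h.meas_p
  have ma := h.meas_a
  have mf := h.measurable_fdens
  have mg := h.measurable_gdens
  have mO : Measurable (oscDens u a 1) := measurable_oscDens mu ma 1
  have mN : Measurable fun z => ‖u z‖ₑ * ‖p z‖ₑ := by fun_prop
  have mH : Measurable fun z => ENNReal.ofReal (‖d z‖ ^ 2 * nsq2 (a z)) := by
    unfold nsq2; fun_prop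
  have mS : Measurable fun z => fdens u a z ^ (3 / 2 : ℝ) := mf.pow_const _
  set S1 : Set E3 := Metric.ball 0 1 with hS1
  set I1 : Set ℝ := Ioo (-7 / 8) (1 / 8) with hI1
  have hsub : Ioo (-63 / 128 : ℝ) (9 / 128) ⊆ I1 := Ioo_subset_Ioo (by norm_num) (by norm_num)
  set φ : SpT → ℝ := fun z => χ z.1 ^ 2 * θ z.2 with hφ
  have hχ1 : tsupport χ ⊆ S1 := hc.support_space.trans (Metric.ball_subset_ball (by norm_num))
  have hχs : tsupport (fun x => χ x ^ 2) ⊆ S1 := (tsupport_sq_subset χ).trans hχ1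
  have hφt : IsTestOn (S1 ×ˢ I1) φ :=
    isTestOn_tensor (hc.smooth_space.pow 2) (hasCompactSupport_sq hc.compact_space) hχs
      hc.smooth_time hc.compact_time (hc.support_time.trans hsub)
  have hφ0 : ∀ z, 0 ≤ φ z := fun z => mul_nonneg (sq_nonneg _) (hc.time_nonneg _)
  have hvol : volume (S1 ×ˢ I1) ≠ ⊤ := by
    rw [Measure.volume_eq_prod, Measure.prod_prod]
    exact ENNReal.mul_ne_top measure_ball_lt_top.ne (by simp [hI1])
  have hFfin : ∫⁻ z in S1 ×ˢ I1, fdens u a z ≠ ⊤ := ne_top_of_le_ne_top hFt hF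
  have hU := h.integrableOn_u hvol hFfin
  have e1 : ∀ᵐ t ∂(volume.restrict I1), ∫⁻ x in S1, fdens u a (x, t) ≠ ⊤ := by
    rw [lintegral_prod_SpT mf] at hFfin
    filter_upwards [ae_lt_top (measurable_slice_lintegral mf S1) hFfin] with t ht using ht.ne
  have e2 : ∀ᵐ t ∂(volume.restrict I1), IntegrableOn (fun x => u (x, t)) S1 := by
    have := hU
    unfold IntegrableOn at this
    rw [volume_restrict_prod_SpT] at this
    exact this.prod_left_ae
  have e3 := h.divFree.ae_slice isOpen_Ioo hU (hc.smooth_space.pow 2)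
    (hasCompactSupport_sq hc.compact_space) hχs
  have e4 : ∀ᵐ t ∂(volume.restrict I1), t ∈ Ioo (-63 / 128 : ℝ) (9 / 128) →
      SliceBounds c (sliceField u a t)
      (∫⁻ x in Metric.ball (0 : E3) (3 / 4), gdens Du Da (x, t)) :=
    ae_restrict_of_ae ((ae_restrict_iff' measurableSet_Ioo).1 hs)
  set E : ℝ → ℝ≥0∞ := fun t => ENNReal.ofReal (θ t) *
      ∫⁻ x in S1, fdens u a (x, t) * ENNReal.ofReal (χ x) ^ 2 with hE
  set Y := essSup E (volume.restrict I1) with hY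
  have e5 : ∀ᵐ t ∂(volume.restrict I1), E t ≤ Y := ENNReal.ae_le_essSup E
  set base : ℝ → ℝ≥0∞ := fun t => L * (∫⁻ x in S1, fdens u a (x, t)) +
    (∫⁻ x in S1, ENNReal.ofReal (‖d (x, t)‖ ^ 2 * nsq2 (a (x, t)))) +
    3 * L * (∫⁻ x in S1, oscDens u a 1 (x, t)) +
    3 * L * (∫⁻ x in S1, ‖u (x, t)‖ₑ * ‖p (x, t)‖ₑ) with hbase
  have m1 := measurable_slice_lintegral mf S1
  have m2 := measurable_slice_lintegral mH S1
  have m3 := measurable_slice_lintegral mO S1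
  have m4 := measurable_slice_lintegral mN S1
  have m5 := measurable_slice_lintegral mS S1
  have m6 := measurable_slice_lintegral mg (Metric.ball (0 : E3) (3 / 4))
  have mbase : Measurable base :=
    (((m1.const_mul _).add m2).add (m3.const_mul _)).add (m4.const_mul _)
  have ibase : ∫⁻ t in I1, base t ≤ L * F + H + 3 * L * O + 3 * L * N := by
    simp only [hbase]
    rw [lintegral_add_right _ (m4.const_mul _), lintegral_add_right _ (m3.const_mul _),
      lintegral_add_right _ m2, lintegral_const_mul _ m1, lintegral_const_mul _ m3,
      lintegral_const_mul _ m4]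
    rw [lintegral_prod_SpT mf] at hF
    rw [lintegral_prod_SpT mH] at hH
    rw [lintegral_prod_SpT mO] at hO
    rw [lintegral_prod_SpT mN] at hN
    gcongr
  set R := ∫⁻ τ in I1, ((∫⁻ x in S1,
      ENNReal.ofReal ((‖u (x, τ)‖ ^ 2 + nsq2 (a (x, τ))) * |tderiv φ (x, τ) + sLap φ (x, τ)| +
          ‖d (x, τ)‖ ^ 2 * nsq2 (a (x, τ)) * φ (x, τ))) + ‖cutoffFlux u p a χ θ τ‖ₑ) with hR
  have hER : Y ≤ ENNReal.ofReal K * R := by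
    refine essSup_le_of_ae_le _ ?_
    filter_upwards [h.energy φ hφt hφ0, e1] with t ht h1
    exact (slice_energy_eq hc mu ma h1).ge.trans ht
  have bound : ∀ X : ℝ → ℝ≥0∞, Measurable X → (∀ᵐ t ∂(volume.restrict I1),
      ‖cutoffFlux u p a χ θ t‖ₑ ≤ 3 * L * (∫⁻ x in S1, oscDens u a 1 (x, t)) +
      3 * L * (∫⁻ x in S1, ‖u (x, t)‖ₑ * ‖p (x, t)‖ₑ) + X t) →
      R ≤ L * F + H + 3 * L * O + 3 * L * N + ∫⁻ t in I1, X t := by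
    intro X mX hX
    calc R ≤ ∫⁻ t in I1, (base t + X t) := by
          refine lintegral_mono_ae ?_
          filter_upwards [hX] with t ht
          refine (add_le_add (slice_heat_le hc mu ma t) ht).trans (le_of_eq ?_)
          simp only [hbase]
          ring
      _ ≤ _ := by
          rw [lintegral_add_left mbase]
          exact add_le_add ibase le_rfl
  have iS : ∫⁻ t in I1, ∫⁻ x in S1, fdens u a (x, t) ^ (3 / 2 : ℝ) ≤ S := by
    rwa [← lintegral_prod_SpT mS]
  have hRfin : R ≠ ⊤ := by
    refine ne_top_of_le_ne_top ?_ (bound (fun t => 27 * (L *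
      ∫⁻ x in S1, fdens u a (x, t) ^ (3 / 2 : ℝ))) ((m5.const_mul _).const_mul _) ?_)
    · rw [lintegral_const_mul _ (m5.const_mul _), lintegral_const_mul _ m5]
      have := ne_top_of_le_ne_top hSt iS
      finiteness
    · filter_upwards [e2, e3] with t h2 h3
      exact (cutoffFlux_le h hc h2 h3).1
  have hYfin : Y ≠ ⊤ := ne_top_of_le_ne_top (by finiteness) hER
  set k : ℝ≥0∞ := (c : ℝ≥0∞) ^ (1 / 4 : ℝ) * 3 ^ (1 / 4 : ℝ) * 6 ^ (1 / 2 : ℝ) with hk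
  have hkt : k ≠ ⊤ := by rw [hk]; finiteness
  have hR2 : R ≤ L * F + H + 3 * L * O + 3 * L * N +
      54 * L * k * (B ^ (1 / 2 : ℝ) * S ^ (1 / 2 : ℝ)) * Y ^ (1 / 4 : ℝ) := by
    refine (bound (fun t => 54 * L * k * Y ^ (1 / 4 : ℝ) *
      ((∫⁻ x in Metric.ball (0 : E3) (3 / 4), gdens Du Da (x, t)) ^ (1 / 2 : ℝ) *
      (∫⁻ x in S1, fdens u a (x, t) ^ (3 / 2 : ℝ)) ^ (1 / 2 : ℝ)))
      (((m6.pow_const _).mul (m5.pow_const _)).const_mul _) ?_).trans (add_le_add le_rfl ?_)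
    · filter_upwards [e2, e3, e4, e5] with t h2 h3 h4 h5
      by_cases ht : t ∈ Ioo (-63 / 128 : ℝ) (9 / 128)
      · refine ((cutoffFlux_le h hc h2 h3).2 (h4 ht)).trans (add_le_add le_rfl ?_)
        rw [mul_assoc (54 * (L : ℝ≥0∞)), mul_assoc (54 * (L : ℝ≥0∞))]
        refine mul_le_mul' le_rfl ?_
        rw [ENNReal.mul_rpow_of_nonneg _ _ (by norm_num),
          ENNReal.mul_rpow_of_nonneg 3 _ (by norm_num),
          ENNReal.mul_rpow_of_nonneg 6 _ (by norm_num), ← ENNReal.rpow_natCast,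
          ← ENNReal.rpow_mul]
        calc _ ≤ (c : ℝ≥0∞) ^ (1 / 4 : ℝ) * (∫⁻ x in Metric.ball (0 : E3) (3 / 4),
                gdens Du Da (x, t)) ^ (((2 : ℕ) : ℝ) * (1 / 4)) *
                (3 ^ (1 / 4 : ℝ) * Y ^ (1 / 4 : ℝ)) * (6 ^ (1 / 2 : ℝ) *
                (∫⁻ x in S1, fdens u a (x, t) ^ (3 / 2 : ℝ)) ^ (1 / 2 : ℝ)) := by
              refine mul_le_mul' (mul_le_mul' le_rfl (mul_le_mul' le_rfl ?_)) le_rfl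
              exact ENNReal.rpow_le_rpow h5 (by norm_num)
          _ = _ := by
              rw [hk, show (((2 : ℕ) : ℝ) * (1 / 4)) = 1 / 2 by norm_num]
              ring
      · have : θ t = 0 := by
          by_contra h0
          exact ht (hc.support_time (subset_tsupport _ h0))
        rw [cutoffFlux_eq hc, this]
        simp
    · rw [lintegral_const_mul' _ _ (by finiteness)]
      have h1 := lintegral_rpow_half_mul_le (μ := volume.restrict I1) m6.aemeasurable
        m5.aemeasurable
      have h2 : ∫⁻ t in I1, ∫⁻ x in Metric.ball (0 : E3) (3 / 4), gdens Du Da (x, t) ≤ B :=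
        (lintegral_cylinder_mono mg (Metric.ball_subset_ball (by norm_num)) le_rfl).trans hB
      calc _ ≤ 54 * L * k * Y ^ (1 / 4 : ℝ) * (B ^ (1 / 2 : ℝ) * S ^ (1 / 2 : ℝ)) := by
            refine mul_le_mul' le_rfl (h1.trans (mul_le_mul' ?_ ?_))
            · exact ENNReal.rpow_le_rpow h2 (by norm_num)
            · exact ENNReal.rpow_le_rpow iS (by norm_num)
        _ = _ := by ring
  have hY3 := le_of_le_add_mul_rpow_quarter
    (P := ENNReal.ofReal K * (L * F + H + 3 * L * O + 3 * L * N))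
    (Q := ENNReal.ofReal K * (54 * L * k * (B ^ (1 / 2 : ℝ) * S ^ (1 / 2 : ℝ)))) hYfin
    ((hER.trans (mul_le_mul' le_rfl hR2)).trans (le_of_eq (by ring)))
  filter_upwards [ae_restrict_of_ae_restrict_of_subset
    (Ioo_subset_Ioo (by norm_num) (by norm_num) : Ioo (-7 / 32 : ℝ) (1 / 32) ⊆ I1) e5,
    ae_restrict_mem measurableSet_Ioo] with t ht htm
  refine le_trans ?_ (ht.trans hY3)
  simp only [hE, hc.time_eq_one t htm, ENNReal.ofReal_one, one_mul]
  calc _ = ∫⁻ x in Metric.ball (0 : E3) (1 / 2),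
        fdens u a (x, t) * ENNReal.ofReal (χ x) ^ 2 := by
        refine setLIntegral_congr_fun measurableSet_ball fun x hx => ?_
        simp [hc.space_eq_one x hx]
    _ ≤ _ := lintegral_mono_set (Metric.ball_subset_ball (by norm_num))

theorem UnitTriple.energy_bound (K : ℝ) : ∃ c : ℝ≥0, ∀ {u d : SpT → E3} {p : SpT → ℝ}
    {Du a : SpT → Fin 3 → Fin 3 → ℝ} {Da : SpT → Fin 3 → Fin 3 → Fin 3 → ℝ},
    UnitTriple K u d p Du a Da → ∀ {M : ℝ≥0∞}, M ≠ ⊤ →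
    ∫⁻ z in Metric.ball 0 1 ×ˢ Ioo (-7 / 8) (1 / 8), fdens u a z ^ (3 / 2 : ℝ) ≤ M →
    ∫⁻ z in Metric.ball 0 1 ×ˢ Ioo (-7 / 8) (1 / 8),
      ENNReal.ofReal (‖d z‖ ^ 2 * nsq2 (a z)) ≤ M ^ (2 / 3 : ℝ) →
    ∫⁻ z in Metric.ball 0 1 ×ˢ Ioo (-7 / 8) (1 / 8), oscDens u a 1 z ≤ M ^ (2 / 3 : ℝ) →
    ∫⁻ z in Metric.ball 0 1 ×ˢ Ioo (-7 / 8) (1 / 8), ‖u z‖ₑ * ‖p z‖ₑ ≤ M ^ (2 / 3 : ℝ) →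
    ∫⁻ z in Metric.ball 0 1 ×ˢ Ioo (-7 / 8) (1 / 8), gdens Du Da z ≤ 1 →
    ∫⁻ z in Metric.ball 0 1 ×ˢ Ioo (-7 / 8) (1 / 8), fdens u a z ≠ ⊤ ∧
    ∀ᵐ t ∂(volume.restrict (Ioo (-7 / 32 : ℝ) (1 / 32))),
      ∫⁻ x in Metric.ball (0 : E3) (1 / 2), fdens u a (x, t) ≤ c * M ^ (2 / 3 : ℝ) := by
  obtain ⟨χ, θ, L, hc⟩ := EnergyCutoff.exists
  obtain ⟨c, hs⟩ := UnitTriple.sliceBounds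
  set V := volume (Metric.ball (0 : E3) 1 ×ˢ Ioo (-7 / 8 : ℝ) (1 / 8)) with hV
  have hVt : V ≠ ⊤ := by
    rw [hV, Measure.volume_eq_prod, Measure.prod_prod]
    exact ENNReal.mul_ne_top measure_ball_lt_top.ne (by simp)
  set v := (V ^ (1 / 2 : ℝ)) ^ (2 / 3 : ℝ) with hv
  have hvt : v ≠ ⊤ := by rw [hv]; finiteness
  set k : ℝ≥0∞ := ENNReal.ofReal K * (54 * L * ((c : ℝ≥0∞) ^ (1 / 4 : ℝ) * 3 ^ (1 / 4 : ℝ) *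
        6 ^ (1 / 2 : ℝ))) with hk
  have hkt : k ≠ ⊤ := by rw [hk]; finiteness
  set c' : ℝ≥0∞ := 2 * (ENNReal.ofReal K * (L * v + 1 + 3 * L + 3 * L)) +
    (2 * k) ^ (4 / 3 : ℝ) with hc'
  have hct : c' ≠ ⊤ := by rw [hc']; finiteness
  refine ⟨c'.toNNReal, fun {u d p Du a Da} h {M} hM h1 h2 h3 h4 h5 => ?_⟩
  rw [ENNReal.coe_toNNReal hct]
  have hF : ∫⁻ z in Metric.ball 0 1 ×ˢ Ioo (-7 / 8) (1 / 8), fdens u a z ≤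
      v * M ^ (2 / 3 : ℝ) := by
    have := ENNReal.rpow_le_rpow (z := 2 / 3) ((lintegral_rpow_le_lintegral_rpow
      h.measurable_fdens.aemeasurable).trans (mul_le_mul' le_rfl h1)) (by norm_num)
    rw [ENNReal.mul_rpow_of_nonneg _ _ (by norm_num), ← ENNReal.rpow_mul,
      show (3 / 2 * (2 / 3) : ℝ) = 1 by norm_num, ENNReal.rpow_one,
      Measure.restrict_apply_univ] at this
    exact this
  have hMt : M ^ (2 / 3 : ℝ) ≠ ⊤ := by finiteness
  have hFt : v * M ^ (2 / 3 : ℝ) ≠ ⊤ := by finiteness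
  refine ⟨ne_top_of_le_ne_top hFt hF, ?_⟩
  have := h.energy_cutoff_le (c := c) hc hF hFt h1 hM h2 hMt h3 hMt h4 hMt h5
    (hs h (ne_top_of_le_ne_top hFt hF) (ne_top_of_le_ne_top (by simp) h5))
  filter_upwards [this] with t ht
  refine ht.trans (le_of_eq ?_)
  rw [ENNReal.one_rpow, one_mul]
  have e : (2 * (ENNReal.ofReal K * (54 * L * ((c : ℝ≥0∞) ^ (1 / 4 : ℝ) * 3 ^ (1 / 4 : ℝ) *
        6 ^ (1 / 2 : ℝ)) * M ^ (1 / 2 : ℝ)))) ^ (4 / 3 : ℝ) =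
      (2 * k) ^ (4 / 3 : ℝ) * M ^ (2 / 3 : ℝ) := by
    have hM' : M ^ (2 / 3 : ℝ) = (M ^ (1 / 2 : ℝ)) ^ (4 / 3 : ℝ) := by
      rw [← ENNReal.rpow_mul]
      norm_num
    rw [hM', ← ENNReal.mul_rpow_of_nonneg _ _ (by norm_num : (0 : ℝ) ≤ 4 / 3)]
    refine congrArg (· ^ (4 / 3 : ℝ)) ?_
    rw [hk]
    ring
  rw [e, hc']
  ring

end

/-! ### Relations between the scale-invariant quantities at a fixed scale -/

theorem lintegral_rpow_mul_rpow_le {α : Type*} [MeasurableSpace α] {μ : Measure α}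
    {f e : α → ℝ≥0∞} (hf : AEMeasurable f μ) (he : AEMeasurable e μ) {q σ : ℝ} (hq : 0 < q)
    (hqσ : q < σ) (hσ : σ < 6) :
    ∫⁻ x, f x ^ q * e x ^ (1 - q / 6) ∂μ ≤
      (∫⁻ x, f x ^ σ * e x ^ (1 - σ / 6) ∂μ) ^ (q / σ) * (∫⁻ x, e x ∂μ) ^ (1 - q / σ) := by
  have hσ0 : 0 < σ := hq.trans hqσ
  have h1 : q / σ < 1 := (div_lt_one hσ0).2 hqσ
  have h2 : 0 < q / σ := div_pos hq hσ0
  refine le_trans (lintegral_mono fun x => ?_)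
    (ENNReal.lintegral_mul_norm_pow_le (hf.pow_const σ |>.mul (he.pow_const _)) he h2.le
      (sub_nonneg.2 h1.le) (by ring))
  simp only [Pi.mul_apply]
  rw [ENNReal.mul_rpow_of_nonneg _ _ h2.le, ← ENNReal.rpow_mul, ← ENNReal.rpow_mul,
    mul_div_cancel₀ _ hσ0.ne', mul_assoc, ← ENNReal.rpow_add_of_nonneg _ _
      (mul_nonneg (by linarith) h2.le) (sub_nonneg.2 h1.le)]
  refine mul_le_mul' le_rfl (le_of_eq (congrArg _ ?_))
  field_simp
  ring

theorem measurable_cubeDens {u : SpT → E3} {a : SpT → Fin 3 → Fin 3 → ℝ} (hu : Measurable u)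
    (ha : Measurable a) :
    Measurable fun z => ENNReal.ofReal (‖u z‖ ^ 3 + Real.sqrt (nsq2 (a z)) ^ 3) := by
  unfold nsq2
  fun_prop

theorem GQ_integrand_eq {u d : SpT → E3} {a : SpT → Fin 3 → Fin 3 → ℝ} {q : ℝ} (hq : 0 < q)
    (hq6 : q < 6) (z : SpT) :
    ENNReal.ofReal (‖d z‖ ^ q * (‖u z‖ ^ 3 + Real.sqrt (nsq2 (a z)) ^ 3) ^ (1 - q / 6)) =
      ‖d z‖ₑ ^ q * ENNReal.ofReal (‖u z‖ ^ 3 + Real.sqrt (nsq2 (a z)) ^ 3) ^ (1 - q / 6) := by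
  rw [ENNReal.ofReal_mul (by positivity), ← ofReal_norm,
    ENNReal.ofReal_rpow_of_nonneg (norm_nonneg _) hq.le,
    ENNReal.ofReal_rpow_of_nonneg (by positivity) (by linarith)]

theorem GQ_le_rpow_mul_CQ_rpow {u d : SpT → E3} {a : SpT → Fin 3 → Fin 3 → ℝ}
    (hu : Measurable u) (hd : Measurable d) (ha : Measurable a) {q σ : ℝ} (hq : 0 < q)
    (hqσ : q < σ) (hσ : σ < 6) {z : SpT} {r : ℝ} (hr : 0 < r) :
    GQ u d a q z r ≤ GQ u d a σ z r ^ (q / σ) * CQ u a z r ^ (1 - q / σ) := by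
  have hσ0 : 0 < σ := hq.trans hqσ
  have h1 : q / σ < 1 := (div_lt_one hσ0).2 hqσ
  have h2 : 0 < q / σ := div_pos hq hσ0
  have hr2 : (ENNReal.ofReal (r ^ (2 + q / 2)))⁻¹ =
      (ENNReal.ofReal (r ^ (2 + σ / 2)))⁻¹ ^ (q / σ) *
        (ENNReal.ofReal (r ^ 2))⁻¹ ^ (1 - q / σ) := by
    rw [ENNReal.inv_rpow, ENNReal.inv_rpow, ENNReal.ofReal_rpow_of_pos (by positivity),
      ENNReal.ofReal_rpow_of_pos (by positivity), ← ENNReal.mul_inv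
        (Or.inl (by simp; positivity)) (Or.inl (by simp)), ← ENNReal.ofReal_mul (by positivity),
      ← Real.rpow_natCast r 2, ← Real.rpow_mul hr.le, ← Real.rpow_mul hr.le,
      ← Real.rpow_add hr]
    refine congrArg (fun s => (ENNReal.ofReal (r ^ s))⁻¹) ?_
    push_cast
    field_simp
    ring
  unfold GQ CQ
  simp only [GQ_integrand_eq hq (hqσ.trans hσ), GQ_integrand_eq hσ0 hσ]
  rw [ENNReal.mul_rpow_of_nonneg _ _ h2.le, ENNReal.mul_rpow_of_nonneg _ _ (by linarith), hr2]
  refine (mul_le_mul' le_rfl (lintegral_rpow_mul_rpow_le hd.enorm.aemeasurable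
    (measurable_cubeDens hu ha).aemeasurable hq hqσ hσ)).trans (le_of_eq ?_)
  ring

theorem GQ_rpow_le {u d : SpT → E3} {a : SpT → Fin 3 → Fin 3 → ℝ}
    (hu : Measurable u) (hd : Measurable d) (ha : Measurable a) {q σ α g : ℝ} (hq : 0 < q)
    (hqσ : q < σ) (hσ : σ < 6) (hα : α = 6 / σ * ((σ - q) / (6 - q))) (hg : 1 ≤ g)
    {z : SpT} {r : ℝ} (hr : 0 < r) (hG : GQ u d a σ z r ≤ ENNReal.ofReal g) :
    GQ u d a q z r ^ (6 / (6 - q)) ≤ ENNReal.ofReal g ^ (6 / (6 - σ)) * CQ u a z r ^ α := by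
  have hσ0 : 0 < σ := hq.trans hqσ
  have h6 : 0 < 6 / (6 - q) := div_pos (by norm_num) (by linarith)
  have h6q : 6 - q ≠ 0 := by linarith
  refine (ENNReal.rpow_le_rpow (GQ_le_rpow_mul_CQ_rpow hu hd ha hq hqσ hσ hr) h6.le).trans ?_
  rw [ENNReal.mul_rpow_of_nonneg _ _ h6.le, ← ENNReal.rpow_mul, ← ENNReal.rpow_mul,
    show (1 - q / σ) * (6 / (6 - q)) = α by rw [hα]; field_simp]
  refine mul_le_mul' ((ENNReal.rpow_le_rpow hG (by positivity)).trans
    (ENNReal.rpow_le_rpow_of_exponent_le (by simpa using ENNReal.ofReal_le_ofReal hg) ?_)) le_rfl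
  rw [div_mul_div_comm, div_le_div_iff₀ (by apply mul_pos <;> linarith) (by linarith)]
  nlinarith

theorem FQ_rpow_le {u : SpT → E3} {p : SpT → ℝ} {a : SpT → Fin 3 → Fin 3 → ℝ}
    (hu : Measurable u) (hp : Measurable p) {z : SpT} {r : ℝ} (hr : 0 < r) :
    FQ u p z r ^ (3 / 2 : ℝ) ≤ CQ u a z r + DQ p z r ^ (2 : ℝ) := by
  have hF : FQ u p z r ≤ CQ u a z r ^ (1 / 3 : ℝ) * DQ p z r ^ (2 / 3 : ℝ) := by
    unfold FQ CQ DQ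
    rw [ENNReal.mul_rpow_of_nonneg _ _ (by norm_num), ENNReal.mul_rpow_of_nonneg _ _ (by norm_num),
      mul_mul_mul_comm, ← ENNReal.rpow_add _ _ (by simp) (by simp; positivity),
      show (1 / 3 + 2 / 3 : ℝ) = 1 by norm_num, ENNReal.rpow_one]
    refine mul_le_mul' le_rfl ?_
    refine le_trans (le_of_eq (lintegral_congr fun x => ?_))
      ((ENNReal.lintegral_mul_norm_pow_le (f := fun z => ‖u z‖ₑ ^ (3 : ℝ))
        (g := fun z => ‖p z‖ₑ ^ (3 / 2 : ℝ)) (p := 1 / 3) (q := 2 / 3)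
        (hu.enorm.pow_const _).aemeasurable (hp.enorm.pow_const _).aemeasurable
        (by norm_num) (by norm_num) (by norm_num)).trans
      (mul_le_mul' (ENNReal.rpow_le_rpow (lintegral_mono fun x => ?_) (by norm_num))
        (ENNReal.rpow_le_rpow (lintegral_mono fun x => ?_) (by norm_num))))
    · rw [ENNReal.ofReal_mul (norm_nonneg _), ofReal_norm, ← Real.norm_eq_abs,
        ofReal_norm, ← ENNReal.rpow_mul, ← ENNReal.rpow_mul]
      norm_num
    · rw [← ofReal_norm, ENNReal.ofReal_rpow_of_nonneg (norm_nonneg _) (by norm_num)]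
      refine ENNReal.ofReal_le_ofReal ?_
      rw [show (3 : ℝ) = ((3 : ℕ) : ℝ) by norm_num, Real.rpow_natCast]
      exact le_add_of_nonneg_right (by positivity)
    · rw [← ofReal_norm, ENNReal.ofReal_rpow_of_nonneg (norm_nonneg _) (by norm_num),
        Real.norm_eq_abs]
  refine (ENNReal.rpow_le_rpow hF (by norm_num)).trans ?_
  rw [ENNReal.mul_rpow_of_nonneg _ _ (by norm_num), ← ENNReal.rpow_mul, ← ENNReal.rpow_mul,
    show (2 / 3 * (3 / 2) : ℝ) = 1 by norm_num, show (1 / 3 * (3 / 2) : ℝ) = 1 / 2 by norm_num,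
    ENNReal.rpow_one]
  set X := CQ u a z r ^ (1 / 2 : ℝ) with hX
  have hC : CQ u a z r = X ^ (2 : ℝ) := by
    rw [hX, ← ENNReal.rpow_mul]
    norm_num
  rw [hC]
  simp only [ENNReal.rpow_two, sq]
  rcases le_total X (DQ p z r) with h | h
  · exact (mul_le_mul' h le_rfl).trans le_add_self
  · exact (mul_le_mul' le_rfl h).trans le_self_add

section Components

variable {u d : SpT → E3} {p : SpT → ℝ} {a : SpT → Fin 3 → Fin 3 → ℝ} {q : ℝ} {z : SpT} {r : ℝ}

theorem half_mul_add_le_MQ :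
    1 / 2 * (CQ u a z r + GQ u d a q z r ^ (6 / (6 - q))) ≤ MQ u d p a q z r :=
  le_self_add.trans (le_self_add.trans le_self_add)

theorem CQ_add_GQ_le_two_mul_MQ :
    CQ u a z r + GQ u d a q z r ^ (6 / (6 - q)) ≤ 2 * MQ u d p a q z r := by
  refine le_trans (le_of_eq ?_) (mul_le_mul' le_rfl half_mul_add_le_MQ)
  rw [← mul_assoc, one_div, ENNReal.mul_inv_cancel (by simp) (by simp), one_mul]

theorem CQ_le_two_mul_MQ : CQ u a z r ≤ 2 * MQ u d p a q z r :=
  le_self_add.trans CQ_add_GQ_le_two_mul_MQ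

theorem GQ_le_MQ_rpow (hq6 : q < 6) :
    GQ u d a q z r ≤ (2 * MQ u d p a q z r) ^ ((6 - q) / 6) := by
  have h : GQ u d a q z r ^ (6 / (6 - q)) ≤ 2 * MQ u d p a q z r :=
    le_add_self.trans CQ_add_GQ_le_two_mul_MQ
  have h1 := ENNReal.rpow_le_rpow h (z := (6 - q) / 6) (div_nonneg (by linarith) (by norm_num))
  rwa [← ENNReal.rpow_mul, div_mul_div_cancel₀ (by linarith), div_self (by norm_num),
    ENNReal.rpow_one] at h1

theorem DQ_le_MQ_rpow : DQ p z r ≤ MQ u d p a q z r ^ (1 / 2 : ℝ) := by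
  have h : DQ p z r ^ (2 : ℝ) ≤ MQ u d p a q z r :=
    le_add_self.trans (le_self_add.trans le_self_add)
  have h1 := ENNReal.rpow_le_rpow h (z := 1 / 2) (by norm_num)
  rwa [← ENNReal.rpow_mul, show (2 * (1 / 2) : ℝ) = 1 by norm_num, ENNReal.rpow_one] at h1

theorem EQ_le_MQ_rpow : EQ u a z r ≤ MQ u d p a q z r ^ (2 / 3 : ℝ) := by
  have h : EQ u a z r ^ (3 / 2 : ℝ) ≤ MQ u d p a q z r := le_add_self.trans le_self_add
  have h1 := ENNReal.rpow_le_rpow h (z := 2 / 3) (by norm_num)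
  rwa [← ENNReal.rpow_mul, show (3 / 2 * (2 / 3) : ℝ) = 1 by norm_num, ENNReal.rpow_one] at h1

theorem FQ_le_MQ_rpow : FQ u p z r ≤ MQ u d p a q z r ^ (2 / 3 : ℝ) := by
  have h : FQ u p z r ^ (3 / 2 : ℝ) ≤ MQ u d p a q z r := le_add_self
  have h1 := ENNReal.rpow_le_rpow h (z := 2 / 3) (by norm_num)
  rwa [← ENNReal.rpow_mul, show (3 / 2 * (2 / 3) : ℝ) = 1 by norm_num, ENNReal.rpow_one] at h1

theorem GQ_two_le_MQ_rpow (hu : Measurable u) (hd : Measurable d) (ha : Measurable a)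
    (hq : 2 < q) (hq6 : q < 6) (hr : 0 < r) :
    GQ u d a 2 z r ≤ (2 * MQ u d p a q z r) ^ (2 / 3 : ℝ) := by
  have h1 : 2 / q < 1 := (div_lt_one (by linarith)).2 hq
  refine (GQ_le_rpow_mul_CQ_rpow hu hd ha two_pos hq hq6 hr).trans
    ((mul_le_mul' (ENNReal.rpow_le_rpow (GQ_le_MQ_rpow (p := p) hq6) (by positivity))
      (ENNReal.rpow_le_rpow (CQ_le_two_mul_MQ (d := d) (p := p) (q := q)) (by linarith))).trans
      (le_of_eq ?_))
  rw [← ENNReal.rpow_mul, ← ENNReal.rpow_add_of_nonneg _ _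
    (mul_nonneg (div_nonneg (by linarith) (by norm_num)) (by positivity)) (by linarith)]
  refine congrArg _ ?_
  field_simp
  ring

theorem MQ_le (hu : Measurable u) (hd : Measurable d) (ha : Measurable a) (hp : Measurable p)
    {σ α g : ℝ} (hq : 0 < q) (hqσ : q < σ) (hσ : σ < 6)
    (hα : α = 6 / σ * ((σ - q) / (6 - q))) (hg : 1 ≤ g) (hr : 0 < r)
    (hG : GQ u d a σ z r ≤ ENNReal.ofReal g) :
    MQ u d p a q z r ≤ 2 * CQ u a z r + 2 * DQ p z r ^ (2 : ℝ) + EQ u a z r ^ (3 / 2 : ℝ) +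
      ENNReal.ofReal g ^ (6 / (6 - σ)) * CQ u a z r ^ α := by
  have hF := FQ_rpow_le (a := a) hu hp (z := z) hr
  have hGq := GQ_rpow_le hu hd ha hq hqσ hσ hα hg hr hG
  unfold MQ
  calc _ ≤ (CQ u a z r + ENNReal.ofReal g ^ (6 / (6 - σ)) * CQ u a z r ^ α) +
        DQ p z r ^ (2 : ℝ) + EQ u a z r ^ (3 / 2 : ℝ) +
        (CQ u a z r + DQ p z r ^ (2 : ℝ)) := by
        refine add_le_add (add_le_add (add_le_add ?_ le_rfl) le_rfl) hF
        exact (mul_le_of_le_one_left zero_le (by simp)).trans (add_le_add le_rfl hGq)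
    _ = _ := by ring

end Components

/-! ### Collecting powers -/

/-- The right-hand side of the decay estimate, without its constant factor. -/
def decayRHS (α : ℝ) (w m b : ℝ≥0∞) : ℝ≥0∞ :=
  w ^ (α / 8) * (m + m ^ α) + w ^ (-15 : ℝ) * b ^ (3 / 4 * α) *
    ∑ k ∈ Finset.range 3, (m ^ ((1 : ℝ) / 2 ^ k) + m ^ (α / 2 ^ k))

theorem rpow_le_add_of_mem_Icc (m : ℝ≥0∞) {r s t : ℝ} (hrs : r ≤ s) (hst : s ≤ t) :
    m ^ s ≤ m ^ t + m ^ r := by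
  rcases le_total 1 m with h | h
  · exact (ENNReal.rpow_le_rpow_of_exponent_le h hst).trans le_self_add
  · exact (ENNReal.rpow_le_rpow_of_exponent_ge h hrs).trans le_add_self

section DecayRHS

variable {α : ℝ} {w m b : ℝ≥0∞}

theorem sum_pow_eq (α : ℝ) (m : ℝ≥0∞) :
    ∑ k ∈ Finset.range 3, (m ^ ((1 : ℝ) / 2 ^ k) + m ^ (α / 2 ^ k)) =
      m + m ^ α + (m ^ (1 / 2 : ℝ) + m ^ (α / 2)) + (m ^ (1 / 4 : ℝ) + m ^ (α / 4)) := by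
  rw [Finset.sum_range_succ, Finset.sum_range_succ, Finset.sum_range_one]
  norm_num

theorem main_le_decayRHS (hw : w ≤ 1) {s : ℝ} (hs : α / 8 ≤ s) :
    w ^ s * m ≤ decayRHS α w m b ∧ w ^ s * m ^ α ≤ decayRHS α w m b := by
  have h : w ^ s ≤ w ^ (α / 8) := ENNReal.rpow_le_rpow_of_exponent_ge hw hs
  exact ⟨(mul_le_mul' h le_self_add).trans le_self_add,
    (mul_le_mul' h le_add_self).trans le_self_add⟩

theorem tail_le_decayRHS (hw : w ≤ 1) (hb : b ≤ 1) {s t : ℝ} (hs : -15 ≤ s)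
    (ht : 3 / 4 * α ≤ t) {x : ℝ≥0∞}
    (hx : x ≤ ∑ k ∈ Finset.range 3, (m ^ ((1 : ℝ) / 2 ^ k) + m ^ (α / 2 ^ k))) :
    w ^ s * (b ^ t * x) ≤ decayRHS α w m b := by
  rw [← mul_assoc]
  exact (mul_le_mul' (mul_le_mul' (ENNReal.rpow_le_rpow_of_exponent_ge hw hs)
    (ENNReal.rpow_le_rpow_of_exponent_ge hb ht)) hx).trans le_add_self

theorem rpow_le_sum_pow (hα : 0 < α) {s : ℝ} (hs : s ∈ Icc (1 / 4 : ℝ) 1) :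
    m ^ s ≤ (∑ k ∈ Finset.range 3, (m ^ ((1 : ℝ) / 2 ^ k) + m ^ (α / 2 ^ k))) ∧
    m ^ (α * s) ≤ ∑ k ∈ Finset.range 3, (m ^ ((1 : ℝ) / 2 ^ k) + m ^ (α / 2 ^ k)) := by
  rw [sum_pow_eq]
  have h1 := rpow_le_add_of_mem_Icc m hs.1 hs.2
  have h2 : m ^ (α * s) ≤ m ^ α + m ^ (α / 4) :=
    rpow_le_add_of_mem_Icc m (by nlinarith [hs.1]) (by nlinarith [hs.2])
  rw [ENNReal.rpow_one] at h1
  constructor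
  · refine h1.trans (add_le_add (le_self_add.trans le_self_add) le_self_add)
  · refine h2.trans (add_le_add (le_add_self.trans le_self_add) le_add_self)

theorem rpow_two_add_le (x y : ℝ≥0∞) : (x + y) ^ (2 : ℝ) ≤ 2 * (x ^ (2 : ℝ) + y ^ (2 : ℝ)) := by
  have := ENNReal.rpow_add_le_mul_rpow_add_rpow x y (p := 2) (by norm_num)
  norm_num at this ⊢
  exact this

theorem combine_le_decayRHS {c g C D E : ℝ≥0∞} (hc : 1 ≤ c) (hg : 1 ≤ g) (hα : 0 < α)
    (hα1 : α ≤ 1) (hw : w ≤ 1) (hb : b ≤ 1)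
    (hC : C ≤ c * (w ^ (-2 : ℝ) * (b * m ^ (1 / 3 : ℝ)) + w * m))
    (hD : D ≤ c * (w ^ (-2 : ℝ) * (b * m ^ (1 / 3 : ℝ) + b ^ (3 / 4 : ℝ) * m ^ (1 / 2 : ℝ)) +
      w * m ^ (1 / 2 : ℝ)))
    (hE : E ≤ c * (w ^ (-2 : ℝ) * (b * m ^ (1 / 3 : ℝ) + b ^ (1 / 2 : ℝ) * m ^ (2 / 3 : ℝ)))) :
    2 * C + 2 * D ^ (2 : ℝ) + E ^ (3 / 2 : ℝ) + g * C ^ α ≤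
      30 * c ^ (2 : ℝ) * (g * decayRHS α w m b) := by
  set R := decayRHS α w m b with hR
  have hcc : c ≤ c ^ (2 : ℝ) := by
    simpa using ENNReal.rpow_le_rpow_of_exponent_le hc (by norm_num : (1 : ℝ) ≤ 2)
  have hb1 : ∀ {s : ℝ}, 3 / 4 ≤ s → 3 / 4 * α ≤ s := fun h => by nlinarith
  have tail : ∀ {s t e : ℝ}, -15 ≤ s → 3 / 4 ≤ t → e ∈ Icc (1 / 4 : ℝ) 1 →
      w ^ s * (b ^ t * m ^ e) ≤ R := fun h1 h2 h3 =>
    tail_le_decayRHS hw hb h1 (hb1 h2) (rpow_le_sum_pow hα h3).1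
  have main : ∀ {s : ℝ}, α / 8 ≤ s → w ^ s * m ≤ R := fun h => (main_le_decayRHS hw h).1
  have hC1 : C ≤ c * (2 * R) := by
    refine hC.trans (mul_le_mul' le_rfl ?_)
    rw [two_mul]
    refine add_le_add ?_ ?_
    · simpa using tail (s := -2) (t := 1) (e := 1 / 3) (by norm_num) (by norm_num) (by norm_num)
    · simpa using main (s := 1) (by linarith)
  have hCα : C ^ α ≤ c * (2 * R) := by
    refine (ENNReal.rpow_le_rpow hC hα.le).trans ?_
    rw [ENNReal.mul_rpow_of_nonneg _ _ hα.le]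
    refine mul_le_mul' (by simpa using ENNReal.rpow_le_rpow_of_exponent_le hc hα1)
      ((ENNReal.rpow_add_le_add_rpow _ _ hα.le hα1).trans ?_)
    rw [two_mul, ENNReal.mul_rpow_of_nonneg _ _ hα.le, ENNReal.mul_rpow_of_nonneg _ _ hα.le,
      ENNReal.mul_rpow_of_nonneg _ _ hα.le, ← ENNReal.rpow_mul, ← ENNReal.rpow_mul]
    refine add_le_add (tail_le_decayRHS hw hb (by linarith) (by linarith) ?_)
      (main_le_decayRHS hw (by linarith)).2
    rw [mul_comm (1 / 3) α]
    exact (rpow_le_sum_pow hα (by norm_num)).2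
  have hD2 : D ^ (2 : ℝ) ≤ c ^ (2 : ℝ) * (10 * R) := by
    refine (ENNReal.rpow_le_rpow hD (by norm_num)).trans ?_
    rw [ENNReal.mul_rpow_of_nonneg _ _ (by norm_num)]
    refine mul_le_mul' le_rfl ?_
    refine (rpow_two_add_le _ _).trans ?_
    rw [ENNReal.mul_rpow_of_nonneg _ _ (by norm_num), ENNReal.mul_rpow_of_nonneg _ _ (by norm_num),
      ← ENNReal.rpow_mul, ← ENNReal.rpow_mul]
    calc _ ≤ 2 * (w ^ (-2 * 2 : ℝ) * (2 * ((b * m ^ (1 / 3 : ℝ)) ^ (2 : ℝ) +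
            (b ^ (3 / 4 : ℝ) * m ^ (1 / 2 : ℝ)) ^ (2 : ℝ))) +
            w ^ (2 : ℝ) * m ^ (1 / 2 * 2 : ℝ)) :=
          mul_le_mul' le_rfl (add_le_add (mul_le_mul' le_rfl (rpow_two_add_le _ _)) le_rfl)
      _ = 4 * (w ^ (-4 : ℝ) * (b ^ (2 : ℝ) * m ^ (2 / 3 : ℝ))) +
            4 * (w ^ (-4 : ℝ) * (b ^ (3 / 2 : ℝ) * m ^ (1 : ℝ))) + 2 * (w ^ (2 : ℝ) * m) := by
          rw [ENNReal.mul_rpow_of_nonneg _ _ (by norm_num),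
            ENNReal.mul_rpow_of_nonneg _ _ (by norm_num), ← ENNReal.rpow_mul, ← ENNReal.rpow_mul,
            ← ENNReal.rpow_mul, show (-2 * 2 : ℝ) = -4 by norm_num,
            show (1 / 2 * 2 : ℝ) = 1 by norm_num, show (1 / 3 * 2 : ℝ) = 2 / 3 by norm_num,
            show (3 / 4 * 2 : ℝ) = 3 / 2 by norm_num, ENNReal.rpow_one]
          ring
      _ ≤ 4 * R + 4 * R + 2 * R := by
          refine add_le_add (add_le_add ?_ ?_) ?_ <;> refine mul_le_mul' le_rfl ?_
          · exact tail (by norm_num) (by norm_num) (by norm_num)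
          · exact tail (by norm_num) (by norm_num) (by norm_num)
          · exact main (by linarith)
      _ = _ := by ring
  have hE2 : E ^ (3 / 2 : ℝ) ≤ c ^ (2 : ℝ) * (4 * R) := by
    refine (ENNReal.rpow_le_rpow hE (by norm_num)).trans ?_
    rw [ENNReal.mul_rpow_of_nonneg _ _ (by norm_num)]
    refine mul_le_mul' (ENNReal.rpow_le_rpow_of_exponent_le hc (by norm_num)) ?_
    rw [ENNReal.mul_rpow_of_nonneg _ _ (by norm_num), ← ENNReal.rpow_mul]
    calc _ ≤ w ^ (-2 * (3 / 2) : ℝ) * (2 * ((b * m ^ (1 / 3 : ℝ)) ^ (3 / 2 : ℝ) +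
            (b ^ (1 / 2 : ℝ) * m ^ (2 / 3 : ℝ)) ^ (3 / 2 : ℝ))) :=
          mul_le_mul' le_rfl (ennreal_add_rpow_three_halves_le _ _)
      _ = 2 * (w ^ (-3 : ℝ) * (b ^ (3 / 2 : ℝ) * m ^ (1 / 2 : ℝ))) +
            2 * (w ^ (-3 : ℝ) * (b ^ (3 / 4 : ℝ) * m ^ (1 : ℝ))) := by
          rw [ENNReal.mul_rpow_of_nonneg _ _ (by norm_num),
            ENNReal.mul_rpow_of_nonneg _ _ (by norm_num), ← ENNReal.rpow_mul, ← ENNReal.rpow_mul,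
            ← ENNReal.rpow_mul, show (-2 * (3 / 2) : ℝ) = -3 by norm_num,
            show (1 / 3 * (3 / 2) : ℝ) = 1 / 2 by norm_num,
            show (2 / 3 * (3 / 2) : ℝ) = 1 by norm_num,
            show (1 / 2 * (3 / 2) : ℝ) = 3 / 4 by norm_num]
          ring
      _ ≤ 2 * R + 2 * R := by
          refine add_le_add ?_ ?_ <;> refine mul_le_mul' le_rfl ?_
          · exact tail (by norm_num) (by norm_num) (by norm_num)
          · exact tail (by norm_num) (by norm_num) (by norm_num)
      _ = _ := by ring
  have hRg : R ≤ g * R := le_mul_of_one_le_left zero_le hg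
  calc _ ≤ 2 * (c ^ (2 : ℝ) * (2 * (g * R))) + 2 * (c ^ (2 : ℝ) * (10 * (g * R))) +
        c ^ (2 : ℝ) * (4 * (g * R)) + g * (c ^ (2 : ℝ) * (2 * R)) := by
        refine add_le_add (add_le_add (add_le_add ?_ ?_) ?_) ?_
        · exact mul_le_mul' le_rfl (hC1.trans (mul_le_mul' hcc (mul_le_mul' le_rfl hRg)))
        · exact mul_le_mul' le_rfl (hD2.trans (mul_le_mul' le_rfl (mul_le_mul' le_rfl hRg)))
        · exact hE2.trans (mul_le_mul' le_rfl (mul_le_mul' le_rfl hRg))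
        · exact mul_le_mul' le_rfl (hCα.trans (mul_le_mul' hcc le_rfl))
    _ = 30 * (c ^ (2 : ℝ) * (g * R)) := by ring
    _ = _ := by ring

end DecayRHS

/-! ### The decay estimate at unit scale -/

theorem Qstar_zero (r : ℝ) :
    Qstar 0 r = Metric.ball (0 : E3) r ×ˢ Ioo (-(7 / 8 * r ^ 2)) (1 / 8 * r ^ 2) := by
  simp [Qstar, ball3]

theorem Qstar_zero_one :
    Qstar 0 1 = Metric.ball (0 : E3) 1 ×ˢ Ioo (-7 / 8 : ℝ) (1 / 8) := by
  rw [Qstar_zero]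
  norm_num

section Integrands

variable (u d : SpT → E3) (p : SpT → ℝ) (a : SpT → Fin 3 → Fin 3 → ℝ) (z : SpT)

theorem nsq2_nonneg' (x : Fin 3 → Fin 3 → ℝ) : 0 ≤ nsq2 x := by
  unfold nsq2
  positivity

theorem ofReal_cube_eq {x : ℝ} (hx : 0 ≤ x) :
    ENNReal.ofReal (x ^ 3) = ENNReal.ofReal (x ^ 2) ^ (3 / 2 : ℝ) := by
  rw [ENNReal.ofReal_pow hx, ENNReal.ofReal_pow hx, ← ENNReal.rpow_natCast, ← ENNReal.rpow_natCast,
    ← ENNReal.rpow_mul]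
  norm_num

theorem cubeDens_eq : ENNReal.ofReal (‖u z‖ ^ 3 + Real.sqrt (nsq2 (a z)) ^ 3) =
    ENNReal.ofReal (‖u z‖ ^ 2) ^ (3 / 2 : ℝ) + ENNReal.ofReal (nsq2 (a z)) ^ (3 / 2 : ℝ) := by
  rw [ENNReal.ofReal_add (by positivity) (by positivity), ofReal_cube_eq (norm_nonneg _),
    ofReal_cube_eq (Real.sqrt_nonneg _), Real.sq_sqrt (nsq2_nonneg' _)]

theorem fdens_eq_add : fdens u a z = ENNReal.ofReal (‖u z‖ ^ 2) + ENNReal.ofReal (nsq2 (a z)) :=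
  ENNReal.ofReal_add (by positivity) (nsq2_nonneg' _)

theorem cubeDens_le : ENNReal.ofReal (‖u z‖ ^ 3 + Real.sqrt (nsq2 (a z)) ^ 3) ≤
    2 * fdens u a z ^ (3 / 2 : ℝ) := by
  rw [cubeDens_eq, fdens_eq_add, two_mul]
  exact add_le_add (ENNReal.rpow_le_rpow le_self_add (by norm_num))
    (ENNReal.rpow_le_rpow le_add_self (by norm_num))

theorem fdens_rpow_le : fdens u a z ^ (3 / 2 : ℝ) ≤
    2 * ENNReal.ofReal (‖u z‖ ^ 3 + Real.sqrt (nsq2 (a z)) ^ 3) := by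
  rw [cubeDens_eq, fdens_eq_add]
  exact ennreal_add_rpow_three_halves_le _ _

theorem EQ_integrand_eq (r : ℝ) : ENNReal.ofReal (‖u z‖ *
      (abs (‖u z‖ ^ 2 - ⨍ y in ball3 (0 : SpT).1 r, ‖u (y, z.2)‖ ^ 2) +
       abs (nsq2 (a z) - ⨍ y in ball3 (0 : SpT).1 r, nsq2 (a (y, z.2))))) = oscDens u a r z := by
  rw [ENNReal.ofReal_mul (norm_nonneg _), ENNReal.ofReal_add (abs_nonneg _) (abs_nonneg _),
    ofReal_norm, ← Real.norm_eq_abs, ← Real.norm_eq_abs, ofReal_norm, ofReal_norm]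
  rfl

theorem FQ_integrand_eq : ENNReal.ofReal (‖u z‖ * |p z|) = ‖u z‖ₑ * ‖p z‖ₑ := by
  rw [ENNReal.ofReal_mul (norm_nonneg _), ofReal_norm, ← Real.norm_eq_abs, ofReal_norm]

theorem DQ_integrand_eq : ENNReal.ofReal (|p z| ^ (3 / 2 : ℝ)) = ‖p z‖ₑ ^ (3 / 2 : ℝ) := by
  rw [← ofReal_norm, ENNReal.ofReal_rpow_of_nonneg (norm_nonneg _) (by norm_num),
    Real.norm_eq_abs]

theorem forcing_le : ENNReal.ofReal (‖d z‖ ^ 2 * nsq2 (a z)) ≤ ENNReal.ofReal (‖d z‖ ^ (2 : ℝ) *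
      (‖u z‖ ^ 3 + Real.sqrt (nsq2 (a z)) ^ 3) ^ (1 - 2 / 6 : ℝ)) := by
  refine ENNReal.ofReal_le_ofReal ?_
  rw [Real.rpow_two]
  refine mul_le_mul_of_nonneg_left ?_ (by positivity)
  have h : nsq2 (a z) = (Real.sqrt (nsq2 (a z)) ^ 3) ^ (1 - 2 / 6 : ℝ) := by
    rw [← Real.rpow_natCast, ← Real.rpow_mul (Real.sqrt_nonneg _),
      show (((3 : ℕ) : ℝ) * (1 - 2 / 6)) = 2 by norm_num, Real.rpow_two,
      Real.sq_sqrt (nsq2_nonneg' _)]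
  calc nsq2 (a z) = _ := h
    _ ≤ _ := Real.rpow_le_rpow (by positivity) (le_add_of_nonneg_left (by positivity))
      (by norm_num)

end Integrands

theorem UnitTriple.decay (K : ℝ) : ∃ c : ℝ≥0, ∀ {u d : SpT → E3} {p : SpT → ℝ}
    {Du a : SpT → Fin 3 → Fin 3 → ℝ} {Da : SpT → Fin 3 → Fin 3 → Fin 3 → ℝ},
    UnitTriple K u d p Du a Da → ∀ {q σ α g : ℝ}, 2 < q → q < σ → σ < 6 →
    α = 6 / σ * ((σ - q) / (6 - q)) → 1 ≤ g → BQ Du Da 0 1 ≤ 1 →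
    (∀ r ∈ Ioc (0 : ℝ) 1, GQ u d a σ 0 r ≤ ENNReal.ofReal g) → MQ u d p a q 0 1 ≠ ⊤ →
    ∀ γ ∈ Ioc (0 : ℝ) (1 / 4), MQ u d p a q 0 γ ≤ c * (ENNReal.ofReal g ^ (6 / (6 - σ)) *
      decayRHS α (ENNReal.ofReal γ) (MQ u d p a q 0 1) (BQ Du Da 0 1)) := by
  obtain ⟨c₁, hE⟩ := UnitTriple.energy_bound K
  obtain ⟨c₀, hD⟩ := UnitTriple.integral_decay
  set k : ℝ≥0∞ := c₁ * 4 ^ (2 / 3 : ℝ) with hk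
  have hkt : k ≠ ⊤ := by rw [hk]; finiteness
  set c : ℝ≥0∞ := 8 * (1 + c₀) * (1 + k) with hc
  have hct : 30 * c ^ (2 : ℝ) ≠ ⊤ := by rw [hc]; finiteness
  refine ⟨(30 * c ^ (2 : ℝ)).toNNReal, fun {u d p Du a Da} h {q σ α g} hq hqσ hσ hα hg hB hG hm γ hγ
    => ?_⟩
  rw [ENNReal.coe_toNNReal hct]
  set m := MQ u d p a q 0 1 with hmdef
  set b := BQ Du Da 0 1 with hb
  set w := ENNReal.ofReal γ with hw
  have hw1 : w ≤ 1 := by rw [hw]; exact ENNReal.ofReal_le_one.2 (by linarith [hγ.2])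
  have hw0 : w ≠ 0 := by rw [hw]; simpa using hγ.1
  have hwt : w ≠ ⊤ := by simp [hw]
  have hα0 : 0 < α := by
    rw [hα]; exact mul_pos (div_pos (by norm_num) (by linarith))
      (div_pos (by linarith) (by linarith))
  have hα1 : α ≤ 1 := by
    rw [hα, div_mul_div_comm, div_le_one (mul_pos (by linarith) (by linarith))]
    nlinarith
  have hb1 : ∫⁻ z in Metric.ball 0 1 ×ˢ Ioo (-7 / 8) (1 / 8), gdens Du Da z = b := by
    simp only [hb, BQ, Qstar_zero_one, ENNReal.ofReal_one, inv_one, one_mul]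
    rfl
  have f1 : ∫⁻ z in Metric.ball 0 1 ×ˢ Ioo (-7 / 8) (1 / 8), fdens u a z ^ (3 / 2 : ℝ) ≤
      4 * m := by
    calc _ ≤ ∫⁻ z in Metric.ball 0 1 ×ˢ Ioo (-7 / 8) (1 / 8),
          2 * ENNReal.ofReal (‖u z‖ ^ 3 + Real.sqrt (nsq2 (a z)) ^ 3) :=
          lintegral_mono fun z => fdens_rpow_le u a z
      _ = 2 * CQ u a 0 1 := by
          rw [lintegral_const_mul' _ _ (by simp), CQ, Qstar_zero_one]
          simp
      _ ≤ 2 * (2 * m) := mul_le_mul' le_rfl CQ_le_two_mul_MQ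
      _ = _ := by ring
  have m4 : ∀ {x : ℝ≥0∞}, x ≤ 4 * m → x ^ (2 / 3 : ℝ) ≤ (4 * m) ^ (2 / 3 : ℝ) := fun hx =>
    ENNReal.rpow_le_rpow hx (by norm_num)
  have f2 : ∫⁻ z in Metric.ball 0 1 ×ˢ Ioo (-7 / 8) (1 / 8),
      ENNReal.ofReal (‖d z‖ ^ 2 * nsq2 (a z)) ≤ (4 * m) ^ (2 / 3 : ℝ) := by
    refine (lintegral_mono fun z => forcing_le u d a z).trans (le_trans (le_of_eq ?_)
      ((GQ_two_le_MQ_rpow (p := p) (z := 0) h.meas_u h.meas_d h.meas_a hq (hqσ.trans hσ)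
        one_pos).trans (m4 (mul_le_mul' (by norm_num) le_rfl))))
    rw [GQ, Qstar_zero_one]
    simp
  have f3 : ∫⁻ z in Metric.ball 0 1 ×ˢ Ioo (-7 / 8) (1 / 8), oscDens u a 1 z ≤
      (4 * m) ^ (2 / 3 : ℝ) := by
    refine le_trans (le_of_eq ?_) ((EQ_le_MQ_rpow (d := d) (p := p) (q := q)).trans
      (m4 (le_mul_of_one_le_left zero_le (by norm_num))))
    rw [EQ, Qstar_zero_one]
    simp only [EQ_integrand_eq]
    simp
  have f4 : ∫⁻ z in Metric.ball 0 1 ×ˢ Ioo (-7 / 8) (1 / 8), ‖u z‖ₑ * ‖p z‖ₑ ≤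
      (4 * m) ^ (2 / 3 : ℝ) := by
    refine le_trans (le_of_eq ?_) ((FQ_le_MQ_rpow (d := d) (a := a) (q := q)).trans
      (m4 (le_mul_of_one_le_left zero_le (by norm_num))))
    rw [FQ, Qstar_zero_one]
    simp only [FQ_integrand_eq]
    simp
  have f5 : ∫⁻ z in Metric.ball 0 1 ×ˢ Ioo (-7 / 8) (1 / 8), ‖p z‖ₑ ^ (3 / 2 : ℝ) ≤
      m ^ (1 / 2 : ℝ) := by
    refine le_trans (le_of_eq ?_) (DQ_le_MQ_rpow (u := u) (d := d) (a := a) (q := q))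
    rw [DQ, Qstar_zero_one]
    simp only [DQ_integrand_eq]
    simp
  obtain ⟨e1, e2⟩ := hE h (M := 4 * m) (by finiteness) f1 f2 f3 f4 (hb1.trans_le hB)
  obtain ⟨d1, d2, d3⟩ := hD h e1 hb1.le (ne_top_of_le_ne_top ENNReal.one_ne_top hB)
    (ne_top_of_le_ne_top (by finiteness) f5) e2 γ hγ.1 hγ.2
  rw [← Qstar_zero] at d1 d2 d3
  have hA : ∀ s : ℝ, 0 ≤ s → s ≤ 1 → ((c₁ : ℝ≥0∞) * (4 * m) ^ (2 / 3 : ℝ)) ^ s ≤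
      (1 + k) * m ^ (2 / 3 * s) := fun s hs hs1 => by
    rw [ENNReal.mul_rpow_of_nonneg 4 _ (by norm_num), ← mul_assoc, ← hk,
      ENNReal.mul_rpow_of_nonneg _ _ hs, ← ENNReal.rpow_mul]
    refine mul_le_mul' ?_ le_rfl
    calc k ^ s ≤ (1 + k) ^ s := ENNReal.rpow_le_rpow le_add_self hs
      _ ≤ (1 + k) ^ (1 : ℝ) := ENNReal.rpow_le_rpow_of_exponent_le le_self_add hs1
      _ = _ := ENNReal.rpow_one _
  have hA2 := hA (1 / 2) (by norm_num) (by norm_num)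
  have hA3 := hA (3 / 4) (by norm_num) (by norm_num)
  have hA1 := hA 1 (by norm_num) (by norm_num)
  rw [ENNReal.rpow_one] at hA1
  norm_num only at hA1 hA2 hA3
  have hwγ : (ENNReal.ofReal (γ ^ 2))⁻¹ = w ^ (-2 : ℝ) := by
    rw [ENNReal.ofReal_pow hγ.1.le, ENNReal.rpow_neg, ← hw]
    norm_num
  have hw3 : ENNReal.ofReal (γ ^ 3) = w ^ (3 : ℝ) := by
    rw [ENNReal.ofReal_pow hγ.1.le, ← hw, ← ENNReal.rpow_natCast]
    norm_num
  have hww : w ^ (-2 : ℝ) * w ^ (3 : ℝ) = w := by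
    rw [← ENNReal.rpow_add _ _ hw0 hwt]
    norm_num
  rw [hw3] at d1 d3
  have hk1 : 1 ≤ 1 + k := le_self_add
  have hc0 : (c₀ : ℝ≥0∞) ≤ 1 + c₀ := le_add_self
  have c1 : (c₀ : ℝ≥0∞) * (1 + k) ≤ c := by
    rw [hc, mul_assoc]
    exact (mul_le_mul' hc0 le_rfl).trans (le_mul_of_one_le_left zero_le (by norm_num))
  have c2 : 8 * (c₀ : ℝ≥0∞) * (1 + k) ≤ c := by
    rw [hc]
    exact mul_le_mul' (mul_le_mul' le_rfl hc0) le_rfl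
  refine (MQ_le h.meas_u h.meas_d h.meas_a h.meas_p (by linarith) hqσ hσ hα hg hγ.1
    (hG γ ⟨hγ.1, by linarith [hγ.2]⟩)).trans ?_
  refine combine_le_decayRHS ?_ ?_ hα0 hα1 hw1 hB ?_ ?_ ?_
  · exact one_le_mul (one_le_mul (by norm_num) le_self_add) le_self_add
  · exact ENNReal.one_le_rpow (by simpa using hg) (div_pos (by norm_num) (by linarith))
  · rw [CQ, hwγ]
    calc _ ≤ w ^ (-2 : ℝ) * ∫⁻ z in Qstar 0 γ, 2 * fdens u a z ^ (3 / 2 : ℝ) :=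
          mul_le_mul' le_rfl (lintegral_mono fun z => cubeDens_le u a z)
      _ = w ^ (-2 : ℝ) * (2 * ∫⁻ z in Qstar 0 γ, fdens u a z ^ (3 / 2 : ℝ)) := by
          rw [lintegral_const_mul' _ _ (by simp)]
      _ ≤ w ^ (-2 : ℝ) * (2 * (c₀ * ((1 + k) * m ^ (1 / 3 : ℝ) * b +
            w ^ (3 : ℝ) * ((1 + k) * (4 * m))))) := by
          refine mul_le_mul' le_rfl (mul_le_mul' le_rfl (d1.trans (mul_le_mul' le_rfl
            (add_le_add (mul_le_mul' hA2 le_rfl) (mul_le_mul' le_rfl (f1.trans ?_))))))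
          exact le_mul_of_one_le_left zero_le hk1
      _ = 2 * (c₀ * (1 + k)) * (w ^ (-2 : ℝ) * (b * m ^ (1 / 3 : ℝ))) +
            8 * c₀ * (1 + k) * ((w ^ (-2 : ℝ) * w ^ (3 : ℝ)) * m) := by ring
      _ ≤ c * (w ^ (-2 : ℝ) * (b * m ^ (1 / 3 : ℝ))) + c * (w * m) := by
          rw [hww]
          refine add_le_add (mul_le_mul' (le_trans ?_ c2) le_rfl) (mul_le_mul' c2 le_rfl)
          rw [mul_assoc 8]
          exact mul_le_mul' (by norm_num) le_rfl
      _ = _ := by ring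
  · simp only [DQ, hwγ, DQ_integrand_eq]
    calc _ ≤ w ^ (-2 : ℝ) * (c₀ * ((1 + k) * m ^ (1 / 3 : ℝ) * b +
            (1 + k) * m ^ (1 / 2 : ℝ) * b ^ (3 / 4 : ℝ) +
            w ^ (3 : ℝ) * ((1 + k) * m ^ (1 / 2 : ℝ)))) := by
          refine mul_le_mul' le_rfl (d3.trans (mul_le_mul' le_rfl (add_le_add (add_le_add
            (mul_le_mul' hA2 le_rfl) (mul_le_mul' hA3 le_rfl)) (mul_le_mul' le_rfl
              (f5.trans ?_)))))
          exact le_mul_of_one_le_left zero_le hk1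
      _ = c₀ * (1 + k) * (w ^ (-2 : ℝ) * (b * m ^ (1 / 3 : ℝ) +
            b ^ (3 / 4 : ℝ) * m ^ (1 / 2 : ℝ)) +
            w ^ (-2 : ℝ) * w ^ (3 : ℝ) * m ^ (1 / 2 : ℝ)) := by ring
      _ ≤ _ := by
          rw [hww]
          exact mul_le_mul' c1 le_rfl
  · simp only [EQ, hwγ, EQ_integrand_eq]
    calc _ ≤ w ^ (-2 : ℝ) * (c₀ * ((1 + k) * m ^ (1 / 3 : ℝ) * b +
            (1 + k) * m ^ (2 / 3 : ℝ) * b ^ (1 / 2 : ℝ))) := by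
          exact mul_le_mul' le_rfl (d2.trans (mul_le_mul' le_rfl (add_le_add
            (mul_le_mul' hA2 le_rfl) (mul_le_mul' hA1 le_rfl))))
      _ = c₀ * (1 + k) * (w ^ (-2 : ℝ) * (b * m ^ (1 / 3 : ℝ) +
            b ^ (1 / 2 : ℝ) * m ^ (2 / 3 : ℝ))) := by ring
      _ ≤ _ := mul_le_mul' c1 le_rfl

/-! ### Parabolic rescaling: change of variables -/

section Affine

variable {E : Type*} [NormedAddCommGroup E] [NormedSpace ℝ E] [MeasurableSpace E] [BorelSpace E]

/-- The dilation `y ↦ x₀ + r y` as a homeomorphism. -/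
def dilation (x₀ : E) (r : ℝ) (hr : r ≠ 0) : E ≃ₜ E :=
  (Homeomorph.smulOfNeZero r hr).trans (Homeomorph.addLeft x₀)

theorem dilation_apply {E : Type*} [NormedAddCommGroup E] [NormedSpace ℝ E] (x₀ : E)
    {r : ℝ} (hr : r ≠ 0) (y : E) :
    dilation x₀ r hr y = x₀ + r • y := rfl

theorem dilation_symm_apply {E : Type*} [NormedAddCommGroup E] [NormedSpace ℝ E] (x₀ : E)
    {r : ℝ} (hr : r ≠ 0) (x : E) :
    (dilation x₀ r hr).symm x = r⁻¹ • (x - x₀) := by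
  rw [Homeomorph.symm_apply_eq, dilation_apply, smul_inv_smul₀ hr]
  abel

theorem map_dilation [FiniteDimensional ℝ E] (μ : Measure E) [μ.IsAddHaarMeasure] (x₀ : E) {r : ℝ}
    (hr : 0 < r) : μ.map (dilation x₀ r hr.ne').toMeasurableEquiv =
      ENNReal.ofReal (r ^ Module.finrank ℝ E)⁻¹ • μ := by
  have h1 : (⇑(dilation x₀ r hr.ne').toMeasurableEquiv : E → E) = (x₀ + ·) ∘ (r • ·) := rfl
  rw [h1, ← Measure.map_map (measurable_const_add x₀) (measurable_const_smul r),
    Measure.map_addHaar_smul μ hr.ne', Measure.map_smul, map_add_left_eq_self, abs_of_nonneg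
      (by positivity)]

end Affine

/-- The parabolic dilation `(y, s) ↦ (x₀ + ρ y, t₀ + ρ² s)`. -/
def parMap (z₀ : SpT) (ρ : ℝ) (hρ : ρ ≠ 0) : SpT ≃ₜ SpT :=
  (dilation z₀.1 ρ hρ).prodCongr (dilation z₀.2 (ρ ^ 2) (pow_ne_zero 2 hρ))

theorem parMap_apply (z₀ : SpT) {ρ : ℝ} (hρ : ρ ≠ 0) (z : SpT) :
    parMap z₀ ρ hρ z = (z₀.1 + ρ • z.1, z₀.2 + ρ ^ 2 * z.2) := rfl

theorem map_parMap (z₀ : SpT) {ρ : ℝ} (hρ : 0 < ρ) :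
    (volume : Measure SpT).map (parMap z₀ ρ hρ.ne').toMeasurableEquiv =
      ENNReal.ofReal (ρ ^ 5)⁻¹ • volume := by
  have h1 := map_dilation (volume : Measure E3) z₀.1 hρ
  have h2 := map_dilation (volume : Measure ℝ) z₀.2 (pow_pos hρ 2)
  have h3 := Measure.map_prod_map (volume : Measure E3) (volume : Measure ℝ)
    (dilation z₀.1 ρ hρ.ne').toMeasurableEquiv.measurable
    (dilation z₀.2 (ρ ^ 2) (pow_pos hρ 2).ne').toMeasurableEquiv.measurable
  rw [h1, h2, Measure.prod_smul_left, Measure.prod_smul_right, smul_smul] at h3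
  refine h3.symm.trans ?_
  rw [← ENNReal.ofReal_mul (by positivity)]
  refine congrArg (fun s => ENNReal.ofReal s • volume) ?_
  simp only [finrank_euclideanSpace, Fintype.card_fin, Module.finrank_self]
  field_simp

theorem setLIntegral_eq_of_map {α : Type*} [MeasurableSpace α] {μ : Measure α} (e : α ≃ᵐ α)
    {r : ℝ} (hr : 0 < r) (h : μ.map e = ENNReal.ofReal r⁻¹ • μ) (f : α → ℝ≥0∞) (s : Set α) :
    ∫⁻ x in s, f x ∂μ = ENNReal.ofReal r * ∫⁻ x in e ⁻¹' s, f (e x) ∂μ := by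
  rw [← lintegral_map_equiv f e, ← e.restrict_map, h, Measure.restrict_smul,
    lintegral_smul_measure, smul_eq_mul, ← mul_assoc, ← ENNReal.ofReal_mul hr.le,
    mul_inv_cancel₀ hr.ne', ENNReal.ofReal_one, one_mul]

theorem setIntegral_eq_of_map {α : Type*} [MeasurableSpace α] {μ : Measure α} (e : α ≃ᵐ α)
    {r : ℝ} (hr : 0 < r) (h : μ.map e = ENNReal.ofReal r⁻¹ • μ) (f : α → ℝ) (s : Set α) :
    ∫ x in s, f x ∂μ = r * ∫ x in e ⁻¹' s, f (e x) ∂μ := by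
  rw [← setIntegral_map_equiv e f, h, Measure.restrict_smul, integral_smul_measure, smul_eq_mul,
    ← mul_assoc, ENNReal.toReal_ofReal (by positivity), mul_inv_cancel₀ hr.ne', one_mul]

section ChangeOfVariables

variable (z₀ : SpT) {ρ : ℝ}

theorem parMap_preimage_Qstar (hρ : 0 < ρ) (γ : ℝ) :
    parMap z₀ ρ hρ.ne' ⁻¹' Qstar z₀ (γ * ρ) = Qstar 0 γ := by
  have h2 : 0 < ρ ^ 2 := by positivity
  ext z
  simp only [mem_preimage, parMap_apply, Qstar, ball3, mem_prod, Metric.mem_ball, mem_Ioo,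
    dist_self_add_left, norm_smul, Real.norm_eq_abs, abs_of_pos hρ, Prod.fst_zero, Prod.snd_zero,
    dist_zero_right]
  refine and_congr ?_ (and_congr ?_ ?_)
  · rw [mul_comm γ, mul_lt_mul_iff_right₀ hρ]
  · rw [← mul_lt_mul_iff_right₀ h2 (b := 0 - 7 / 8 * γ ^ 2)]
    constructor <;> intro h <;> nlinarith
  · rw [← mul_lt_mul_iff_right₀ h2 (c := 0 + 1 / 8 * γ ^ 2)]
    constructor <;> intro h <;> nlinarith

theorem dilation_preimage_ball (hρ : 0 < ρ) (x₀ : E3) (γ : ℝ) :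
    dilation x₀ ρ hρ.ne' ⁻¹' Metric.ball x₀ (γ * ρ) = Metric.ball 0 γ := by
  ext x
  simp only [mem_preimage, dilation_apply, Metric.mem_ball, dist_self_add_left, norm_smul,
    Real.norm_eq_abs, abs_of_pos hρ, dist_zero_right]
  rw [mul_comm γ, mul_lt_mul_iff_right₀ hρ]

theorem setLIntegral_Qstar_eq (hρ : 0 < ρ) (F : SpT → ℝ≥0∞) (γ : ℝ) :
    ∫⁻ z in Qstar z₀ (γ * ρ), F z =
      ENNReal.ofReal (ρ ^ 5) * ∫⁻ z in Qstar 0 γ, F (parMap z₀ ρ hρ.ne' z) := by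
  rw [setLIntegral_eq_of_map (parMap z₀ ρ hρ.ne').toMeasurableEquiv (by positivity)
    (map_parMap z₀ hρ)]
  exact congrArg (fun s => ENNReal.ofReal (ρ ^ 5) * ∫⁻ z in s, F (parMap z₀ ρ hρ.ne' z))
    (parMap_preimage_Qstar z₀ hρ γ)

theorem setIntegral_Qstar_eq (hρ : 0 < ρ) (F : SpT → ℝ) :
    ∫ z in Qstar z₀ ρ, F z = ρ ^ 5 * ∫ z in Qstar 0 1, F (parMap z₀ ρ hρ.ne' z) := by
  rw [setIntegral_eq_of_map (parMap z₀ ρ hρ.ne').toMeasurableEquiv (by positivity)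
    (map_parMap z₀ hρ)]
  refine congrArg (fun s => ρ ^ 5 * ∫ z in s, F (parMap z₀ ρ hρ.ne' z)) ?_
  simpa using parMap_preimage_Qstar z₀ hρ 1

theorem map_dilation_three (hρ : 0 < ρ) (x₀ : E3) :
    (volume : Measure E3).map (dilation x₀ ρ hρ.ne').toMeasurableEquiv =
      ENNReal.ofReal (ρ ^ 3)⁻¹ • volume := by
  simpa using map_dilation (volume : Measure E3) x₀ hρ

theorem setIntegral_ball_eq (hρ : 0 < ρ) (x₀ : E3) (f : E3 → ℝ) (γ : ℝ) :
    ∫ x in Metric.ball x₀ (γ * ρ), f x = ρ ^ 3 * ∫ y in Metric.ball 0 γ, f (x₀ + ρ • y) := by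
  rw [setIntegral_eq_of_map (dilation x₀ ρ hρ.ne').toMeasurableEquiv (by positivity)
    (map_dilation_three hρ x₀)]
  exact congrArg (fun s => ρ ^ 3 * ∫ y in s, f (x₀ + ρ • y)) (dilation_preimage_ball hρ x₀ γ)

theorem setLIntegral_ball_eq (hρ : 0 < ρ) (x₀ : E3) (f : E3 → ℝ≥0∞) (γ : ℝ) :
    ∫⁻ x in Metric.ball x₀ (γ * ρ), f x =
      ENNReal.ofReal (ρ ^ 3) * ∫⁻ y in Metric.ball 0 γ, f (x₀ + ρ • y) := by
  rw [setLIntegral_eq_of_map (dilation x₀ ρ hρ.ne').toMeasurableEquiv (by positivity)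
    (map_dilation_three hρ x₀)]
  exact congrArg (fun s => ENNReal.ofReal (ρ ^ 3) * ∫⁻ y in s, f (x₀ + ρ • y))
    (dilation_preimage_ball hρ x₀ γ)

theorem setAverage_ball_eq (hρ : 0 < ρ) (x₀ : E3) (f : E3 → ℝ) (γ : ℝ) :
    ⨍ x in Metric.ball x₀ (γ * ρ), f x = ⨍ y in Metric.ball 0 γ, f (x₀ + ρ • y) := by
  have h := setIntegral_ball_eq hρ x₀ (fun _ => 1) γ
  simp only [setIntegral_const, smul_eq_mul, mul_one] at h
  rw [setAverage_eq, setAverage_eq, setIntegral_ball_eq hρ, h, smul_eq_mul, smul_eq_mul, mul_inv,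
    mul_mul_mul_comm, inv_mul_cancel₀ (by positivity), one_mul]

theorem map_dilation_time (hρ : 0 < ρ) (t₀ : ℝ) :
    (volume : Measure ℝ).map (dilation t₀ (ρ ^ 2) (pow_pos hρ 2).ne').toMeasurableEquiv =
      ENNReal.ofReal (ρ ^ 2)⁻¹ • volume := by
  simpa using map_dilation (volume : Measure ℝ) t₀ (pow_pos hρ 2)

theorem dilation_preimage_Istar (hρ : 0 < ρ) (t₀ : ℝ) :
    dilation t₀ (ρ ^ 2) (pow_pos hρ 2).ne' ⁻¹' Istar t₀ ρ = Ioo (-7 / 8) (1 / 8) := by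
  have h2 : 0 < ρ ^ 2 := by positivity
  ext s
  simp only [mem_preimage, dilation_apply, Istar, mem_Ioo, smul_eq_mul]
  constructor <;> rintro ⟨h, h'⟩ <;> constructor <;> nlinarith

theorem setLIntegral_Istar_eq (hρ : 0 < ρ) (t₀ : ℝ) (f : ℝ → ℝ≥0∞) :
    ∫⁻ t in Istar t₀ ρ, f t =
      ENNReal.ofReal (ρ ^ 2) * ∫⁻ s in Ioo (-7 / 8) (1 / 8), f (t₀ + ρ ^ 2 * s) := by
  rw [setLIntegral_eq_of_map (dilation t₀ (ρ ^ 2) (pow_pos hρ 2).ne').toMeasurableEquiv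
    (by positivity) (map_dilation_time hρ t₀)]
  exact congrArg (fun s => ENNReal.ofReal (ρ ^ 2) * ∫⁻ t in s, f (t₀ + ρ ^ 2 * t))
    (dilation_preimage_Istar hρ t₀)

theorem ae_Istar_comp (hρ : 0 < ρ) {t₀ : ℝ} {P : ℝ → Prop} (h : ∀ᵐ t ∂(volume.restrict (Istar t₀ ρ)), P t) :
    ∀ᵐ s ∂(volume.restrict (Ioo (-7 / 8 : ℝ) (1 / 8))), P (t₀ + ρ ^ 2 * s) := by
  set e := (dilation t₀ (ρ ^ 2) (pow_pos hρ 2).ne').toMeasurableEquiv with he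
  have h1 : ((volume : Measure ℝ).restrict (Ioo (-7 / 8) (1 / 8))).map e =
      ENNReal.ofReal (ρ ^ 2)⁻¹ • volume.restrict (Istar t₀ ρ) := by
    rw [← Measure.restrict_smul, ← map_dilation_time hρ t₀, ← he, e.restrict_map]
    exact congrArg (fun s => (volume.restrict s).map e) (dilation_preimage_Istar hρ t₀).symm
  have h2 : ∀ᵐ t ∂(((volume : Measure ℝ).restrict (Ioo (-7 / 8) (1 / 8))).map e), P t := by
    rw [h1]
    exact Measure.ae_smul_measure h _
  exact ae_of_ae_map e.measurable.aemeasurable h2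

end ChangeOfVariables

/-! ### Scale invariance -/

/-- Rescaled velocity. -/
def scaleU (z₀ : SpT) (ρ : ℝ) (hρ : ρ ≠ 0) (u : SpT → E3) (z : SpT) : E3 :=
  ρ • u (parMap z₀ ρ hρ z)

/-- Rescaled matrix field of homogeneity `n`. -/
def scaleMat (z₀ : SpT) (ρ : ℝ) (hρ : ρ ≠ 0) (n : ℕ) (a : SpT → Fin 3 → Fin 3 → ℝ) (z : SpT)
    (i j : Fin 3) : ℝ := ρ ^ n * a (parMap z₀ ρ hρ z) i j

/-- Rescaled array of second derivatives. -/
def scaleTen (z₀ : SpT) (ρ : ℝ) (hρ : ρ ≠ 0) (Da : SpT → Fin 3 → Fin 3 → Fin 3 → ℝ) (z : SpT)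
    (i j k : Fin 3) : ℝ := ρ ^ 2 * Da (parMap z₀ ρ hρ z) i j k

/-- Rescaled pressure. -/
def scaleP (z₀ : SpT) (ρ : ℝ) (hρ : ρ ≠ 0) (p : SpT → ℝ) (z : SpT) : ℝ :=
  ρ ^ 2 * p (parMap z₀ ρ hρ z)

theorem nsq2_const_mul (c : ℝ) (x : Fin 3 → Fin 3 → ℝ) :
    nsq2 (fun i j => c * x i j) = c ^ 2 * nsq2 x := by
  simp only [nsq2, mul_pow, Finset.mul_sum]

theorem nsq3_const_mul (c : ℝ) (x : Fin 3 → Fin 3 → Fin 3 → ℝ) :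
    nsq3 (fun i j k => c * x i j k) = c ^ 2 * nsq3 x := by
  simp only [nsq3, mul_pow, Finset.mul_sum]

section

variable (z₀ : SpT) {ρ : ℝ} (hρ : 0 < ρ) (u d : SpT → E3) (p : SpT → ℝ)
  (Du a : SpT → Fin 3 → Fin 3 → ℝ) (Da : SpT → Fin 3 → Fin 3 → Fin 3 → ℝ)

theorem norm_scaleU (z : SpT) :
    ‖scaleU z₀ ρ hρ.ne' u z‖ = ρ * ‖u (parMap z₀ ρ hρ.ne' z)‖ := by
  rw [scaleU, norm_smul, Real.norm_eq_abs, abs_of_pos hρ]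

theorem nsq2_scaleMat (n : ℕ) (z : SpT) :
    nsq2 (scaleMat z₀ ρ hρ.ne' n a z) = (ρ ^ n) ^ 2 * nsq2 (a (parMap z₀ ρ hρ.ne' z)) :=
  nsq2_const_mul _ _

theorem nsq3_scaleTen (z : SpT) :
    nsq3 (scaleTen z₀ ρ hρ.ne' Da z) = (ρ ^ 2) ^ 2 * nsq3 (Da (parMap z₀ ρ hρ.ne' z)) :=
  nsq3_const_mul _ _

theorem cube_scale (z : SpT) :
    ‖scaleU z₀ ρ hρ.ne' u z‖ ^ 3 + Real.sqrt (nsq2 (scaleMat z₀ ρ hρ.ne' 1 a z)) ^ 3 =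
      ρ ^ 3 * (‖u (parMap z₀ ρ hρ.ne' z)‖ ^ 3 +
        Real.sqrt (nsq2 (a (parMap z₀ ρ hρ.ne' z))) ^ 3) := by
  rw [norm_scaleU z₀ hρ, nsq2_scaleMat z₀ hρ, Real.sqrt_mul (by positivity), Real.sqrt_sq (by positivity)]
  ring

theorem inv_mul_setLIntegral_scale {γ s s' κ : ℝ} (hs : 0 < s) (hs' : 0 < s') (hκ : 0 < κ)
    (h : s' * ρ ^ 5 = κ * s) (f g : SpT → ℝ)
    (hfg : ∀ z, g z = κ * f (parMap z₀ ρ hρ.ne' z)) :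
    (ENNReal.ofReal s')⁻¹ * ∫⁻ z in Qstar 0 γ, ENNReal.ofReal (g z) =
      (ENNReal.ofReal s)⁻¹ * ∫⁻ z in Qstar z₀ (γ * ρ), ENNReal.ofReal (f z) := by
  rw [setLIntegral_Qstar_eq z₀ hρ]
  simp only [hfg, ENNReal.ofReal_mul hκ.le]
  rw [lintegral_const_mul' _ _ (by simp), ← mul_assoc, ← mul_assoc]
  congr 1
  rw [← ENNReal.ofReal_inv_of_pos hs, ← ENNReal.ofReal_inv_of_pos hs', ← ENNReal.ofReal_mul
    (by positivity), ← ENNReal.ofReal_mul (by positivity)]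
  congr 1
  field_simp
  linarith

variable {γ : ℝ}

theorem CQ_scale (hγ : 0 < γ) :
    CQ (scaleU z₀ ρ hρ.ne' u) (scaleMat z₀ ρ hρ.ne' 1 a) 0 γ = CQ u a z₀ (γ * ρ) :=
  inv_mul_setLIntegral_scale z₀ hρ (κ := ρ ^ 3) (by positivity) (by positivity) (by positivity)
    (by ring) (fun z => ‖u z‖ ^ 3 + Real.sqrt (nsq2 (a z)) ^ 3) _ fun z => cube_scale z₀ hρ u a z

theorem BQ_scale (hγ : 0 < γ) : BQ (scaleMat z₀ ρ hρ.ne' 2 Du) (scaleTen z₀ ρ hρ.ne' Da) 0 γ =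
    BQ Du Da z₀ (γ * ρ) :=
  inv_mul_setLIntegral_scale z₀ hρ (κ := ρ ^ 4) (by positivity) (by positivity) (by positivity)
    (by ring) (fun z => nsq2 (Du z) + nsq3 (Da z)) _ fun z => by
      rw [nsq2_scaleMat z₀ hρ, nsq3_scaleTen z₀ hρ]
      ring

theorem DQ_scale (hγ : 0 < γ) : DQ (scaleP z₀ ρ hρ.ne' p) 0 γ = DQ p z₀ (γ * ρ) :=
  inv_mul_setLIntegral_scale z₀ hρ (κ := ρ ^ 3) (by positivity) (by positivity) (by positivity)
    (by ring) (fun z => |p z| ^ (3 / 2 : ℝ)) _ fun z => by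
      rw [scaleP, abs_mul, abs_of_pos (by positivity : (0 : ℝ) < ρ ^ 2),
        Real.mul_rpow (by positivity) (abs_nonneg _), ← Real.rpow_natCast, ← Real.rpow_natCast,
        ← Real.rpow_mul hρ.le]
      norm_num

theorem FQ_scale (hγ : 0 < γ) : FQ (scaleU z₀ ρ hρ.ne' u) (scaleP z₀ ρ hρ.ne' p) 0 γ =
    FQ u p z₀ (γ * ρ) :=
  inv_mul_setLIntegral_scale z₀ hρ (κ := ρ ^ 3) (by positivity) (by positivity) (by positivity)
    (by ring) (fun z => ‖u z‖ * |p z|) _ fun z => by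
      rw [norm_scaleU z₀ hρ, scaleP, abs_mul, abs_of_pos (by positivity : (0 : ℝ) < ρ ^ 2)]
      ring

theorem GQ_scale (hγ : 0 < γ) (q : ℝ) :
    GQ (scaleU z₀ ρ hρ.ne' u) (fun z => d (parMap z₀ ρ hρ.ne' z)) (scaleMat z₀ ρ hρ.ne' 1 a) q 0 γ =
      GQ u d a q z₀ (γ * ρ) := by
  refine inv_mul_setLIntegral_scale z₀ hρ (κ := ρ ^ (3 - q / 2)) (by positivity) (by positivity)
    (by positivity) ?_ (fun z => ‖d z‖ ^ q *
      (‖u z‖ ^ 3 + Real.sqrt (nsq2 (a z)) ^ 3) ^ (1 - q / 6)) _ fun z => ?_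
  · rw [Real.mul_rpow hγ.le hρ.le, mul_left_comm, ← Real.rpow_add hρ, ← Real.rpow_natCast]
    congr 2
    push_cast
    ring
  · rw [cube_scale z₀ hρ, Real.mul_rpow (by positivity) (by positivity), ← Real.rpow_natCast ρ 3,
      ← Real.rpow_mul hρ.le, mul_left_comm]
    congr 2
    push_cast
    ring

theorem EQ_scale (hγ : 0 < γ) : EQ (scaleU z₀ ρ hρ.ne' u) (scaleMat z₀ ρ hρ.ne' 1 a) 0 γ =
    EQ u a z₀ (γ * ρ) := by
  refine inv_mul_setLIntegral_scale z₀ hρ (κ := ρ ^ 3) (by positivity) (by positivity)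
    (by positivity) (by ring) (fun z => ‖u z‖ *
      (abs (‖u z‖ ^ 2 - ⨍ y in ball3 z₀.1 (γ * ρ), ‖u (y, z.2)‖ ^ 2) +
       abs (nsq2 (a z) - ⨍ y in ball3 z₀.1 (γ * ρ), nsq2 (a (y, z.2))))) _ fun z => ?_
  have av : ∀ (F : SpT → ℝ) (c : ℝ), ⨍ y in ball3 (0 : SpT).1 γ, c * F (parMap z₀ ρ hρ.ne' (y, z.2)) =
      c * ⨍ y in ball3 z₀.1 (γ * ρ), F (y, (parMap z₀ ρ hρ.ne' z).2) := fun F c => by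
    unfold ball3
    rw [setAverage_ball_eq hρ, setAverage_eq, setAverage_eq, integral_const_mul, smul_eq_mul,
      smul_eq_mul, mul_left_comm]
    rfl
  have key : ∀ F : SpT → ℝ, |ρ ^ 2 * F (parMap z₀ ρ hρ.ne' z) -
      ⨍ y in ball3 (0 : SpT).1 γ, ρ ^ 2 * F (parMap z₀ ρ hρ.ne' (y, z.2))| =
      ρ ^ 2 * |F (parMap z₀ ρ hρ.ne' z) -
        ⨍ y in ball3 z₀.1 (γ * ρ), F (y, (parMap z₀ ρ hρ.ne' z).2)| := fun F => by
    rw [av, ← mul_sub, abs_mul, abs_of_pos (by positivity)]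
  have e1 : ∀ z, ‖scaleU z₀ ρ hρ.ne' u z‖ ^ 2 = ρ ^ 2 * ‖u (parMap z₀ ρ hρ.ne' z)‖ ^ 2 := fun z => by
    rw [norm_scaleU z₀ hρ, mul_pow]
  have e2 : ∀ z, nsq2 (scaleMat z₀ ρ hρ.ne' 1 a z) = ρ ^ 2 * nsq2 (a (parMap z₀ ρ hρ.ne' z)) :=
    fun z => by rw [nsq2_scaleMat z₀ hρ, pow_one]
  simp only [e1, e2]
  rw [key fun z => ‖u z‖ ^ 2, key fun z => nsq2 (a z), norm_scaleU z₀ hρ]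
  ring

theorem MQ_scale (hγ : 0 < γ) (q : ℝ) :
    MQ (scaleU z₀ ρ hρ.ne' u) (fun z => d (parMap z₀ ρ hρ.ne' z)) (scaleP z₀ ρ hρ.ne' p)
      (scaleMat z₀ ρ hρ.ne' 1 a) q 0 γ = MQ u d p a q z₀ (γ * ρ) := by
  unfold MQ
  rw [CQ_scale z₀ hρ u a hγ, GQ_scale z₀ hρ u d a hγ, DQ_scale z₀ hρ p hγ, EQ_scale z₀ hρ u a hγ,
    FQ_scale z₀ hρ u p hγ]

end

/-! ### Rescaling of suitable triples -/

theorem IsTestOn.sderiv_isTestOn {U : Set SpT} {ψ : SpT → ℝ} (h : IsTestOn U ψ) (j : Fin 3) :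
    IsTestOn U (sderiv j ψ) :=
  ⟨IsTestOn.sderiv_contDiff h.1 j, h.2.1.fderiv_apply ℝ _,
    (tsupport_fderiv_apply_subset ℝ _).trans h.2.2⟩

theorem IsTestOn.eq_zero {U : Set SpT} {ψ : SpT → ℝ} (h : IsTestOn U ψ) {z : SpT} (hz : z ∉ U) :
    ψ z = 0 :=
  image_eq_zero_of_notMem_tsupport fun hs => hz (h.2.2 hs)

theorem IsTestOn.tderiv_eq_zero {U : Set SpT} {ψ : SpT → ℝ} (h : IsTestOn U ψ) {z : SpT}
    (hz : z ∉ U) : tderiv ψ z = 0 := by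
  rw [tderiv, fderiv_of_notMem_tsupport (𝕜 := ℝ) fun hs => hz (h.2.2 hs)]
  rfl

section

variable (z₀ : SpT) {ρ : ℝ} (hρ : 0 < ρ)

/-- A function on the unit cylinder transplanted to the cylinder of radius `ρ` at `z₀`. -/
def transplant (ψ : SpT → ℝ) (w : SpT) : ℝ := ψ ((parMap z₀ ρ hρ.ne').symm w)

theorem transplant_parMap (ψ : SpT → ℝ) (z : SpT) :
    transplant z₀ hρ ψ (parMap z₀ ρ hρ.ne' z) = ψ z := by
  rw [transplant, Homeomorph.symm_apply_apply]

theorem parMap_symm_apply (w : SpT) : (parMap z₀ ρ hρ.ne').symm w =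
    (ρ⁻¹ • (w.1 - z₀.1), (ρ ^ 2)⁻¹ • (w.2 - z₀.2)) :=
  Prod.ext (dilation_symm_apply _ _ _) (dilation_symm_apply _ _ _)

theorem hasFDerivAt_transplant {ψ : SpT → ℝ} (hψ : ContDiff ℝ (⊤ : ℕ∞) ψ) (w : SpT) :
    HasFDerivAt (transplant z₀ hρ ψ) ((fderiv ℝ ψ ((parMap z₀ ρ hρ.ne').symm w)).comp
      ((ρ⁻¹ • ContinuousLinearMap.id ℝ E3).prodMap
        ((ρ ^ 2)⁻¹ • ContinuousLinearMap.id ℝ ℝ))) w := by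
  have h1 : HasFDerivAt (parMap z₀ ρ hρ.ne').symm ((ρ⁻¹ • ContinuousLinearMap.id ℝ E3).prodMap
        ((ρ ^ 2)⁻¹ • ContinuousLinearMap.id ℝ ℝ)) w := by
    rw [show ⇑(parMap z₀ ρ hρ.ne').symm = fun w =>
      (ρ⁻¹ • (w.1 - z₀.1), (ρ ^ 2)⁻¹ • (w.2 - z₀.2)) from funext (parMap_symm_apply z₀ hρ)]
    have h2 := (hasFDerivAt_snd (𝕜 := ℝ) (p := w)).sub_const z₀.2
    exact ((hasFDerivAt_fst.sub_const z₀.1).const_smul ρ⁻¹).prodMk (h2.const_smul (ρ ^ 2)⁻¹)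
  exact ((hψ.differentiable (by simp)) _).hasFDerivAt.comp w h1

theorem sderiv_transplant {ψ : SpT → ℝ} (hψ : ContDiff ℝ (⊤ : ℕ∞) ψ) (j : Fin 3) :
    sderiv j (transplant z₀ hρ ψ) = fun w => ρ⁻¹ * transplant z₀ hρ (sderiv j ψ) w := by
  funext w
  rw [sderiv, (hasFDerivAt_transplant z₀ hρ hψ w).fderiv, transplant, sderiv, ← smul_eq_mul,
    ← map_smul]
  simp

theorem tderiv_transplant {ψ : SpT → ℝ} (hψ : ContDiff ℝ (⊤ : ℕ∞) ψ) (w : SpT) :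
    tderiv (transplant z₀ hρ ψ) w = (ρ ^ 2)⁻¹ * transplant z₀ hρ (tderiv ψ) w := by
  rw [tderiv, (hasFDerivAt_transplant z₀ hρ hψ w).fderiv, transplant, tderiv, ← smul_eq_mul,
    ← map_smul]
  simp

theorem sderiv_sderiv_transplant {ψ : SpT → ℝ} (hψ : ContDiff ℝ (⊤ : ℕ∞) ψ) (i j : Fin 3)
    (w : SpT) : sderiv i (sderiv j (transplant z₀ hρ ψ)) w =
      (ρ ^ 2)⁻¹ * transplant z₀ hρ (sderiv i (sderiv j ψ)) w := by
  rw [sderiv_transplant z₀ hρ hψ]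
  have h := hasFDerivAt_transplant z₀ hρ (IsTestOn.sderiv_contDiff hψ j) w
  have h2 := congrFun (sderiv_transplant z₀ hρ (IsTestOn.sderiv_contDiff hψ j) i) w
  rw [sderiv, h.fderiv] at h2
  rw [sderiv, (h.const_mul ρ⁻¹).fderiv, smul_apply, smul_eq_mul, h2,
    ← mul_assoc, ← sq, inv_pow]

theorem sLap_transplant {ψ : SpT → ℝ} (hψ : ContDiff ℝ (⊤ : ℕ∞) ψ) (w : SpT) :
    sLap (transplant z₀ hρ ψ) w = (ρ ^ 2)⁻¹ * transplant z₀ hρ (sLap ψ) w := by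
  simp only [sLap, sderiv_sderiv_transplant z₀ hρ hψ, ← Finset.mul_sum, transplant]

theorem parMap_symm_mem {w : SpT} :
    (parMap z₀ ρ hρ.ne').symm w ∈ Qstar 0 1 ↔ w ∈ Qstar z₀ ρ := by
  rw [← parMap_preimage_Qstar z₀ hρ 1, one_mul, mem_preimage, Homeomorph.apply_symm_apply]

theorem isTestOn_transplant {U : Set SpT} {ψ : SpT → ℝ} (hψ : IsTestOn (Qstar 0 1) ψ)
    (hU : Qstar z₀ ρ ⊆ U) : IsTestOn U (transplant z₀ hρ ψ) := by
  refine ⟨?_, hψ.2.1.comp_homeomorph _, ?_⟩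
  · refine hψ.1.comp ?_
    rw [show ⇑(parMap z₀ ρ hρ.ne').symm = fun w =>
      (ρ⁻¹ • (w.1 - z₀.1), (ρ ^ 2)⁻¹ • (w.2 - z₀.2)) from funext (parMap_symm_apply z₀ hρ)]
    fun_prop
  · have h := tsupport_comp_eq_preimage ψ (parMap z₀ ρ hρ.ne').symm
    refine (subset_of_eq h).trans fun w hw => hU ?_
    rw [← parMap_symm_mem z₀ hρ]
    exact hψ.2.2 hw

theorem setIntegral_transplant {U : Set SpT} (hU : MeasurableSet U) (hQ : Qstar z₀ ρ ⊆ U)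
    {F : SpT → ℝ} (hF : ∀ w ∉ Qstar z₀ ρ, F w = 0) :
    ∫ w in U, F w = ρ ^ 5 * ∫ z in Qstar 0 1, F (parMap z₀ ρ hρ.ne' z) := by
  rw [setIntegral_eq_of_subset_of_forall_sdiff_eq_zero hU hQ fun w hw => hF w hw.2,
    setIntegral_Qstar_eq z₀ hρ]

theorem transplant_eq_zero {ψ : SpT → ℝ} (hψ : IsTestOn (Qstar 0 1) ψ) {w : SpT}
    (hw : w ∉ Qstar z₀ ρ) : transplant z₀ hρ ψ w = 0 :=
  hψ.eq_zero fun h => hw ((parMap_symm_mem z₀ hρ).1 h)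

theorem WeakSGrad.rescale {U : Set SpT} (hU : MeasurableSet U) (hQ : Qstar z₀ ρ ⊆ U)
    {f : SpT → ℝ} {g : Fin 3 → SpT → ℝ} (h : WeakSGrad U f g) :
    WeakSGrad (Qstar 0 1) (fun z => ρ * f (parMap z₀ ρ hρ.ne' z))
      fun j z => ρ ^ 2 * g j (parMap z₀ ρ hρ.ne' z) := fun j ψ hψ => by
  have h1 := h j _ (isTestOn_transplant z₀ hρ hψ hQ)
  rw [sderiv_transplant z₀ hρ hψ.1] at h1
  rw [setIntegral_transplant z₀ hρ hU hQ fun w hw => by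
      beta_reduce
      rw [transplant_eq_zero z₀ hρ (hψ.sderiv_isTestOn j) hw, mul_zero, mul_zero],
    setIntegral_transplant z₀ hρ hU hQ fun w hw => by
      rw [transplant_eq_zero z₀ hρ hψ hw, mul_zero], ← mul_neg] at h1
  simp only [transplant_parMap, mul_left_comm _ ρ⁻¹] at h1
  rw [integral_const_mul] at h1
  have h2 := mul_left_cancel₀ (by positivity) h1
  simp only [mul_assoc]
  rw [integral_const_mul, integral_const_mul, ← mul_neg, ← h2]
  field_simp

theorem DivFreeOn.rescale {U : Set SpT} (hU : MeasurableSet U) (hQ : Qstar z₀ ρ ⊆ U)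
    {u : SpT → E3} (h : DivFreeOn U u) : DivFreeOn (Qstar 0 1) (scaleU z₀ ρ hρ.ne' u) :=
  fun ψ hψ => by
  have h1 := h _ (isTestOn_transplant z₀ hρ hψ hQ)
  simp only [sderiv_transplant z₀ hρ hψ.1] at h1
  rw [setIntegral_transplant z₀ hρ hU hQ fun w hw => by
    simp only [transplant_eq_zero z₀ hρ (hψ.sderiv_isTestOn _) hw, mul_zero, Finset.sum_const_zero]] at h1
  simp only [transplant_parMap, mul_left_comm _ ρ⁻¹, ← Finset.mul_sum] at h1
  rw [integral_const_mul] at h1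
  have h2 : ∫ z in Qstar 0 1, ∑ j, u (parMap z₀ ρ hρ.ne' z) j * sderiv j ψ z = 0 := by
    simpa [hρ.ne'] using h1
  simp only [scaleU, PiLp.smul_apply, smul_eq_mul, mul_assoc, ← Finset.mul_sum]
  rw [integral_const_mul, h2, mul_zero]

theorem PressureEqOn.rescale {U : Set SpT} (hU : MeasurableSet U) (hQ : Qstar z₀ ρ ⊆ U)
    {u : SpT → E3} {p : SpT → ℝ} {a : SpT → Fin 3 → Fin 3 → ℝ} (h : PressureEqOn U u p a) :
    PressureEqOn (Qstar 0 1) (scaleU z₀ ρ hρ.ne' u) (scaleP z₀ ρ hρ.ne' p)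
      (scaleMat z₀ ρ hρ.ne' 1 a) := fun ψ hψ => by
  have h1 := h _ (isTestOn_transplant z₀ hρ hψ hQ)
  simp only [sderiv_sderiv_transplant z₀ hρ hψ.1, sLap_transplant z₀ hρ hψ.1] at h1
  rw [setIntegral_transplant z₀ hρ hU hQ fun w hw => by
      rw [transplant, sLap, Finset.sum_eq_zero fun j _ => ((hψ.sderiv_isTestOn j).sderiv_isTestOn j).eq_zero
        fun h => hw ((parMap_symm_mem z₀ hρ).1 h), mul_zero, mul_zero],
    setIntegral_transplant z₀ hρ hU hQ fun w hw => by
      simp only [transplant_eq_zero z₀ hρ ((hψ.sderiv_isTestOn _).sderiv_isTestOn _) hw, mul_zero,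
        Finset.sum_const_zero], ← mul_neg] at h1
  simp only [transplant_parMap, mul_left_comm _ (ρ ^ 2)⁻¹, ← Finset.mul_sum] at h1
  rw [integral_const_mul, integral_const_mul, ← mul_neg] at h1
  have h2 := mul_left_cancel₀ (by positivity) (mul_left_cancel₀ (by positivity) h1)
  have e : ∀ z i j, (scaleU z₀ ρ hρ.ne' u z i * scaleU z₀ ρ hρ.ne' u z j + ∑ k,
      scaleMat z₀ ρ hρ.ne' 1 a z k i * scaleMat z₀ ρ hρ.ne' 1 a z k j) =
      ρ ^ 2 * (u (parMap z₀ ρ hρ.ne' z) i * u (parMap z₀ ρ hρ.ne' z) j +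
        ∑ k, a (parMap z₀ ρ hρ.ne' z) k i * a (parMap z₀ ρ hρ.ne' z) k j) := fun z i j => by
    simp only [scaleU, scaleMat, PiLp.smul_apply, smul_eq_mul, mul_add, Finset.mul_sum]
    congr 1
    · ring
    · exact Finset.sum_congr rfl fun k _ => by ring
  simp only [e, scaleP, mul_assoc, ← Finset.mul_sum]
  rw [integral_const_mul, integral_const_mul, ← mul_neg, h2]

end

/-! ### Rescaling of the local energy inequality -/

theorem lintegral_le_setLIntegral_of_eq_zero {α : Type*} [MeasurableSpace α] {μ : Measure α}
    {s : Set α} (hs : MeasurableSet s) {f : α → ℝ≥0∞} (h : ∀ x ∉ s, f x = 0) :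
    ∫⁻ x, f x ∂μ ≤ ∫⁻ x in s, f x ∂μ := by
  rw [← lintegral_indicator hs]
  refine lintegral_mono fun x => ?_
  by_cases hx : x ∈ s <;> simp [hx, h]

theorem add_sq_mul_mem_Istar {ρ : ℝ} (hρ : 0 < ρ) (t₀ : ℝ) {s : ℝ} (hs : s ∈ Ioo (-7 / 8 : ℝ) (1 / 8)) :
    t₀ + ρ ^ 2 * s ∈ Istar t₀ ρ := by
  rw [← dilation_preimage_Istar hρ t₀] at hs
  exact hs

section

variable (z₀ : SpT) {ρ : ℝ} (hρ : 0 < ρ)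

theorem mem_ball_of_mk_mem_Qstar {z : SpT} {x : E3} {t r : ℝ} (h : (x, t) ∈ Qstar z r) :
    x ∈ Metric.ball z.1 r := (mem_prod.1 h).1

theorem setIntegral_slice {Ω : Set E3} (hΩ : MeasurableSet Ω) (hQ : Metric.ball z₀.1 ρ ⊆ Ω)
    {F : SpT → ℝ} (hF : ∀ w ∉ Qstar z₀ ρ, F w = 0) (s : ℝ) :
    ∫ x in Ω, F (x, z₀.2 + ρ ^ 2 * s) =
      ρ ^ 3 * ∫ y in Metric.ball 0 1, F (parMap z₀ ρ hρ.ne' (y, s)) := by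
  rw [setIntegral_eq_of_subset_of_forall_sdiff_eq_zero hΩ hQ
    fun x hx => hF _ fun h => hx.2 (mem_ball_of_mk_mem_Qstar h)]
  have h := setIntegral_ball_eq hρ z₀.1 (fun x => F (x, z₀.2 + ρ ^ 2 * s)) 1
  rw [one_mul] at h
  exact h

theorem setLIntegral_slice_le {Ω : Set E3} {F : SpT → ℝ≥0∞} (hF : ∀ w ∉ Qstar z₀ ρ, F w = 0)
    (s : ℝ) : ∫⁻ x in Ω, F (x, z₀.2 + ρ ^ 2 * s) ≤
      ENNReal.ofReal (ρ ^ 3) * ∫⁻ y in Metric.ball 0 1, F (parMap z₀ ρ hρ.ne' (y, s)) := by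
  refine (setLIntegral_le_lintegral _ _).trans ((lintegral_le_setLIntegral_of_eq_zero
    (Metric.isOpen_ball (x := z₀.1) (ε := ρ)).measurableSet fun x hx => hF _ fun h => hx (mem_ball_of_mk_mem_Qstar h)).trans
    (le_of_eq ?_))
  have h := setLIntegral_ball_eq hρ z₀.1 (fun x => F (x, z₀.2 + ρ ^ 2 * s)) 1
  rw [one_mul] at h
  exact h

/-- Density of the parabolic and quartic terms of the local energy inequality. -/
def bulkDens (u d : SpT → E3) (a : SpT → Fin 3 → Fin 3 → ℝ) (φ : SpT → ℝ) (z : SpT) : ℝ :=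
  (‖u z‖ ^ 2 + nsq2 (a z)) * |tderiv φ z + sLap φ z| + ‖d z‖ ^ 2 * nsq2 (a z) * φ z

/-- Density of the flux terms of the local energy inequality. -/
def fluxDens (u : SpT → E3) (p : SpT → ℝ) (a : SpT → Fin 3 → Fin 3 → ℝ) (φ : SpT → ℝ)
    (z : SpT) : ℝ :=
  (‖u z‖ ^ 2 / 2 + nsq2 (a z) / 2 + p z) * (∑ j, u z j * sderiv j φ z) +
    ∑ i, ∑ j, u z i * sderiv j φ z * (∑ k, a z k i * a z k j)

variable (u d : SpT → E3) (p : SpT → ℝ) (a : SpT → Fin 3 → Fin 3 → ℝ) {φ : SpT → ℝ}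

theorem bulkDens_nonneg (hφ : ∀ z, 0 ≤ φ z) (z : SpT) : 0 ≤ bulkDens u d a φ z := by
  have := nsq2_nonneg' (a z)
  have := hφ z
  unfold bulkDens
  positivity

theorem bulkDens_eq_zero {U : Set SpT} (hφ : IsTestOn U φ) {z : SpT} (hz : z ∉ U) :
    bulkDens u d a φ z = 0 := by
  have h : sLap φ z = 0 := Finset.sum_eq_zero fun j _ =>
    ((hφ.sderiv_isTestOn j).sderiv_isTestOn j).eq_zero hz
  simp [bulkDens, h, hφ.tderiv_eq_zero hz, hφ.eq_zero hz]

theorem fluxDens_eq_zero {U : Set SpT} (hφ : IsTestOn U φ) {z : SpT} (hz : z ∉ U) :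
    fluxDens u p a φ z = 0 := by
  simp [fluxDens, (hφ.sderiv_isTestOn _).eq_zero hz]

theorem bulkDens_transplant_le (hρ1 : ρ ≤ 1) (hφ : ContDiff ℝ (⊤ : ℕ∞) φ) (hφ0 : ∀ z, 0 ≤ φ z)
    (z : SpT) : bulkDens u d a (transplant z₀ hρ φ) (parMap z₀ ρ hρ.ne' z) ≤
      (ρ ^ 4)⁻¹ * bulkDens (scaleU z₀ ρ hρ.ne' u) (fun z => d (parMap z₀ ρ hρ.ne' z))
        (scaleMat z₀ ρ hρ.ne' 1 a) φ z := by
  have h1 := nsq2_nonneg' (a (parMap z₀ ρ hρ.ne' z))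
  have h2 := hφ0 z
  have h3 : ρ ^ 2 ≤ 1 := pow_le_one₀ hρ.le hρ1
  have h4 : 1 ≤ (ρ ^ 2)⁻¹ := (one_le_inv₀ (by positivity)).2 h3
  unfold bulkDens
  rw [tderiv_transplant z₀ hρ hφ, sLap_transplant z₀ hρ hφ, ← mul_add, abs_mul,
    abs_of_pos (by positivity : 0 < (ρ ^ 2)⁻¹), norm_scaleU z₀ hρ, nsq2_scaleMat z₀ hρ,
    transplant_parMap, transplant_parMap, transplant_parMap]
  set D := ‖d (parMap z₀ ρ hρ.ne' z)‖ ^ 2 * nsq2 (a (parMap z₀ ρ hρ.ne' z)) * φ z with hD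
  have hD0 : 0 ≤ D := by positivity
  have h5 : D ≤ (ρ ^ 2)⁻¹ * D := le_mul_of_one_le_left hD0 h4
  refine (add_le_add le_rfl h5).trans (le_of_eq ?_)
  rw [hD]
  field_simp

theorem fluxDens_transplant (hφ : ContDiff ℝ (⊤ : ℕ∞) φ) (z : SpT) :
    fluxDens u p a (transplant z₀ hρ φ) (parMap z₀ ρ hρ.ne' z) =
      (ρ ^ 4)⁻¹ * fluxDens (scaleU z₀ ρ hρ.ne' u) (scaleP z₀ ρ hρ.ne' p)
        (scaleMat z₀ ρ hρ.ne' 1 a) φ z := by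
  unfold fluxDens
  rw [norm_scaleU z₀ hρ, nsq2_scaleMat z₀ hρ]
  simp only [sderiv_transplant z₀ hρ hφ, transplant_parMap, scaleU, scaleP, scaleMat,
    PiLp.smul_apply, smul_eq_mul, Fin.sum_univ_three]
  field_simp

end

theorem ofReal_integral_le_of_energy {Ω : Set E3} {t LHS CT : ℝ} {f g : SpT → ℝ} {h : SpT → ℝ}
    (hf : ∀ z, 0 ≤ f z) (hg : ∀ z, 0 ≤ g z) (hCT : 0 ≤ CT)
    (hle : LHS + (∫ τ in Ioo 0 t, ∫ x in Ω, f (x, τ)) ≤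
      CT * ∫ τ in Ioo 0 t, ((∫ x in Ω, g (x, τ)) + |∫ x in Ω, h (x, τ)|)) :
    ENNReal.ofReal LHS ≤ ENNReal.ofReal CT *
      ∫⁻ τ, ((∫⁻ x in Ω, ENNReal.ofReal (g (x, τ))) + ‖∫ x in Ω, h (x, τ)‖ₑ) := by
  have h1 : 0 ≤ ∫ τ in Ioo 0 t, ∫ x in Ω, f (x, τ) :=
    integral_nonneg fun τ => integral_nonneg fun x => hf _
  refine (ENNReal.ofReal_le_ofReal (le_trans (by linarith) hle)).trans ?_
  rw [ENNReal.ofReal_mul hCT]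
  refine mul_le_mul' le_rfl ((Real.ofReal_le_enorm _).trans
    ((enorm_integral_le_lintegral_enorm _).trans
      ((setLIntegral_le_lintegral _ _).trans (lintegral_mono fun τ => ?_))))
  refine (enorm_add_le _ _).trans (add_le_add ((enorm_integral_le_lintegral_enorm _).trans
    (le_of_eq (lintegral_congr fun x => Real.enorm_eq_ofReal (hg _)))) (le_of_eq ?_))
  rw [Real.enorm_abs]

section

variable {Ω : Set E3} {T CT : ℝ} {u d : SpT → E3} {p : SpT → ℝ} {Du a : SpT → Fin 3 → Fin 3 → ℝ}
  {Da : SpT → Fin 3 → Fin 3 → Fin 3 → ℝ} {z₀ : SpT} {ρ : ℝ}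

theorem LocalEnergyIneq.rescale (hΩ : MeasurableSet Ω) (hCT : 0 ≤ CT)
    (h : LocalEnergyIneq Ω T CT u d p Du a Da) (hρ : 0 < ρ) (hρ1 : ρ ≤ 1)
    (hQ : Qstar z₀ ρ ⊆ Ω ×ˢ Ioo 0 T) {φ : SpT → ℝ} (hφ : IsTestOn (Qstar 0 1) φ)
    (hφ0 : ∀ z, 0 ≤ φ z) : ∀ᵐ s ∂(volume.restrict (Ioo (-7 / 8 : ℝ) (1 / 8))),
    ENNReal.ofReal (∫ x in Metric.ball (0 : E3) 1, (‖scaleU z₀ ρ hρ.ne' u (x, s)‖ ^ 2 +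
        nsq2 (scaleMat z₀ ρ hρ.ne' 1 a (x, s))) * φ (x, s)) ≤
      ENNReal.ofReal CT * ∫⁻ τ in Ioo (-7 / 8 : ℝ) (1 / 8), ((∫⁻ x in Metric.ball (0 : E3) 1,
        ENNReal.ofReal (bulkDens (scaleU z₀ ρ hρ.ne' u) (fun z => d (parMap z₀ ρ hρ.ne' z))
          (scaleMat z₀ ρ hρ.ne' 1 a) φ (x, τ))) +
        ‖∫ x in Metric.ball (0 : E3) 1, fluxDens (scaleU z₀ ρ hρ.ne' u) (scaleP z₀ ρ hρ.ne' p)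
          (scaleMat z₀ ρ hρ.ne' 1 a) φ (x, τ)‖ₑ) := by
  have hball : z₀.1 ∈ Metric.ball z₀.1 ρ := Metric.mem_ball_self hρ
  have hIsub : Istar z₀.2 ρ ⊆ Ioo 0 T := fun t ht => (mem_prod.1 (hQ (mem_prod.2 ⟨hball, ht⟩ :
    (z₀.1, t) ∈ Qstar z₀ ρ))).2
  have ht0 : z₀.2 + ρ ^ 2 * 0 ∈ Istar z₀.2 ρ :=
    add_sq_mul_mem_Istar hρ z₀.2 ⟨by norm_num, by norm_num⟩
  have hBsub : Metric.ball z₀.1 ρ ⊆ Ω := fun x hx => (mem_prod.1 (hQ (mem_prod.2 ⟨hx, ht0⟩ :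
    (x, z₀.2 + ρ ^ 2 * 0) ∈ Qstar z₀ ρ))).1
  have hφt := isTestOn_transplant z₀ hρ hφ hQ
  have hφQ := isTestOn_transplant z₀ hρ hφ subset_rfl
  have hφt0 : ∀ z, 0 ≤ transplant z₀ hρ φ z := fun z => hφ0 _
  have h1 := ae_Istar_comp hρ (ae_restrict_of_ae_restrict_of_subset hIsub h)
  filter_upwards [h1] with s hs
  have h2 := ofReal_integral_le_of_energy
    (f := fun z => (nsq2 (Du z) + nsq3 (Da z)) * transplant z₀ hρ φ z)
    (g := bulkDens u d a (transplant z₀ hρ φ)) (h := fluxDens u p a (transplant z₀ hρ φ))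
    (fun z => mul_nonneg (add_nonneg (nsq2_nonneg' _) (by unfold nsq3; positivity)) (hφt0 z))
    (bulkDens_nonneg u d a hφt0) hCT (hs _ hφt.1 hφt.2.1
      (hφt.2.2.trans (prod_mono_right Ioo_subset_Ioi_self)) hφt0)
  have h3 := setIntegral_slice z₀ hρ hΩ hBsub
    (F := fun z => (‖u z‖ ^ 2 + nsq2 (a z)) * transplant z₀ hρ φ z)
    (fun w hw => by rw [hφQ.eq_zero hw, mul_zero]) s
  have h4 : ∫ x in Ω, (‖u (x, z₀.2 + ρ ^ 2 * s)‖ ^ 2 + nsq2 (a (x, z₀.2 + ρ ^ 2 * s))) *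
      transplant z₀ hρ φ (x, z₀.2 + ρ ^ 2 * s) =
      ρ * ∫ x in Metric.ball (0 : E3) 1, (‖scaleU z₀ ρ hρ.ne' u (x, s)‖ ^ 2 +
        nsq2 (scaleMat z₀ ρ hρ.ne' 1 a (x, s))) * φ (x, s) := by
    rw [h3]
    simp only [norm_scaleU z₀ hρ, nsq2_scaleMat z₀ hρ, transplant_parMap, mul_pow, pow_one,
      ← mul_add, mul_assoc]
    rw [integral_const_mul]
    ring
  rw [h4, ENNReal.ofReal_mul hρ.le] at h2
  refine (ENNReal.mul_le_mul_iff_right (a := ENNReal.ofReal ρ) (by simpa using hρ) (by simp)).1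
    (h2.trans ?_)
  rw [mul_left_comm]
  refine mul_le_mul' le_rfl ((lintegral_le_setLIntegral_of_eq_zero (s := Istar z₀.2 ρ)
    measurableSet_Ioo fun τ hτ => ?_).trans ?_)
  · have hn : ∀ x, (x, τ) ∉ Qstar z₀ ρ := fun x hx => hτ (mem_prod.1 hx).2
    simp [bulkDens_eq_zero u d a hφQ (hn _), fluxDens_eq_zero u p a hφQ (hn _)]
  rw [setLIntegral_Istar_eq hρ, show ENNReal.ofReal ρ = ENNReal.ofReal (ρ ^ 2) *
    ENNReal.ofReal ρ⁻¹ by rw [← ENNReal.ofReal_mul (by positivity)]; congr 1; field_simp, mul_assoc]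
  have e : ρ ^ 3 * (ρ ^ 4)⁻¹ = ρ⁻¹ := by field_simp
  refine mul_le_mul' le_rfl ?_
  rw [← lintegral_const_mul' _ _ (by simp)]
  refine lintegral_mono fun τ => ?_
  rw [mul_add]
  refine add_le_add ?_ (le_of_eq ?_)
  · refine (setLIntegral_slice_le z₀ hρ (F := fun z => ENNReal.ofReal
      (bulkDens u d a (transplant z₀ hρ φ) z)) (fun w hw => by
        rw [bulkDens_eq_zero u d a hφQ hw, ENNReal.ofReal_zero]) τ).trans ?_
    rw [← e, ENNReal.ofReal_mul (by positivity), mul_assoc]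
    refine mul_le_mul' le_rfl ?_
    rw [← lintegral_const_mul' _ _ (by simp)]
    refine lintegral_mono fun x => ?_
    rw [← ENNReal.ofReal_mul (by positivity)]
    exact ENNReal.ofReal_le_ofReal (bulkDens_transplant_le z₀ hρ u d a hρ1 hφ.1 hφ0 _)
  · rw [setIntegral_slice z₀ hρ hΩ hBsub (fun w hw => fluxDens_eq_zero u p a hφQ hw)]
    simp only [fluxDens_transplant z₀ hρ u p a hφ.1]
    rw [integral_const_mul, ← mul_assoc, e, enorm_mul, Real.enorm_eq_ofReal (by positivity)]

theorem Suitable.unitTriple (hΩ : IsOpen Ω) (hCT : 0 ≤ CT) (h : Suitable Ω T CT u d p Du a Da)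
    (hρ : 0 < ρ) (hρ1 : ρ ≤ 1) (hQ : Qstar z₀ ρ ⊆ Ω ×ˢ Ioo 0 T) :
    UnitTriple CT (scaleU z₀ ρ hρ.ne' u) (fun z => d (parMap z₀ ρ hρ.ne' z))
      (scaleP z₀ ρ hρ.ne' p) (scaleMat z₀ ρ hρ.ne' 2 Du) (scaleMat z₀ ρ hρ.ne' 1 a)
      (scaleTen z₀ ρ hρ.ne' Da) := by
  have hm : Measurable (parMap z₀ ρ hρ.ne') := (parMap z₀ ρ hρ.ne').continuous.measurable
  have hU : MeasurableSet (Ω ×ˢ Ioo 0 T) := hΩ.measurableSet.prod measurableSet_Ioo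
  have m1 := h.reg.meas_u.comp hm
  have m2 := h.reg.meas_p.comp hm
  have m3 := h.reg.meas_Du.comp hm
  have m4 := h.reg.meas_Dd.comp hm
  have m5 := h.reg.meas_D2d.comp hm
  refine ⟨m1.const_smul ρ, h.reg.meas_d.comp hm, m2.const_mul _, ?_, ?_, ?_, fun i => ?_,
    fun i k => ?_, ?_, ?_, fun φ hφ hφ0 => ?_⟩
  · exact measurable_pi_lambda _ fun i => measurable_pi_lambda _ fun j =>
      (measurable_pi_iff.1 (measurable_pi_iff.1 m3 i) j).const_mul _
  · exact measurable_pi_lambda _ fun i => measurable_pi_lambda _ fun j =>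
      (measurable_pi_iff.1 (measurable_pi_iff.1 m4 i) j).const_mul _
  · exact measurable_pi_lambda _ fun i => measurable_pi_lambda _ fun j =>
      measurable_pi_lambda _ fun k => (measurable_pi_iff.1 (measurable_pi_iff.1
        (measurable_pi_iff.1 m5 i) j) k).const_mul _
  · rw [← Qstar_zero_one]
    exact (h.reg.grad_u i).rescale z₀ hρ hU hQ
  · rw [← Qstar_zero_one]
    simpa only [scaleMat, scaleTen, pow_one] using (h.reg.grad_Dd i k).rescale z₀ hρ hU hQ
  · rw [← Qstar_zero_one]
    exact h.divFree.rescale z₀ hρ hU hQ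
  · rw [← Qstar_zero_one]
    exact h.pres.rescale z₀ hρ hU hQ
  · rw [← Qstar_zero_one] at hφ
    exact h.locen.rescale hΩ.measurableSet hCT hρ hρ1 hQ hφ hφ0

end

/-- Decay estimate (Proposition `lc`): for each `C_T > 0` there is `c̄ > 0` depending only
on `C_T` such that for all `2 < q < σ < 6`, with `α = (6/σ)·(σ−q)/(6−q)`,
`M_q(γρ) ≤ c̄ g_σ^{6/(6−σ)} [γ^{α/8}(M_q + M_q^α) + γ^{−15} B^{3α/4} Σ_{k=0}^{2}(M_q^{1/2^k} + M_q^{α/2^k})](ρ)`. -/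
theorem stmt6 (CT : ℝ) (hCT : 0 < CT) :
    ∃ cbar : ℝ, 0 < cbar ∧
      ∀ q σ : ℝ, 2 < q → q < σ → σ < 6 →
      ∀ α : ℝ, α = 6 / σ * ((σ - q) / (6 - q)) →
      ∀ (Ω : Set E3), IsOpen Ω → ∀ T : ℝ, 0 < T →
      ∀ (u d : SpT → E3) (p : SpT → ℝ) (Du Dd : SpT → Fin 3 → Fin 3 → ℝ)
        (D2d : SpT → Fin 3 → Fin 3 → Fin 3 → ℝ),
      Suitable Ω T CT u d p Du Dd D2d →
      ∀ z₀ ∈ Ω ×ˢ Ioo 0 T, ∀ ρ₀ : ℝ, ρ₀ ∈ Ioc (0 : ℝ) 1 →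
      Qstar z₀ ρ₀ ⊆ Ω ×ˢ Ioo 0 T →
      ∀ gσ : ℝ, 1 ≤ gσ →
      (∀ ρ : ℝ, ρ ∈ Ioc (0 : ℝ) ρ₀ → BQ Du D2d z₀ ρ ≤ 1) →
      (∀ ρ : ℝ, ρ ∈ Ioc (0 : ℝ) ρ₀ → GQ u d Dd σ z₀ ρ ≤ ENNReal.ofReal gσ) →
      ∀ ρ : ℝ, ρ ∈ Ioc (0 : ℝ) ρ₀ → ∀ γ : ℝ, γ ∈ Ioc (0 : ℝ) (1 / 4) →
      MQ u d p Dd q z₀ (γ * ρ) ≤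
        ENNReal.ofReal cbar * ENNReal.ofReal gσ ^ ((6 : ℝ) / (6 - σ)) *
          (ENNReal.ofReal (γ ^ (α / 8)) *
              (MQ u d p Dd q z₀ ρ + MQ u d p Dd q z₀ ρ ^ α) +
           ENNReal.ofReal (γ ^ (-15 : ℝ)) * BQ Du D2d z₀ ρ ^ (3 / 4 * α) *
             ∑ k ∈ Finset.range 3,
               (MQ u d p Dd q z₀ ρ ^ ((1 : ℝ) / 2 ^ k) +
                MQ u d p Dd q z₀ ρ ^ (α / 2 ^ k))) := by
  obtain ⟨c, hc⟩ := UnitTriple.decay CT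
  refine ⟨c + 1, by positivity, fun q σ hq hqσ hσ α hα Ω hΩ T _ u d p Du Dd D2d hS z₀ _ ρ₀ hρ₀ hQ
    gσ hg hB hG ρ hρ γ hγ => ?_⟩
  have hρ0 := hρ.1
  have hγ0 := hγ.1
  have hQρ : Qstar z₀ ρ ⊆ Qstar z₀ ρ₀ := by
    have : ρ ^ 2 ≤ ρ₀ ^ 2 := pow_le_pow_left₀ hρ0.le hρ.2 2
    exact prod_mono (Metric.ball_subset_ball hρ.2) (Ioo_subset_Ioo (by linarith) (by linarith))
  rw [← ENNReal.ofReal_rpow_of_pos hγ0, ← ENNReal.ofReal_rpow_of_pos hγ0]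
  have hle : (c : ℝ≥0∞) ≤ ENNReal.ofReal (c + 1) := by
    rw [ENNReal.ofReal_add c.coe_nonneg zero_le_one, ENNReal.ofReal_coe_nnreal]
    exact le_self_add
  have hgp : (1 : ℝ≥0∞) ≤ ENNReal.ofReal gσ ^ ((6 : ℝ) / (6 - σ)) :=
    ENNReal.one_le_rpow (by simpa using hg) (div_pos (by norm_num) (by linarith))
  rw [mul_assoc]
  by_cases hM : MQ u d p Dd q z₀ ρ = ⊤
  · have hw : ENNReal.ofReal γ ^ (α / 8) ≠ 0 :=
      (ENNReal.rpow_pos (ENNReal.ofReal_pos.2 hγ0) ENNReal.ofReal_ne_top).ne'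
    have hcb : ENNReal.ofReal ((c : ℝ) + 1) ≠ 0 := (ENNReal.ofReal_pos.2 (by positivity)).ne'
    rw [hM, top_add, ENNReal.mul_top hw, top_add, ENNReal.mul_top (zero_lt_one.trans_le hgp).ne',
      ENNReal.mul_top hcb]
    exact le_top
  have key := hc (hS.unitTriple hΩ hCT.le hρ0 (hρ.2.trans hρ₀.2) (hQρ.trans hQ)) hq hqσ hσ hα hg
    (by rw [BQ_scale z₀ hρ0 _ _ one_pos, one_mul]; exact hB ρ hρ)
    (fun r hr => by
      rw [GQ_scale z₀ hρ0 _ _ _ hr.1]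
      exact hG _ ⟨mul_pos hr.1 hρ0, (mul_le_of_le_one_left hρ0.le hr.2).trans hρ.2⟩)
    (by rwa [MQ_scale z₀ hρ0 _ _ _ _ one_pos, one_mul]) γ hγ
  rw [MQ_scale z₀ hρ0 _ _ _ _ one_pos, MQ_scale z₀ hρ0 _ _ _ _ hγ0,
    BQ_scale z₀ hρ0 _ _ one_pos, one_mul] at key
  exact key.trans (mul_le_mul' hle le_rfl)
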